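/- Let Ω ⊂ ℝ² be a closed polygon and let 0 < α ≤ 1. Let h : Ω → ℝ² be a homeomorphism onto its image with finite α-Hölder seminorm |h|_α < ∞, whose inverse h⁻¹ : h(Ω) → ℝ² also has finite α-Hölder seminorm |h⁻¹|_α < ∞. Then there exists β with 0 < β < α, depending only on α, such that for each ε > 0 there exist a triangulation K of Ω and a homeomorphism f : Ω → f(Ω) ⊂ ℝ² that is piecewise affine over K and satisfies ‖f − h‖_β < ε, where ‖·‖_β = ‖·‖_∞ + |·|_β. -/

import Mathlib

open Set Geometry EuclideanGeometry Metric Real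

noncomputable section

abbrev E2 : Type := EuclideanSpace ℝ (Fin 2)

/-- The set of Hölder ratios of exponent `α` of `u` on `S`. -/
def holderRatioSet (α : ℝ) (S : Set E2) (u : E2 → E2) : Set ℝ :=
  {c | ∃ x ∈ S, ∃ y ∈ S, x ≠ y ∧ c = ‖u x - u y‖ / ‖x - y‖ ^ α}

/-- The Hölder seminorm of exponent `α` of `u` on `S`. -/
def holderSeminorm (α : ℝ) (S : Set E2) (u : E2 → E2) : ℝ :=
  sSup (holderRatioSet α S u)

/-- The supremum norm of `u` on `S`. -/
def supNorm (S : Set E2) (u : E2 → E2) : ℝ :=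
  sSup ((fun x => ‖u x‖) '' S)

/-- `f` is a homeomorphism of `S` onto its image `f '' S`. -/
def IsHomeoOn (f : E2 → E2) (S : Set E2) : Prop :=
  ContinuousOn f S ∧ Set.InjOn f S ∧ ContinuousOn (Function.invFunOn f S) (f '' S)

/-- `K` is a triangulation of `Ω`. -/
def IsTriangulation (K : SimplicialComplex ℝ E2) (Ω : Set E2) : Prop :=
  K.faces.Finite ∧ (∀ s ∈ K.faces, s.card ≤ 3) ∧ K.space = Ω ∧
    ∀ s ∈ K.faces, ∃ t ∈ K.faces, s ⊆ t ∧ t.card = 3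

/-- A closed polygon: a compact set admitting a triangulation. -/
def IsClosedPolygon (Ω : Set E2) : Prop :=
  IsCompact Ω ∧ ∃ K : SimplicialComplex ℝ E2, IsTriangulation K Ω

/-- `f` is piecewise affine over the simplicial complex `K`. -/
def PiecewiseAffineOn (f : E2 → E2) (K : SimplicialComplex ℝ E2) : Prop :=
  ∀ s ∈ K.faces, ∃ A : E2 →ᵃ[ℝ] E2, ∀ x ∈ convexHull ℝ (s : Set E2), f x = A x

/-- Every angle of every triangular face of `K` has sine at least `c`. -/
def AngleLB (K : SimplicialComplex ℝ E2) (c : ℝ) : Prop :=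
  ∀ s ∈ K.faces, ∀ p ∈ s, ∀ q ∈ s, ∀ r ∈ s,
    p ≠ q → q ≠ r → p ≠ r → c ≤ Real.sin (∠ p q r)

/-- Length of an edge (a two-element face). -/
def edgeLen (e : Finset E2) : ℝ := Metric.diam (e : Set E2)

/-- `o` is the incenter of the triangle `p₁p₂p₃` with inradius `r`. -/
def IsIncenter (p₁ p₂ p₃ o : E2) (r : ℝ) : Prop :=
  o ∈ interior (convexHull ℝ {p₁, p₂, p₃}) ∧
  Metric.infDist o (affineSpan ℝ ({p₁, p₂} : Set E2) : Set E2) = r ∧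
  Metric.infDist o (affineSpan ℝ ({p₂, p₃} : Set E2) : Set E2) = r ∧
  Metric.infDist o (affineSpan ℝ ({p₃, p₁} : Set E2) : Set E2) = r


/-! ### Consecutive pairs of lists -/

/-- The consecutive pairs of a list. -/
def seqEdges {α : Type*} : List α → List (α × α)
  | [] => []
  | [_] => []
  | a :: b :: t => (a, b) :: seqEdges (b :: t)

/-- The cyclically consecutive pairs of a list. -/
def cyc {α : Type*} : List α → List (α × α)
  | [] => []
  | a :: t => seqEdges (a :: t ++ [a])

section lists

variable {α β : Type*}

theorem seqEdges_append (l₁ l₂ : List α) (b : α) :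
    seqEdges (l₁ ++ b :: l₂) = seqEdges (l₁ ++ [b]) ++ seqEdges (b :: l₂) := by
  induction l₁ with
  | nil => simp [seqEdges]
  | cons a t ih => cases t <;> simp_all [seqEdges]

theorem cyc_split (a b : α) (t₁ t₂ : List α) :
    cyc (a :: t₁ ++ b :: t₂) = seqEdges (a :: t₁ ++ [b]) ++ seqEdges (b :: t₂ ++ [a]) := by
  have := seqEdges_append (a :: t₁) (t₂ ++ [a]) b
  simpa [cyc] using this

theorem cyc_rotate_perm (l₁ l₂ : List α) : (cyc (l₁ ++ l₂)).Perm (cyc (l₂ ++ l₁)) := by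
  cases l₁ with
  | nil => simp
  | cons a t₁ =>
    cases l₂ with
    | nil => simp
    | cons b t₂ =>
      rw [cyc_split, cyc_split]
      exact List.perm_append_comm

theorem seqEdges_map (f : α → β) (l : List α) :
    seqEdges (l.map f) = (seqEdges l).map (Prod.map f f) := by
  induction l with
  | nil => simp [seqEdges]
  | cons a t ih => cases t <;> simp_all [seqEdges]

theorem cyc_map (f : α → β) (l : List α) : cyc (l.map f) = (cyc l).map (Prod.map f f) := by
  cases l with
  | nil => simp [cyc]
  | cons a t => simpa [cyc] using seqEdges_map f (a :: t ++ [a])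

theorem mem_of_mem_seqEdges {l : List α} {e : α × α} (h : e ∈ seqEdges l) :
    e.1 ∈ l ∧ e.2 ∈ l := by
  induction l with
  | nil => simp [seqEdges] at h
  | cons a t ih =>
    cases t with
    | nil => simp [seqEdges] at h
    | cons b t =>
      simp only [seqEdges, List.mem_cons] at h
      rcases h with rfl | h
      · simp
      · have := ih h
        exact ⟨List.mem_cons_of_mem _ this.1, List.mem_cons_of_mem _ this.2⟩

theorem mem_of_mem_cyc {l : List α} {e : α × α} (h : e ∈ cyc l) : e.1 ∈ l ∧ e.2 ∈ l := by
  cases l with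
  | nil => simp [cyc] at h
  | cons a t =>
    have := mem_of_mem_seqEdges h
    simp only [List.mem_append, List.mem_cons] at this ⊢
    tauto

theorem seqEdges_range_map (g : ℕ → α) (n : ℕ) :
    seqEdges ((List.range (n + 1)).map g) = (List.range n).map (fun k => (g k, g (k + 1))) := by
  induction n with
  | zero => simp [seqEdges]
  | succ n ih =>
    rw [List.range_succ, List.map_append, List.range_succ, List.map_append] at *
    have := seqEdges_append ((List.range n).map g) [g (n + 1)] (g n)
    simp only [List.map_cons, List.map_nil, List.append_assoc, List.cons_append,
      List.nil_append] at *
    rw [this, ih]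
    simp [seqEdges]

theorem cyc_range_map (g : ℕ → α) (n : ℕ) (h : g n = g 0) :
    cyc ((List.range n).map g) = (List.range n).map (fun k => (g k, g (k + 1))) := by
  cases n with
  | zero => simp [cyc]
  | succ n =>
    rw [← seqEdges_range_map g (n + 1)]
    conv_rhs => rw [List.range_succ, List.map_append, List.range_succ_eq_map]
    conv_lhs => rw [List.range_succ_eq_map]
    simp [cyc, h]

end lists

/-! ### Winding angles of closed polygonal curves in the complex plane -/

/-- The oriented angle at `x` from `a` to `b`. -/
def ang (x a b : ℂ) : ℝ := Complex.arg ((b - x) / (a - x))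

/-- The total angle swept by a closed polygonal curve, seen from `x`. -/
def wind (l : List ℂ) (x : ℂ) : ℝ := ((cyc l).map fun e => ang x e.1 e.2).sum

/-- The trace of a closed polygonal curve. -/
def poly (l : List ℂ) : Set ℂ := {x | ∃ e ∈ cyc l, x ∈ segment ℝ e.1 e.2}

/-- The trace of an open polygonal curve. -/
def path (l : List ℂ) : Set ℂ := {x | ∃ e ∈ seqEdges l, x ∈ segment ℝ e.1 e.2}

theorem ne_of_not_mem_segment {x a b : ℂ} (h : x ∉ segment ℝ a b) : a - x ≠ 0 ∧ b - x ≠ 0 := by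
  constructor
  · intro h'
    exact h (by rw [← sub_eq_zero.mp h']; exact left_mem_segment _ _ _)
  · intro h'
    exact h (by rw [← sub_eq_zero.mp h']; exact right_mem_segment _ _ _)

theorem ratio_mem_slitPlane {x a b : ℂ} (h : x ∉ segment ℝ a b) :
    (b - x) / (a - x) ∈ Complex.slitPlane := by
  obtain ⟨ha, hb⟩ := ne_of_not_mem_segment h
  by_contra hs
  rw [Complex.mem_slitPlane_iff] at hs
  push Not at hs
  obtain ⟨hre, him⟩ := hs
  set z := (b - x) / (a - x) with hz
  have h1 : b - x = z.re * (a - x) := by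
    have : z = (z.re : ℂ) := by apply Complex.ext <;> simp [him]
    rw [← this, hz, div_mul_cancel₀ _ ha]
  apply h
  have hpos : 0 < 1 - z.re := by linarith
  refine ⟨-z.re / (1 - z.re), 1 / (1 - z.re), div_nonneg (by linarith) hpos.le,
    by positivity, by field_simp; ring, ?_⟩
  have hne : (1 - (z.re : ℂ)) ≠ 0 := by
    have : ((1 - z.re : ℝ) : ℂ) ≠ 0 := by exact_mod_cast hpos.ne'
    simpa using this
  simp only [Complex.real_smul]
  push_cast
  field_simp
  linear_combination h1

theorem ang_symm {x a b : ℂ} (h : x ∉ segment ℝ a b) : ang x b a = -ang x a b := by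
  have := ratio_mem_slitPlane h
  rw [ang, ang, ← inv_div, Complex.arg_inv, if_neg]
  rw [Complex.mem_slitPlane_iff_arg] at this
  exact this.1

theorem prod_ratio_seqEdges (x : ℂ) (l : List ℂ) (a b : ℂ)
    (h : ∀ p ∈ a :: l, p - x ≠ 0) :
    ((seqEdges (a :: l ++ [b])).map fun e => (e.2 - x) / (e.1 - x)).prod
      = (b - x) / (a - x) := by
  induction l generalizing a with
  | nil => simp [seqEdges]
  | cons c t ih =>
    have h1 := ih c (fun p hp => h p (List.mem_cons_of_mem _ hp))
    have hc := h c (by simp)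
    have ha := h a (by simp)
    simp only [List.cons_append, seqEdges, List.map_cons, List.prod_cons] at h1 ⊢
    rw [h1]
    field_simp

theorem ne_of_not_mem_poly {l : List ℂ} {x : ℂ} (h : x ∉ poly l) : ∀ p ∈ l, p - x ≠ 0 := by
  intro p hp
  obtain ⟨s, t, rfl⟩ := List.append_of_mem hp
  have h1 := cyc_rotate_perm s (p :: t)
  have : ∃ q, (p, q) ∈ cyc (s ++ p :: t) := by
    cases ht : t ++ s with
    | nil => exact ⟨p, h1.mem_iff.mpr (by simp_all [cyc, seqEdges])⟩
    | cons q r =>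
      refine ⟨q, h1.mem_iff.mpr ?_⟩
      rw [List.cons_append, ht]
      simp [cyc, seqEdges]
  obtain ⟨q, hq⟩ := this
  exact (ne_of_not_mem_segment (x := x) (a := p) (b := q) fun hx => h ⟨_, hq, hx⟩).1

theorem wind_int {l : List ℂ} {x : ℂ} (h : x ∉ poly l) : ∃ n : ℤ, wind l x = n * (2 * π) := by
  have hne := ne_of_not_mem_poly h
  have key : ∀ L : List (ℂ × ℂ), (∀ e ∈ L, e.1 - x ≠ 0 ∧ e.2 - x ≠ 0) →
      Complex.exp ((L.map fun e => Complex.log ((e.2 - x) / (e.1 - x))).sum)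
        = (L.map fun e => (e.2 - x) / (e.1 - x)).prod := by
    intro L hL
    induction L with
    | nil => simp
    | cons e L ih =>
      have h1 := hL e (by simp)
      simp only [List.map_cons, List.sum_cons, List.prod_cons, Complex.exp_add]
      rw [ih (fun e he => hL e (by simp [he])), Complex.exp_log (div_ne_zero h1.2 h1.1)]
  have him : ∀ L : List (ℂ × ℂ), ((L.map fun e => Complex.log ((e.2 - x) / (e.1 - x))).sum).im
      = (L.map fun e => ang x e.1 e.2).sum := by
    intro L
    induction L with
    | nil => simp
    | cons e L ih => simp [ih, ang, Complex.log_im]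
  have h1 : Complex.exp (((cyc l).map fun e => Complex.log ((e.2 - x) / (e.1 - x))).sum) = 1 := by
    rw [key]
    · cases l with
      | nil => simp [cyc]
      | cons a t =>
        rw [cyc, prod_ratio_seqEdges x t a a hne, div_self (hne a (by simp))]
    · intro e he
      exact ⟨hne _ (mem_of_mem_cyc he).1, hne _ (mem_of_mem_cyc he).2⟩
  obtain ⟨n, hn⟩ := Complex.exp_eq_one_iff.mp h1
  refine ⟨n, ?_⟩
  rw [wind, ← him, hn]
  simp

theorem const_of_int_valued {T : Type*} [TopologicalSpace T] {S : Set T} (hS : IsPreconnected S)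
    {f : T → ℝ} (hf : ContinuousOn f S) (hint : ∀ t ∈ S, ∃ n : ℤ, f t = n * (2 * π))
    {s t : T} (hs : s ∈ S) (ht : t ∈ S) : f s = f t := by
  have hπ := Real.pi_pos
  have key : ∀ s ∈ S, ∀ t ∈ S, ¬ f s < f t := by
    intro s hs t ht hlt
    obtain ⟨n, hn⟩ := hint s hs
    obtain ⟨m, hm⟩ := hint t ht
    have hnm : n < m := by
      by_contra hcon
      have : (m : ℝ) ≤ n := by exact_mod_cast not_lt.mp hcon
      nlinarith
    have hnm' : (n : ℝ) + 1 ≤ m := by exact_mod_cast hnm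
    have hmem : (n + 1 / 2) * (2 * π) ∈ f '' S :=
      (hS.image f hf).ordConnected.out (mem_image_of_mem f hs) (mem_image_of_mem f ht)
        ⟨by rw [hn]; nlinarith, by rw [hm]; nlinarith⟩
    obtain ⟨r, hr, hfr⟩ := hmem
    obtain ⟨k, hk⟩ := hint r hr
    have h1 : (k : ℝ) = n + 1 / 2 := by
      have : (k : ℝ) * (2 * π) = (n + 1 / 2) * (2 * π) := by rw [← hk, hfr]
      exact mul_right_cancel₀ (by positivity) this
    have h2 : (2 * k : ℝ) = 2 * n + 1 := by linarith
    have h3 : 2 * k = 2 * n + 1 := by exact_mod_cast h2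
    omega
  exact le_antisymm (not_lt.mp (key t ht s hs)) (not_lt.mp (key s hs t ht))

theorem wind_homotopy {T : Type*} [TopologicalSpace T] {S : Set T} (hS : IsPreconnected S)
    (l : List (T → ℂ)) (x : T → ℂ) (hl : ∀ γ ∈ l, ContinuousOn γ S) (hx : ContinuousOn x S)
    (hav : ∀ t ∈ S, ∀ e ∈ cyc l, x t ∉ segment ℝ (e.1 t) (e.2 t)) {s t : T} (hs : s ∈ S)
    (ht : t ∈ S) : wind (l.map (· s)) (x s) = wind (l.map (· t)) (x t) := by
  refine const_of_int_valued hS (f := fun t => wind (l.map (· t)) (x t)) ?_ ?_ hs ht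
  · have : ∀ L : List ((T → ℂ) × (T → ℂ)), (∀ e ∈ L, ContinuousOn e.1 S ∧ ContinuousOn e.2 S ∧
        ∀ t ∈ S, x t ∉ segment ℝ (e.1 t) (e.2 t)) →
        ContinuousOn (fun t => (L.map fun e => ang (x t) (e.1 t) (e.2 t)).sum) S := by
      intro L hL
      induction L with
      | nil => simpa using continuousOn_const
      | cons e L ih =>
        simp only [List.map_cons, List.sum_cons]
        refine ContinuousOn.add ?_ (ih fun e he => hL e (by simp [he]))
        obtain ⟨h1, h2, h3⟩ := hL e (by simp)
        intro t ht
        have hd : ContinuousWithinAt (fun t => (e.2 t - x t) / (e.1 t - x t)) S t :=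
          ((h2 t ht).sub (hx t ht)).div ((h1 t ht).sub (hx t ht))
            (ne_of_not_mem_segment (h3 t ht)).1
        exact ContinuousAt.comp_continuousWithinAt (g := Complex.arg)
          (Complex.continuousAt_arg (ratio_mem_slitPlane (h3 t ht))) hd
    refine (this (cyc l) fun e he => ⟨hl _ (mem_of_mem_cyc he).1, hl _ (mem_of_mem_cyc he).2,
      fun t ht => hav t ht e he⟩).congr fun t _ => ?_
    simp only [wind, cyc_map, List.map_map]
    rfl
  · intro t ht
    apply wind_int
    rintro ⟨e, he, hxe⟩
    rw [cyc_map, List.mem_map] at he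
    obtain ⟨e', he', rfl⟩ := he
    exact hav t ht e' he' hxe

theorem wind_const {S : Set ℂ} (hS : IsPreconnected S) {l : List ℂ} (h : Disjoint S (poly l))
    {x y : ℂ} (hx : x ∈ S) (hy : y ∈ S) : wind l x = wind l y := by
  have := wind_homotopy hS (l.map fun p => fun _ : ℂ => p) id (by simp [continuousOn_const])
    continuousOn_id (by
      intro t ht e he hxe
      rw [cyc_map, List.mem_map] at he
      obtain ⟨e', he', rfl⟩ := he
      exact Set.disjoint_left.mp h ht ⟨e', he', hxe⟩) hx hy
  simpa [Function.comp_def] using this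

theorem wind_perm {l l' : List ℂ} (h : (cyc l).Perm (cyc l')) (x : ℂ) : wind l x = wind l' x :=
  (h.map _).sum_eq

theorem poly_perm {l l' : List ℂ} (h : (cyc l).Perm (cyc l')) : poly l = poly l' := by
  ext x
  simp only [poly, mem_ofPred_eq, h.mem_iff]

theorem ang_eq_sub {x a b c : ℂ} (ha : 0 < ((a - x) * c).re) (hb : 0 < ((b - x) * c).re) :
    ang x a b = Complex.arg ((b - x) * c) - Complex.arg ((a - x) * c) := by
  have ha0 : (a - x) * c ≠ 0 := fun h => by simp [h] at ha
  have hb0 : (b - x) * c ≠ 0 := fun h => by simp [h] at hb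
  have hc : c ≠ 0 := right_ne_zero_of_mul ha0
  have hax : a - x ≠ 0 := left_ne_zero_of_mul ha0
  have h1 := abs_lt.mp (Complex.abs_arg_lt_pi_div_two_iff.mpr (Or.inl ha))
  have h2 := abs_lt.mp (Complex.abs_arg_lt_pi_div_two_iff.mpr (Or.inl hb))
  have hinv : Complex.arg ((a - x) * c)⁻¹ = -Complex.arg ((a - x) * c) := by
    rw [Complex.arg_inv, if_neg]
    linarith [Real.pi_pos]
  have : (b - x) / (a - x) = ((b - x) * c) * ((a - x) * c)⁻¹ := by field_simp
  rw [ang, this, Complex.arg_mul hb0 (inv_ne_zero ha0), hinv]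
  · ring
  · rw [hinv]
    constructor <;> linarith

theorem wind_eq_zero_of_halfPlane {l : List ℂ} {x c : ℂ} (h : ∀ p ∈ l, 0 < ((p - x) * c).re) :
    wind l x = 0 := by
  have key : ∀ (t : List ℂ) (a b : ℂ), 0 < ((b - x) * c).re →
      (∀ p ∈ a :: t, 0 < ((p - x) * c).re) →
      ((seqEdges (a :: t ++ [b])).map fun e => ang x e.1 e.2).sum
        = Complex.arg ((b - x) * c) - Complex.arg ((a - x) * c) := by
    intro t
    induction t with
    | nil =>
      intro a b hb h
      simpa [seqEdges] using ang_eq_sub (h a (by simp)) hb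
    | cons d t ih =>
      intro a b hb h
      have h1 := ih d b hb (fun p hp => h p (List.mem_cons_of_mem _ hp))
      simp only [List.cons_append, seqEdges, List.map_cons, List.sum_cons] at h1 ⊢
      rw [h1, ang_eq_sub (h a (by simp)) (h d (by simp))]
      ring
  cases l with
  | nil => simp [wind, cyc]
  | cons a t => rw [wind, cyc, key t a a (h a (by simp)) h, sub_self]

theorem wind_split {a b x : ℂ} (t₁ t₂ : List ℂ) (h : x ∉ segment ℝ a b) :
    wind (a :: t₁ ++ b :: t₂) x = wind (a :: t₁ ++ [b]) x + wind (a :: b :: t₂) x := by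
  have h1 := cyc_split a b t₁ []
  have h2 : cyc (a :: b :: t₂) = (a, b) :: seqEdges (b :: t₂ ++ [a]) := by
    simp [cyc, seqEdges]
  have h3 := ang_symm h
  rw [wind, wind, wind, cyc_split, h1, h2]
  simp [seqEdges, h3]

theorem isCompact_segment (a b : ℂ) : IsCompact (segment ℝ a b) := by
  rw [← convexHull_pair]
  exact (Set.toFinite _).isCompact_convexHull ℝ

theorem poly_eq_iUnion (l : List ℂ) : poly l = ⋃ e ∈ {e | e ∈ cyc l}, segment ℝ e.1 e.2 := by
  ext x
  simp [poly]

theorem isCompact_poly (l : List ℂ) : IsCompact (poly l) := by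
  rw [poly_eq_iUnion]
  exact (List.finite_toSet (cyc l)).isCompact_biUnion fun e _ => isCompact_segment _ _

/-! ### Polygonal cells -/

/-- `V` is a region cut out by the closed polygonal curve `l`. -/
structure Cell (l : List ℂ) (V : Set ℂ) : Prop where
  preconn : IsPreconnected V
  disj : Disjoint V (poly l)
  wind_ne : ∀ x ∈ V, wind l x ≠ 0
  bdry : poly l ⊆ closure V

theorem Cell.perm {l l' : List ℂ} {V : Set ℂ} (h : Cell l V) (hp : (cyc l).Perm (cyc l')) :
    Cell l' V where
  preconn := h.preconn
  disj := by rw [← poly_perm hp]; exact h.disj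
  wind_ne x hx := by rw [← wind_perm hp]; exact h.wind_ne x hx
  bdry := by rw [← poly_perm hp]; exact h.bdry

theorem Cell.disjoint_poly {l₁ l₂ : List ℂ} {V₁ : Set ℂ} (h₁ : Cell l₁ V₁)
    (h : ∀ x ∈ poly l₂ \ poly l₁, wind l₁ x = 0) : Disjoint V₁ (poly l₂) := by
  rw [Set.disjoint_left]
  intro x hx hx2
  exact h₁.wind_ne x hx (h x ⟨hx2, Set.disjoint_left.mp h₁.disj hx⟩)

theorem Cell.wind_eq_zero {l₁ l₂ : List ℂ} {V₁ : Set ℂ} (h₁ : Cell l₁ V₁)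
    (hd : Disjoint V₁ (poly l₂)) {y : ℂ} (hy1 : y ∈ poly l₁) (hy2 : y ∉ poly l₂)
    (hy : wind l₂ y = 0) : ∀ x ∈ V₁, wind l₂ x = 0 := by
  intro x hx
  have hopen : (poly l₂)ᶜ ∈ nhds y := (isCompact_poly l₂).isClosed.isOpen_compl.mem_nhds hy2
  obtain ⟨ε, hε, hball⟩ := Metric.mem_nhds_iff.mp hopen
  obtain ⟨z, hzV, hz⟩ := Metric.mem_closure_iff.mp (h₁.bdry hy1) ε hε
  have h1 : wind l₂ y = wind l₂ z :=
    wind_const (convex_ball y ε).isPreconnected (Set.disjoint_left.mpr fun w hw => hball hw)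
      (mem_ball_self hε) (by rwa [mem_ball, dist_comm])
  rw [wind_const h₁.preconn hd hx hzV, ← h1, hy]

theorem Cell.disjoint_cell {l₁ l₂ : List ℂ} {V₁ V₂ : Set ℂ} (h₁ : Cell l₁ V₁) (h₂ : Cell l₂ V₂)
    (h21 : ∀ x ∈ poly l₂ \ poly l₁, wind l₁ x = 0) {y : ℂ} (hy1 : y ∈ poly l₁)
    (hy2 : y ∉ poly l₂) (hy : wind l₂ y = 0) : Disjoint V₁ V₂ := by
  rw [Set.disjoint_left]
  intro x hx hx2
  exact h₂.wind_ne x hx2 (h₁.wind_eq_zero (h₁.disjoint_poly h21) hy1 hy2 hy x hx)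

theorem poly_split (a b : ℂ) (t₁ t₂ : List ℂ) :
    poly (a :: t₁ ++ b :: t₂) = path (a :: t₁ ++ [b]) ∪ path (b :: t₂ ++ [a]) := by
  ext x
  simp only [poly, path, cyc_split, List.mem_append, mem_ofPred_eq, mem_union]
  constructor
  · rintro ⟨e, h | h, hx⟩
    exacts [Or.inl ⟨e, h, hx⟩, Or.inr ⟨e, h, hx⟩]
  · rintro (⟨e, h, hx⟩ | ⟨e, h, hx⟩)
    exacts [⟨e, Or.inl h, hx⟩, ⟨e, Or.inr h, hx⟩]

theorem path_pair (a b : ℂ) : path [a, b] = segment ℝ a b := by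
  ext x; simp [path, seqEdges]

theorem poly_left (a b : ℂ) (t₁ : List ℂ) :
    poly (a :: t₁ ++ [b]) = path (a :: t₁ ++ [b]) ∪ segment ℝ a b := by
  have := poly_split a b t₁ []
  rw [this, segment_symm, ← path_pair]; rfl

theorem poly_right (a b : ℂ) (t₂ : List ℂ) :
    poly (a :: b :: t₂) = segment ℝ a b ∪ path (b :: t₂ ++ [a]) := by
  have := poly_split a b [] t₂
  rw [← path_pair]; exact this

theorem Cell.glue {a b : ℂ} {t₁ t₂ : List ℂ} {V₁ V₂ : Set ℂ} (h₁ : Cell (a :: t₁ ++ [b]) V₁)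
    (h₂ : Cell (a :: b :: t₂) V₂)
    (hdiag : ∀ x ∈ openSegment ℝ a b, x ∉ poly (a :: t₁ ++ b :: t₂))
    (h12 : ∀ x ∈ poly (a :: t₁ ++ [b]) \ poly (a :: b :: t₂), wind (a :: b :: t₂) x = 0)
    (h21 : ∀ x ∈ poly (a :: b :: t₂) \ poly (a :: t₁ ++ [b]), wind (a :: t₁ ++ [b]) x = 0)
    (hne1 : (poly (a :: t₁ ++ [b]) \ poly (a :: b :: t₂)).Nonempty)
    (hne2 : (poly (a :: b :: t₂) \ poly (a :: t₁ ++ [b])).Nonempty) :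
    Cell (a :: t₁ ++ b :: t₂) (V₁ ∪ V₂ ∪ openSegment ℝ a b) := by
  obtain ⟨y, hy1, hy2⟩ := hne1
  obtain ⟨z, hz2, hz1⟩ := hne2
  have d1 := h₁.disjoint_poly h21
  have d2 := h₂.disjoint_poly h12
  have hos : openSegment ℝ a b ⊆ segment ℝ a b := openSegment_subset_segment ℝ a b
  have hs1 : segment ℝ a b ⊆ poly (a :: t₁ ++ [b]) := by rw [poly_left]; exact subset_union_right
  have hs2 : segment ℝ a b ⊆ poly (a :: b :: t₂) := by rw [poly_right]; exact subset_union_left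
  have hsub : poly (a :: t₁ ++ b :: t₂) ⊆ poly (a :: t₁ ++ [b]) ∪ poly (a :: b :: t₂) := by
    rw [poly_split, poly_left, poly_right]
    intro x hx
    simp only [mem_union] at hx ⊢
    tauto
  have hdisj : Disjoint (V₁ ∪ V₂ ∪ openSegment ℝ a b) (poly (a :: t₁ ++ b :: t₂)) := by
    rw [Set.disjoint_left]
    rintro x ((hx | hx) | hx) hx'
    · rcases hsub hx' with h | h
      exacts [Set.disjoint_left.mp h₁.disj hx h, Set.disjoint_left.mp d1 hx h]
    · rcases hsub hx' with h | h
      exacts [Set.disjoint_left.mp d2 hx h, Set.disjoint_left.mp h₂.disj hx h]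
    · exact hdiag x hx hx'
  have hmid : midpoint ℝ a b ∈ openSegment ℝ a b := by
    rw [openSegment_eq_image_lineMap]
    exact ⟨2⁻¹, by norm_num, rfl⟩
  have hpc : IsPreconnected (V₁ ∪ V₂ ∪ openSegment ℝ a b) := by
    have e : V₁ ∪ V₂ ∪ openSegment ℝ a b
        = (V₁ ∪ openSegment ℝ a b) ∪ (V₂ ∪ openSegment ℝ a b) := by
      ext; simp only [mem_union]; tauto
    rw [e]
    refine IsPreconnected.union (midpoint ℝ a b) (Or.inr hmid) (Or.inr hmid) ?_ ?_
    · exact h₁.preconn.subset_closure subset_union_left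
        (union_subset subset_closure ((hos.trans hs1).trans h₁.bdry))
    · exact h₂.preconn.subset_closure subset_union_left
        (union_subset subset_closure ((hos.trans hs2).trans h₂.bdry))
  have hw1 : ∀ x ∈ V₁, wind (a :: t₁ ++ b :: t₂) x ≠ 0 := by
    intro x hx
    rw [wind_split t₁ t₂ fun h => Set.disjoint_left.mp h₁.disj hx (hs1 h),
      h₁.wind_eq_zero d1 hy1 hy2 (h12 y ⟨hy1, hy2⟩) x hx, add_zero]
    exact h₁.wind_ne x hx
  refine ⟨hpc, hdisj, ?_, ?_⟩
  · rintro x ((hx | hx) | hx)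
    · exact hw1 x hx
    · rw [wind_split t₁ t₂ fun h => Set.disjoint_left.mp h₂.disj hx (hs2 h),
        h₂.wind_eq_zero d2 hz2 hz1 (h21 z ⟨hz2, hz1⟩) x hx, zero_add]
      exact h₂.wind_ne x hx
    · obtain ⟨q, hq⟩ : V₁.Nonempty := by
        rw [← closure_nonempty_iff]; exact ⟨y, h₁.bdry hy1⟩
      rw [wind_const hpc hdisj (Or.inr hx) (Or.inl (Or.inl hq))]
      exact hw1 q hq
  · refine hsub.trans (union_subset ?_ ?_)
    · exact h₁.bdry.trans (closure_mono fun x hx => Or.inl (Or.inl hx))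
    · exact h₂.bdry.trans (closure_mono fun x hx => Or.inl (Or.inr hx))

/-! ### Simple polygons -/

/-- `l` lists the vertices of a simple closed polygon. -/
structure SimplePoly (l : List ℂ) : Prop where
  three_le : 3 ≤ l.length
  nodup : l.Nodup
  meet : ∀ e ∈ cyc l, ∀ e' ∈ cyc l, ∀ x ∈ segment ℝ e.1 e.2, x ∈ segment ℝ e'.1 e'.2 →
    e = e' ∨ (x = e.1 ∨ x = e.2) ∧ (x = e'.1 ∨ x = e'.2)

theorem SimplePoly.rotate {l₁ l₂ : List ℂ} (h : SimplePoly (l₁ ++ l₂)) :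
    SimplePoly (l₂ ++ l₁) where
  three_le := by have := h.three_le; simp only [List.length_append] at this ⊢; omega
  nodup := List.nodup_append_comm.mp h.nodup
  meet e he e' he' := h.meet e ((cyc_rotate_perm l₁ l₂).mem_iff.mpr he) e'
    ((cyc_rotate_perm l₁ l₂).mem_iff.mpr he')

theorem fst_mem_of_mem_seqEdges {α : Type*} {l : List α} {b : α} {e : α × α}
    (h : e ∈ seqEdges (l ++ [b])) : e.1 ∈ l := by
  induction l with
  | nil => simp [seqEdges] at h
  | cons a t ih =>
    cases t with
    | nil => simp [seqEdges] at h; simp [h]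
    | cons c t =>
      simp only [List.cons_append, seqEdges, List.mem_cons] at h ih ⊢
      rcases h with rfl | h
      · simp
      · exact Or.inr (ih h)

theorem exists_cyc_fst {α : Type*} {l : List α} {p : α} (hp : p ∈ l) : ∃ q, (p, q) ∈ cyc l := by
  obtain ⟨s, t, rfl⟩ := List.append_of_mem hp
  have h1 := cyc_rotate_perm s (p :: t)
  cases ht : t ++ s with
  | nil => exact ⟨p, h1.mem_iff.mpr (by simp_all [cyc, seqEdges])⟩
  | cons q r =>
    refine ⟨q, h1.mem_iff.mpr ?_⟩
    rw [List.cons_append, ht]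
    simp [cyc, seqEdges]

theorem SimplePoly.vertex_on_edge {l : List ℂ} (h : SimplePoly l) {p : ℂ} (hp : p ∈ l)
    {e : ℂ × ℂ} (he : e ∈ cyc l) (hpe : p ∈ segment ℝ e.1 e.2) : p = e.1 ∨ p = e.2 := by
  obtain ⟨q, hq⟩ := exists_cyc_fst hp
  rcases h.meet e he _ hq p hpe (left_mem_segment _ _ _) with rfl | h
  · exact Or.inl rfl
  · exact h.1

theorem middle_mem {α : Type*} {a b : α} {t : List α} (ht : t ≠ []) {e : α × α}
    (he : e ∈ seqEdges (a :: t ++ [b])) : e.1 ∈ t ∨ e.2 ∈ t := by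
  cases t with
  | nil => exact absurd rfl ht
  | cons c t =>
    simp only [List.cons_append, seqEdges, List.mem_cons] at he
    rcases he with rfl | he
    · simp
    · exact Or.inl (fst_mem_of_mem_seqEdges (l := c :: t) he)

theorem eq_of_mem_segment_of_mem_segment {c x d : ℂ} (h1 : x ∈ segment ℝ c d)
    (h2 : d ∈ segment ℝ c x) : x = d := by
  rw [mem_segment_iff_wbtw] at h1 h2
  exact (wbtw_swap_right_iff ℝ c).mp ⟨h1, h2⟩

theorem wind_eq_of_segment {l : List ℂ} {x y : ℂ} (h : ∀ z ∈ segment ℝ x y, z ∉ poly l) :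
    wind l x = wind l y :=
  wind_const (convex_segment x y).isPreconnected (Set.disjoint_left.mpr h)
    (left_mem_segment _ _ _) (right_mem_segment _ _ _)

theorem wind_path_eq {l : List ℂ} (t : List ℂ) (c b : ℂ)
    (h : ∀ e ∈ seqEdges (c :: t ++ [b]), ∀ x ∈ segment ℝ e.1 e.2, x ≠ b → x ∉ poly l)
    (hb : ∀ e ∈ seqEdges (c :: t), b ∉ segment ℝ e.1 e.2) :
    ∀ x ∈ path (c :: t ++ [b]), x ≠ b → wind l x = wind l c := by
  induction t generalizing c with
  | nil =>
    intro x hx hxb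
    simp only [List.cons_append, List.nil_append, path_pair] at hx
    refine (wind_eq_of_segment fun z hz => h (c, b) (by simp [seqEdges]) z
      ((convex_segment c b).segment_subset (left_mem_segment _ _ _) hx hz) ?_).symm
    rintro rfl
    exact hxb (eq_of_mem_segment_of_mem_segment hx hz)
  | cons d t ih =>
    have hcd : ∀ z ∈ segment ℝ c d, z ∉ poly l := fun z hz =>
      h (c, d) (by simp [seqEdges]) z hz (by
        rintro rfl
        exact hb (c, d) (by simp [seqEdges]) hz)
    rintro x ⟨e, he, hx⟩ hxb
    have he' : e = (c, d) ∨ e ∈ seqEdges (d :: t ++ [b]) := by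
      simpa [seqEdges] using he
    rcases he' with rfl | he'
    · exact (wind_eq_of_segment fun z hz => hcd z
        ((convex_segment c d).segment_subset (left_mem_segment _ _ _) hx hz)).symm
    · rw [wind_eq_of_segment hcd]
      refine ih d (fun e he => h e ?_) (fun e he => hb e ?_) x ⟨e, he', hx⟩ hxb
      · simp only [List.cons_append, seqEdges, List.mem_cons] at he ⊢
        exact Or.inr he
      · simp only [seqEdges, List.mem_cons]
        exact Or.inr he

theorem seqEdges_sub_append {α : Type*} (l r : List α) (e : α × α) (h : e ∈ seqEdges l) :
    e ∈ seqEdges (l ++ r) := by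
  induction l with
  | nil => simp [seqEdges] at h
  | cons a t ih =>
    cases t with
    | nil => simp [seqEdges] at h
    | cons b t =>
      simp only [List.cons_append, seqEdges, List.mem_cons] at h ih ⊢
      tauto

/-- The two boundary arcs of a simple polygon cut at `a`, `b` only meet at `a` and `b`. -/
theorem SimplePoly.path_inter {a b : ℂ} {t₁ t₂ : List ℂ} (h : SimplePoly (a :: t₁ ++ b :: t₂))
    {x : ℂ} (h1 : x ∈ path (a :: t₁ ++ [b])) (h2 : x ∈ path (b :: t₂ ++ [a])) :
    x = a ∨ x = b := by
  obtain ⟨e, he, hx⟩ := h1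
  obtain ⟨e', he', hx'⟩ := h2
  have hc := cyc_split a b t₁ t₂
  have hnd := h.nodup
  have hd : ∀ p ∈ a :: t₁, ∀ q ∈ b :: t₂, p ≠ q := by
    have := (List.nodup_append.mp hnd).2.2
    simpa using this
  have m1 := fst_mem_of_mem_seqEdges (l := a :: t₁) he
  have m2 := fst_mem_of_mem_seqEdges (l := b :: t₂) he'
  have n1 := (mem_of_mem_seqEdges he).2
  have n2 := (mem_of_mem_seqEdges he').2
  rcases h.meet e (by rw [hc]; exact List.mem_append_left _ he) e'
    (by rw [hc]; exact List.mem_append_right _ he') x hx hx' with heq | ⟨hh, hh'⟩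
  · exact absurd (congrArg Prod.fst heq) (hd _ m1 _ m2)
  · by_contra hcon
    push Not at hcon
    have k1 : x ∈ a :: t₁ := by
      rcases hh with rfl | rfl
      · exact m1
      · rw [List.mem_append] at n1
        rcases n1 with n1 | n1
        · exact n1
        · exact absurd (List.mem_singleton.mp n1) hcon.2
    have k2 : x ∈ b :: t₂ := by
      rcases hh' with rfl | rfl
      · exact m2
      · rw [List.mem_append] at n2
        rcases n2 with n2 | n2
        · exact n2
        · exact absurd (List.mem_singleton.mp n2) hcon.1
    exact hd _ k1 _ k2 rfl

theorem SimplePoly.wind_arc {a b : ℂ} {t₁ t₂ : List ℂ} (h : SimplePoly (a :: t₁ ++ b :: t₂))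
    (ht : t₁ ≠ []) (hdiag : ∀ x ∈ segment ℝ a b, x ∈ poly (a :: t₁ ++ b :: t₂) → x = a ∨ x = b)
    {y : ℂ} (hy : y ∈ path (a :: t₁ ++ [b])) (hya : y ≠ a) (hyb : y ≠ b)
    (hw : wind (a :: b :: t₂) y = 0) :
    ∀ x ∈ path (a :: t₁ ++ [b]), x ≠ a → x ≠ b → wind (a :: b :: t₂) x = 0 := by
  have hav : ∀ x ∈ path (a :: t₁ ++ [b]), x ≠ a → x ≠ b → x ∉ poly (a :: b :: t₂) := by
    intro x hx hxa hxb hx2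
    rw [poly_right] at hx2
    rcases hx2 with hx2 | hx2
    · rcases hdiag x hx2 (by rw [poly_split]; exact Or.inl hx) with h | h
      exacts [hxa h, hxb h]
    · rcases h.path_inter hx hx2 with h | h
      exacts [hxa h, hxb h]
  obtain ⟨c, t, rfl⟩ := List.exists_cons_of_ne_nil ht
  have hnd := h.nodup
  have hca : c ≠ a := by
    rintro rfl
    simp at hnd
  have hc := cyc_split a b (c :: t) t₂
  have hmem : ∀ e ∈ seqEdges (c :: t ++ [b]), e ∈ seqEdges (a :: (c :: t) ++ [b]) := by
    intro e he
    simp only [List.cons_append, seqEdges, List.mem_cons] at he ⊢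
    exact Or.inr he
  have hbl : b ∈ a :: (c :: t) ++ b :: t₂ := by simp
  have hal : a ∈ a :: (c :: t) ++ b :: t₂ := by simp
  have hbt : b ∉ a :: c :: t := fun hb =>
    (List.nodup_append.mp hnd).2.2 b hb b (by simp) rfl
  have hat : a ∉ c :: t ++ [b] := by
    intro ha
    have : a ∉ c :: t ++ b :: t₂ := (List.nodup_cons.mp hnd).1
    apply this
    simp only [List.mem_append, List.mem_cons] at ha ⊢
    rcases ha with ha | ha | ha
    · exact Or.inl ha
    · exact Or.inr (Or.inl ha)
    · simp at ha
  have key : ∀ x ∈ path (a :: (c :: t) ++ [b]), x ≠ a → x ≠ b →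
      wind (a :: b :: t₂) x = wind (a :: b :: t₂) c := by
    rintro x ⟨e, he, hx⟩ hxa hxb
    have he' : e = (a, c) ∨ e ∈ seqEdges (c :: t ++ [b]) := by
      simpa [seqEdges] using he
    rcases he' with rfl | he'
    · apply wind_eq_of_segment
      intro z hz
      have hz' : z ∈ segment ℝ a c :=
        (convex_segment a c).segment_subset hx (right_mem_segment _ _ _) hz
      refine hav z ⟨_, he, hz'⟩ ?_ ?_
      · rintro rfl
        apply hxa
        rw [segment_symm] at hx hz
        exact eq_of_mem_segment_of_mem_segment hx hz
      · rintro rfl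
        rcases h.vertex_on_edge hbl (by rw [hc]; exact List.mem_append_left _ he) hz' with h | h
        · exact hbt (by simp [h])
        · exact hbt (by simp [h])
    · refine wind_path_eq t c b (fun g hg z hz hzb => ?_) (fun e he hb => ?_) x ⟨e, he', hx⟩ hxb
      · refine hav z ⟨g, hmem g hg, hz⟩ ?_ hzb
        rintro rfl
        have := mem_of_mem_seqEdges hg
        rcases h.vertex_on_edge hal (by rw [hc]; exact List.mem_append_left _ (hmem g hg)) hz
          with h | h
        · exact hat (h ▸ this.1)
        · exact hat (h ▸ this.2)
      · have hm := mem_of_mem_seqEdges he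
        have he2 := hmem e (seqEdges_sub_append _ [b] e he)
        rcases h.vertex_on_edge hbl (by rw [hc]; exact List.mem_append_left _ he2) hb with h | h
        · exact hbt (List.mem_cons_of_mem _ (h ▸ hm.1))
        · exact hbt (List.mem_cons_of_mem _ (h ▸ hm.2))
  intro x hx hxa hxb
  rw [key x hx hxa hxb, ← key y hy hya hyb, hw]


/-- Cutting data for a simple polygon along a chord. -/
structure Chord (a b : ℂ) (t₁ t₂ : List ℂ) : Prop where
  simple : SimplePoly (a :: t₁ ++ b :: t₂)
  left_ne : t₁ ≠ []
  right_ne : t₂ ≠ []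
  diag : ∀ x ∈ segment ℝ a b, x ∈ poly (a :: t₁ ++ b :: t₂) → x = a ∨ x = b
  left : ∃ x ∈ path (a :: t₁ ++ [b]), x ≠ a ∧ x ≠ b ∧ wind (a :: b :: t₂) x = 0
  right : ∃ x ∈ path (b :: t₂ ++ [a]), x ≠ a ∧ x ≠ b ∧ wind (a :: t₁ ++ [b]) x = 0

namespace Chord

variable {a b : ℂ} {t₁ t₂ : List ℂ} (h : Chord a b t₁ t₂)

include h

theorem wind_left : ∀ x ∈ path (a :: t₁ ++ [b]), x ≠ a → x ≠ b → wind (a :: b :: t₂) x = 0 := by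
  obtain ⟨y, hy, hya, hyb, hw⟩ := h.left
  exact h.simple.wind_arc h.left_ne h.diag hy hya hyb hw

theorem wind_right : ∀ x ∈ path (b :: t₂ ++ [a]), x ≠ a → x ≠ b →
    wind (a :: t₁ ++ [b]) x = 0 := by
  obtain ⟨y, hy, hya, hyb, hw⟩ := h.right
  have hs : SimplePoly (b :: t₂ ++ a :: t₁) := h.simple.rotate (l₁ := a :: t₁) (l₂ := b :: t₂)
  have hp : (cyc (a :: t₁ ++ [b])).Perm (cyc (b :: a :: t₁)) := cyc_rotate_perm (a :: t₁) [b]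
  have := hs.wind_arc h.right_ne (fun x hx hx' => by
    rw [segment_symm] at hx
    rw [poly_perm (cyc_rotate_perm (b :: t₂) (a :: t₁))] at hx'
    exact (h.diag x hx hx').symm) hy hyb hya (by rw [← wind_perm hp]; exact hw)
  intro x hx hxa hxb
  rw [wind_perm hp]
  exact this x hx hxb hxa

theorem mem_left {x : ℂ} (hx : x ∈ poly (a :: t₁ ++ [b]) \ poly (a :: b :: t₂)) :
    x ∈ path (a :: t₁ ++ [b]) ∧ x ≠ a ∧ x ≠ b := by
  obtain ⟨h1, h2⟩ := hx
  rw [poly_right] at h2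
  rw [poly_left] at h1
  refine ⟨h1.resolve_right fun h => h2 (Or.inl h), ?_, ?_⟩
  · rintro rfl; exact h2 (Or.inl (left_mem_segment _ _ _))
  · rintro rfl; exact h2 (Or.inl (right_mem_segment _ _ _))

theorem mem_right {x : ℂ} (hx : x ∈ poly (a :: b :: t₂) \ poly (a :: t₁ ++ [b])) :
    x ∈ path (b :: t₂ ++ [a]) ∧ x ≠ a ∧ x ≠ b := by
  obtain ⟨h1, h2⟩ := hx
  rw [poly_right] at h1
  rw [poly_left] at h2
  refine ⟨h1.resolve_left fun h => h2 (Or.inr h), ?_, ?_⟩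
  · rintro rfl; exact h2 (Or.inr (left_mem_segment _ _ _))
  · rintro rfl; exact h2 (Or.inr (right_mem_segment _ _ _))

theorem poly_inter : poly (a :: t₁ ++ [b]) ∩ poly (a :: b :: t₂) ⊆ segment ℝ a b := by
  rintro x ⟨h1, h2⟩
  rw [poly_right] at h2
  rw [poly_left] at h1
  rcases h1 with h1 | h1
  · rcases h2 with h2 | h2
    · exact h2
    · rcases h.simple.path_inter h1 h2 with rfl | rfl
      exacts [left_mem_segment _ _ _, right_mem_segment _ _ _]
  · exact h1

theorem left_diff : (poly (a :: t₁ ++ [b]) \ poly (a :: b :: t₂)).Nonempty := by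
  obtain ⟨x, hx, hxa, hxb, -⟩ := h.left
  refine ⟨x, by rw [poly_left]; exact Or.inl hx, fun hx2 => ?_⟩
  have hx1 : x ∈ poly (a :: t₁ ++ b :: t₂) := by rw [poly_split]; exact Or.inl hx
  have := h.poly_inter ⟨by rw [poly_left]; exact Or.inl hx, hx2⟩
  rcases h.diag x this hx1 with h | h
  exacts [hxa h, hxb h]

theorem right_diff : (poly (a :: b :: t₂) \ poly (a :: t₁ ++ [b])).Nonempty := by
  obtain ⟨x, hx, hxa, hxb, -⟩ := h.right
  refine ⟨x, by rw [poly_right]; exact Or.inr hx, fun hx2 => ?_⟩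
  have hx1 : x ∈ poly (a :: t₁ ++ b :: t₂) := by rw [poly_split]; exact Or.inr hx
  have := h.poly_inter ⟨hx2, by rw [poly_right]; exact Or.inr hx⟩
  rcases h.diag x this hx1 with h | h
  exacts [hxa h, hxb h]

theorem cell_glue {V₁ V₂ : Set ℂ} (h₁ : Cell (a :: t₁ ++ [b]) V₁) (h₂ : Cell (a :: b :: t₂) V₂) :
    Cell (a :: t₁ ++ b :: t₂) (V₁ ∪ V₂ ∪ openSegment ℝ a b) := by
  refine h₁.glue h₂ (fun x hx hx' => ?_) (fun x hx => ?_) (fun x hx => ?_)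
    h.left_diff h.right_diff
  · have hab : a ≠ b := by
      rintro rfl
      have := h.simple.nodup
      simp at this
    rcases h.diag x (openSegment_subset_segment ℝ a b hx) hx' with rfl | rfl
    · exact hab (left_mem_openSegment_iff.mp hx)
    · exact hab (right_mem_openSegment_iff.mp hx)
  · obtain ⟨k1, k2, k3⟩ := h.mem_left hx
    exact h.wind_left x k1 k2 k3
  · obtain ⟨k1, k2, k3⟩ := h.mem_right hx
    exact h.wind_right x k1 k2 k3

theorem inter_subset {V₁ V₂ : Set ℂ} (h₁ : Cell (a :: t₁ ++ [b]) V₁)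
    (h₂ : Cell (a :: b :: t₂) V₂) :
    (poly (a :: t₁ ++ [b]) ∪ V₁) ∩ (poly (a :: b :: t₂) ∪ V₂) ⊆ segment ℝ a b := by
  have h12 : ∀ x ∈ poly (a :: t₁ ++ [b]) \ poly (a :: b :: t₂), wind (a :: b :: t₂) x = 0 := by
    intro x hx
    obtain ⟨k1, k2, k3⟩ := h.mem_left hx
    exact h.wind_left x k1 k2 k3
  have h21 : ∀ x ∈ poly (a :: b :: t₂) \ poly (a :: t₁ ++ [b]), wind (a :: t₁ ++ [b]) x = 0 := by
    intro x hx
    obtain ⟨k1, k2, k3⟩ := h.mem_right hx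
    exact h.wind_right x k1 k2 k3
  obtain ⟨y, hy⟩ := h.left_diff
  rintro x ⟨h1 | h1, h2 | h2⟩
  · exact h.poly_inter ⟨h1, h2⟩
  · exact absurd h1 (Set.disjoint_left.mp (h₂.disjoint_poly h12) h2)
  · exact absurd h2 (Set.disjoint_left.mp (h₁.disjoint_poly h21) h1)
  · exact absurd h2 (Set.disjoint_left.mp (h₁.disjoint_cell h₂ h21 hy.1 hy.2 (h12 y hy)) h1)

theorem simple_left : SimplePoly (a :: t₁ ++ [b]) where
  three_le := by
    have := List.length_pos_iff.mpr h.left_ne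
    simp only [List.length_append, List.length_cons, List.length_nil]
    omega
  nodup := h.simple.nodup.sublist (List.Sublist.append_left (by simp) _)
  meet := by
    have hc := cyc_split a b t₁ t₂
    have hc1 : cyc (a :: t₁ ++ [b]) = seqEdges (a :: t₁ ++ [b]) ++ [(b, a)] := by
      rw [cyc_split]; rfl
    have hm : ∀ e ∈ seqEdges (a :: t₁ ++ [b]), e ∈ cyc (a :: t₁ ++ b :: t₂) := fun e he => by
      rw [hc]; exact List.mem_append_left _ he
    have key : ∀ e ∈ seqEdges (a :: t₁ ++ [b]), ∀ x ∈ segment ℝ e.1 e.2, x ∈ segment ℝ b a →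
        (x = e.1 ∨ x = e.2) ∧ (x = b ∨ x = a) := by
      intro e he x hx hx'
      rw [segment_symm] at hx'
      have h1 := h.diag x hx' ⟨e, hm e he, hx⟩
      refine ⟨h.simple.vertex_on_edge ?_ (hm e he) hx, h1.symm⟩
      rcases h1 with rfl | rfl <;> simp
    intro e he e' he' x hx hx'
    rw [hc1, List.mem_append, List.mem_singleton] at he he'
    rcases he with he | rfl <;> rcases he' with he' | rfl
    · exact h.simple.meet e (hm e he) e' (hm e' he') x hx hx'
    · exact Or.inr (key e he x hx hx')
    · exact Or.inr (key e' he' x hx' hx).symm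
    · exact Or.inl rfl

theorem symm : Chord b a t₂ t₁ where
  simple := h.simple.rotate (l₁ := a :: t₁) (l₂ := b :: t₂)
  left_ne := h.right_ne
  right_ne := h.left_ne
  diag x hx hx' := by
    rw [segment_symm] at hx
    rw [poly_perm (cyc_rotate_perm (b :: t₂) (a :: t₁))] at hx'
    exact (h.diag x hx hx').symm
  left := by
    obtain ⟨x, hx, hxa, hxb, hw⟩ := h.right
    refine ⟨x, hx, hxb, hxa, ?_⟩
    exact (wind_perm (cyc_rotate_perm (a :: t₁) [b]) x).symm.trans hw
  right := by
    obtain ⟨x, hx, hxa, hxb, hw⟩ := h.left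
    refine ⟨x, hx, hxb, hxa, ?_⟩
    rw [wind_perm (cyc_rotate_perm (b :: t₂) [a])]
    exact hw

theorem simple_right : SimplePoly (a :: b :: t₂) :=
  h.symm.simple_left.rotate (l₁ := b :: t₂) (l₂ := [a])

end Chord

/-! ### Existence of diagonals -/

theorem re_affine {v c p q : ℂ} {s t : ℝ} (hst : s + t = 1) :
    ((s • p + t • q - v) * c).re = s * ((p - v) * c).re + t * ((q - v) * c).re := by
  have : s • p + t • q - v = s • (p - v) + t • (q - v) := by
    have hv : v = s • v + t • v := by rw [← add_smul, hst, one_smul]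
    rw [smul_sub, smul_sub]
    nth_rewrite 1 [hv]
    abel
  rw [this, add_mul, Complex.add_re, smul_mul_assoc, smul_mul_assoc, Complex.smul_re,
    Complex.smul_re, smul_eq_mul, smul_eq_mul]

theorem wind_zero_of_wedge {l : List ℂ} {v x d cξ cβ : ℂ} {η : ℝ} (hη : 0 < η)
    (hx : ((x - v) * cξ).re = η) (hxβ : ((x - v) * cβ).re ≤ 0) (hd : (d * cξ).re = 0)
    (hdβ : (d * cβ).re < 0)
    (h : ∀ e ∈ cyc l, (η < ((e.1 - v) * cξ).re ∧ η < ((e.2 - v) * cξ).re) ∨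
      (e.1 = v ∧ 0 < ((e.2 - v) * cβ).re) ∨ (e.2 = v ∧ 0 < ((e.1 - v) * cβ).re)) :
    wind l x = 0 := by
  have hyξ : ∀ τ : ℝ, ((x + τ * d - v) * cξ).re = η := by
    intro τ
    have : (x + τ * d - v) * cξ = (x - v) * cξ + τ * (d * cξ) := by ring
    rw [this, Complex.add_re, Complex.re_ofReal_mul, hx, hd]; simp
  have hyβ : ∀ τ : ℝ, ((x + τ * d - v) * cβ).re = ((x - v) * cβ).re + τ * (d * cβ).re := by
    intro τ
    have : (x + τ * d - v) * cβ = (x - v) * cβ + τ * (d * cβ) := by ring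
    rw [this, Complex.add_re, Complex.re_ofReal_mul]
  have hv : ∀ q y : ℂ, ((y - v) * cξ).re = η → ((y - v) * cβ).re ≤ 0 → 0 < ((q - v) * cβ).re →
      y ∉ segment ℝ v q := by
    rintro q y hy hyb hq ⟨s, t, hs, ht, hst, rfl⟩
    rw [re_affine hst] at hy hyb
    simp only [sub_self, zero_mul, Complex.zero_re, mul_zero, zero_add] at hy hyb
    have : t = 0 := le_antisymm (by by_contra hc; push Not at hc; nlinarith) ht
    rw [this] at hy
    simp at hy
    exact hη.ne hy
  have hav : ∀ τ ∈ Ici (0 : ℝ), ∀ e ∈ cyc l, x + τ * d ∉ segment ℝ e.1 e.2 := by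
    intro τ hτ e he hmem
    have hb : ((x + τ * d - v) * cβ).re ≤ 0 := by
      rw [hyβ]; nlinarith [mem_Ici.mp hτ]
    rcases h e he with ⟨h1, h2⟩ | ⟨h1, h2⟩ | ⟨h1, h2⟩
    · obtain ⟨s, t, hs, ht, hst, hy⟩ := hmem
      have h3 := hyξ τ
      rw [← hy, re_affine hst] at h3
      have ht : t = 1 - s := by linarith
      subst ht
      nlinarith [mul_nonneg hs (sub_nonneg.mpr h1.le), mul_nonneg ht (sub_nonneg.mpr h2.le)]
    · rw [h1] at hmem
      exact hv _ _ (hyξ τ) hb h2 hmem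
    · rw [h1, segment_symm] at hmem
      exact hv _ _ (hyξ τ) hb h2 hmem
  have hbd : ∃ m : ℝ, ∀ p ∈ l, m < ((p - v) * cβ).re := by
    clear h hav
    induction l with
    | nil => exact ⟨0, by simp⟩
    | cons a t ih =>
      obtain ⟨m, hm⟩ := ih
      refine ⟨min m (((a - v) * cβ).re - 1), fun p hp => ?_⟩
      rcases List.mem_cons.mp hp with rfl | hp
      · exact lt_of_le_of_lt (min_le_right _ _) (by linarith)
      · exact lt_of_le_of_lt (min_le_left _ _) (hm p hp)
  obtain ⟨m, hm⟩ := hbd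
  set τ : ℝ := |m| / (-(d * cβ).re) with hτ
  have hτ0 : 0 ≤ τ := div_nonneg (abs_nonneg _) (by linarith)
  have hτm : τ * (d * cβ).re ≤ m := by
    have : τ * (-(d * cβ).re) = |m| := div_mul_cancel₀ _ (by linarith)
    linarith [neg_abs_le m]
  have h1 := wind_homotopy (T := ℝ) (convex_Ici (0 : ℝ)).isPreconnected
    (l.map fun p => fun _ : ℝ => p) (fun τ : ℝ => x + τ * d) (by simp [continuousOn_const])
    (by fun_prop) (by
      intro t ht e he hxe
      rw [cyc_map, List.mem_map] at he
      obtain ⟨e', he', rfl⟩ := he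
      exact hav t ht e' he' hxe) (self_mem_Ici (a := (0 : ℝ))) (mem_Ici.mpr hτ0)
  simp only [List.map_map, Function.comp_def, List.map_id', Complex.ofReal_zero, zero_mul,
    add_zero] at h1
  rw [h1]
  refine wind_eq_zero_of_halfPlane (c := cβ) fun p hp => ?_
  have e1 : (p - (x + τ * d)) * cβ = (p - v) * cβ - (x + τ * d - v) * cβ := by ring
  rw [e1, Complex.sub_re, hyβ]
  linarith [hm p hp]

/-- The polygon `v, u, m, w` with `v` a strictly supported vertex, together with affine
coordinates at the corner `v`. -/
structure Corner (v u w : ℂ) (m : List ℂ) (ξ α β : ℂ) : Prop where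
  simple : SimplePoly (v :: u :: m ++ [w])
  ne_nil : m ≠ []
  pos : ∀ p ∈ u :: m ++ [w], 0 < ((p - v) * ξ).re
  αu : ((u - v) * α).re = 1
  αw : ((w - v) * α).re = 0
  βu : ((u - v) * β).re = 0
  βw : ((w - v) * β).re = 1
  ext : ∀ x : ℂ, x - v = ((x - v) * α).re • (u - v) + ((x - v) * β).re • (w - v)

theorem seqEdges_cons_cons {a b : ℂ} {l : List ℂ} :
    seqEdges (a :: b :: l) = (a, b) :: seqEdges (b :: l) := rfl

namespace Corner

variable {v u w ξ α β : ℂ} {m : List ℂ} (h : Corner v u w m ξ α β)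

include h

omit h in
theorem cyc_eq : cyc (v :: u :: m ++ [w]) = (v, u) :: (seqEdges (u :: m ++ [w]) ++ [(w, v)]) := by
  have := seqEdges_append (u :: m) [v] w
  simp only [cyc, List.cons_append, seqEdges_cons_cons, List.append_assoc,
    List.nil_append] at this ⊢
  rw [this]
  rfl

theorem middle_ne {z : ℂ} (hz : z ∈ m) : z ≠ v ∧ z ≠ u ∧ z ≠ w := by
  have := h.simple.nodup
  simp only [List.cons_append, List.nodup_cons, List.mem_cons, List.mem_append,
    List.nodup_append, List.not_mem_nil, or_false, not_or] at this
  obtain ⟨⟨h1, h2, h3⟩, ⟨h4, h5⟩, h6, h7, h8⟩ := this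
  refine ⟨?_, ?_, h8 z hz w rfl⟩
  · rintro rfl; exact h2 hz
  · rintro rfl; exact h4 hz

theorem uw : u ≠ w ∧ v ≠ u ∧ v ≠ w := by
  have := h.simple.nodup
  simp only [List.cons_append, List.nodup_cons, List.mem_cons, List.mem_append,
    List.nodup_append, List.not_mem_nil, or_false, not_or] at this
  tauto

theorem mem_vu {y : ℂ} (hβ : ((y - v) * β).re = 0) (h0 : 0 ≤ ((y - v) * α).re)
    (h1 : ((y - v) * α).re ≤ 1) : y ∈ segment ℝ v u := by
  refine ⟨1 - ((y - v) * α).re, ((y - v) * α).re, by linarith, h0, by ring, ?_⟩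
  have := h.ext y
  rw [hβ, zero_smul, add_zero] at this
  rw [sub_smul, one_smul, sub_add, ← smul_sub, ← neg_sub u v, smul_neg, ← this]
  abel

theorem mem_wv {y : ℂ} (hα : ((y - v) * α).re = 0) (h0 : 0 ≤ ((y - v) * β).re)
    (h1 : ((y - v) * β).re ≤ 1) : y ∈ segment ℝ w v := by
  refine ⟨((y - v) * β).re, 1 - ((y - v) * β).re, h0, by linarith, by ring, ?_⟩
  have := h.ext y
  rw [hα, zero_smul, zero_add] at this
  rw [sub_smul, one_smul, add_sub, add_sub_right_comm, ← smul_sub, ← this]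
  abel

theorem vu_coord {y : ℂ} (hy : y ∈ segment ℝ v u) : ((y - v) * β).re = 0 := by
  obtain ⟨s, t, hs, ht, hst, rfl⟩ := hy
  rw [re_affine hst, h.βu]; simp

theorem wv_coord {y : ℂ} (hy : y ∈ segment ℝ w v) : ((y - v) * α).re = 0 := by
  obtain ⟨s, t, hs, ht, hst, rfl⟩ := hy
  rw [re_affine hst, h.αw]; simp

/-- An edge cannot leave the corner triangle through its two sides at `v`. -/
theorem exit {x c d : ℂ} (he : (c, d) ∈ cyc (v :: u :: m ++ [w]) ∨
      (d, c) ∈ cyc (v :: u :: m ++ [w])) (hx : x ∈ segment ℝ c d) (hxα : 0 < ((x - v) * α).re)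
    (hxβ : 0 < ((x - v) * β).re) (hx1 : ((x - v) * α).re + ((x - v) * β).re ≤ 1) (hc : c ∈ m)
    (hc1 : ((c - v) * α).re + ((c - v) * β).re ≤ 1) :
    0 ≤ ((c - v) * α).re ∧ 0 ≤ ((c - v) * β).re := by
  by_contra hcon
  have hmin : min ((c - v) * α).re ((c - v) * β).re < 0 := by
    rw [min_lt_iff]
    by_contra h'
    push Not at h'
    exact hcon h'
  set y : ℝ → ℂ := fun t => (1 - t) • x + t • c with hy
  have hcont : ContinuousOn (fun t => min ((y t - v) * α).re ((y t - v) * β).re) (Icc 0 1) := by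
    apply Continuous.continuousOn
    simp only [hy]
    fun_prop
  have h0 : (0 : ℝ) ∈ (fun t => min ((y t - v) * α).re ((y t - v) * β).re) '' Icc 0 1 := by
    apply intermediate_value_Icc' zero_le_one hcont
    constructor
    · simpa [hy] using hmin.le
    · simp only [hy, sub_zero, one_smul, zero_smul, add_zero]
      exact (lt_min hxα hxβ).le
  obtain ⟨t, ⟨ht0, ht1⟩, ht⟩ := h0
  simp only at ht
  have hyα : 0 ≤ ((y t - v) * α).re := by rw [← ht]; exact min_le_left _ _
  have hyβ : 0 ≤ ((y t - v) * β).re := by rw [← ht]; exact min_le_right _ _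
  have hsum : ((y t - v) * α).re + ((y t - v) * β).re ≤ 1 := by
    simp only [hy]
    rw [re_affine (by ring), re_affine (by ring)]
    nlinarith
  have hyx : y t ∈ segment ℝ c x := by
    rw [segment_symm]
    exact ⟨1 - t, t, by linarith, ht0, by ring, rfl⟩
  have hycd : y t ∈ segment ℝ c d :=
    (convex_segment c d).segment_subset (left_mem_segment _ _ _) hx hyx
  have hyd : y t ≠ d := by
    intro heq
    rw [heq] at hyx
    have := eq_of_mem_segment_of_mem_segment hx hyx
    rw [heq, ← this] at ht
    exact (lt_min hxα hxβ).ne' ht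
  have hy0 : ((y t - v) * α).re = 0 ∨ ((y t - v) * β).re = 0 := by
    rcases le_total ((y t - v) * α).re ((y t - v) * β).re with hl | hl
    · exact Or.inl (by rwa [min_eq_left hl] at ht)
    · exact Or.inr (by rwa [min_eq_right hl] at ht)
  obtain ⟨n1, n2, n3⟩ := h.middle_ne hc
  have key : ∀ p q : ℂ, (p, q) ∈ cyc (v :: u :: m ++ [w]) → c ≠ p → c ≠ q →
      y t ∉ segment ℝ p q := by
    intro p q hpq hp hq hmem
    rcases he with he | he
    · rcases h.simple.meet _ he _ hpq _ hycd hmem with heq | ⟨h1 | h1, h2⟩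
      · exact hp (congrArg Prod.fst heq)
      · simp only at h1 h2
        rw [h1] at h2
        rcases h2 with h2 | h2
        exacts [hp h2, hq h2]
      · exact hyd h1
    · rw [segment_symm] at hycd
      rcases h.simple.meet _ he _ hpq _ hycd hmem with heq | ⟨h1 | h1, h2⟩
      · exact hq (congrArg Prod.snd heq)
      · exact hyd h1
      · simp only at h1 h2
        rw [h1] at h2
        rcases h2 with h2 | h2
        exacts [hp h2, hq h2]
  rcases hy0 with hy0 | hy0
  · refine key w v (by rw [cyc_eq]; simp) n3 n1 (h.mem_wv hy0 hyβ (by linarith))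
  · refine key v u (by rw [cyc_eq]; simp) n1 n2 (h.mem_vu hy0 hyα (by linarith))

theorem pick {x c d : ℂ} (hx : x ∈ segment ℝ c d) (hxu : x ≠ u) (hxw : x ≠ w)
    (hx1 : ((x - v) * α).re + ((x - v) * β).re ≤ 1) (hd : d ∈ u :: m ++ [w]) :
    ((c - v) * α).re + ((c - v) * β).re ≤ ((x - v) * α).re + ((x - v) * β).re ∨
      (d ∈ m ∧ ((d - v) * α).re + ((d - v) * β).re ≤ ((x - v) * α).re + ((x - v) * β).re) := by
  by_contra hcon
  push Not at hcon
  obtain ⟨hc, hd'⟩ := hcon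
  obtain ⟨s, t, hs, ht, hst, hval⟩ := hx
  have hS : ((x - v) * α).re + ((x - v) * β).re = s * (((c - v) * α).re + ((c - v) * β).re)
          + t * (((d - v) * α).re + ((d - v) * β).re) := by
    rw [← hval, re_affine hst, re_affine hst]; ring
  have hd1 : ((x - v) * α).re + ((x - v) * β).re ≤ ((d - v) * α).re + ((d - v) * β).re ∧
      (d ∈ m ∨ d = u ∨ d = w) := by
    simp only [List.cons_append, List.mem_cons, List.mem_append, List.not_mem_nil,
      or_false] at hd
    rcases hd with rfl | hd | rfl
    · rw [h.αu, h.βu]; exact ⟨by linarith, Or.inr (Or.inl rfl)⟩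
    · exact ⟨(hd' hd).le, Or.inl hd⟩
    · rw [h.αw, h.βw]; exact ⟨by linarith, Or.inr (Or.inr rfl)⟩
  have hs0 : s = 0 := by
    refine le_antisymm (le_of_not_gt fun hs' => ?_) hs
    have := mul_lt_mul_of_pos_left hc hs'
    have := mul_le_mul_of_nonneg_left hd1.1 ht
    have e : s * (((x - v) * α).re + ((x - v) * β).re) + t * (((x - v) * α).re + ((x - v) * β).re)
      = ((x - v) * α).re + ((x - v) * β).re := by rw [← add_mul, hst, one_mul]
    linarith
  have ht1 : t = 1 := by linarith
  have hxd : d = x := by rw [← hval, hs0, ht1]; simp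
  rcases hd1.2 with h1 | h1 | h1
  · have := hd' h1
    rw [hxd] at this
    exact lt_irrefl _ this
  · exact hxu (hxd ▸ h1)
  · exact hxw (hxd ▸ h1)

/-- A crossing of the polygon with the open corner region forces a vertex in the corner triangle
at a level not above that of the crossing. -/
theorem exists_vertex {x : ℂ} (hx : x ∈ poly (v :: u :: m ++ [w])) (hxu : x ≠ u) (hxw : x ≠ w)
    (hxα : 0 < ((x - v) * α).re) (hxβ : 0 < ((x - v) * β).re)
    (hx1 : ((x - v) * α).re + ((x - v) * β).re ≤ 1) :
    ∃ c ∈ m, 0 ≤ ((c - v) * α).re ∧ 0 ≤ ((c - v) * β).re ∧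
      ((c - v) * α).re + ((c - v) * β).re ≤ ((x - v) * α).re + ((x - v) * β).re := by
  obtain ⟨⟨c, d⟩, he, hxe⟩ := hx
  have he0 := he
  rw [cyc_eq, List.mem_cons, List.mem_append, List.mem_singleton] at he
  have he' : (c, d) ∈ seqEdges (u :: m ++ [w]) := by
    rcases he with he | he | he
    · simp only [Prod.mk.injEq] at he
      rw [he.1, he.2] at hxe
      exact absurd (h.vu_coord hxe) hxβ.ne'
    · exact he
    · simp only [Prod.mk.injEq] at he
      rw [he.1, he.2] at hxe
      exact absurd (h.wv_coord hxe) hxα.ne'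
  have hmid := middle_mem h.ne_nil he'
  have hmem := mem_of_mem_seqEdges he'
  simp only at hmid hmem hxe
  have hxe' := hxe
  rw [segment_symm] at hxe'
  have hc : c ∈ m → ((c - v) * α).re + ((c - v) * β).re ≤ ((x - v) * α).re + ((x - v) * β).re →
      ∃ c ∈ m, 0 ≤ ((c - v) * α).re ∧ 0 ≤ ((c - v) * β).re ∧
      ((c - v) * α).re + ((c - v) * β).re ≤ ((x - v) * α).re + ((x - v) * β).re := fun hc hl =>
    have := h.exit (Or.inl he0) hxe hxα hxβ hx1 hc (hl.trans hx1)
    ⟨c, hc, this.1, this.2, hl⟩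
  have hd : d ∈ m → ((d - v) * α).re + ((d - v) * β).re ≤ ((x - v) * α).re + ((x - v) * β).re →
      ∃ c ∈ m, 0 ≤ ((c - v) * α).re ∧ 0 ≤ ((c - v) * β).re ∧
      ((c - v) * α).re + ((c - v) * β).re ≤ ((x - v) * α).re + ((x - v) * β).re := fun hd hl =>
    have := h.exit (Or.inr he0) hxe' hxα hxβ hx1 hd (hl.trans hx1)
    ⟨d, hd, this.1, this.2, hl⟩
  rcases hmid with hm | hm
  · rcases h.pick hxe hxu hxw hx1 hmem.2 with h1 | ⟨h1, h2⟩
    exacts [hc hm h1, hd h1 h2]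
  · rcases h.pick hxe' hxu hxw hx1 hmem.1 with h1 | ⟨h1, h2⟩
    exacts [hd hm h1, hc h1 h2]

theorem coord_pos {z : ℂ} (hz : z ∈ m) (hα : 0 ≤ ((z - v) * α).re) (hβ : 0 ≤ ((z - v) * β).re)
    (h1 : ((z - v) * α).re + ((z - v) * β).re ≤ 1) :
    0 < ((z - v) * α).re ∧ 0 < ((z - v) * β).re := by
  obtain ⟨n1, n2, n3⟩ := h.middle_ne hz
  have hzl : z ∈ v :: u :: m ++ [w] := by simp [hz]
  constructor
  · refine lt_of_le_of_ne hα fun h0 => ?_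
    have := h.mem_wv h0.symm hβ (by linarith)
    rcases h.simple.vertex_on_edge hzl (e := (w, v)) (by rw [cyc_eq]; simp) this with h | h
    exacts [n3 h, n1 h]
  · refine lt_of_le_of_ne hβ fun h0 => ?_
    have := h.mem_vu h0.symm hα (by linarith)
    rcases h.simple.vertex_on_edge hzl (e := (v, u)) (by rw [cyc_eq]; simp) this with h | h
    exacts [n1 h, n2 h]

theorem chord_ear (hZ : ∀ z ∈ m, ¬ (0 ≤ ((z - v) * α).re ∧ 0 ≤ ((z - v) * β).re ∧
    ((z - v) * α).re + ((z - v) * β).re ≤ 1)) : Chord w u [v] m := by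
  have hperm : (cyc (w :: [v] ++ u :: m)).Perm (cyc (v :: u :: m ++ [w])) :=
    cyc_rotate_perm [w] (v :: u :: m)
  refine ⟨h.simple.rotate (l₁ := v :: u :: m) (l₂ := [w]), by simp, h.ne_nil, ?_, ?_, ?_⟩
  · intro x hx hxp
    rw [poly_perm hperm] at hxp
    by_contra hcon
    push Not at hcon
    obtain ⟨s, t, hs, ht, hst, hval⟩ := hx
    have hα : ((x - v) * α).re = t := by
      rw [← hval, re_affine hst, h.αw, h.αu]; ring
    have hβ : ((x - v) * β).re = s := by
      rw [← hval, re_affine hst, h.βw, h.βu]; ring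
    have ht0 : 0 < t := by
      refine lt_of_le_of_ne ht fun h0 => hcon.1 ?_
      have : s = 1 := by linarith
      rw [← hval, ← h0, this]; simp
    have hs0 : 0 < s := by
      refine lt_of_le_of_ne hs fun h0 => hcon.2 ?_
      have : t = 1 := by linarith
      rw [← hval, ← h0, this]; simp
    obtain ⟨c, hc, k1, k2, k3⟩ := h.exists_vertex hxp hcon.2 hcon.1 (by rwa [hα]) (by rwa [hβ])
      (by rw [hα, hβ]; linarith)
    exact hZ c hc ⟨k1, k2, by rw [hα, hβ] at k3; linarith⟩
  · refine ⟨v, ⟨(w, v), by simp [seqEdges], right_mem_segment _ _ _⟩, h.uw.2.2, h.uw.2.1, ?_⟩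
    refine wind_eq_zero_of_halfPlane (c := ξ) fun p hp => h.pos p ?_
    simp only [List.cons_append, List.mem_cons, List.mem_append, List.not_mem_nil,
      or_false] at hp ⊢
    tauto
  · obtain ⟨z, t, hzt⟩ := List.exists_cons_of_ne_nil h.ne_nil
    have hz : z ∈ m := by rw [hzt]; simp
    obtain ⟨n1, n2, n3⟩ := h.middle_ne hz
    refine ⟨z, ⟨(u, z), by rw [hzt]; simp [seqEdges], right_mem_segment _ _ _⟩, n3, n2, ?_⟩
    have hlist : ∀ p ∈ w :: [v] ++ [u], p = v ∨ p = u ∨ p = w := by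
      intro p hp
      simp only [List.cons_append, List.nil_append, List.mem_cons, List.not_mem_nil,
        or_false] at hp
      tauto
    have hsub : ∀ p c : ℂ, ((p - z) * c).re = ((p - v) * c).re - ((z - v) * c).re := by
      intro p c
      rw [← Complex.sub_re]
      congr 1
      ring
    by_cases hα : 0 ≤ ((z - v) * α).re
    · by_cases hβ : 0 ≤ ((z - v) * β).re
      · have h1 : 1 < ((z - v) * α).re + ((z - v) * β).re := by
          by_contra h1
          exact hZ z hz ⟨hα, hβ, not_lt.mp h1⟩
        refine wind_eq_zero_of_halfPlane (c := -α - β) fun p hp => ?_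
        rw [mul_sub, mul_neg, Complex.sub_re, Complex.neg_re, hsub, hsub]
        rcases hlist p hp with rfl | rfl | rfl
        · simp only [sub_self, zero_mul, Complex.zero_re]; linarith
        · rw [h.αu, h.βu]; linarith
        · rw [h.αw, h.βw]; linarith
      · push Not at hβ
        refine wind_eq_zero_of_halfPlane (c := β) fun p hp => ?_
        rw [hsub]
        rcases hlist p hp with rfl | rfl | rfl
        · simp only [sub_self, zero_mul, Complex.zero_re]; linarith
        · rw [h.βu]; linarith
        · rw [h.βw]; linarith
    · push Not at hα
      refine wind_eq_zero_of_halfPlane (c := α) fun p hp => ?_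
      rw [hsub]
      rcases hlist p hp with rfl | rfl | rfl
      · simp only [sub_self, zero_mul, Complex.zero_re]; linarith
      · rw [h.αu]; linarith
      · rw [h.αw]; linarith

theorem chord_inner {m₁ m₂ : List ℂ} {z : ℂ} (hm : m = m₁ ++ z :: m₂)
    (hα : 0 ≤ ((z - v) * α).re) (hβ : 0 ≤ ((z - v) * β).re)
    (h1 : ((z - v) * α).re + ((z - v) * β).re ≤ 1)
    (hmin : ∀ c ∈ m, 0 ≤ ((c - v) * α).re → 0 ≤ ((c - v) * β).re →
      ((z - v) * α).re + ((z - v) * β).re ≤ ((c - v) * α).re + ((c - v) * β).re) :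
    Chord v z (u :: m₁) (m₂ ++ [w]) := by
  have hz : z ∈ m := by rw [hm]; simp
  obtain ⟨pα, pβ⟩ := h.coord_pos hz hα hβ h1
  obtain ⟨n1, n2, n3⟩ := h.middle_ne hz
  have hlist : v :: (u :: m₁) ++ z :: (m₂ ++ [w]) = v :: u :: m ++ [w] := by rw [hm]; simp
  obtain ⟨η, hη, hηl⟩ : ∃ η : ℝ, 0 < η ∧ ∀ p ∈ u :: m ++ [w], η < ((p - v) * ξ).re := by
    have : ∀ l : List ℂ, (∀ p ∈ l, 0 < ((p - v) * ξ).re) →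
        ∃ η : ℝ, 0 < η ∧ ∀ p ∈ l, η < ((p - v) * ξ).re := by
      intro l hl
      induction l with
      | nil => exact ⟨1, one_pos, by simp⟩
      | cons a t ih =>
        obtain ⟨η, h0, h1⟩ := ih fun p hp => hl p (by simp [hp])
        have ha := hl a (by simp)
        refine ⟨min η (((a - v) * ξ).re / 2), lt_min h0 (by linarith), fun p hp => ?_⟩
        rcases List.mem_cons.mp hp with rfl | hp
        · exact lt_of_le_of_lt (min_le_right _ _) (by linarith)
        · exact lt_of_le_of_lt (min_le_left _ _) (h1 p hp)
    exact this _ h.pos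
  have hu := hηl u (by simp)
  have hw := hηl w (by simp)
  set ξu := ((u - v) * ξ).re with hξu
  set ξw := ((w - v) * ξ).re with hξw
  have hu0 : 0 < ξu := hη.trans hu
  have hw0 : 0 < ξw := hη.trans hw
  have hre : ∀ (r : ℝ) (p c : ℂ), ((v + (r : ℂ) * (p - v) - v) * c).re = r * ((p - v) * c).re := by
    intro r p c
    rw [add_sub_cancel_left, mul_assoc, Complex.re_ofReal_mul]
  have hdre : ∀ (r s : ℝ) (c : ℂ), (((r : ℂ) * (u - v) - (s : ℂ) * (w - v)) * c).re
      = r * ((u - v) * c).re - s * ((w - v) * c).re := by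
    intro r s c
    rw [sub_mul, mul_assoc, mul_assoc, Complex.sub_re, Complex.re_ofReal_mul,
      Complex.re_ofReal_mul]
  refine ⟨by rw [hlist]; exact h.simple, by simp, by simp, ?_, ?_, ?_⟩
  · intro x hx hxp
    rw [hlist] at hxp
    by_contra hcon
    push Not at hcon
    obtain ⟨s, t, hs, ht, hst, hval⟩ := hx
    have eα : ((x - v) * α).re = t * ((z - v) * α).re := by
      rw [← hval, re_affine hst]; simp
    have eβ : ((x - v) * β).re = t * ((z - v) * β).re := by
      rw [← hval, re_affine hst]; simp
    have ht0 : 0 < t := by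
      refine lt_of_le_of_ne ht fun h0 => hcon.1 ?_
      have : s = 1 := by linarith
      rw [← hval, ← h0, this]; simp
    have hs0 : 0 < s := by
      refine lt_of_le_of_ne hs fun h0 => hcon.2 ?_
      have : t = 1 := by linarith
      rw [← hval, ← h0, this]; simp
    have ha := mul_pos ht0 pα
    have hb := mul_pos ht0 pβ
    obtain ⟨c, hc, k1, k2, k3⟩ := h.exists_vertex hxp (by
        rintro rfl; rw [h.βu] at eβ; linarith) (by
        rintro rfl; rw [h.αw] at eα; linarith) (by rwa [eα]) (by rwa [eβ])
      (by rw [eα, eβ]; nlinarith)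
    have := hmin c hc k1 k2
    rw [eα, eβ] at k3
    nlinarith
  · refine ⟨v + ((η / ξu : ℝ) : ℂ) * (u - v), ⟨(v, u), by simp [seqEdges], ?_⟩, ?_, ?_, ?_⟩
    · refine ⟨1 - η / ξu, η / ξu, sub_nonneg.mpr ((div_le_one hu0).mpr hu.le), by positivity,
        by ring, ?_⟩
      simp only [Complex.real_smul]; push_cast; ring
    · intro heq
      have := hre (η / ξu) u ξ
      rw [heq, div_mul_cancel₀ _ hu0.ne'] at this
      simp only [sub_self, zero_mul, Complex.zero_re] at this
      exact hη.ne this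
    · intro heq
      have := hre (η / ξu) u β
      rw [heq, h.βu] at this
      linarith
    · refine wind_zero_of_wedge (v := v) (cξ := ξ) (cβ := β) (η := η)
        (d := ((1 / ξu : ℝ) : ℂ) * (u - v) - ((1 / ξw : ℝ) : ℂ) * (w - v)) hη ?_ ?_ ?_ ?_ ?_
      · rw [hre, div_mul_cancel₀ _ hu0.ne']
      · rw [hre, h.βu, mul_zero]
      · rw [hdre, ← hξu, ← hξw]; field_simp; ring
      · rw [hdre, h.βu, h.βw]; simp only [mul_zero, mul_one, zero_sub, neg_lt_zero]; positivity
      · have hc : cyc (v :: z :: (m₂ ++ [w])) =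
            (v, z) :: (seqEdges (z :: m₂ ++ [w]) ++ [(w, v)]) := by
          have := seqEdges_append (z :: m₂) [v] w
          simp only [cyc, List.cons_append, seqEdges_cons_cons, List.append_assoc,
            List.nil_append] at this ⊢
          rw [this]
          rfl
        rw [hc]
        intro e he
        simp only [List.mem_cons, List.mem_append, List.not_mem_nil, or_false] at he
        rcases he with rfl | he | rfl
        · exact Or.inr (Or.inl ⟨rfl, pβ⟩)
        · have := mem_of_mem_seqEdges he
          refine Or.inl ⟨hηl _ ?_, hηl _ ?_⟩
          · have := this.1; rw [hm]; simp only [List.cons_append, List.mem_cons,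
              List.mem_append, List.not_mem_nil, or_false] at this ⊢; tauto
          · have := this.2; rw [hm]; simp only [List.cons_append, List.mem_cons,
              List.mem_append, List.not_mem_nil, or_false] at this ⊢; tauto
        · exact Or.inr (Or.inr ⟨rfl, by rw [h.βw]; exact one_pos⟩)
  · refine ⟨v + ((η / ξw : ℝ) : ℂ) * (w - v), ⟨(w, v), ?_, ?_⟩, ?_, ?_, ?_⟩
    · have := seqEdges_append (z :: m₂) [v] w
      have e : z :: (m₂ ++ [w]) ++ [v] = z :: m₂ ++ w :: [v] := by simp
      rw [e, this]; simp [seqEdges]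
    · refine ⟨η / ξw, 1 - η / ξw, by positivity, sub_nonneg.mpr ((div_le_one hw0).mpr hw.le),
        by ring, ?_⟩
      simp only [Complex.real_smul]; push_cast; ring
    · intro heq
      have := hre (η / ξw) w ξ
      rw [heq, div_mul_cancel₀ _ hw0.ne'] at this
      simp only [sub_self, zero_mul, Complex.zero_re] at this
      exact hη.ne this
    · intro heq
      have := hre (η / ξw) w α
      rw [heq, h.αw] at this
      linarith
    · refine wind_zero_of_wedge (v := v) (cξ := ξ) (cβ := α) (η := η)
        (d := ((-1 / ξu : ℝ) : ℂ) * (u - v) - ((-1 / ξw : ℝ) : ℂ) * (w - v)) hη ?_ ?_ ?_ ?_ ?_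
      · rw [hre, div_mul_cancel₀ _ hw0.ne']
      · rw [hre, h.αw, mul_zero]
      · rw [hdre, ← hξu, ← hξw]; field_simp; ring
      · rw [hdre, h.αu, h.αw]
        have : 0 < 1 / ξu := by positivity
        rw [neg_div, neg_div]
        linarith
      · have hc : cyc (v :: (u :: m₁) ++ [z]) =
            (v, u) :: (seqEdges (u :: m₁ ++ [z]) ++ [(z, v)]) := by
          rw [cyc_split]; simp [seqEdges]
        rw [hc]
        intro e he
        simp only [List.mem_cons, List.mem_append, List.not_mem_nil, or_false] at he
        rcases he with rfl | he | rfl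
        · exact Or.inr (Or.inl ⟨rfl, by rw [h.αu]; exact one_pos⟩)
        · have := mem_of_mem_seqEdges he
          refine Or.inl ⟨hηl _ ?_, hηl _ ?_⟩
          · have := this.1; rw [hm]; simp only [List.cons_append, List.mem_cons,
              List.mem_append, List.not_mem_nil, or_false] at this ⊢; tauto
          · have := this.2; rw [hm]; simp only [List.cons_append, List.mem_cons,
              List.mem_append, List.not_mem_nil, or_false] at this ⊢; tauto
        · exact Or.inr (Or.inr ⟨rfl, pα⟩)

end Corner

theorem re_mul_neg_conj_pos {p v : ℂ} (hpv : p ≠ v) (h : ‖p‖ ≤ ‖v‖) :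
    0 < ((p - v) * (-(starRingEnd ℂ) v)).re := by
  have h1 : Complex.normSq p ≤ Complex.normSq v := by
    rw [Complex.normSq_eq_norm_sq, Complex.normSq_eq_norm_sq]
    gcongr
  have h2 : 0 < Complex.normSq (p - v) := Complex.normSq_pos.mpr (sub_ne_zero.mpr hpv)
  simp only [Complex.normSq_apply, Complex.sub_re, Complex.sub_im] at h1 h2
  simp only [Complex.mul_re, Complex.sub_re, Complex.sub_im, Complex.neg_re, Complex.neg_im,
    Complex.conj_re, Complex.conj_im]
  nlinarith

theorem SimplePoly.exists_corner {l : List ℂ} (h : SimplePoly l) (h4 : 4 ≤ l.length) :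
    ∃ s t : List ℂ, l = s ++ t ∧ ∃ v u w m ξ α β, t ++ s = v :: u :: m ++ [w] ∧
      Corner v u w m ξ α β := by
  have hne : l.toFinset.Nonempty := by
    rw [List.toFinset_nonempty_iff]
    rintro rfl
    simp at h4
  obtain ⟨v, hv, hmax⟩ := l.toFinset.exists_max_image (fun p => ‖p‖) hne
  rw [List.mem_toFinset] at hv
  obtain ⟨s, t', rfl⟩ := List.append_of_mem hv
  refine ⟨s, v :: t', rfl, ?_⟩
  have hs := h.rotate
  have hlen : 3 ≤ (t' ++ s).length := by
    simp only [List.length_append, List.length_cons] at h4 ⊢; omega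
  obtain ⟨u, r, hr⟩ : ∃ u r, t' ++ s = u :: r := by
    cases hts : t' ++ s with
    | nil => rw [hts] at hlen; simp at hlen
    | cons u r => exact ⟨u, r, rfl⟩
  obtain ⟨m, w, hm⟩ : ∃ m w, r = m ++ [w] := by
    rcases List.eq_nil_or_concat r with h0 | ⟨m, w, h0⟩
    · rw [hr, h0] at hlen; simp at hlen
    · exact ⟨m, w, by simpa using h0⟩
  have hl : v :: t' ++ s = v :: u :: m ++ [w] := by
    rw [List.cons_append, hr, hm]; simp
  have hmne : m ≠ [] := by
    rintro rfl
    rw [hr, hm] at hlen; simp at hlen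
  rw [hl] at hs
  have hmem : ∀ p ∈ u :: m ++ [w], ‖p‖ ≤ ‖v‖ := by
    intro p hp
    apply hmax
    rw [List.mem_toFinset]
    have h1 : p ∈ v :: t' ++ s := by
      rw [hl]
      simp only [List.cons_append, List.mem_cons] at hp ⊢
      tauto
    simp only [List.cons_append, List.mem_cons, List.mem_append] at h1 ⊢
    tauto
  have hnv : ∀ p ∈ u :: m ++ [w], p ≠ v := by
    have := hs.nodup
    rw [List.cons_append, List.cons_append, List.nodup_cons] at this
    rintro p hp rfl
    exact this.1 hp
  have hpos : ∀ p ∈ u :: m ++ [w], 0 < ((p - v) * (-(starRingEnd ℂ) v)).re := fun p hp =>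
    re_mul_neg_conj_pos (hnv p hp) (hmem p hp)
  set ξ := -(starRingEnd ℂ) v with hξ
  have huw : u ≠ w := by
    have := hs.nodup
    rintro rfl
    simp at this
  have hcyc : cyc (v :: u :: m ++ [w]) = (v, u) :: (seqEdges (u :: m ++ [w]) ++ [(w, v)]) :=
    Corner.cyc_eq
  have hΔ : (u - v).re * (w - v).im - (u - v).im * (w - v).re ≠ 0 := by
    intro h0
    have hu := hpos u (by simp)
    have hw := hpos w (by simp)
    have hprop : ((((u - v) * ξ).re : ℝ) : ℂ) * (w - v) = (((w - v) * ξ).re : ℂ) * (u - v) := by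
      generalize u - v = a at *
      generalize w - v = b at *
      apply Complex.ext
      · rw [Complex.re_ofReal_mul, Complex.re_ofReal_mul, Complex.mul_re, Complex.mul_re]
        linear_combination ξ.im * h0
      · rw [Complex.im_ofReal_mul, Complex.im_ofReal_mul, Complex.mul_re, Complex.mul_re]
        linear_combination ξ.re * h0
    have hgen : ∀ p q : ℂ, p ∈ u :: m ++ [w] → 0 < ((q - v) * ξ).re → 0 < ((p - v) * ξ).re →
        ((((p - v) * ξ).re : ℝ) : ℂ) * (q - v) = (((q - v) * ξ).re : ℂ) * (p - v) →
        ((p - v) * ξ).re ≤ ((q - v) * ξ).re → p ∈ segment ℝ v q := by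
      intro p q hp hq hpp heq hle
      generalize ((p - v) * ξ).re = A at hpp heq hle
      generalize ((q - v) * ξ).re = B at hq heq hle
      refine ⟨1 - A / B, A / B, sub_nonneg.mpr ((div_le_one hq).mpr hle), by positivity,
        by ring, ?_⟩
      have hq0 : (B : ℂ) ≠ 0 := by exact_mod_cast hq.ne'
      simp only [Complex.real_smul]
      push_cast
      field_simp
      linear_combination heq
    rcases le_total ((u - v) * ξ).re ((w - v) * ξ).re with hle | hle
    · have := hgen u w (by simp) hw hu hprop hle
      rw [segment_symm] at this
      rcases hs.vertex_on_edge (by simp) (e := (w, v)) (by rw [hcyc]; simp) this with h | h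
      exacts [huw h, hnv u (by simp) h]
    · have := hgen w u (by simp) hu hw hprop.symm hle
      rcases hs.vertex_on_edge (by simp) (e := (v, u)) (by rw [hcyc]; simp) this with h | h
      exacts [hnv w (by simp) h, huw h.symm]
  set Δ := (u - v).re * (w - v).im - (u - v).im * (w - v).re with hΔd
  have hα : ∀ x : ℂ, (x * (Complex.I * (starRingEnd ℂ) (w - v) * ((Δ⁻¹ : ℝ) : ℂ))).re
      = (x.re * (w - v).im - x.im * (w - v).re) / Δ := by
    intro x
    generalize w - v = b
    simp [Complex.mul_re, Complex.mul_im]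
    ring
  have hβ : ∀ x : ℂ, (x * (-Complex.I * (starRingEnd ℂ) (u - v) * ((Δ⁻¹ : ℝ) : ℂ))).re
      = ((u - v).re * x.im - (u - v).im * x.re) / Δ := by
    intro x
    generalize u - v = b
    simp [Complex.mul_re, Complex.mul_im]
    ring
  refine ⟨v, u, w, m, ξ, Complex.I * (starRingEnd ℂ) (w - v) * ((Δ⁻¹ : ℝ) : ℂ),
    -Complex.I * (starRingEnd ℂ) (u - v) * ((Δ⁻¹ : ℝ) : ℂ), hl,
    ⟨hs, hmne, hpos, ?_, ?_, ?_, ?_, ?_⟩⟩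
  · rw [hα, div_eq_one_iff_eq hΔ]
  · rw [hα]; ring
  · rw [hβ]; ring
  · rw [hβ, div_eq_one_iff_eq hΔ]
  · intro x
    rw [hα, hβ]
    generalize x - v = c at *
    generalize u - v = a at *
    generalize w - v = b at *
    apply Complex.ext
    · rw [Complex.add_re, Complex.smul_re, Complex.smul_re, smul_eq_mul, smul_eq_mul,
        div_mul_eq_mul_div, div_mul_eq_mul_div, ← add_div, eq_div_iff hΔ, hΔd]
      ring
    · rw [Complex.add_im, Complex.smul_im, Complex.smul_im, smul_eq_mul, smul_eq_mul,
        div_mul_eq_mul_div, div_mul_eq_mul_div, ← add_div, eq_div_iff hΔ, hΔd]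
      ring

theorem SimplePoly.exists_chord {l : List ℂ} (h : SimplePoly l) (h4 : 4 ≤ l.length) :
    ∃ s t : List ℂ, l = s ++ t ∧ ∃ a b t₁ t₂, t ++ s = a :: t₁ ++ b :: t₂ ∧ Chord a b t₁ t₂ := by
  obtain ⟨s, t, rfl, v, u, w, m, ξ, α, β, hl, hc⟩ := h.exists_corner h4
  by_cases hZ : ∀ z ∈ m, ¬ (0 ≤ ((z - v) * α).re ∧ 0 ≤ ((z - v) * β).re ∧
    ((z - v) * α).re + ((z - v) * β).re ≤ 1)
  · have hch := hc.chord_ear hZ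
    rcases List.eq_nil_or_concat s with rfl | ⟨s', w', hs'⟩
    · refine ⟨v :: u :: m, [w], by simpa using hl, w, u, [v], m, by simp, hch⟩
    · rw [List.concat_eq_append] at hs'
      subst hs'
      have h1 : t ++ s' = v :: u :: m ∧ w' = w := by
        have h1 : (t ++ s') ++ [w'] = (v :: u :: m) ++ [w] := by simpa using hl
        have := List.append_inj' h1 rfl
        exact ⟨this.1, by simpa using this.2⟩
      obtain ⟨h1, rfl⟩ := h1
      refine ⟨s', w' :: t, by simp, w', u, [v], m, ?_, hch⟩
      rw [List.cons_append, h1]; simp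
  · push Not at hZ
    obtain ⟨z₀, hz₀, hz₀'⟩ := hZ
    obtain ⟨z, hz, hmin⟩ := Finset.exists_min_image
      (m.toFinset.filter fun z => 0 ≤ ((z - v) * α).re ∧ 0 ≤ ((z - v) * β).re ∧
        ((z - v) * α).re + ((z - v) * β).re ≤ 1)
      (fun z => ((z - v) * α).re + ((z - v) * β).re)
      ⟨z₀, by rw [Finset.mem_filter, List.mem_toFinset]; exact ⟨hz₀, hz₀'⟩⟩
    rw [Finset.mem_filter, List.mem_toFinset] at hz
    obtain ⟨m₁, m₂, hm⟩ := List.append_of_mem hz.1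
    refine ⟨s, t, rfl, v, z, u :: m₁, m₂ ++ [w], by rw [hl, hm]; simp,
      hc.chord_inner hm hz.2.1 hz.2.2.1 hz.2.2.2 fun c hcm k1 k2 => ?_⟩
    by_cases hc1 : ((c - v) * α).re + ((c - v) * β).re ≤ 1
    · refine hmin c ?_
      rw [Finset.mem_filter, List.mem_toFinset]
      exact ⟨hcm, k1, k2, hc1⟩
    · linarith [hz.2.2.2]

/-- The signed area form of a triangle in the complex plane. -/
def cdet (p q z : ℂ) : ℝ := (q - p).re * (z - p).im - (q - p).im * (z - p).re

theorem SimplePoly.cdet_ne_zero {p q r : ℂ} (h : SimplePoly [p, q, r]) : cdet p q r ≠ 0 := by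
  have hn := h.nodup
  simp only [List.nodup_cons, List.mem_cons, List.not_mem_nil, or_false, not_or,
    List.nodup_nil, and_true, not_false_eq_true] at hn
  obtain ⟨⟨hpq, hpr⟩, hqr⟩ := hn
  intro h0
  have hqp : q - p ≠ 0 := sub_ne_zero.mpr (Ne.symm hpq)
  have him : ((r - p) / (q - p)).im = 0 := by
    rw [Complex.div_im, ← sub_div, div_eq_zero_iff]
    left
    rw [cdet] at h0
    linarith
  have hr : r = ((r - p) / (q - p)).re • (q - p) +ᵥ p := by
    have : (r - p) / (q - p) = (((r - p) / (q - p)).re : ℂ) := by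
      apply Complex.ext <;> simp [him]
    rw [Complex.real_smul, ← this, div_mul_cancel₀ _ hqp]
    simp
  have hcol : Collinear ℝ {p, q, r} := by
    rw [collinear_iff_of_mem (p₀ := p) (by simp)]
    refine ⟨q - p, ?_⟩
    rintro z (rfl | rfl | rfl)
    · exact ⟨0, by simp⟩
    · exact ⟨1, by simp⟩
    · exact ⟨_, hr⟩
  rcases hcol.wbtw_or_wbtw_or_wbtw with hw | hw | hw <;> rw [← mem_segment_iff_wbtw] at hw
  · rw [segment_symm] at hw
    rcases h.vertex_on_edge (p := q) (by simp) (e := (r, p)) (by simp [cyc, seqEdges]) hw with h | h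
    exacts [hqr h, hpq h.symm]
  · rw [segment_symm] at hw
    rcases h.vertex_on_edge (p := r) (by simp) (e := (p, q)) (by simp [cyc, seqEdges]) hw with h | h
    exacts [hpr h.symm, hqr h.symm]
  · rw [segment_symm] at hw
    rcases h.vertex_on_edge (p := p) (by simp) (e := (q, r)) (by simp [cyc, seqEdges]) hw with h | h
    exacts [hpq h, hpr h]

theorem ang_im (x a b : ℂ) :
    ((b - x) / (a - x)).im = cdet a b x / Complex.normSq (a - x) := by
  rw [Complex.div_im, ← sub_div, cdet]
  congr 1
  simp only [Complex.sub_re, Complex.sub_im]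
  ring

theorem ang_pos {x a b : ℂ} (h : 0 < cdet a b x) : 0 < ang x a b := by
  have ha : a - x ≠ 0 := by
    intro h0
    rw [sub_eq_zero] at h0
    subst h0
    simp [cdet] at h
  have him : 0 < ((b - x) / (a - x)).im := by
    rw [ang_im]
    exact div_pos h (Complex.normSq_pos.mpr ha)
  refine lt_of_le_of_ne (Complex.arg_nonneg_iff.mpr him.le) ?_
  intro h0
  have := (Complex.arg_eq_zero_iff.mp h0.symm).2
  exact him.ne' this

theorem ang_neg {x a b : ℂ} (h : cdet a b x < 0) : ang x a b < 0 := by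
  have ha : a - x ≠ 0 := by
    intro h0
    rw [sub_eq_zero] at h0
    subst h0
    simp [cdet] at h
  have him : ((b - x) / (a - x)).im < 0 := by
    rw [ang_im]
    exact div_neg_of_neg_of_pos h (Complex.normSq_pos.mpr ha)
  exact Complex.arg_neg_iff.mpr him

theorem cdet_combo (p q r : ℂ) {a b c : ℝ} (h : a + b + c = 1) :
    cdet p q (a * p + b * q + c * r) = c * cdet p q r ∧
    cdet q r (a * p + b * q + c * r) = a * cdet p q r ∧
    cdet r p (a * p + b * q + c * r) = b * cdet p q r := by
  obtain rfl : c = 1 - a - b := by linarith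
  refine ⟨?_, ?_, ?_⟩ <;>
  · simp only [cdet, Complex.sub_re, Complex.sub_im, Complex.add_re, Complex.add_im,
      Complex.re_ofReal_mul, Complex.im_ofReal_mul]
    ring

/-- The open triangle with given vertices. -/
def openTri (p q r : ℂ) : Set ℂ :=
  {z | ∃ a b c : ℝ, 0 < a ∧ 0 < b ∧ 0 < c ∧ a + b + c = 1 ∧ z = a * p + b * q + c * r}

theorem openTri_closure {p q r : ℂ} {a b c : ℝ} (ha : 0 ≤ a) (hb : 0 ≤ b) (hc : 0 ≤ c)
    (h : a + b + c = 1) : (a * p + b * q + c * r : ℂ) ∈ closure (openTri p q r) := by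
  have h1 := segment_subset_closure_openSegment (𝕜 := ℝ)
    (x := (a * p + b * q + c * r : ℂ)) (y := ((1 / 3 : ℝ) * p + (1 / 3 : ℝ) * q + (1 / 3 : ℝ) * r))
  refine closure_mono ?_ (h1 (left_mem_segment _ _ _))
  rintro z ⟨s, t, hs, ht, hst, rfl⟩
  refine ⟨s * a + t * (1 / 3), s * b + t * (1 / 3), s * c + t * (1 / 3), by positivity,
    by positivity, by positivity, by linear_combination s * h + hst, ?_⟩
  simp only [Complex.real_smul]
  push_cast
  ring

theorem cyc_three {α : Type*} (p q r : α) : cyc [p, q, r] = [(p, q), (q, r), (r, p)] := by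
  simp [cyc, seqEdges]

theorem SimplePoly.cell_tri {p q r : ℂ} (h : SimplePoly [p, q, r]) :
    Cell [p, q, r] (openTri p q r) := by
  have hΔ := h.cdet_ne_zero
  refine ⟨?_, ?_, ?_, ?_⟩
  · refine Convex.isPreconnected ?_
    rintro _ ⟨a, b, c, ha, hb, hc, h1, rfl⟩ _ ⟨a', b', c', ha', hb', hc', h1', rfl⟩ s t hs ht hst
    have key : ∀ u v : ℝ, 0 < u → 0 < v → 0 < s * u + t * v := by
      intro u v hu hv
      rcases hs.eq_or_lt with rfl | hs
      · have : t = 1 := by linarith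
        subst this; simpa using hv
      · positivity
    refine ⟨s * a + t * a', s * b + t * b', s * c + t * c', key _ _ ha ha', key _ _ hb hb',
      key _ _ hc hc', by linear_combination s * h1 + t * h1' + hst, ?_⟩
    simp only [Complex.real_smul]
    push_cast
    ring
  · rw [Set.disjoint_left]
    rintro z ⟨a, b, c, ha, hb, hc, h1, rfl⟩ ⟨e, he, hz⟩
    obtain ⟨d1, d2, d3⟩ := cdet_combo p q r h1
    have hseg : ∀ u v z : ℂ, z ∈ segment ℝ u v → cdet u v z = 0 := by
      rintro u v z ⟨s, t, -, -, hst, rfl⟩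
      obtain rfl : s = 1 - t := by linarith
      simp [cdet]
      ring
    rw [cyc_three] at he
    simp only [List.mem_cons, List.not_mem_nil, or_false] at he
    rcases he with rfl | rfl | rfl
    · rw [hseg _ _ _ hz] at d1
      exact mul_ne_zero hc.ne' hΔ d1.symm
    · rw [hseg _ _ _ hz] at d2
      exact mul_ne_zero ha.ne' hΔ d2.symm
    · rw [hseg _ _ _ hz] at d3
      exact mul_ne_zero hb.ne' hΔ d3.symm
  · rintro z ⟨a, b, c, ha, hb, hc, h1, rfl⟩
    obtain ⟨d1, d2, d3⟩ := cdet_combo p q r h1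
    rw [wind, cyc_three]
    simp only [List.map_cons, List.map_nil, List.sum_cons, List.sum_nil]
    rcases lt_or_gt_of_ne hΔ with hlt | hgt
    · have e1 := ang_neg (d1.trans_lt (mul_neg_of_pos_of_neg hc hlt))
      have e2 := ang_neg (d2.trans_lt (mul_neg_of_pos_of_neg ha hlt))
      have e3 := ang_neg (d3.trans_lt (mul_neg_of_pos_of_neg hb hlt))
      exact ne_of_lt (by linarith)
    · have e1 := ang_pos ((mul_pos hc hgt).trans_eq d1.symm)
      have e2 := ang_pos ((mul_pos ha hgt).trans_eq d2.symm)
      have e3 := ang_pos ((mul_pos hb hgt).trans_eq d3.symm)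
      exact ne_of_gt (by linarith)
  · rintro z ⟨e, he, s, t, hs, ht, hst, rfl⟩
    rw [cyc_three] at he
    simp only [List.mem_cons, List.not_mem_nil, or_false] at he
    rcases he with rfl | rfl | rfl
    · convert openTri_closure (p := p) (q := q) (r := r) hs ht le_rfl (by linarith) using 1
      simp
    · convert openTri_closure (p := p) (q := q) (r := r) le_rfl hs ht (by linarith) using 1
      simp
    · convert openTri_closure (p := p) (q := q) (r := r) ht le_rfl hs (by linarith) using 1
      simp [add_comm]

/-- `f` selects, at each point of `S`, one of finitely many affine maps. -/
def PLOn {E F : Type*} [AddCommGroup E] [Module ℝ E] [AddCommGroup F] [Module ℝ F]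
    (f : E → F) (S : Set E) : Prop :=
  ∃ 𝒜 : Set (E →ᵃ[ℝ] F), 𝒜.Finite ∧ ∀ x ∈ S, ∃ A ∈ 𝒜, f x = A x

/-- The area form on `ℝ × ℝ`. -/
def det3 (a b x : ℝ × ℝ) : ℝ := (b.1 - a.1) * (x.2 - a.2) - (b.2 - a.2) * (x.1 - a.1)

theorem det3_rot (a b c : ℝ × ℝ) : det3 b c a = det3 a b c := by simp only [det3]; ring

theorem det3_swap (a b c : ℝ × ℝ) : det3 b a c = -det3 a b c := by simp only [det3]; ring

theorem det3_lineMap (a b x y : ℝ × ℝ) (τ : ℝ) :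
    det3 a b (x + τ • (y - x)) = (1 - τ) * det3 a b x + τ * det3 a b y := by
  simp only [det3, Prod.fst_add, Prod.snd_add, Prod.smul_fst, Prod.smul_snd, Prod.fst_sub,
    Prod.snd_sub, smul_eq_mul]
  ring

/-- All positively ordered triples of vertices span a triangle of area at least `1 / 2`. -/
def ConvexPos (l : List (ℝ × ℝ)) : Prop := ∀ a b c, List.Sublist [a, b, c] l → 1 ≤ det3 a b c

theorem ConvexPos.sublist {l l' : List (ℝ × ℝ)} (h : ConvexPos l) (hs : List.Sublist l' l) :
    ConvexPos l' := fun a b c habc => h a b c (habc.trans hs)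

theorem ConvexPos.rotate {s t : List (ℝ × ℝ)} (h : ConvexPos (s ++ t)) : ConvexPos (t ++ s) := by
  intro a b c habc
  obtain ⟨l₁, l₂, he, h₁, h₂⟩ := List.sublist_append_iff.mp habc
  rcases l₁ with _ | ⟨a', _ | ⟨b', _ | ⟨c', l₁⟩⟩⟩
  · simp only [List.nil_append] at he
    subst he
    exact h a b c (h₂.trans (List.sublist_append_left _ _))
  · simp only [List.cons_append, List.nil_append, List.cons.injEq] at he
    obtain ⟨rfl, rfl⟩ := he
    rw [← det3_rot]
    exact h b c a (h₂.append h₁)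
  · simp only [List.cons_append, List.nil_append, List.cons.injEq] at he
    obtain ⟨rfl, rfl, rfl⟩ := he
    rw [← det3_rot, ← det3_rot]
    exact h c a b (h₂.append h₁)
  · simp only [List.cons_append, List.cons.injEq] at he
    obtain ⟨rfl, rfl, rfl, he⟩ := he
    have : l₁ = [] := by
      rcases l₁ with _ | ⟨x, l₁⟩
      · rfl
      · simp at he
    subst this
    exact h a b c (h₁.trans (List.sublist_append_right _ _))

/-- The convex domain bounded by a closed polygon. -/
def polyDom (l : List (ℝ × ℝ)) : Set (ℝ × ℝ) := {x | ∀ e ∈ cyc l, 0 ≤ det3 e.1 e.2 x}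

theorem polyDom_add_smul {l : List (ℝ × ℝ)} {x y : ℝ × ℝ} (hx : x ∈ polyDom l)
    (hy : y ∈ polyDom l) {τ : ℝ} (h0 : 0 ≤ τ) (h1 : τ ≤ 1) : x + τ • (y - x) ∈ polyDom l := by
  intro e he
  rw [det3_lineMap]
  exact add_nonneg (mul_nonneg (by linarith) (hx e he)) (mul_nonneg h0 (hy e he))

theorem polyDom_perm {l l' : List (ℝ × ℝ)} (h : (cyc l).Perm (cyc l')) :
    polyDom l = polyDom l' := by
  ext x
  simp only [polyDom, mem_ofPred_eq, h.mem_iff]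

theorem mem_seqEdges_cons {α : Type*} {v : α} {l : List α} {e : α × α}
    (h : e ∈ seqEdges (v :: l)) : e.1 = v ∨ e ∈ seqEdges l := by
  cases l with
  | nil => simp [seqEdges] at h
  | cons a t =>
    simp only [seqEdges, List.mem_cons] at h
    rcases h with rfl | h
    · exact Or.inl rfl
    · exact Or.inr h

theorem mem_seqEdges_concat {α : Type*} {v : α} {l : List α} {e : α × α}
    (h : e ∈ seqEdges (l ++ [v])) : e.2 = v ∨ e ∈ seqEdges l := by
  induction l with
  | nil => simp [seqEdges] at h
  | cons a t ih =>
    cases t with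
    | nil =>
      simp only [List.cons_append, List.nil_append, seqEdges, List.mem_cons,
        List.not_mem_nil, or_false] at h
      subst h
      exact Or.inl rfl
    | cons b t =>
      simp only [List.cons_append, seqEdges, List.mem_cons] at h ih ⊢
      rcases h with rfl | h
      · exact Or.inr (Or.inl rfl)
      · exact (ih h).imp_right Or.inr

theorem sublist_of_mem_seqEdges {α : Type*} {l : List α} {e : α × α} (h : e ∈ seqEdges l) :
    List.Sublist [e.1, e.2] l := by
  induction l with
  | nil => simp [seqEdges] at h
  | cons a t ih =>
    cases t with
    | nil => simp [seqEdges] at h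
    | cons b t =>
      simp only [seqEdges, List.mem_cons] at h
      rcases h with rfl | h
      · simp
      · exact (ih h).cons _

theorem ConvexPos.mem_polyDom {l : List (ℝ × ℝ)} (h : ConvexPos l) {v : ℝ × ℝ} (hv : v ∈ l) :
    v ∈ polyDom l := by
  obtain ⟨s, t, rfl⟩ := List.append_of_mem hv
  rw [polyDom_perm (cyc_rotate_perm s (v :: t))]
  replace h := h.rotate
  intro e he
  rw [List.cons_append] at he h
  change e ∈ seqEdges (v :: (t ++ s) ++ [v]) at he
  rcases mem_seqEdges_concat he with h1 | he
  · simp [det3, h1, mul_comm]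
  rcases mem_seqEdges_cons he with h1 | he
  · simp [det3, h1]
  have := h v e.1 e.2 ((sublist_of_mem_seqEdges he).cons_cons v)
  rw [← det3_rot] at this
  linarith

theorem eq_of_det3_eq_zero {a b t x : ℝ × ℝ} (h : det3 a b x = 0) (ht : 1 ≤ det3 a t b) :
    x = a + (det3 a t x / det3 a t b) • (b - a) := by
  have h0 : det3 a t b ≠ 0 := by linarith
  ext
  · simp only [Prod.fst_add, Prod.smul_fst, Prod.fst_sub, smul_eq_mul]
    rw [div_mul_eq_mul_div, ← sub_eq_iff_eq_add', eq_div_iff h0]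
    simp only [det3] at *
    linear_combination (-(t.1 - a.1)) * h
  · simp only [Prod.snd_add, Prod.smul_snd, Prod.snd_sub, smul_eq_mul]
    rw [div_mul_eq_mul_div, ← sub_eq_iff_eq_add', eq_div_iff h0]
    simp only [det3] at *
    linear_combination (-(t.2 - a.2)) * h

theorem ConvexPos.mem_chord {a b : ℝ × ℝ} {t₁ : List (ℝ × ℝ)} (ht : t₁ ≠ [])
    (h : ConvexPos (a :: t₁ ++ [b])) {x : ℝ × ℝ} (hx : x ∈ polyDom (a :: t₁ ++ [b]))
    (h0 : det3 a b x = 0) : ∃ τ : ℝ, 0 ≤ τ ∧ τ ≤ 1 ∧ x = a + τ • (b - a) := by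
  obtain ⟨t, t', rfl⟩ := List.exists_cons_of_ne_nil ht
  have hd : 1 ≤ det3 a t b := h a t b (by simp)
  have hx1 := eq_of_det3_eq_zero h0 hd
  refine ⟨_, div_nonneg ?_ (by linarith), ?_, hx1⟩
  · exact hx (a, t) (by simp [cyc, seqEdges])
  obtain ⟨s, z, hs⟩ : ∃ s z, t :: t' = s ++ [z] := by
    rcases List.eq_nil_or_concat (t :: t') with h | ⟨s, z, h⟩
    · simp at h
    · exact ⟨s, z, by simpa using h⟩
  rw [hs] at h hx
  have hz : 1 ≤ det3 a z b := h a z b (by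
    simp only [List.cons_append, List.append_assoc]
    exact (List.sublist_append_right _ _).cons_cons _)
  have hx2 := hx (z, b) (by
    have : a :: (s ++ [z]) ++ [b] = (a :: s) ++ z :: [b] := by simp
    rw [this, List.cons_append, cyc, ← List.cons_append]
    have h2 := seqEdges_append (a :: s) ([b] ++ [a]) z
    have h3 : a :: s ++ z :: [b] ++ [a] = a :: s ++ z :: ([b] ++ [a]) := by simp
    rw [h3, h2]
    simp [seqEdges])
  simp only at hx2
  have h3 : det3 z b b = 0 := by simp only [det3]; ring
  have h4 : det3 z b a = det3 a z b := by simp only [det3]; ring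
  rw [hx1, det3_lineMap, h3, h4] at hx2
  by_contra hlt
  push Not at hlt
  have h5 : (1 - det3 a t x / det3 a t b) * det3 a z b < 0 := mul_neg_of_neg_of_pos
    (by linarith) (by linarith)
  linarith

/-- A piecewise affine Lipschitz embedding of a convex polygonal domain onto a filled polygon,
where each vertex of the domain is paired with its image. -/
structure IsFill (l : List ((ℝ × ℝ) × ℂ)) (L : ℝ) (F : ℝ × ℝ → ℂ) (V : Set ℂ) : Prop where
  lip : ∀ x ∈ polyDom (l.map Prod.fst), ∀ y ∈ polyDom (l.map Prod.fst),
    ‖F x - F y‖ ≤ L * ‖x - y‖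
  pl : PLOn F (polyDom (l.map Prod.fst))
  inj : InjOn F (polyDom (l.map Prod.fst))
  image : ∀ x ∈ polyDom (l.map Prod.fst), F x ∈ poly (l.map Prod.snd) ∪ V
  cell : Cell (l.map Prod.snd) V
  bdry : ∀ e ∈ cyc l, ∀ τ : ℝ, 0 ≤ τ → τ ≤ 1 →
    F (e.1.1 + τ • (e.2.1 - e.1.1)) = e.1.2 + τ • (e.2.2 - e.1.2)
  hull : ∀ B : Set ℂ, Convex ℝ B → (∀ v ∈ l, v.2 ∈ B) →
    ∀ x ∈ polyDom (l.map Prod.fst), F x ∈ B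

theorem IsFill.rotate {s t : List ((ℝ × ℝ) × ℂ)} {L : ℝ} {F : ℝ × ℝ → ℂ} {V : Set ℂ}
    (h : IsFill (s ++ t) L F V) : IsFill (t ++ s) L F V := by
  have hp := cyc_rotate_perm s t
  have h1 : polyDom ((t ++ s).map Prod.fst) = polyDom ((s ++ t).map Prod.fst) :=
    polyDom_perm (by rw [cyc_map, cyc_map]; exact (hp.map _).symm)
  have h2 : (cyc ((s ++ t).map Prod.snd)).Perm (cyc ((t ++ s).map Prod.snd)) := by
    rw [cyc_map, cyc_map]; exact hp.map _
  refine ⟨?_, ?_, ?_, ?_, h.cell.perm h2, fun e he => h.bdry e (hp.mem_iff.mpr he), ?_⟩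
  · rw [h1]; exact h.lip
  · rw [h1]; exact h.pl
  · rw [h1]; exact h.inj
  · rw [h1, ← poly_perm h2]; exact h.image
  · intro B hB hv
    rw [h1]
    exact h.hull B hB fun v hv' => hv v (by simpa [or_comm] using hv')

theorem abs_det3_sub_le {a b x y : ℝ × ℝ} {M : ℝ} (ha : ‖a‖ ≤ M) (hb : ‖b‖ ≤ M) :
    |det3 a b x - det3 a b y| ≤ 4 * M * ‖x - y‖ := by
  have e : det3 a b x - det3 a b y
      = (b.1 - a.1) * (x - y).2 - (b.2 - a.2) * (x - y).1 := by
    simp only [det3, Prod.fst_sub, Prod.snd_sub]; ring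
  have h1 := norm_fst_le a
  have h2 := norm_snd_le a
  have h3 := norm_fst_le b
  have h4 := norm_snd_le b
  have h5 := norm_fst_le (x - y)
  have h6 := norm_snd_le (x - y)
  rw [Real.norm_eq_abs] at *
  have k1 : |b.1 - a.1| ≤ 2 * M := (abs_sub _ _).trans (by linarith)
  have k2 : |b.2 - a.2| ≤ 2 * M := (abs_sub _ _).trans (by linarith)
  have hM : 0 ≤ M := (norm_nonneg _).trans ha
  calc _ = |(b.1 - a.1) * (x - y).2 - (b.2 - a.2) * (x - y).1| := by rw [e]
    _ ≤ |(b.1 - a.1) * (x - y).2| + |(b.2 - a.2) * (x - y).1| := abs_sub _ _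
    _ ≤ 2 * M * ‖x - y‖ + 2 * M * ‖x - y‖ := by
      rw [abs_mul, abs_mul]; gcongr
    _ = _ := by ring

theorem exists_isFill_tri {a b c : (ℝ × ℝ) × ℂ} {M R : ℝ}
    (hs : SimplePoly ([a, b, c].map Prod.snd)) (hc : ConvexPos ([a, b, c].map Prod.fst))
    (hM : ∀ v ∈ [a, b, c], ‖v.1‖ ≤ M) (hR : ∀ v ∈ [a, b, c], ‖v.2‖ ≤ R) :
    ∃ F V, IsFill [a, b, c] (12 * M * R) F V := by
  obtain ⟨a, p⟩ := a
  obtain ⟨b, q⟩ := b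
  obtain ⟨c, r⟩ := c
  have hΔ : 1 ≤ det3 a b c := hc a b c (by simp)
  simp only [List.map_cons, List.map_nil] at hs hc
  simp only [List.mem_cons, List.not_mem_nil, or_false, forall_eq_or_imp, forall_eq] at hM hR
  obtain ⟨ha, hb, hc'⟩ := hM
  obtain ⟨hp, hq, hr⟩ := hR
  set Δ := det3 a b c with hΔd
  have hΔ0 : Δ ≠ 0 := by linarith
  have hsum : ∀ x, det3 b c x / Δ + det3 c a x / Δ + det3 a b x / Δ = 1 := by
    intro x
    rw [← add_div, ← add_div, div_eq_one_iff_eq hΔ0, hΔd]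
    simp only [det3]; ring
  set F : ℝ × ℝ → ℂ := fun x => ((det3 b c x / Δ : ℝ) : ℂ) * p + ((det3 c a x / Δ : ℝ) : ℂ) * q +
    ((det3 a b x / Δ : ℝ) : ℂ) * r with hF
  have hD : ∀ x, x ∈ polyDom [a, b, c] ↔ 0 ≤ det3 a b x ∧ 0 ≤ det3 b c x ∧ 0 ≤ det3 c a x := by
    intro x
    simp [polyDom, cyc_three]
  refine ⟨F, openTri p q r, ?_, ?_, ?_, ?_, hs.cell_tri, ?_, ?_⟩ <;>
    try simp only [List.map_cons, List.map_nil]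
  · intro x _ y _
    have e : F x - F y = (((det3 b c x - det3 b c y) / Δ : ℝ) : ℂ) * p +
        (((det3 c a x - det3 c a y) / Δ : ℝ) : ℂ) * q +
        (((det3 a b x - det3 a b y) / Δ : ℝ) : ℂ) * r := by
      simp only [hF]; push_cast; ring
    have hM : 0 ≤ M := (norm_nonneg _).trans ha
    have key : ∀ (u v : ℝ × ℝ) (w : ℂ), ‖u‖ ≤ M → ‖v‖ ≤ M → ‖w‖ ≤ R →
        ‖(((det3 u v x - det3 u v y) / Δ : ℝ) : ℂ) * w‖ ≤ 4 * M * ‖x - y‖ * R := by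
      intro u v w hu hv hw
      rw [norm_mul, Complex.norm_real, Real.norm_eq_abs, abs_div, abs_of_pos (by linarith : 0 < Δ)]
      have := abs_det3_sub_le (x := x) (y := y) hu hv
      gcongr
      exact (div_le_self (abs_nonneg _) hΔ).trans this
    rw [e]
    refine (norm_add₃_le).trans ?_
    linarith [key b c p hb hc' hp, key c a q hc' ha hq, key a b r ha hb hr]
  · let A : (ℝ × ℝ) × (ℝ × ℝ) → (ℝ × ℝ →ᵃ[ℝ] ℝ) := fun e =>
      ((e.2.1 - e.1.1) • (LinearMap.snd ℝ ℝ ℝ) -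
        (e.2.2 - e.1.2) • (LinearMap.fst ℝ ℝ ℝ)).toAffineMap
        + AffineMap.const ℝ (ℝ × ℝ) (-((e.2.1 - e.1.1) * e.1.2 - (e.2.2 - e.1.2) * e.1.1))
    have hA : ∀ u v x, A (u, v) x = det3 u v x := by
      intro u v x
      simp [A, det3]; ring
    let S : ℂ → (ℝ →ₗ[ℝ] ℂ) := fun w => LinearMap.toSpanSingleton ℝ ℂ ((Δ⁻¹ : ℝ) • w)
    refine ⟨{(S p).toAffineMap.comp (A (b, c)) + (S q).toAffineMap.comp (A (c, a)) +
      (S r).toAffineMap.comp (A (a, b))}, Set.finite_singleton _, fun x _ => ⟨_, rfl, ?_⟩⟩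
    simp [hF, hA, S, div_eq_mul_inv, mul_assoc]
  · intro x _ y _ hxy
    have hd := hs.cdet_ne_zero
    obtain ⟨d1, d2, d3⟩ := cdet_combo p q r (hsum x)
    obtain ⟨e1, e2, e3⟩ := cdet_combo p q r (hsum y)
    simp only [hF] at hxy
    rw [hxy] at d1 d2 d3
    have f1 : det3 a b x = det3 a b y := by
      have := mul_right_cancel₀ hd (d1.symm.trans e1)
      exact (div_left_inj' hΔ0).mp this
    have f2 : det3 b c x = det3 b c y := by
      have := mul_right_cancel₀ hd (d2.symm.trans e2)
      exact (div_left_inj' hΔ0).mp this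
    have hx1 : Δ * (x.1 - y.1) = 0 := by
      rw [hΔd]
      simp only [det3] at f1 f2 ⊢
      linear_combination (c.1 - b.1) * f1 - (b.1 - a.1) * f2
    have hx2 : Δ * (x.2 - y.2) = 0 := by
      rw [hΔd]
      simp only [det3] at f1 f2 ⊢
      linear_combination (c.2 - b.2) * f1 - (b.2 - a.2) * f2
    ext
    · have := (mul_eq_zero.mp hx1).resolve_left hΔ0
      linarith
    · have := (mul_eq_zero.mp hx2).resolve_left hΔ0
      linarith
  · intro x hx
    rw [hD] at hx
    obtain ⟨h1, h2, h3⟩ := hx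
    have hΔp : 0 < Δ := by linarith
    have key : ∀ u v w : ℝ, u + v = Δ → 0 ≤ u → 0 ≤ v → ∀ p q : ℂ,
        ((u / Δ : ℝ) : ℂ) * p + ((v / Δ : ℝ) : ℂ) * q ∈ segment ℝ p q := by
      intro u v w h hu hv p q
      exact ⟨u / Δ, v / Δ, by positivity, by positivity,
        by rw [← add_div, h, div_self hΔ0], by simp⟩
    have hs' : det3 b c x + det3 c a x + det3 a b x = Δ := by
      rw [hΔd]; simp only [det3]; ring
    rcases h1.eq_or_lt with g1 | g1
    · left
      refine ⟨(p, q), by simp [cyc_three], ?_⟩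
      simpa [hF, ← g1] using key _ _ 0 (by linarith) h2 h3 p q
    rcases h2.eq_or_lt with g2 | g2
    · left
      refine ⟨(q, r), by simp [cyc_three], ?_⟩
      simpa [hF, ← g2] using key _ _ 0 (by linarith) h3 h1 q r
    rcases h3.eq_or_lt with g3 | g3
    · left
      refine ⟨(r, p), by simp [cyc_three], ?_⟩
      rw [segment_symm]
      simpa [hF, ← g3] using key _ _ 0 (by linarith) h2 h1 p r
    right
    exact ⟨_, _, _, by positivity, by positivity, by positivity, hsum x, rfl⟩
  · intro e he τ h0 h1
    rw [cyc_three] at he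
    have z1 : det3 b c b = 0 := by simp only [det3]; ring
    have z2 : det3 c a c = 0 := by simp only [det3]; ring
    have z3 : det3 a b a = 0 := by simp only [det3]; ring
    have z1' : det3 b c c = 0 := by simp only [det3]; ring
    have z2' : det3 c a a = 0 := by simp only [det3]; ring
    have z3' : det3 a b b = 0 := by simp only [det3]; ring
    have y1 : det3 b c a = Δ := by rw [hΔd]; simp only [det3]; ring
    have y2 : det3 c a b = Δ := by rw [hΔd]; simp only [det3]; ring
    have y3 : det3 a b c = Δ := rfl
    simp only [List.mem_cons, List.not_mem_nil, or_false] at he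
    rcases he with rfl | rfl | rfl <;>
      simp only [hF, det3_lineMap, z1, z2, z3, z1', z2', z3', y1, y2, y3, mul_zero, add_zero,
        zero_add, zero_div, mul_div_assoc, div_self hΔ0, Complex.real_smul] <;>
      push_cast <;> ring
  · intro B hB hv x hx
    rw [hD] at hx
    obtain ⟨h1, h2, h3⟩ := hx
    have hΔp : 0 < Δ := by linarith
    have := hB.sum_mem (t := Finset.univ) (w := ![det3 b c x / Δ, det3 c a x / Δ, det3 a b x / Δ])
      (z := ![p, q, r]) ?_ ?_ ?_
    · simpa [Fin.sum_univ_three, hF] using this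
    · intro i _
      fin_cases i <;> simp <;> positivity
    · simpa [Fin.sum_univ_three] using hsum x
    · intro i _
      fin_cases i
      · exact hv (a, p) (by simp)
      · exact hv (b, q) (by simp)
      · exact hv (c, r) (by simp)

theorem lipschitz_glue {D : Set (ℝ × ℝ)} {F F₁ F₂ : ℝ × ℝ → ℂ} {a b : ℝ × ℝ} {L : ℝ}
    (hD : ∀ x ∈ D, ∀ y ∈ D, ∀ τ : ℝ, 0 ≤ τ → τ ≤ 1 → x + τ • (y - x) ∈ D)
    (h₁ : ∀ x ∈ D, det3 a b x ≤ 0 → F x = F₁ x) (h₂ : ∀ x ∈ D, 0 ≤ det3 a b x → F x = F₂ x)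
    (l₁ : ∀ x ∈ D, ∀ y ∈ D, det3 a b x ≤ 0 → det3 a b y ≤ 0 → ‖F₁ x - F₁ y‖ ≤ L * ‖x - y‖)
    (l₂ : ∀ x ∈ D, ∀ y ∈ D, 0 ≤ det3 a b x → 0 ≤ det3 a b y → ‖F₂ x - F₂ y‖ ≤ L * ‖x - y‖) :
    ∀ x ∈ D, ∀ y ∈ D, ‖F x - F y‖ ≤ L * ‖x - y‖ := by
  have key : ∀ x ∈ D, ∀ y ∈ D, det3 a b x ≤ 0 → 0 < det3 a b y → ‖F x - F y‖ ≤ L * ‖x - y‖ := by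
    intro x hx y hy hdx hdy
    set s := det3 a b x / (det3 a b x - det3 a b y) with hs
    have hne : det3 a b x - det3 a b y < 0 := by linarith
    have hs0 : 0 ≤ s := div_nonneg_of_nonpos hdx hne.le
    have hs1 : s ≤ 1 := by rw [hs, div_le_one_of_neg hne]; linarith
    set z := x + s • (y - x) with hz
    have hzD : z ∈ D := hD x hx y hy s hs0 hs1
    have hdz : det3 a b z = 0 := by
      have hne' := hne.ne
      rw [hz, det3_lineMap, hs]
      field_simp
      ring
    have e1 : x - z = -s • (y - x) := by rw [hz]; simp
    have e2 : z - y = -(1 - s) • (y - x) := by rw [hz]; module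
    have k1 := l₁ x hx z hzD hdx hdz.le
    have k2 := l₂ z hzD y hy hdz.ge hdy.le
    rw [← h₁ x hx hdx, ← h₁ z hzD hdz.le, e1, norm_smul, norm_neg, Real.norm_of_nonneg hs0] at k1
    rw [← h₂ y hy hdy.le, ← h₂ z hzD hdz.ge, e2, norm_smul, norm_neg,
      Real.norm_of_nonneg (by linarith)] at k2
    calc _ ≤ ‖F x - F z‖ + ‖F z - F y‖ := norm_sub_le_norm_sub_add_norm_sub _ _ _
      _ ≤ _ := add_le_add k1 k2
      _ = _ := by rw [norm_sub_rev x y]; ring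
  intro x hx y hy
  rcases le_or_gt (det3 a b x) 0 with h | h <;> rcases le_or_gt (det3 a b y) 0 with h' | h'
  · rw [h₁ x hx h, h₁ y hy h']; exact l₁ x hx y hy h h'
  · exact key x hx y hy h h'
  · rw [norm_sub_rev, norm_sub_rev x]; exact key y hy x hx h' h
  · rw [h₂ x hx h.le, h₂ y hy h'.le]; exact l₂ x hx y hy h.le h'.le


theorem IsFill.glue {a b : (ℝ × ℝ) × ℂ} {t₁ t₂ : List ((ℝ × ℝ) × ℂ)} {L : ℝ}
    {F₁ F₂ : ℝ × ℝ → ℂ} {V₁ V₂ : Set ℂ}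
    (hch : Chord a.2 b.2 (t₁.map Prod.snd) (t₂.map Prod.snd))
    (hc : ConvexPos ((a :: t₁ ++ b :: t₂).map Prod.fst))
    (h₁ : IsFill (a :: t₁ ++ [b]) L F₁ V₁) (h₂ : IsFill (a :: b :: t₂) L F₂ V₂) :
    IsFill (a :: t₁ ++ b :: t₂) L (fun x => if det3 a.1 b.1 x ≤ 0 then F₁ x else F₂ x)
      (V₁ ∪ V₂ ∪ openSegment ℝ a.2 b.2) := by
  set F : ℝ × ℝ → ℂ := fun x => if det3 a.1 b.1 x ≤ 0 then F₁ x else F₂ x with hF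
  set D := polyDom ((a :: t₁ ++ b :: t₂).map Prod.fst) with hD
  have ht₁ : t₁.map Prod.fst ≠ [] := fun h => hch.left_ne (by simpa using h)
  have ht₂ : t₂.map Prod.fst ≠ [] := fun h => hch.right_ne (by simpa using h)
  have hc₁ : ConvexPos (a.1 :: t₁.map Prod.fst ++ [b.1]) := by
    refine hc.sublist ?_
    simp only [List.map_append, List.map_cons]
    exact List.Sublist.append_left (by simp) _
  have hc₂ : ConvexPos (b.1 :: t₂.map Prod.fst ++ [a.1]) := by
    refine ConvexPos.rotate (s := [a.1]) (hc.sublist ?_)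
    simp
  have hcyc₁ : cyc (a :: t₁ ++ [b]) = seqEdges (a :: t₁ ++ [b]) ++ [(b, a)] := by
    have := cyc_split a b t₁ []
    simpa [seqEdges] using this
  have hcyc₂ : cyc (a :: b :: t₂) = (a, b) :: seqEdges (b :: t₂ ++ [a]) := by
    have := cyc_split a b [] t₂
    simpa [seqEdges] using this
  have hcycD : ∀ x ∈ D, ∀ e ∈ cyc (a :: t₁ ++ b :: t₂), 0 ≤ det3 e.1.1 e.2.1 x := by
    intro x hx e he
    refine hx (e.1.1, e.2.1) ?_
    rw [cyc_map]
    exact List.mem_map_of_mem (f := Prod.map Prod.fst Prod.fst) he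
  have mem₁ : ∀ x ∈ D, det3 a.1 b.1 x ≤ 0 → x ∈ polyDom ((a :: t₁ ++ [b]).map Prod.fst) := by
    intro x hx h0 e he
    rw [cyc_map, List.mem_map] at he
    obtain ⟨e, he, rfl⟩ := he
    rw [hcyc₁, List.mem_append, List.mem_singleton] at he
    rcases he with he | rfl
    · exact hcycD x hx e (by rw [cyc_split]; exact List.mem_append_left _ he)
    · simp only [Prod.map_fst, Prod.map_snd]
      rw [det3_swap]; linarith
  have mem₂ : ∀ x ∈ D, 0 ≤ det3 a.1 b.1 x → x ∈ polyDom ((a :: b :: t₂).map Prod.fst) := by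
    intro x hx h0 e he
    rw [cyc_map, List.mem_map] at he
    obtain ⟨e, he, rfl⟩ := he
    rw [hcyc₂, List.mem_cons] at he
    rcases he with rfl | he
    · exact h0
    · exact hcycD x hx e (by rw [cyc_split]; exact List.mem_append_right _ he)
  have vmem : ∀ v ∈ a :: t₁ ++ b :: t₂, v.1 ∈ D := fun v hv =>
    hc.mem_polyDom (List.mem_map_of_mem hv)
  have haD := vmem a (by simp)
  have hbD := vmem b (by simp)
  have chord₁ : ∀ τ : ℝ, 0 ≤ τ → τ ≤ 1 →
      F₁ (a.1 + τ • (b.1 - a.1)) = a.2 + τ • (b.2 - a.2) := by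
    intro τ h0 h1
    have := h₁.bdry (b, a) (by rw [hcyc₁]; simp) (1 - τ) (by linarith) (by linarith)
    simp only at this
    rw [show a.1 + τ • (b.1 - a.1) = b.1 + (1 - τ) • (a.1 - b.1) by module, this]
    module
  have chord₂ : ∀ τ : ℝ, 0 ≤ τ → τ ≤ 1 →
      F₂ (a.1 + τ • (b.1 - a.1)) = a.2 + τ • (b.2 - a.2) := fun τ h0 h1 =>
    h₂.bdry (a, b) (by rw [hcyc₂]; simp) τ h0 h1
  have dchord : ∀ τ : ℝ, det3 a.1 b.1 (a.1 + τ • (b.1 - a.1)) = 0 := by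
    intro τ
    rw [det3_lineMap]
    simp only [det3]; ring
  have onchord : ∀ x ∈ D, det3 a.1 b.1 x = 0 →
      ∃ τ : ℝ, 0 ≤ τ ∧ τ ≤ 1 ∧ x = a.1 + τ • (b.1 - a.1) := by
    intro x hx h0
    refine hc₁.mem_chord ht₁ ?_ h0
    have := mem₁ x hx h0.le
    simpa using this
  have F1 : ∀ x ∈ D, det3 a.1 b.1 x ≤ 0 → F x = F₁ x := fun x _ h => if_pos h
  have F2 : ∀ x ∈ D, 0 ≤ det3 a.1 b.1 x → F x = F₂ x := by
    intro x hx h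
    rcases h.eq_or_lt with h | h
    · obtain ⟨τ, h0, h1, rfl⟩ := onchord x hx h.symm
      rw [F1 _ hx h.ge, chord₁ τ h0 h1, chord₂ τ h0 h1]
    · exact if_neg (not_le.mpr h)
  have hmap : (a :: t₁ ++ b :: t₂).map Prod.snd
      = a.2 :: t₁.map Prod.snd ++ b.2 :: t₂.map Prod.snd := by simp
  have hmap₁ : (a :: t₁ ++ [b]).map Prod.snd = a.2 :: t₁.map Prod.snd ++ [b.2] := by simp
  have hmap₂ : (a :: b :: t₂).map Prod.snd = a.2 :: b.2 :: t₂.map Prod.snd := by simp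
  have cell₁ := h₁.cell
  have cell₂ := h₂.cell
  rw [hmap₁] at cell₁
  rw [hmap₂] at cell₂
  have hcell := hch.cell_glue cell₁ cell₂
  rw [← hmap] at hcell
  have lift₁ : ∀ v : ℂ, v ∈ segment ℝ a.2 b.2 → v ∈ poly ((a :: t₁ ++ b :: t₂).map Prod.snd) ∪
      (V₁ ∪ V₂ ∪ openSegment ℝ a.2 b.2) := by
    intro v hv
    rw [← insert_endpoints_openSegment] at hv
    rcases hv with rfl | rfl | hv
    · obtain ⟨q, hq⟩ := exists_cyc_fst (l := (a :: t₁ ++ b :: t₂).map Prod.snd) (p := a.2) (by simp)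
      exact Or.inl ⟨_, hq, left_mem_segment _ _ _⟩
    · obtain ⟨q, hq⟩ := exists_cyc_fst (l := (a :: t₁ ++ b :: t₂).map Prod.snd) (p := b.2) (by simp)
      exact Or.inl ⟨_, hq, left_mem_segment _ _ _⟩
    · exact Or.inr (Or.inr hv)
  refine ⟨?_, ?_, ?_, ?_, hcell, ?_, ?_⟩
  · exact lipschitz_glue (fun x hx y hy τ => polyDom_add_smul hx hy) F1 F2
      (fun x hx y hy hx0 hy0 => h₁.lip x (mem₁ x hx hx0) y (mem₁ y hy hy0))
      (fun x hx y hy hx0 hy0 => h₂.lip x (mem₂ x hx hx0) y (mem₂ y hy hy0))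
  · obtain ⟨A₁, f₁, g₁⟩ := h₁.pl
    obtain ⟨A₂, f₂, g₂⟩ := h₂.pl
    refine ⟨A₁ ∪ A₂, f₁.union f₂, fun x hx => ?_⟩
    rcases le_total (det3 a.1 b.1 x) 0 with h | h
    · obtain ⟨A, hA, he⟩ := g₁ x (mem₁ x hx h)
      exact ⟨A, Or.inl hA, (F1 x hx h).trans he⟩
    · obtain ⟨A, hA, he⟩ := g₂ x (mem₂ x hx h)
      exact ⟨A, Or.inr hA, (F2 x hx h).trans he⟩
  · have key : ∀ x ∈ D, ∀ y ∈ D, det3 a.1 b.1 x ≤ 0 → 0 ≤ det3 a.1 b.1 y → F x = F y → x = y := by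
      intro x hx y hy hx0 hy0 hxy
      have i1 := h₁.image x (mem₁ x hx hx0)
      have i2 := h₂.image y (mem₂ y hy hy0)
      rw [F1 x hx hx0, F2 y hy hy0] at hxy
      rw [hmap₁] at i1
      rw [hmap₂, ← hxy] at i2
      have hseg := hch.inter_subset cell₁ cell₂ ⟨i1, i2⟩
      rw [segment_eq_image'] at hseg
      obtain ⟨τ, ⟨h0, h1⟩, hτ⟩ := hseg
      simp only at hτ
      have hcD : a.1 + τ • (b.1 - a.1) ∈ D := polyDom_add_smul haD hbD h0 h1
      have e1 := h₁.inj (mem₁ _ hcD (dchord τ).le) (mem₁ x hx hx0) ((chord₁ τ h0 h1).trans hτ)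
      have e2 := h₂.inj (mem₂ _ hcD (dchord τ).ge) (mem₂ y hy hy0)
        ((chord₂ τ h0 h1).trans (hτ.trans hxy))
      exact e1.symm.trans e2
    intro x hx y hy hxy
    rcases le_total (det3 a.1 b.1 x) 0 with h | h <;>
      rcases le_total (det3 a.1 b.1 y) 0 with h' | h'
    · rw [F1 x hx h, F1 y hy h'] at hxy
      exact h₁.inj (mem₁ x hx h) (mem₁ y hy h') hxy
    · exact key x hx y hy h h' hxy
    · exact (key y hy x hx h' h hxy.symm).symm
    · rw [F2 x hx h, F2 y hy h'] at hxy
      exact h₂.inj (mem₂ x hx h) (mem₂ y hy h') hxy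
  · intro x hx
    rcases le_total (det3 a.1 b.1 x) 0 with h | h
    · rw [F1 x hx h]
      rcases h₁.image x (mem₁ x hx h) with i | i
      · rw [hmap₁, poly_left] at i
        rcases i with i | i
        · left; rw [hmap, poly_split]; exact Or.inl i
        · exact lift₁ _ i
      · exact Or.inr (Or.inl (Or.inl i))
    · rw [F2 x hx h]
      rcases h₂.image x (mem₂ x hx h) with i | i
      · rw [hmap₂, poly_right] at i
        rcases i with i | i
        · exact lift₁ _ i
        · left; rw [hmap, poly_split]; exact Or.inr i
      · exact Or.inr (Or.inl (Or.inr i))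
  · intro e he τ h0 h1
    have hmem := mem_of_mem_cyc he
    have hD1 := polyDom_add_smul (vmem _ hmem.1) (vmem _ hmem.2) h0 h1
    rw [cyc_split, List.mem_append] at he
    rcases he with he | he
    · have hd : det3 a.1 b.1 (e.1.1 + τ • (e.2.1 - e.1.1)) ≤ 0 := by
        have hv : ∀ v ∈ a :: t₁ ++ [b], det3 a.1 b.1 v.1 ≤ 0 := by
          intro v hv
          have hc₁' : ConvexPos ((a :: t₁ ++ [b]).map Prod.fst) := by simpa using hc₁
          have := hc₁'.mem_polyDom (List.mem_map_of_mem hv) (b.1, a.1) (by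
            rw [cyc_map, hcyc₁]; simp)
          simp only at this
          rw [det3_swap] at this
          linarith
        obtain ⟨m1, m2⟩ := mem_of_mem_seqEdges he
        rw [det3_lineMap]
        have := mul_nonpos_of_nonneg_of_nonpos (by linarith : 0 ≤ 1 - τ) (hv _ m1)
        have := mul_nonpos_of_nonneg_of_nonpos h0 (hv _ m2)
        linarith
      rw [F1 _ hD1 hd]
      exact h₁.bdry e (by rw [hcyc₁]; exact List.mem_append_left _ he) τ h0 h1
    · have hd : 0 ≤ det3 a.1 b.1 (e.1.1 + τ • (e.2.1 - e.1.1)) := by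
        have hv : ∀ v ∈ b :: t₂ ++ [a], 0 ≤ det3 a.1 b.1 v.1 := by
          intro v hv
          have hc₂' : ConvexPos ((b :: t₂ ++ [a]).map Prod.fst) := by simpa using hc₂
          refine hc₂'.mem_polyDom (List.mem_map_of_mem hv) (a.1, b.1) ?_
          have := cyc_split b a t₂ []
          rw [cyc_map, this]
          simp [seqEdges]
        obtain ⟨m1, m2⟩ := mem_of_mem_seqEdges he
        rw [det3_lineMap]
        exact add_nonneg (mul_nonneg (by linarith) (hv _ m1)) (mul_nonneg h0 (hv _ m2))
      rw [F2 _ hD1 hd]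
      exact h₂.bdry e (by rw [hcyc₂]; exact List.mem_cons_of_mem _ he) τ h0 h1
  · intro B hB hv x hx
    rcases le_total (det3 a.1 b.1 x) 0 with h | h
    · rw [F1 x hx h]
      exact h₁.hull B hB (fun v hv' => hv v (by simp at hv' ⊢; tauto)) x (mem₁ x hx h)
    · rw [F2 x hx h]
      exact h₂.hull B hB (fun v hv' => hv v (by simp at hv' ⊢; tauto)) x (mem₂ x hx h)

theorem exists_isFill {M R : ℝ} (l : List ((ℝ × ℝ) × ℂ)) (hs : SimplePoly (l.map Prod.snd))
    (hc : ConvexPos (l.map Prod.fst)) (hM : ∀ v ∈ l, ‖v.1‖ ≤ M) (hR : ∀ v ∈ l, ‖v.2‖ ≤ R) :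
    ∃ F V, IsFill l (12 * M * R) F V := by
  induction hn : l.length using Nat.strong_induction_on generalizing l with
  | _ n ih =>
    have h3 : 3 ≤ l.length := by simpa using hs.three_le
    rcases h3.eq_or_lt with h3 | h4
    · obtain ⟨a, b, c, rfl⟩ := List.length_eq_three.mp h3.symm
      exact exists_isFill_tri hs hc hM hR
    obtain ⟨s, t, hst, a, b, t₁, t₂, hts, hch⟩ :=
      hs.exists_chord (by rw [List.length_map]; exact h4)
    obtain ⟨s, t, rfl, rfl, rfl⟩ := List.map_eq_append_iff.mp hst
    rw [← List.map_append] at hts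
    obtain ⟨u₁, u₂, he, hu₁, hu₂⟩ := List.map_eq_append_iff.mp hts
    obtain ⟨a, u₁, rfl, rfl, rfl⟩ := List.map_eq_cons_iff.mp hu₁
    obtain ⟨b, u₂, rfl, rfl, rfl⟩ := List.map_eq_cons_iff.mp hu₂
    have hc' : ConvexPos ((t ++ s).map Prod.fst) := by
      rw [List.map_append] at hc ⊢
      exact hc.rotate
    have hmem : ∀ v ∈ a :: u₁ ++ b :: u₂, v ∈ s ++ t := by
      intro v hv
      rw [← he] at hv
      simpa [or_comm] using hv
    have hlen : (a :: u₁ ++ b :: u₂).length = n := by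
      rw [← hn, ← he]; simp [add_comm]
    have l1 : 0 < u₁.length := by
      have := List.length_pos_iff.mpr hch.left_ne; simpa using this
    have l2 : 0 < u₂.length := by
      have := List.length_pos_iff.mpr hch.right_ne; simpa using this
    simp only [List.length_append, List.length_cons] at hlen
    rw [he] at hc'
    obtain ⟨F₁, V₁, h₁⟩ := ih (a :: u₁ ++ [b]).length (by simp; omega) (a :: u₁ ++ [b])
      (by simpa using hch.simple_left)
      (hc'.sublist ((List.Sublist.append_left (by simp) _).map _))
      (fun v hv => hM v (hmem v (by simp at hv ⊢; tauto)))
      (fun v hv => hR v (hmem v (by simp at hv ⊢; tauto))) rfl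
    obtain ⟨F₂, V₂, h₂⟩ := ih (a :: b :: u₂).length (by simp; omega) (a :: b :: u₂)
      (by simpa using hch.simple_right)
      (hc'.sublist (List.Sublist.map _ (by simp)))
      (fun v hv => hM v (hmem v (by simp at hv ⊢; tauto)))
      (fun v hv => hR v (hmem v (by simp at hv ⊢; tauto))) rfl
    have := h₁.glue hch hc' h₂
    rw [← he] at this
    exact ⟨_, _, this.rotate⟩

section PL

variable {E F G : Type*} [AddCommGroup E] [Module ℝ E] [AddCommGroup F] [Module ℝ F]
  [AddCommGroup G] [Module ℝ G] {S : Set E}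

theorem PLOn.affine (A : E →ᵃ[ℝ] F) : PLOn A S :=
  ⟨{A}, Set.finite_singleton _, fun _ _ => ⟨A, rfl, rfl⟩⟩

theorem PLOn.congr {f g : E → F} (h : PLOn f S) (hfg : ∀ x ∈ S, f x = g x) : PLOn g S := by
  obtain ⟨A, hA, h⟩ := h
  refine ⟨A, hA, fun x hx => ?_⟩
  rw [← hfg x hx]
  exact h x hx

theorem PLOn.select {ι : Type*} {s : Set ι} (hs : s.Finite) {f : ι → E → F} {g : E → F}
    (hf : ∀ i ∈ s, PLOn (f i) S) (h : ∀ x ∈ S, ∃ i ∈ s, g x = f i x) : PLOn g S := by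
  choose! A hA hA' using hf
  refine ⟨⋃ i ∈ s, A i, hs.biUnion hA, fun x hx => ?_⟩
  obtain ⟨i, hi, he⟩ := h x hx
  obtain ⟨B, hB, hBx⟩ := hA' i hi x hx
  exact ⟨B, Set.mem_biUnion hi hB, he.trans hBx⟩

theorem PLOn.comp₂ {f : E → F} {g : E → G} {H : Type*} [AddCommGroup H] [Module ℝ H]
    (hf : PLOn f S) (hg : PLOn g S) (T : (F × G) →ᵃ[ℝ] H) : PLOn (fun x => T (f x, g x)) S := by
  obtain ⟨A, hA, h⟩ := hf
  obtain ⟨B, hB, h'⟩ := hg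
  refine ⟨Set.image2 (fun a b => T.comp (a.prod b)) A B, hA.image2 _ hB, fun x hx => ?_⟩
  obtain ⟨a, ha, ea⟩ := h x hx
  obtain ⟨b, hb, eb⟩ := h' x hx
  exact ⟨_, Set.mem_image2_of_mem ha hb, by simp [ea, eb]⟩

theorem PLOn.prodMk {f : E → F} {g : E → G} (hf : PLOn f S) (hg : PLOn g S) :
    PLOn (fun x => (f x, g x)) S := hf.comp₂ hg (AffineMap.id ℝ (F × G))

theorem PLOn.add {f g : E → F} (hf : PLOn f S) (hg : PLOn g S) : PLOn (fun x => f x + g x) S :=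
  hf.comp₂ hg ((LinearMap.fst ℝ F F + LinearMap.snd ℝ F F).toAffineMap)

theorem PLOn.sub {f g : E → F} (hf : PLOn f S) (hg : PLOn g S) : PLOn (fun x => f x - g x) S :=
  hf.comp₂ hg ((LinearMap.fst ℝ F F - LinearMap.snd ℝ F F).toAffineMap)

theorem PLOn.comp {f : E → F} {T : Set F} {g : F → G} (hg : PLOn g T) (hf : PLOn f S)
    (h : ∀ x ∈ S, f x ∈ T) : PLOn (fun x => g (f x)) S := by
  obtain ⟨A, hA, h1⟩ := hf
  obtain ⟨B, hB, h2⟩ := hg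
  refine ⟨Set.image2 (fun a b => b.comp a) A B, hA.image2 _ hB, fun x hx => ?_⟩
  obtain ⟨a, ha, ea⟩ := h1 x hx
  obtain ⟨b, hb, eb⟩ := h2 _ (h x hx)
  exact ⟨_, Set.mem_image2_of_mem ha hb, eb.trans (by rw [ea]; rfl)⟩

theorem PLOn.mono {f : E → F} {T : Set E} (hf : PLOn f T) (h : S ⊆ T) : PLOn f S := by
  obtain ⟨A, hA, h1⟩ := hf
  exact ⟨A, hA, fun x hx => h1 x (h hx)⟩

theorem PLOn.smul {f : E → F} (c : ℝ) (hf : PLOn f S) : PLOn (fun x => c • f x) S := by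
  obtain ⟨A, hA, h⟩ := hf
  refine ⟨(fun a => c • a) '' A, hA.image _, fun x hx => ?_⟩
  obtain ⟨a, ha, ea⟩ := h x hx
  exact ⟨_, Set.mem_image_of_mem _ ha, by simp [ea]⟩

theorem PLOn.min {f g : E → ℝ} (hf : PLOn f S) (hg : PLOn g S) :
    PLOn (fun x => min (f x) (g x)) S :=
  PLOn.select (Set.finite_univ (α := Bool)) (f := fun b => if b then f else g)
    (fun b _ => by cases b <;> simpa) fun x _ => by
      rcases min_choice (f x) (g x) with h | h
      · exact ⟨true, trivial, by simpa using h⟩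
      · exact ⟨false, trivial, by simpa using h⟩

theorem PLOn.max {f g : E → ℝ} (hf : PLOn f S) (hg : PLOn g S) :
    PLOn (fun x => max (f x) (g x)) S :=
  PLOn.select (Set.finite_univ (α := Bool)) (f := fun b => if b then f else g)
    (fun b _ => by cases b <;> simpa) fun x _ => by
      rcases max_choice (f x) (g x) with h | h
      · exact ⟨true, trivial, by simpa using h⟩
      · exact ⟨false, trivial, by simpa using h⟩

end PL

/-- The piecewise linear interpolation of a sequence of points. -/
def PLN (P : ℕ → ℂ) (s : ℝ) : ℂ := P ⌊s⌋₊ + (s - ⌊s⌋₊) • (P (⌊s⌋₊ + 1) - P ⌊s⌋₊)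

theorem PLN_add (P : ℕ → ℂ) (k : ℕ) {τ : ℝ} (h0 : 0 ≤ τ) (h1 : τ ≤ 1) :
    PLN P (k + τ) = P k + τ • (P (k + 1) - P k) := by
  rcases h1.eq_or_lt with rfl | h1
  · have : ⌊(k : ℝ) + 1⌋₊ = k + 1 := by exact_mod_cast Nat.floor_natCast (k + 1)
    simp [PLN, this]
  · have : ⌊(k : ℝ) + τ⌋₊ = k := by
      rw [Nat.floor_eq_iff (by positivity)]
      constructor <;> linarith
    simp [PLN, this]

theorem exists_nat_add {n : ℕ} (hn : 1 ≤ n) {s : ℝ} (h0 : 0 ≤ s) (h1 : s ≤ n) :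
    ∃ k : ℕ, ∃ τ : ℝ, k < n ∧ 0 ≤ τ ∧ τ ≤ 1 ∧ s = k + τ := by
  rcases h1.eq_or_lt with rfl | h1
  · refine ⟨n - 1, 1, by omega, by norm_num, le_rfl, ?_⟩
    rw [Nat.cast_sub hn]; simp
  · refine ⟨⌊s⌋₊, s - ⌊s⌋₊, ?_, ?_, ?_, by ring⟩
    · rwa [Nat.floor_lt h0]
    · linarith [Nat.floor_le h0]
    · linarith [Nat.lt_floor_add_one s]

section Lens

variable {α β : Type*}

/-- The closed polygon running along `P` up to index `a` and back along `Q` from index `c`. -/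
def lensFun (P Q : ℕ → α) (a c k : ℕ) : α := if k ≤ a then P k else Q (a + c - k)

/-- The vertex list of the closed polygon running along `P` and back along `Q`. -/
def lensList (P Q : ℕ → α) (a c : ℕ) : List α := (List.range (a + c)).map (lensFun P Q a c)

theorem lensList_map (f : α → β) (P Q : ℕ → α) (a c : ℕ) :
    (lensList P Q a c).map f = lensList (fun k => f (P k)) (fun k => f (Q k)) a c := by
  rw [lensList, lensList, List.map_map]
  refine List.map_congr_left fun k _ => ?_
  simp only [Function.comp, lensFun]
  split_ifs <;> rfl

theorem mem_cyc_lensList {P Q : ℕ → α} {a c : ℕ} (h0 : P 0 = Q 0) (ha : P a = Q c)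
    (hc : 1 ≤ c) {e : α × α} :
    e ∈ cyc (lensList P Q a c) ↔
      (∃ k < a, e = (P k, P (k + 1))) ∨ ∃ j < c, e = (Q (j + 1), Q j) := by
  have hend : lensFun P Q a c (a + c) = lensFun P Q a c 0 := by
    rw [lensFun, lensFun, if_neg (by omega), if_pos (by omega)]
    simp [h0]
  have hQ : ∀ j ≤ c, lensFun P Q a c (a + c - j) = Q j := by
    intro j hj
    rw [lensFun]
    split_ifs with h
    · have : j = c := by omega
      subst this
      simpa using ha
    · congr 1; omega
  rw [lensList, cyc_range_map _ _ hend, List.mem_map]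
  constructor
  · rintro ⟨k, hk, rfl⟩
    rw [List.mem_range] at hk
    by_cases h : k < a
    · left
      refine ⟨k, h, ?_⟩
      rw [lensFun, lensFun, if_pos h.le, if_pos (by omega)]
    · right
      refine ⟨a + c - k - 1, by omega, ?_⟩
      rw [← hQ _ (by omega), ← hQ _ (by omega)]
      congr 2 <;> omega
  · rintro (⟨k, hk, rfl⟩ | ⟨j, hj, rfl⟩)
    · refine ⟨k, by rw [List.mem_range]; omega, ?_⟩
      rw [lensFun, lensFun, if_pos hk.le, if_pos (by omega)]
    · refine ⟨a + c - j - 1, by rw [List.mem_range]; omega, ?_⟩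
      rw [← hQ j (by omega), ← hQ (j + 1) (by omega)]
      congr 2; omega

theorem mem_lensList {P Q : ℕ → α} {a c : ℕ} {v : α} (h : v ∈ lensList P Q a c) :
    (∃ k ≤ a, v = P k) ∨ ∃ j ≤ c, v = Q j := by
  rw [lensList, List.mem_map] at h
  obtain ⟨k, hk, rfl⟩ := h
  rw [lensFun]
  split_ifs with h
  · exact Or.inl ⟨k, h, rfl⟩
  · exact Or.inr ⟨_, by omega, rfl⟩

end Lens

/-- A point of the lower parabola of the lens of width `X`. -/
def lowPt (X x : ℝ) : ℝ × ℝ := (x, x * (x - X))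

/-- A point of the upper parabola of the lens of width `X`. -/
def upPt (X x : ℝ) : ℝ × ℝ := (x, x * (X - x))

theorem det3_llu {X x y z : ℝ} (hX : 1 ≤ X) (hx : 0 ≤ x) (hxy : x + 1 ≤ y) (hy : y ≤ X)
    (hz : 0 ≤ z) (hzX : z ≤ X) (h : (1 ≤ z ∧ z + 1 ≤ X) ∨ (1 ≤ x ∧ y + 1 ≤ X)) :
    1 ≤ det3 (lowPt X x) (lowPt X y) (upPt X z) := by
  have e : det3 (lowPt X x) (lowPt X y) (upPt X z)
      = (y - x) * (z * (X - z) + (z * (X - x - y) + x * y)) := by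
    simp only [det3, lowPt, upPt]; ring
  have hE : X * (z * (X - z) + (z * (X - x - y) + x * y)) =
      X * (z * (X - z)) + ((X - z) * (x * y) + z * ((X - x) * (X - y))) := by ring
  have k1 : 0 ≤ (X - z) * (x * y) :=
    mul_nonneg (by linarith) (mul_nonneg hx (by linarith))
  have k2 : 0 ≤ z * ((X - x) * (X - y)) :=
    mul_nonneg hz (mul_nonneg (by linarith) (by linarith))
  have k3 : 0 ≤ z * (X - z) := mul_nonneg hz (by linarith)
  have hge : X * 1 ≤ X * (z * (X - z) + (z * (X - x - y) + x * y)) := by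
    rw [hE]
    rcases h with ⟨h1, h2⟩ | ⟨h1, h2⟩
    · have : 1 ≤ z * (X - z) := one_le_mul_of_one_le_of_one_le h1 (by linarith)
      nlinarith
    · have j1 : 1 ≤ x * y := one_le_mul_of_one_le_of_one_le h1 (by linarith)
      have j2 : 1 ≤ (X - x) * (X - y) :=
        one_le_mul_of_one_le_of_one_le (by linarith) (by linarith)
      have := mul_le_mul_of_nonneg_left j1 (by linarith : 0 ≤ X - z)
      have := mul_le_mul_of_nonneg_left j2 hz
      have := mul_nonneg (by linarith : 0 ≤ X) k3
      linarith
  rw [e]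
  exact one_le_mul_of_one_le_of_one_le (by linarith) (le_of_mul_le_mul_left hge (by linarith))

theorem det3_lll {X x y z : ℝ} (hxy : x + 1 ≤ y) (hyz : y + 1 ≤ z) :
    1 ≤ det3 (lowPt X x) (lowPt X y) (lowPt X z) := by
  have e : det3 (lowPt X x) (lowPt X y) (lowPt X z) = (y - x) * ((z - x) * (z - y)) := by
    simp only [det3, lowPt]; ring
  rw [e]
  exact one_le_mul_of_one_le_of_one_le (by linarith)
    (one_le_mul_of_one_le_of_one_le (by linarith) (by linarith))

theorem det3_luu (X x y z : ℝ) : det3 (lowPt X x) (upPt X y) (upPt X z)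
    = det3 (lowPt X (X - y)) (lowPt X (X - z)) (upPt X (X - x)) := by
  simp only [det3, lowPt, upPt]; ring

theorem det3_uuu (X x y z : ℝ) : det3 (upPt X x) (upPt X y) (upPt X z)
    = det3 (lowPt X (X - x)) (lowPt X (X - y)) (lowPt X (X - z)) := by
  simp only [det3, lowPt, upPt]; ring

theorem cast_mul_succ_le {c i j : ℕ} (hc : 1 ≤ c) (h : i < j) : (c : ℝ) * i + 1 ≤ c * j := by
  have : c * i + 1 ≤ c * j := by nlinarith
  exact_mod_cast this

/-- The convex lens domain has vertices in strictly convex position. -/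
theorem convexPos_lens {a c : ℕ} (ha : 1 ≤ a) (hc : 1 ≤ c) :
    ConvexPos (lensList (fun k => lowPt (a * c) (c * k)) (fun k => upPt (a * c) (a * k)) a c) := by
  intro A B C hABC
  rw [lensList, List.sublist_map_iff] at hABC
  obtain ⟨l, hl, he⟩ := hABC
  have hpw := List.pairwise_lt_range.sublist hl
  have hlt : ∀ i ∈ l, i < a + c := fun i hi => List.mem_range.mp (hl.subset hi)
  rcases l with _ | ⟨i, _ | ⟨j, _ | ⟨k, _ | ⟨m, l⟩⟩⟩⟩ <;> simp at he
  obtain ⟨rfl, rfl, rfl⟩ := he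
  simp only [List.pairwise_cons, List.mem_cons, List.not_mem_nil, or_false, forall_eq_or_imp,
    forall_eq] at hpw hlt
  obtain ⟨⟨hij, hik⟩, hjk, -⟩ := hpw
  obtain ⟨hi, hj, hk⟩ := hlt
  have hX : (1 : ℝ) ≤ a * c := by exact_mod_cast Nat.mul_pos ha hc
  have ex : ∀ m, m < a + c → ¬ m ≤ a →
      1 ≤ (a : ℝ) * (a + c - m : ℕ) ∧ (a : ℝ) * (a + c - m : ℕ) + 1 ≤ a * c := by
    intro m h1 h2
    refine ⟨?_, cast_mul_succ_le ha (by omega)⟩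
    exact_mod_cast Nat.mul_pos ha (by omega)
  have el : ∀ m, m ≤ a → 0 ≤ (c : ℝ) * m ∧ (c : ℝ) * m ≤ a * c := by
    intro m h
    refine ⟨by positivity, ?_⟩
    have : c * m ≤ a * c := by nlinarith
    exact_mod_cast this
  simp only [lensFun]
  by_cases h1 : i ≤ a
  · rw [if_pos h1]
    by_cases h2 : j ≤ a
    · rw [if_pos h2]
      by_cases h3 : k ≤ a
      · rw [if_pos h3]
        exact det3_lll (cast_mul_succ_le hc hij) (cast_mul_succ_le hc hjk)
      · rw [if_neg h3]
        have := ex k hk h3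
        exact det3_llu hX (el i h1).1 (cast_mul_succ_le hc hij) (el j h2).2 (by linarith)
          (by linarith) (Or.inl this)
    · rw [if_neg h2, if_neg (by omega), det3_luu]
      have e2 := ex j hj h2
      have e3 := ex k hk (by omega)
      have := cast_mul_succ_le ha (show a + c - k < a + c - j by omega)
      have := el i h1
      exact det3_llu hX (by linarith) (by linarith) (by linarith) (by linarith) (by linarith)
        (Or.inr ⟨by linarith, by linarith⟩)
  · rw [if_neg h1, if_neg (by omega), if_neg (by omega), det3_uuu]
    have := cast_mul_succ_le ha (show a + c - k < a + c - j by omega)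
    have := cast_mul_succ_le ha (show a + c - j < a + c - i by omega)
    exact det3_lll (by linarith) (by linarith)

section Env

/-- The line through two consecutive nodes of the polygon inscribed in the lower parabola. -/
def nodeLine (m w i : ℕ) (x : ℝ) : ℝ :=
  ((w : ℝ) * i + w * (i + 1) - m * w) * x - w * i * (w * (i + 1))

/-- The piecewise linear function interpolating the lower parabola at equidistant nodes. -/
def env (m w : ℕ) (hm : (Finset.range m).Nonempty) (x : ℝ) : ℝ :=
  (Finset.range m).sup' hm fun i => nodeLine m w i x

variable {m w : ℕ} (hm : (Finset.range m).Nonempty) (hw : 1 ≤ w)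

theorem nodeLine_le_env {i : ℕ} (hi : i < m) (x : ℝ) : nodeLine m w i x ≤ env m w hm x :=
  Finset.le_sup' (fun i => nodeLine m w i x) (Finset.mem_range.mpr hi)

theorem exists_env_eq (x : ℝ) : ∃ i < m, env m w hm x = nodeLine m w i x := by
  obtain ⟨i, hi, h⟩ := Finset.exists_mem_eq_sup' hm fun i => nodeLine m w i x
  exact ⟨i, Finset.mem_range.mp hi, h⟩

theorem nodeLine_node (i k : ℕ) :
    nodeLine m w i (w * k) ≤ w * k * (w * k - m * w) := by
  have h : (0 : ℤ) ≤ ((k : ℤ) - i) * (k - i - 1) := by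
    rcases lt_or_ge i k with h | h
    · exact mul_nonneg (by omega) (by omega)
    · exact mul_nonneg_of_nonpos_of_nonpos (by omega) (by omega)
  have h' : (0 : ℝ) ≤ ((k : ℝ) - i) * (k - i - 1) := by exact_mod_cast h
  have := mul_nonneg (mul_nonneg (Nat.cast_nonneg (α := ℝ) w) (Nat.cast_nonneg (α := ℝ) w)) h'
  rw [nodeLine]
  nlinarith

theorem nodeLine_lineMap (i : ℕ) (x y τ : ℝ) :
    nodeLine m w i ((1 - τ) * x + τ * y)
      = (1 - τ) * nodeLine m w i x + τ * nodeLine m w i y := by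
  simp only [nodeLine]; ring

theorem env_node {k : ℕ} (hk : k < m) {τ : ℝ} (h0 : 0 ≤ τ) (h1 : τ ≤ 1) :
    env m w hm (w * (k + τ)) = (1 - τ) * (w * k * (w * k - m * w)) +
      τ * (w * (k + 1 : ℕ) * (w * (k + 1 : ℕ) - m * w)) := by
  have e : (w : ℝ) * (k + τ) = (1 - τ) * (w * k) + τ * (w * (k + 1 : ℕ)) := by push_cast; ring
  apply le_antisymm
  · obtain ⟨i, -, hi⟩ := exists_env_eq (w := w) hm (w * (k + τ))
    rw [hi, e, nodeLine_lineMap]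
    have := mul_le_mul_of_nonneg_left (nodeLine_node (m := m) (w := w) i k)
      (by linarith : 0 ≤ 1 - τ)
    have := mul_le_mul_of_nonneg_left (nodeLine_node (m := m) (w := w) i (k + 1)) h0
    linarith
  · refine le_trans (le_of_eq ?_) (nodeLine_le_env hm hk _)
    rw [nodeLine]
    push_cast
    ring

theorem env_nonpos {x : ℝ} (h0 : 0 ≤ x) (h1 : x ≤ m * w) : env m w hm x ≤ 0 := by
  obtain ⟨i, hi, h⟩ := exists_env_eq (w := w) hm x
  rw [h]
  have hi' : (i : ℝ) + 1 ≤ m := by exact_mod_cast hi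
  have hw0 : (0 : ℝ) ≤ w := Nat.cast_nonneg w
  have hi0 : (0 : ℝ) ≤ i := Nat.cast_nonneg i
  have hX : (0 : ℝ) ≤ m * w := by positivity
  have e : (m * w : ℝ) * nodeLine m w i x = -((m * w - x) * (w * i * (w * (i + 1)))
      + x * ((w * (m - i)) * (w * (m - (i + 1))))) := by
    rw [nodeLine]; ring
  rcases hX.eq_or_lt with h' | h'
  · have hx : x = 0 := by linarith
    rw [nodeLine, hx, mul_zero, zero_sub]
    exact neg_nonpos.mpr (by positivity)
  · have k1 : 0 ≤ (m * w - x) * (w * i * (w * (i + 1)) : ℝ) :=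
      mul_nonneg (by linarith) (by positivity)
    have k2 : 0 ≤ x * (((w : ℝ) * (m - i)) * (w * (m - (i + 1)))) :=
      mul_nonneg h0 (mul_nonneg (mul_nonneg hw0 (by linarith)) (mul_nonneg hw0 (by linarith)))
    by_contra hc
    push Not at hc
    have := mul_pos h' hc
    linarith

theorem env_ge {x : ℝ} (h0 : 0 ≤ x) (h1 : x ≤ m * w) :
    -(m * w * x) ≤ env m w hm x ∧ -(m * w * (m * w - x)) ≤ env m w hm x := by
  have hm' : 1 ≤ m := by simpa [Nat.one_le_iff_ne_zero] using hm
  have hw0 : (0 : ℝ) ≤ w := Nat.cast_nonneg w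
  constructor
  · refine le_trans ?_ (nodeLine_le_env (i := 0) hm hm' x)
    rw [nodeLine]
    have := mul_nonneg hw0 h0
    push_cast
    nlinarith
  · refine le_trans ?_ (nodeLine_le_env (i := m - 1) hm (by omega) x)
    rw [nodeLine, Nat.cast_sub hm']
    have := mul_nonneg hw0 (by linarith : 0 ≤ m * w - x)
    push_cast
    nlinarith

theorem env_lip (x y : ℝ) : |env m w hm x - env m w hm y| ≤ m * w * |x - y| := by
  have key : ∀ x y, env m w hm x - env m w hm y ≤ m * w * |x - y| := by
    intro x y
    obtain ⟨i, hi, h⟩ := exists_env_eq (w := w) hm x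
    have h' := nodeLine_le_env (w := w) hm hi y
    have hi' : (i : ℝ) + 1 ≤ m := by exact_mod_cast hi
    have hw0 : (0 : ℝ) ≤ w := Nat.cast_nonneg w
    have hi0 : (0 : ℝ) ≤ i := Nat.cast_nonneg i
    have hs : |(w : ℝ) * i + w * (i + 1) - m * w| ≤ m * w := by
      rw [abs_le]
      constructor <;> nlinarith
    calc env m w hm x - env m w hm y ≤ nodeLine m w i x - nodeLine m w i y := by linarith
      _ = ((w : ℝ) * i + w * (i + 1) - m * w) * (x - y) := by simp only [nodeLine]; ring
      _ ≤ |(w : ℝ) * i + w * (i + 1) - m * w| * |x - y| := by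
        rw [← abs_mul]; exact le_abs_self _
      _ ≤ _ := by gcongr
  rw [abs_le]
  constructor
  · have := key y x
    rw [abs_sub_comm] at this
    linarith
  · exact key x y

theorem env_le_roof {n : ℕ} {x : ℝ} (hn : 1 ≤ n) (hnm : n < m) (hw : 1 ≤ w) (h0 : 0 ≤ x)
    (h1 : x ≤ m * w) :
    env m w hm x ≤ max (-((m * w - w * n) * x)) (w * n * (x - m * w)) := by
  obtain ⟨i, hi, h⟩ := exists_env_eq (w := w) hm x
  rw [h]
  have z0 := nodeLine_node (m := m) (w := w) i 0
  have z1 := nodeLine_node (m := m) (w := w) i n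
  have z2 := nodeLine_node (m := m) (w := w) i m
  have hx1 : (0 : ℝ) < w * n := by exact_mod_cast Nat.mul_pos hw hn
  have hx2 : (0 : ℝ) < m * w - w * n := by
    have : (n : ℝ) + 1 ≤ m := by exact_mod_cast hnm
    have : (1 : ℝ) ≤ w := by exact_mod_cast hw
    nlinarith
  set p : ℝ := w * n with hp
  rcases le_total x p with hx | hx
  · refine le_max_of_le_left ?_
    have e := nodeLine_lineMap (m := m) (w := w) i (w * (0 : ℕ)) p (x / p)
    have e2 : (1 - x / p) * (w * (0 : ℕ)) + x / p * p = x := by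
      field_simp
      simp
    rw [e2] at e
    rw [e]
    have hd : x / p ≤ 1 := (div_le_one hx1).mpr hx
    have := mul_le_mul_of_nonneg_left z0 (by linarith : 0 ≤ 1 - x / p)
    have := mul_le_mul_of_nonneg_left z1 (by positivity : 0 ≤ x / p)
    have e3 : x / p * (p * (p - m * w)) = -((m * w - p) * x) := by
      field_simp; ring
    simp only [Nat.cast_zero, mul_zero, zero_mul] at *
    linarith
  · refine le_max_of_le_right ?_
    set q : ℝ := m * w - p with hq
    have e := nodeLine_lineMap (m := m) (w := w) i p (w * m) ((x - p) / q)
    have e2 : (1 - (x - p) / q) * p + (x - p) / q * (w * m) = x := by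
      rw [show (w : ℝ) * m = q + p by rw [hq]; ring]
      field_simp
      ring
    rw [e2] at e
    rw [e]
    have hd : (x - p) / q ≤ 1 := (div_le_one hx2).mpr (by linarith)
    have := mul_le_mul_of_nonneg_left z2 (div_nonneg (sub_nonneg.mpr hx) hx2.le)
    have := mul_le_mul_of_nonneg_left z1 (by linarith : 0 ≤ 1 - (x - p) / q)
    have e3 : (1 - (x - p) / q) * (p * (p - m * w)) = p * (x - m * w) := by
      have hq' : p - m * w = -q := by rw [hq]; ring
      have hx' : x - m * w = (x - p) - q := by rw [hq]; ring
      rw [hq', hx']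
      field_simp
      ring
    have e4 : (w * m * (w * m - m * w) : ℝ) = 0 := by ring
    rw [e4] at *
    linarith

theorem env_pl {E : Type*} [AddCommGroup E] [Module ℝ E] {S : Set E} {f : E → ℝ}
    (hf : PLOn f S) : PLOn (fun b => env m w hm (f b)) S := by
  refine PLOn.select (Finset.finite_toSet (Finset.range m))
    (f := fun i b => nodeLine m w i (f b)) (fun i _ => ?_) fun b _ => ?_
  · have h1 := hf.smul ((w : ℝ) * i + w * (i + 1) - m * w)
    exact h1.sub (PLOn.affine (AffineMap.const ℝ E (w * i * (w * (i + 1)) : ℝ)))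
  · obtain ⟨i, hi, h⟩ := exists_env_eq (w := w) hm (f b)
    exact ⟨i, by simpa using hi, h⟩

end Env

/-- A monotone stretching of `[v, 0]` onto `[p, u]`. -/
def stretch (X u p v y : ℝ) : ℝ :=
  y + min u (2 * X * max 0 (y - v / 2)) - min (v - p) (2 * X * max 0 (v / 2 - y))

section Stretch

variable {X u p v : ℝ}

theorem stretch_strictMono (hX : 0 ≤ X) : StrictMono (stretch X u p v) := by
  intro y z h
  have h1 : max 0 (y - v / 2) ≤ max 0 (z - v / 2) := max_le_max le_rfl (by linarith)
  have h2 : max 0 (v / 2 - z) ≤ max 0 (v / 2 - y) := max_le_max le_rfl (by linarith)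
  have h3 : min u (2 * X * max 0 (y - v / 2)) ≤ min u (2 * X * max 0 (z - v / 2)) :=
    min_le_min le_rfl (by gcongr)
  have h4 : min (v - p) (2 * X * max 0 (v / 2 - z)) ≤ min (v - p) (2 * X * max 0 (v / 2 - y)) :=
    min_le_min le_rfl (by gcongr)
  simp only [stretch]
  linarith

theorem stretch_zero (hu : u ≤ -(X * v)) (hp : p ≤ v) (hv : v ≤ 0) : stretch X u p v 0 = u := by
  rw [stretch, max_eq_right (by linarith), max_eq_left (by linarith),
    min_eq_left (by linarith), min_eq_right (by linarith)]
  ring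

theorem stretch_self (hu : 0 ≤ u) (hp : X * v ≤ p) (hv : v ≤ 0) :
    stretch X u p v v = p := by
  rw [stretch, max_eq_left (by linarith), max_eq_right (by linarith),
    min_eq_right (by linarith), min_eq_left (by linarith)]
  ring

theorem abs_stretch_sub_le (hX : 1 ≤ X) {u' p' v' y y' δ : ℝ} (hu : |u - u'| ≤ 2 * X ^ 2 * δ)
    (hp : |p - p'| ≤ 2 * X ^ 2 * δ) (hv : |v - v'| ≤ 2 * X ^ 2 * δ) (hy : |y - y'| ≤ X ^ 2 * δ) :
    |stretch X u p v y - stretch X u' p' v' y'| ≤ 15 * X ^ 3 * δ := by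
  have hX2 : 0 ≤ X ^ 2 * δ := (abs_nonneg _).trans hy
  have hX3 : X ^ 2 * δ ≤ X ^ 3 * δ := by
    have : X ^ 3 * δ = X * (X ^ 2 * δ) := by ring
    rw [this]
    exact le_mul_of_one_le_left hX2 hX
  have hd : ∀ s t : ℝ, |s - t| ≤ 2 * X ^ 2 * δ →
      |2 * X * max 0 s - 2 * X * max 0 t| ≤ 4 * X ^ 3 * δ := by
    intro s t h
    have h1 : |max 0 s - max 0 t| ≤ |s - t| := by
      have := abs_max_sub_max_le_max 0 s 0 t
      simpa using this
    rw [← mul_sub, abs_mul, abs_of_nonneg (by linarith : 0 ≤ 2 * X)]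
    calc 2 * X * |max 0 s - max 0 t| ≤ 2 * X * (2 * X ^ 2 * δ) := by
          gcongr; exact h1.trans h
      _ = _ := by ring
  have t1 : |min u (2 * X * max 0 (y - v / 2)) - min u' (2 * X * max 0 (y' - v' / 2))|
      ≤ 4 * X ^ 3 * δ := by
    refine (abs_min_sub_min_le_max _ _ _ _).trans (max_le (by linarith) (hd _ _ ?_))
    rw [abs_le] at hv hy ⊢
    constructor <;> linarith
  have t2 : |min (v - p) (2 * X * max 0 (v / 2 - y)) - min (v' - p') (2 * X * max 0 (v' / 2 - y'))|
      ≤ 4 * X ^ 3 * δ := by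
    refine (abs_min_sub_min_le_max _ _ _ _).trans (max_le ?_ (hd _ _ ?_))
    · rw [abs_le] at hv hp ⊢
      constructor <;> linarith
    · rw [abs_le] at hv hy ⊢
      constructor <;> linarith
  simp only [stretch]
  rw [abs_le] at t1 t2 hy ⊢
  constructor <;> linarith

end Stretch

/-- A map from the standard triangle onto the closed region bounded by the broken lines
`P` and `Q`, sending the boundary to the boundary. -/
structure IsCellMap (P Q : ℕ → ℂ) (n a c : ℕ) (L : ℝ) (G : (Fin 3 → ℝ) → ℂ) (V : Set ℂ) :
    Prop where
  lip : ∀ b ∈ stdSimplex ℝ (Fin 3), ∀ b' ∈ stdSimplex ℝ (Fin 3), ‖G b - G b'‖ ≤ L * ‖b - b'‖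
  pl : PLOn G (stdSimplex ℝ (Fin 3))
  inj : InjOn G (stdSimplex ℝ (Fin 3))
  cell : Cell (lensList P Q a c) V
  image : ∀ b ∈ stdSimplex ℝ (Fin 3), G b ∈ poly (lensList P Q a c) ∪ V
  side_left : ∀ b ∈ stdSimplex ℝ (Fin 3), b 2 = 0 → G b = PLN P (n * b 1)
  side_right : ∀ b ∈ stdSimplex ℝ (Fin 3), b 0 = 0 → G b = PLN P (n + (a - n) * b 2)
  side_long : ∀ b ∈ stdSimplex ℝ (Fin 3), b 1 = 0 → G b = PLN Q (c * b 2)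
  hull : ∀ B : Set ℂ, Convex ℝ B → (∀ v ∈ lensList P Q a c, v ∈ B) →
    ∀ b ∈ stdSimplex ℝ (Fin 3), G b ∈ B

section Cell

variable (n a c : ℕ)

/-- The horizontal coordinate of the parametrisation of the lens by a triangle. -/
def lensX (b : Fin 3 → ℝ) : ℝ := c * n * b 1 + a * c * b 2

/-- The vertical coordinate in the triangle inscribed in the lens. -/
def lensY (b : Fin 3 → ℝ) : ℝ := -(c * n * (a * c - c * n) * b 1)

/-- The two lower sides of the triangle inscribed in the lens. -/
def lensRoof (x : ℝ) : ℝ := max (-((a * c - c * n) * x)) (c * n * (x - a * c))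

/-- The parametrisation of the lens by a triangle. -/
def lensMap (ha : (Finset.range a).Nonempty) (hc : (Finset.range c).Nonempty) (b : Fin 3 → ℝ) :
    ℝ × ℝ :=
  (lensX n a c b, stretch (a * c) (-env c a hc (lensX n a c b)) (env a c ha (lensX n a c b))
    (lensRoof n a c (lensX n a c b)) (lensY n a c b))

variable {n a c} (hn : 1 ≤ n) (hna : n < a) (hc1 : 1 ≤ c) (ha : (Finset.range a).Nonempty)
  (hc : (Finset.range c).Nonempty) {b b' : Fin 3 → ℝ}

theorem stdSimplex_three (hb : b ∈ stdSimplex ℝ (Fin 3)) :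
    0 ≤ b 0 ∧ 0 ≤ b 1 ∧ 0 ≤ b 2 ∧ b 0 + b 1 + b 2 = 1 :=
  ⟨hb.1 0, hb.1 1, hb.1 2, by have := hb.2; rwa [Fin.sum_univ_three] at this⟩

include hn hna hc1 in
theorem lens_consts : (1 : ℝ) ≤ c * n ∧ (1 : ℝ) ≤ a * c - c * n ∧ (2 : ℝ) ≤ a * c := by
  have h1 : (1 : ℝ) ≤ c * n := by exact_mod_cast Nat.mul_pos hc1 hn
  have h2 : (n : ℝ) + 1 ≤ a := by exact_mod_cast hna
  have h3 : (1 : ℝ) ≤ c := by exact_mod_cast hc1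
  have h4 : (1 : ℝ) ≤ a * c - c * n := by nlinarith
  exact ⟨h1, h4, by linarith⟩

include hn hna hc1 in
theorem lens_bounds (hb : b ∈ stdSimplex ℝ (Fin 3)) :
    0 ≤ lensX n a c b ∧ lensX n a c b ≤ a * c ∧
      lensRoof n a c (lensX n a c b) ≤ lensY n a c b ∧ lensY n a c b ≤ 0 := by
  obtain ⟨h1, h2, h3⟩ := lens_consts hn hna hc1
  obtain ⟨b0, b1, b2, hs⟩ := stdSimplex_three hb
  set p : ℝ := c * n with hp
  set q : ℝ := a * c - p with hq
  have hX : (a * c : ℝ) = p + q := by rw [hq]; ring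
  have hp0 : 0 ≤ p := by linarith
  have hq0 : 0 ≤ q := by linarith
  have e : lensX n a c b = p * b 1 + (p + q) * b 2 := by rw [lensX, ← hp, hX]
  have e' : lensY n a c b = -(p * q * b 1) := by rw [lensY]
  have hpq : 0 ≤ p * q * b 1 := by positivity
  refine ⟨by rw [e]; positivity, ?_, ?_, by linarith⟩
  · rw [e, hX]
    have := mul_nonneg hq0 b1
    have := mul_nonneg (add_nonneg hp0 hq0) b0
    nlinarith
  · rw [lensRoof, ← hp, ← hq, e, e', hX]
    refine max_le ?_ ?_
    · have := mul_nonneg hq0 (mul_nonneg (add_nonneg hp0 hq0) b2)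
      nlinarith
    · have := mul_nonneg hp0 (mul_nonneg (add_nonneg hp0 hq0) b0)
      have hb0 : b 0 = 1 - b 1 - b 2 := by linarith
      rw [hb0] at this
      nlinarith

include hn hna hc1 in
theorem lens_env {x : ℝ} (h0 : 0 ≤ x) (h1 : x ≤ a * c) :
    -env c a hc x ≤ -(a * c * lensRoof n a c x) ∧ env a c ha x ≤ lensRoof n a c x ∧
      0 ≤ -env c a hc x ∧ a * c * lensRoof n a c x ≤ env a c ha x ∧ lensRoof n a c x ≤ 0 := by
  obtain ⟨k1, k2, k3⟩ := lens_consts hn hna hc1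
  have hca : (c * a : ℝ) = a * c := mul_comm _ _
  have hr : a * c * lensRoof n a c x ≤ max (-(a * c * x)) (-(a * c * (a * c - x))) := by
    rw [lensRoof, mul_max_of_nonneg _ _ (by linarith)]
    refine max_le_max ?_ ?_
    · rw [mul_neg, neg_le_neg_iff]
      refine mul_le_mul_of_nonneg_left ?_ (by linarith)
      nlinarith
    · rw [← mul_neg]
      refine mul_le_mul_of_nonneg_left ?_ (by linarith)
      nlinarith
  have e1 := env_ge (w := c) ha h0 h1
  have e2 := env_ge (w := a) hc h0 (by rwa [hca])
  rw [hca] at e2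
  have hr1 := hr.trans (max_le e1.1 e1.2)
  have hr2 := hr.trans (max_le e2.1 e2.2)
  refine ⟨by linarith, ?_, ?_, hr1, ?_⟩
  · exact env_le_roof ha hn hna hc1 h0 h1
  · have := env_nonpos (w := a) hc h0 (by rwa [hca])
    linarith
  · refine max_le ?_ ?_
    · have := mul_nonneg (by linarith : (0 : ℝ) ≤ a * c - c * n) h0
      linarith
    · have := mul_nonneg (by linarith : (0 : ℝ) ≤ c * n) (by linarith : 0 ≤ a * c - x)
      linarith

theorem mem_polyDom_lens {x y : ℝ} (h1 : env a c ha x ≤ y) (h2 : y ≤ -env c a hc x) (hc1 : 1 ≤ c) :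
    (x, y) ∈ polyDom (lensList (fun k => lowPt (a * c) (c * k)) (fun k => upPt (a * c) (a * k))
      a c) := by
  intro e he
  rw [mem_cyc_lensList (by simp [lowPt, upPt]) (by simp [lowPt, upPt, mul_comm]) hc1] at he
  rcases he with ⟨k, hk, rfl⟩ | ⟨j, hj, rfl⟩
  · have h := nodeLine_le_env (w := c) ha hk x
    have := mul_nonneg (Nat.cast_nonneg (α := ℝ) c) (sub_nonneg.mpr (h.trans h1))
    refine this.trans (le_of_eq ?_)
    simp only [det3, lowPt, nodeLine]
    push_cast
    ring
  · have h := nodeLine_le_env (w := a) hc hj x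
    have := mul_nonneg (Nat.cast_nonneg (α := ℝ) a)
      (sub_nonneg.mpr (h2.trans (neg_le_neg h)))
    refine this.trans (le_of_eq ?_)
    simp only [det3, upPt, nodeLine]
    push_cast
    ring

include hn hna hc1 in
theorem lensMap_mem (hb : b ∈ stdSimplex ℝ (Fin 3)) :
    lensMap n a c ha hc b ∈ polyDom (lensList (fun k => lowPt (a * c) (c * k))
      (fun k => upPt (a * c) (a * k)) a c) := by
  obtain ⟨x0, x1, y0, y1⟩ := lens_bounds hn hna hc1 hb
  obtain ⟨e1, e2, e3, e4, e5⟩ := lens_env hn hna hc1 ha hc x0 x1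
  have hX : (0 : ℝ) ≤ a * c := by positivity
  refine mem_polyDom_lens ha hc ?_ ?_ hc1
  · calc _ = _ := (stretch_self e3 e4 e5).symm
      _ ≤ _ := (stretch_strictMono hX).monotone y0
  · calc _ ≤ _ := (stretch_strictMono hX).monotone y1
      _ = _ := stretch_zero e1 e2 e5

include hn hna hc1 in
theorem lensMap_injOn : InjOn (lensMap n a c ha hc) (stdSimplex ℝ (Fin 3)) := by
  intro b hb b' hb' h
  obtain ⟨k1, k2, k3⟩ := lens_consts hn hna hc1
  have hX : (0 : ℝ) ≤ a * c := by positivity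
  have h1 : lensX n a c b = lensX n a c b' := congrArg Prod.fst h
  have h2 := congrArg Prod.snd h
  simp only [lensMap, h1] at h2
  have h3 := (stretch_strictMono hX).injective h2
  simp only [lensY, neg_inj] at h3
  have hne : (c * n * (a * c - c * n) : ℝ) ≠ 0 := (mul_pos (by linarith) (by linarith)).ne'
  have e1 := mul_left_cancel₀ hne h3
  simp only [lensX, e1] at h1
  have e2 := mul_left_cancel₀ (show (a * c : ℝ) ≠ 0 by linarith) (add_left_cancel h1)
  have s := stdSimplex_three hb
  have s' := stdSimplex_three hb'
  ext i
  fin_cases i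
  · change b 0 = b' 0
    linarith [s.2.2.2, s'.2.2.2]
  · exact e1
  · exact e2

include hn hna hc1 in
theorem lensMap_lip :
    ‖lensMap n a c ha hc b - lensMap n a c ha hc b'‖ ≤ 15 * (a * c) ^ 3 * ‖b - b'‖ := by
  obtain ⟨k1, k2, k3⟩ := lens_consts hn hna hc1
  set p : ℝ := c * n with hp
  set q : ℝ := a * c - p with hq
  set X : ℝ := a * c with hX
  set δ := ‖b - b'‖ with hδ
  have hδ0 : 0 ≤ δ := norm_nonneg _
  have hb : ∀ i, |b i - b' i| ≤ δ := fun i => norm_le_pi_norm (b - b') i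
  have hpX : p ≤ X := by linarith
  have hqX : q ≤ X := by linarith
  have hx : |lensX n a c b - lensX n a c b'| ≤ 2 * X * δ := by
    have e : lensX n a c b - lensX n a c b' = p * (b 1 - b' 1) + X * (b 2 - b' 2) := by
      simp only [lensX, ← hp, ← hX]; ring
    rw [e]
    refine (abs_add_le _ _).trans ?_
    rw [abs_mul p, abs_mul X, abs_of_nonneg (by linarith : 0 ≤ p),
      abs_of_nonneg (by linarith : 0 ≤ X)]
    have := mul_le_mul hpX (hb 1) (abs_nonneg _) (by linarith)
    have := mul_le_mul_of_nonneg_left (hb 2) (by linarith : 0 ≤ X)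
    linarith
  have hxx : X * |lensX n a c b - lensX n a c b'| ≤ 2 * X ^ 2 * δ := by
    calc _ ≤ X * (2 * X * δ) := by gcongr
      _ = _ := by ring
  have hy : |lensY n a c b - lensY n a c b'| ≤ X ^ 2 * δ := by
    have e : lensY n a c b - lensY n a c b' = -(p * q * (b 1 - b' 1)) := by
      simp only [lensY, ← hp, ← hq, ← hX]; ring
    rw [e, abs_neg, abs_mul, abs_of_nonneg (mul_nonneg (by linarith) (by linarith)), pow_two]
    gcongr
    exact hb 1
  have hv : |lensRoof n a c (lensX n a c b) - lensRoof n a c (lensX n a c b')| ≤ 2 * X ^ 2 * δ := by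
    refine le_trans ?_ hxx
    simp only [lensRoof, ← hp, ← hq, ← hX]
    refine (abs_max_sub_max_le_max _ _ _ _).trans (max_le ?_ ?_)
    · rw [show -(q * lensX n a c b) - -(q * lensX n a c b')
        = -(q * (lensX n a c b - lensX n a c b')) by ring, abs_neg, abs_mul,
        abs_of_nonneg (by linarith : 0 ≤ q)]
      gcongr
    · rw [show p * (lensX n a c b - X) - p * (lensX n a c b' - X)
        = p * (lensX n a c b - lensX n a c b') by ring, abs_mul,
        abs_of_nonneg (by linarith : 0 ≤ p)]
      gcongr
  have hpp := (env_lip (w := c) ha (lensX n a c b) (lensX n a c b')).trans hxx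
  have huu : |-env c a hc (lensX n a c b) - -env c a hc (lensX n a c b')| ≤ 2 * X ^ 2 * δ := by
    have := env_lip (w := a) hc (lensX n a c b) (lensX n a c b')
    rw [mul_comm (c : ℝ) a] at this
    rw [neg_sub_neg, abs_sub_comm]
    exact this.trans hxx
  have h := abs_stretch_sub_le (X := X) (by linarith) huu hpp hv hy
  rw [Prod.norm_def]
  refine max_le ?_ h
  refine hx.trans (mul_le_mul_of_nonneg_right ?_ hδ0)
  calc 2 * X ≤ 15 * (X * 1) := by linarith
    _ ≤ 15 * (X * X ^ 2) := by
      gcongr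
      exact one_le_pow₀ (by linarith)
    _ = 15 * X ^ 3 := by ring

theorem PLOn.eval {S : Set (Fin 3 → ℝ)} (i : Fin 3) (r : ℝ) :
    PLOn (fun b : Fin 3 → ℝ => r * b i) S :=
  PLOn.smul r (PLOn.affine (LinearMap.proj (R := ℝ) (φ := fun _ : Fin 3 => ℝ) i).toAffineMap)

theorem PLOn.const {E F : Type*} [AddCommGroup E] [Module ℝ E] [AddCommGroup F] [Module ℝ F]
    {S : Set E} (c : F) : PLOn (fun _ : E => c) S := PLOn.affine (AffineMap.const ℝ E c)

theorem lensMap_pl {S : Set (Fin 3 → ℝ)} : PLOn (lensMap n a c ha hc) S := by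
  have hx : PLOn (lensX n a c) S := (PLOn.eval 1 _).add (PLOn.eval 2 _)
  have hy : PLOn (lensY n a c) S :=
    (PLOn.eval 1 (-(c * n * (a * c - c * n)))).congr fun b _ => by rw [lensY]; ring
  have hv : PLOn (fun b => lensRoof n a c (lensX n a c b)) S := by
    refine PLOn.max ((hx.smul (-(a * c - c * n))).congr fun b _ => ?_)
      ((hx.sub (PLOn.const (a * c : ℝ))).smul _)
    rw [smul_eq_mul]; ring
  have hp := env_pl (w := c) ha hx
  have hu : PLOn (fun b => -env c a hc (lensX n a c b)) S :=
    ((env_pl (w := a) hc hx).smul (-1)).congr fun b _ => by rw [smul_eq_mul]; ring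
  have hv2 : PLOn (fun b => lensRoof n a c (lensX n a c b) / 2) S :=
    (hv.smul (1 / 2)).congr fun b _ => by rw [smul_eq_mul]; ring
  have h0 : PLOn (fun _ : Fin 3 → ℝ => (0 : ℝ)) S := PLOn.const 0
  exact hx.prodMk ((hy.add (hu.min ((h0.max (hy.sub hv2)).smul (2 * (a * c))))).sub
    ((hv.sub hp).min ((h0.max (hv2.sub hy)).smul (2 * (a * c)))))

include hn hna hc1 in
theorem lensMap_low (hb : b ∈ stdSimplex ℝ (Fin 3)) (h : b 2 = 0 ∨ b 0 = 0) :
    lensMap n a c ha hc b = (lensX n a c b, env a c ha (lensX n a c b)) := by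
  obtain ⟨x0, x1, y0, y1⟩ := lens_bounds hn hna hc1 hb
  obtain ⟨e1, e2, e3, e4, e5⟩ := lens_env hn hna hc1 ha hc x0 x1
  obtain ⟨-, -, -, hs⟩ := stdSimplex_three hb
  rw [lensMap, Prod.mk.injEq]
  refine ⟨rfl, ?_⟩
  have hy : lensY n a c b = lensRoof n a c (lensX n a c b) := by
    refine le_antisymm ?_ y0
    rcases h with h | h
    · refine le_max_of_le_left (le_of_eq ?_)
      rw [lensY, lensX, h]; ring
    · refine le_max_of_le_right (le_of_eq ?_)
      have : b 1 = 1 - b 2 := by linarith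
      rw [lensY, lensX, this]; ring
  rw [hy, stretch_self e3 e4 e5]

include hn hna hc1 in
theorem lensMap_up (hb : b ∈ stdSimplex ℝ (Fin 3)) (h : b 1 = 0) :
    lensMap n a c ha hc b = (lensX n a c b, -env c a hc (lensX n a c b)) := by
  obtain ⟨x0, x1, y0, y1⟩ := lens_bounds hn hna hc1 hb
  obtain ⟨e1, e2, e3, e4, e5⟩ := lens_env hn hna hc1 ha hc x0 x1
  rw [lensMap, Prod.mk.injEq]
  refine ⟨rfl, ?_⟩
  have hy : lensY n a c b = 0 := by rw [lensY, h]; ring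
  rw [hy, stretch_zero e1 e2 e5]

theorem norm_lowPt_le {X x : ℝ} (hX : 1 ≤ X) (h0 : 0 ≤ x) (h1 : x ≤ X) :
    ‖lowPt X x‖ ≤ X ^ 2 ∧ ‖upPt X x‖ ≤ X ^ 2 := by
  have h : ‖x‖ ≤ X ^ 2 := by
    rw [Real.norm_of_nonneg h0]; nlinarith
  have h2 : ‖x * (X - x)‖ ≤ X ^ 2 := by
    rw [Real.norm_of_nonneg (mul_nonneg h0 (by linarith)), pow_two]
    exact mul_le_mul h1 (by linarith) (by linarith) (by linarith)
  refine ⟨max_le h ?_, max_le h h2⟩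
  change ‖x * (x - X)‖ ≤ X ^ 2
  rwa [← neg_sub, mul_neg, norm_neg]

theorem exists_isCellMap {P Q : ℕ → ℂ} {R : ℝ} (hn : 1 ≤ n) (hna : n < a) (hc1 : 1 ≤ c)
    (h0 : P 0 = Q 0) (h1 : P a = Q c) (hs : SimplePoly (lensList P Q a c))
    (hP : ∀ k ≤ a, ‖P k‖ ≤ R) (hQ : ∀ j ≤ c, ‖Q j‖ ≤ R) :
    ∃ G V, IsCellMap P Q n a c (180 * (a * c) ^ 5 * R) G V := by
  have ha : (Finset.range a).Nonempty := ⟨0, by simp; omega⟩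
  have hc : (Finset.range c).Nonempty := ⟨0, by simp; omega⟩
  obtain ⟨k1, k2, k3⟩ := lens_consts hn hna hc1
  have hX0 : (0 : ℝ) ≤ a * c := by positivity
  set l := lensList (fun k : ℕ => (lowPt (a * c) (c * k), P k))
    (fun k : ℕ => (upPt (a * c) (a * k), Q k)) a c with hl
  have hfst : l.map Prod.fst = lensList (fun k => lowPt (a * c) (c * k))
      (fun k => upPt (a * c) (a * k)) a c := lensList_map _ _ _ _ _
  have hsnd : l.map Prod.snd = lensList P Q a c := lensList_map _ _ _ _ _
  obtain ⟨F, V, hF⟩ := exists_isFill (M := (a * c) ^ 2) (R := R) l (by rwa [hsnd])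
    (by rw [hfst]; exact convexPos_lens (by omega) hc1) (by
      intro v hv
      rcases mem_lensList hv with ⟨k, hk, rfl⟩ | ⟨j, hj, rfl⟩
      · refine (norm_lowPt_le (by linarith) (by positivity) ?_).1
        rw [mul_comm]; gcongr
      · refine (norm_lowPt_le (by linarith) (by positivity) ?_).2
        gcongr) (by
      intro v hv
      rcases mem_lensList hv with ⟨k, hk, rfl⟩ | ⟨j, hj, rfl⟩
      · exact hP k hk
      · exact hQ j hj)
  have hR : 0 ≤ R := (norm_nonneg _).trans (hP 0 (Nat.zero_le _))
  have hcyc := fun e => mem_cyc_lensList (P := fun k : ℕ => (lowPt (a * c) (c * k), P k))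
    (Q := fun k : ℕ => (upPt (a * c) (a * k), Q k)) (a := a) (c := c)
    (by simp [lowPt, upPt, h0]) (by simp [lowPt, upPt, mul_comm, h1]) hc1 (e := e)
  have hdom := fun b (hb : b ∈ stdSimplex ℝ (Fin 3)) => lensMap_mem hn hna hc1 ha hc hb
  rw [← hfst] at hdom
  have low : ∀ s : ℝ, 0 ≤ s → s ≤ a → F (c * s, env a c ha (c * s)) = PLN P s := by
    intro s hs0 hs1
    obtain ⟨k, τ, hk, t0, t1, rfl⟩ := exists_nat_add (by omega : 1 ≤ a) hs0 hs1
    have := hF.bdry _ ((hcyc _).mpr (Or.inl ⟨k, hk, rfl⟩)) τ t0 t1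
    rw [PLN_add P k t0 t1, ← this, env_node ha hk t0 t1]
    congr 1
    simp only [lowPt, Prod.mk_sub_mk, Prod.smul_mk, Prod.mk_add_mk, smul_eq_mul]
    push_cast
    rw [Prod.mk.injEq]
    constructor <;> ring
  have up : ∀ s : ℝ, 0 ≤ s → s ≤ c → F (a * s, -env c a hc (a * s)) = PLN Q s := by
    intro s hs0 hs1
    obtain ⟨k, τ, hk, t0, t1, rfl⟩ := exists_nat_add hc1 hs0 hs1
    have := hF.bdry _ ((hcyc _).mpr (Or.inr ⟨k, hk, rfl⟩)) (1 - τ) (by linarith) (by linarith)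
    rw [PLN_add Q k t0 t1, env_node hc hk t0 t1]
    have e : Q k + τ • (Q (k + 1) - Q k) = Q (k + 1) + (1 - τ) • (Q k - Q (k + 1)) := by
      module
    rw [e, ← this]
    congr 1
    simp only [upPt, Prod.mk_sub_mk, Prod.smul_mk, Prod.mk_add_mk, smul_eq_mul]
    push_cast
    rw [Prod.mk.injEq]
    constructor <;> ring
  have hnR : (n : ℝ) + 1 ≤ a := by exact_mod_cast hna
  refine ⟨fun b => F (lensMap n a c ha hc b), V, ?_, ?_, ?_, ?_, ?_, ?_, ?_, ?_, ?_⟩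
  · intro b hb b' hb'
    refine (hF.lip _ (hdom b hb) _ (hdom b' hb')).trans ?_
    calc _ ≤ 12 * (a * c) ^ 2 * R * (15 * (a * c) ^ 3 * ‖b - b'‖) := by
          gcongr
          exact lensMap_lip hn hna hc1 ha hc
      _ = _ := by ring
  · exact hF.pl.comp (lensMap_pl ha hc) hdom
  · exact hF.inj.comp (lensMap_injOn hn hna hc1 ha hc) hdom
  · rw [← hsnd]; exact hF.cell
  · intro b hb
    rw [← hsnd]; exact hF.image _ (hdom b hb)
  · intro b hb h
    obtain ⟨b0, b1, b2, hsum⟩ := stdSimplex_three hb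
    have hle : (n : ℝ) * b 1 ≤ a := by nlinarith
    rw [lensMap_low hn hna hc1 ha hc hb (Or.inl h), ← low _ (by positivity) hle]
    rw [lensX, h]
    congr 2 <;> [skip; congr 1] <;> ring
  · intro b hb h
    obtain ⟨b0, b1, b2, hsum⟩ := stdSimplex_three hb
    have h1 : b 1 = 1 - b 2 := by linarith
    have hle : (n : ℝ) + (a - n) * b 2 ≤ a := by nlinarith
    rw [lensMap_low hn hna hc1 ha hc hb (Or.inr h),
      ← low _ (add_nonneg (Nat.cast_nonneg n) (mul_nonneg (by linarith) b2)) hle]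
    rw [lensX, h1]
    congr 2 <;> [skip; congr 1] <;> ring
  · intro b hb h
    obtain ⟨b0, b1, b2, hsum⟩ := stdSimplex_three hb
    have hle : (c : ℝ) * b 2 ≤ c := by nlinarith [Nat.cast_nonneg (α := ℝ) c]
    rw [lensMap_up hn hna hc1 ha hc hb h, ← up _ (by positivity) hle]
    rw [lensX, h]
    congr 2 <;> [skip; congr 2] <;> ring
  · intro B hB hv b hb
    refine hF.hull B hB (fun v hv' => hv _ ?_) _ (hdom b hb)
    rw [← hsnd]
    exact List.mem_map_of_mem hv'

end Cell

section Lattice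

/-- The lattice point of the plane with given integer coordinates. -/
def lat (p : ℤ × ℤ) : ℂ := ⟨p.1, p.2⟩

/-- The sup distance of lattice points. -/
def ld (p q : ℤ × ℤ) : ℤ := max |p.1 - q.1| |p.2 - q.2|

/-- The sup distance of a point of the plane to a lattice point. -/
def sd (x : ℂ) (q : ℤ × ℤ) : ℝ := max |x.re - q.1| |x.im - q.2|

/-- Neighbouring lattice points. -/
def Unit4 (p q : ℤ × ℤ) : Prop := |p.1 - q.1| + |p.2 - q.2| = 1

theorem lat_injective : Function.Injective lat := by
  intro p q h
  have h1 := congrArg Complex.re h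
  have h2 := congrArg Complex.im h
  simp only [lat, Int.cast_inj] at h1 h2
  exact Prod.ext h1 h2

theorem ld_comm (p q : ℤ × ℤ) : ld p q = ld q p := by
  rw [ld, ld, abs_sub_comm, abs_sub_comm p.2]

theorem ld_eq_zero {p q : ℤ × ℤ} : ld p q = 0 ↔ p = q := by
  constructor
  · intro h
    have h1 := (le_max_left |p.1 - q.1| |p.2 - q.2|).trans_eq h
    have h2 := (le_max_right |p.1 - q.1| |p.2 - q.2|).trans_eq h
    exact Prod.ext (by simpa [sub_eq_zero] using h1) (by simpa [sub_eq_zero] using h2)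
  · rintro rfl
    simp [ld]

theorem ld_triangle (p q r : ℤ × ℤ) : ld p r ≤ ld p q + ld q r := by
  refine max_le ?_ ?_
  · exact (abs_sub_le _ q.1 _).trans (add_le_add (le_max_left _ _) (le_max_left _ _))
  · exact (abs_sub_le _ q.2 _).trans (add_le_add (le_max_right _ _) (le_max_right _ _))

theorem sd_lat (p q : ℤ × ℤ) : sd (lat p) q = ld p q := by
  simp [sd, lat, ld]

theorem sd_le_norm (x : ℂ) (q : ℤ × ℤ) : sd x q ≤ ‖x - lat q‖ :=
  max_le (by simpa [lat] using Complex.abs_re_le_norm (x - lat q))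
    (by simpa [lat] using Complex.abs_im_le_norm (x - lat q))

theorem norm_le_sd (x : ℂ) (q : ℤ × ℤ) : ‖x - lat q‖ ≤ 2 * sd x q := by
  have h := Complex.norm_le_abs_re_add_abs_im (x - lat q)
  have h1 : |(x - lat q).re| ≤ sd x q := le_max_left _ _
  have h2 : |(x - lat q).im| ≤ sd x q := le_max_right _ _
  linarith

theorem Unit4.symm {p q : ℤ × ℤ} (h : Unit4 p q) : Unit4 q p := by
  rwa [Unit4, abs_sub_comm, abs_sub_comm q.2]

theorem segment_param {E : Type*} [AddCommGroup E] [Module ℝ E] {x a b : E}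
    (h : x ∈ segment ℝ a b) : ∃ τ : ℝ, 0 ≤ τ ∧ τ ≤ 1 ∧ x = a + τ • (b - a) := by
  rw [segment_eq_image'] at h
  obtain ⟨τ, hτ, rfl⟩ := h
  exact ⟨τ, hτ.1, hτ.2, rfl⟩

theorem Unit4.mem_segment {p q : ℤ × ℤ} (h : Unit4 p q) {x : ℂ}
    (hx : x ∈ segment ℝ (lat p) (lat q)) :
    x = lat p ∨ x = lat q ∨ (p = (⌊x.re⌋, ⌊x.im⌋) ∧ q = (⌈x.re⌉, ⌈x.im⌉)) ∨
      (q = (⌊x.re⌋, ⌊x.im⌋) ∧ p = (⌈x.re⌉, ⌈x.im⌉)) := by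
  obtain ⟨τ, h0, h1, hxe⟩ := segment_param hx
  rcases h0.eq_or_lt with rfl | h0
  · left; simpa using hxe
  rcases h1.eq_or_lt with rfl | h1
  · right; left; simpa using hxe
  have hre : x.re = p.1 + τ * (q.1 - p.1) := by rw [hxe]; simp [lat]
  have him : x.im = p.2 + τ * (q.2 - p.2) := by rw [hxe]; simp [lat]
  rw [Unit4] at h
  have hcase : (q.1 = p.1 + 1 ∧ q.2 = p.2) ∨ (q.1 = p.1 - 1 ∧ q.2 = p.2) ∨
      (q.1 = p.1 ∧ q.2 = p.2 + 1) ∨ (q.1 = p.1 ∧ q.2 = p.2 - 1) := by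
    rcases abs_cases (p.1 - q.1) with ⟨e, _⟩ | ⟨e, _⟩ <;>
      rcases abs_cases (p.2 - q.2) with ⟨e', _⟩ | ⟨e', _⟩ <;> omega
  have up : ∀ (i : ℤ), ⌊(i : ℝ) + τ⌋ = i ∧ ⌈(i : ℝ) + τ⌉ = i + 1 := by
    intro i
    rw [Int.floor_eq_iff, Int.ceil_eq_iff]
    push_cast
    refine ⟨⟨?_, ?_⟩, ?_, ?_⟩ <;> linarith
  have down : ∀ (i : ℤ), ⌊(i : ℝ) - τ⌋ = i - 1 ∧ ⌈(i : ℝ) - τ⌉ = i := by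
    intro i
    rw [Int.floor_eq_iff, Int.ceil_eq_iff]
    push_cast
    refine ⟨⟨?_, ?_⟩, ?_, ?_⟩ <;> linarith
  obtain ⟨p1, p2⟩ := p
  obtain ⟨q1, q2⟩ := q
  simp only at hre him hcase
  right; right
  rcases hcase with ⟨rfl, rfl⟩ | ⟨rfl, rfl⟩ | ⟨rfl, rfl⟩ | ⟨rfl, rfl⟩
  · left
    rw [show x.re = p1 + τ by rw [hre]; push_cast; ring, show x.im = q2 by rw [him]; ring]
    simp [up]
  · right
    rw [show x.re = p1 - τ by rw [hre]; push_cast; ring, show x.im = q2 by rw [him]; ring]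
    simp [down]
  · left
    rw [show x.im = p2 + τ by rw [him]; push_cast; ring, show x.re = q1 by rw [hre]; ring]
    simp [up]
  · right
    rw [show x.im = p2 - τ by rw [him]; push_cast; ring, show x.re = q1 by rw [hre]; ring]
    simp [down]

theorem Unit4.ne {p q : ℤ × ℤ} (h : Unit4 p q) : p ≠ q := by
  rintro rfl
  simp [Unit4] at h

theorem Unit4.lat_mem_segment {p q r : ℤ × ℤ} (h : Unit4 p q)
    (hx : lat r ∈ segment ℝ (lat p) (lat q)) : lat r = lat p ∨ lat r = lat q := by
  rcases h.mem_segment hx with h' | h' | ⟨h1, h2⟩ | ⟨h1, h2⟩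
  · exact Or.inl h'
  · exact Or.inr h'
  · simp only [lat, Int.floor_intCast, Int.ceil_intCast] at h1 h2
    exact absurd (h1.trans h2.symm) h.ne
  · simp only [lat, Int.floor_intCast, Int.ceil_intCast] at h1 h2
    exact absurd (h2.trans h1.symm) h.ne

theorem Unit4.le_sd {p q w : ℤ × ℤ} {R : ℤ} (hR : 1 ≤ R) (h : Unit4 p q) (hp : R ≤ ld p w)
    (hq : R ≤ ld q w) {x : ℂ} (hx : x ∈ segment ℝ (lat p) (lat q)) : (R : ℝ) ≤ sd x w := by
  obtain ⟨τ, h0, h1, hxe⟩ := segment_param hx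
  have hre : x.re = p.1 + τ * (q.1 - p.1) := by rw [hxe]; simp [lat]
  have him : x.im = p.2 + τ * (q.2 - p.2) := by rw [hxe]; simp [lat]
  rw [Unit4] at h
  have hcase : (R ≤ p.1 - w.1 ∧ R ≤ q.1 - w.1) ∨ (R ≤ w.1 - p.1 ∧ R ≤ w.1 - q.1) ∨
      (R ≤ p.2 - w.2 ∧ R ≤ q.2 - w.2) ∨ (R ≤ w.2 - p.2 ∧ R ≤ w.2 - q.2) := by
    simp only [ld, le_max_iff, le_abs] at hp hq
    rcases abs_cases (p.1 - q.1) with ⟨e, _⟩ | ⟨e, _⟩ <;>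
      rcases abs_cases (p.2 - q.2) with ⟨e', _⟩ | ⟨e', _⟩ <;> omega
  have key : ∀ {s t c : ℤ}, R ≤ s - c → R ≤ t - c → (R : ℝ) ≤ s + τ * (t - s) - c := by
    intro s t c hs ht
    have hs' : (R : ℝ) ≤ s - c := by exact_mod_cast hs
    have ht' : (R : ℝ) ≤ t - c := by exact_mod_cast ht
    nlinarith
  have key' : ∀ {s t c : ℤ}, R ≤ c - s → R ≤ c - t → (R : ℝ) ≤ -(s + τ * (t - s) - c) := by
    intro s t c hs ht
    have hs' : (R : ℝ) ≤ c - s := by exact_mod_cast hs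
    have ht' : (R : ℝ) ≤ c - t := by exact_mod_cast ht
    nlinarith
  rw [sd, le_max_iff, le_abs, le_abs, hre, him]
  rcases hcase with ⟨a, b⟩ | ⟨a, b⟩ | ⟨a, b⟩ | ⟨a, b⟩
  · exact Or.inl (Or.inl (key a b))
  · exact Or.inl (Or.inr (key' a b))
  · exact Or.inr (Or.inl (key a b))
  · exact Or.inr (Or.inr (key' a b))

theorem sd_lineMap (w b : ℤ × ℤ) {τ : ℝ} (h0 : 0 ≤ τ) :
    sd (lat w + τ • (lat b - lat w)) w = τ * ld b w := by
  simp only [sd, lat, ld]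
  push_cast
  rw [mul_max_of_nonneg _ _ h0]
  congr 1 <;> simp [abs_mul, abs_of_nonneg h0]

/-- The edges of the plane graph consisting of the unit lattice edges outside the sup balls of
radius `R` around the points of `W` and the spokes of these balls. -/
def LEdge (W : Set (ℤ × ℤ)) (R : ℤ) (p q : ℤ × ℤ) : Prop :=
  (Unit4 p q ∧ ∀ w ∈ W, R ≤ ld p w ∧ R ≤ ld q w) ∨ (p ∈ W ∧ ld q p = R) ∨ (q ∈ W ∧ ld p q = R)

/-- Two edges coincide or meet at `x` only as common endpoint. -/
def GoodMeet {α : Type*} (p q p' q' x : α) : Prop :=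
  (p = p' ∧ q = q') ∨ (p = q' ∧ q = p') ∨ ((x = p ∨ x = q) ∧ (x = p' ∨ x = q'))

theorem GoodMeet.symm {α : Type*} {p q p' q' x : α} (h : GoodMeet p q p' q' x) :
    GoodMeet p' q' p q x := by
  unfold GoodMeet at *; tauto

theorem GoodMeet.swap {α : Type*} {p q p' q' x : α} (h : GoodMeet p q p' q' x) :
    GoodMeet q p p' q' x := by
  unfold GoodMeet at *; tauto

variable {W : Set (ℤ × ℤ)} {R : ℤ}

theorem LEdge.symm {p q : ℤ × ℤ} (h : LEdge W R p q) : LEdge W R q p := by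
  rcases h with ⟨h, h'⟩ | h | h
  · exact Or.inl ⟨h.symm, fun w hw => (h' w hw).symm⟩
  · exact Or.inr (Or.inr h)
  · exact Or.inr (Or.inl h)

theorem goodMeet_unit_unit {p q p' q' : ℤ × ℤ} {x : ℂ} (h : Unit4 p q) (h' : Unit4 p' q')
    (hx : x ∈ segment ℝ (lat p) (lat q)) (hx' : x ∈ segment ℝ (lat p') (lat q')) :
    GoodMeet (lat p) (lat q) (lat p') (lat q') x := by
  rcases h.mem_segment hx with rfl | rfl | h1
  · exact Or.inr (Or.inr ⟨Or.inl rfl, h'.lat_mem_segment hx'⟩)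
  · exact Or.inr (Or.inr ⟨Or.inr rfl, h'.lat_mem_segment hx'⟩)
  rcases h'.mem_segment hx' with rfl | rfl | h2
  · exact Or.inr (Or.inr ⟨h.lat_mem_segment hx, Or.inl rfl⟩)
  · exact Or.inr (Or.inr ⟨h.lat_mem_segment hx, Or.inr rfl⟩)
  rcases h1 with ⟨rfl, rfl⟩ | ⟨rfl, rfl⟩ <;> rcases h2 with ⟨rfl, rfl⟩ | ⟨rfl, rfl⟩
  · exact Or.inl ⟨rfl, rfl⟩
  · exact Or.inr (Or.inl ⟨rfl, rfl⟩)
  · exact Or.inr (Or.inl ⟨rfl, rfl⟩)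
  · exact Or.inl ⟨rfl, rfl⟩

theorem goodMeet_unit_spoke (hR : 1 ≤ R) {p q w b : ℤ × ℤ} {x : ℂ} (h : Unit4 p q)
    (hp : R ≤ ld p w) (hq : R ≤ ld q w) (hb : ld b w = R)
    (hx : x ∈ segment ℝ (lat p) (lat q)) (hx' : x ∈ segment ℝ (lat w) (lat b)) :
    GoodMeet (lat p) (lat q) (lat w) (lat b) x := by
  have h1 := h.le_sd hR hp hq hx
  obtain ⟨τ, h0, h2, hxe⟩ := segment_param hx'
  rw [hxe, sd_lineMap _ _ h0, hb] at h1
  have hR' : (0 : ℝ) < R := by exact_mod_cast hR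
  have : τ = 1 := le_antisymm h2 (by
    by_contra hc
    push Not at hc
    nlinarith)
  have hxb : x = lat b := by rw [hxe, this]; simp
  subst hxb
  exact Or.inr (Or.inr ⟨h.lat_mem_segment hx, Or.inr rfl⟩)

theorem goodMeet_spoke_spoke (hR : 1 ≤ R) (hW : ∀ w ∈ W, ∀ w' ∈ W, w ≠ w' → 2 * R < ld w w')
    {w b w' b' : ℤ × ℤ} {x : ℂ} (hw : w ∈ W) (hw' : w' ∈ W) (hb : ld b w = R) (hb' : ld b' w' = R)
    (hx : x ∈ segment ℝ (lat w) (lat b)) (hx' : x ∈ segment ℝ (lat w') (lat b')) :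
    GoodMeet (lat w) (lat b) (lat w') (lat b') x := by
  obtain ⟨τ, h0, h1, hxe⟩ := segment_param hx
  obtain ⟨τ', h0', h1', hxe'⟩ := segment_param hx'
  have s : sd x w = τ * R := by rw [hxe, sd_lineMap _ _ h0, hb]
  have s' : sd x w' = τ' * R := by rw [hxe', sd_lineMap _ _ h0', hb']
  have hR' : (0 : ℝ) < R := by exact_mod_cast hR
  by_cases hww : w = w'
  · subst hww
    have : τ = τ' := by
      rw [s] at s'
      exact mul_right_cancel₀ hR'.ne' s'
    subst this
    rcases h0.eq_or_lt with rfl | h0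
    · exact Or.inr (Or.inr ⟨Or.inl (by simpa using hxe), Or.inl (by simpa using hxe)⟩)
    · rw [hxe] at hxe'
      have := smul_right_injective ℂ h0.ne' (add_left_cancel hxe')
      exact Or.inl ⟨rfl, by simpa using this⟩
  · exfalso
    have h := hW w hw w' hw' hww
    have h2 : (2 * R : ℝ) < ld w w' := by exact_mod_cast h
    have h3 : (ld w w' : ℝ) ≤ sd x w + sd x w' := by
      simp only [ld, sd]
      push_cast
      refine max_le ?_ ?_
      · refine (abs_sub_le _ x.re _).trans (add_le_add ?_ (le_max_left _ _))
        rw [abs_sub_comm]; exact le_max_left _ _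
      · refine (abs_sub_le _ x.im _).trans (add_le_add ?_ (le_max_right _ _))
        rw [abs_sub_comm]; exact le_max_right _ _
    rw [s, s'] at h3
    nlinarith

theorem LEdge.goodMeet (hR : 1 ≤ R) (hW : ∀ w ∈ W, ∀ w' ∈ W, w ≠ w' → 2 * R < ld w w')
    {p q p' q' : ℤ × ℤ} {x : ℂ} (h : LEdge W R p q) (h' : LEdge W R p' q')
    (hx : x ∈ segment ℝ (lat p) (lat q)) (hx' : x ∈ segment ℝ (lat p') (lat q')) :
    GoodMeet (lat p) (lat q) (lat p') (lat q') x := by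
  have us : ∀ {p q w b : ℤ × ℤ}, (Unit4 p q ∧ ∀ w ∈ W, R ≤ ld p w ∧ R ≤ ld q w) → w ∈ W →
      ld b w = R → x ∈ segment ℝ (lat p) (lat q) → x ∈ segment ℝ (lat w) (lat b) →
      GoodMeet (lat p) (lat q) (lat w) (lat b) x := fun h hw hb hx hx' =>
    goodMeet_unit_spoke hR h.1 (h.2 _ hw).1 (h.2 _ hw).2 hb hx hx'
  have ss := fun {w b w' b' : ℤ × ℤ} => goodMeet_spoke_spoke (x := x) hR hW (w := w) (b := b)
    (w' := w') (b' := b')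
  have hxs := hx
  have hxs' := hx'
  rw [segment_symm] at hxs hxs'
  rcases h with h | ⟨h, hb⟩ | ⟨h, hb⟩ <;> rcases h' with h' | ⟨h', hb'⟩ | ⟨h', hb'⟩
  · exact goodMeet_unit_unit h.1 h'.1 hx hx'
  · exact us h h' hb' hx hx'
  · exact (us h h' hb' hx hxs').symm.swap.symm
  · exact (us h' h hb hx' hx).symm
  · exact ss h h' hb hb' hx hx'
  · exact (ss h h' hb hb' hx hxs').symm.swap.symm
  · exact (us h' h hb hx' hxs).symm.swap
  · exact (ss h h' hb hb' hxs hx').swap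
  · exact (ss h h' hb hb' hxs hxs').swap.symm.swap.symm

end Lattice

section Path

variable {W : Set (ℤ × ℤ)} {R : ℤ}

/-- The subgraph of the plane graph `LEdge` on the vertex set `A`. -/
def latGraph (W A : Set (ℤ × ℤ)) (R : ℤ) : SimpleGraph (ℤ × ℤ) :=
  SimpleGraph.fromRel fun p q => LEdge W R p q ∧ p ∈ A ∧ q ∈ A

theorem latGraph_adj {A : Set (ℤ × ℤ)} {p q : ℤ × ℤ} (h : (latGraph W A R).Adj p q) :
    LEdge W R p q ∧ p ∈ A ∧ q ∈ A := by
  rw [latGraph, SimpleGraph.fromRel_adj] at h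
  rcases h.2 with h | h
  · exact h
  · exact ⟨h.1.symm, h.2.2, h.2.1⟩

theorem latGraph_step (hR : 1 ≤ R) (hW : ∀ w ∈ W, ∀ w' ∈ W, w ≠ w' → 4 * R < ld w w')
    {A : Set (ℤ × ℤ)} {p r : ℤ × ℤ} (hpr : ld p r ≤ 1) (hp : ∀ w ∈ W, R ≤ ld p w)
    (hr : ∀ w ∈ W, R ≤ ld r w)
    (hA : ∀ s, ld s p ≤ 1 → (∀ w ∈ W, R ≤ ld s w) → s ∈ A) :
    (latGraph W A R).Reachable p r := by
  have hAr : r ∈ A := hA r (by rwa [ld_comm]) hr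
  have hAp : p ∈ A := hA p (by rw [ld_eq_zero.mpr rfl]; norm_num) hp
  have edge : ∀ {s t : ℤ × ℤ}, Unit4 s t → (∀ w ∈ W, R ≤ ld s w) → (∀ w ∈ W, R ≤ ld t w) →
      s ∈ A → t ∈ A → (latGraph W A R).Reachable s t := by
    intro s t h hs ht hsA htA
    refine SimpleGraph.Adj.reachable ?_
    rw [latGraph, SimpleGraph.fromRel_adj]
    exact ⟨h.ne, Or.inl ⟨Or.inl ⟨h, fun w hw => ⟨hs w hw, ht w hw⟩⟩, hsA, htA⟩⟩
  have h1 : |p.1 - r.1| ≤ 1 := (le_max_left _ _).trans hpr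
  have h2 : |p.2 - r.2| ≤ 1 := (le_max_right _ _).trans hpr
  by_cases e1 : p.1 = r.1
  · by_cases e2 : p.2 = r.2
    · rw [Prod.ext e1 e2]
    · refine edge ?_ hp hr hAp hAr
      have : |p.2 - r.2| ≠ 0 := by rw [Ne, abs_eq_zero, sub_eq_zero]; exact e2
      have := abs_nonneg (p.2 - r.2)
      rw [Unit4, e1, sub_self, abs_zero]
      omega
  · have n1 : |p.1 - r.1| ≠ 0 := by rw [Ne, abs_eq_zero, sub_eq_zero]; exact e1
    have := abs_nonneg (p.1 - r.1)
    by_cases e2 : p.2 = r.2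
    · refine edge ?_ hp hr hAp hAr
      rw [Unit4, e2, sub_self, abs_zero]
      omega
    · have n2 : |p.2 - r.2| ≠ 0 := by rw [Ne, abs_eq_zero, sub_eq_zero]; exact e2
      have := abs_nonneg (p.2 - r.2)
      have d1 : |p.1 - r.1| = 1 := by omega
      have d2 : |p.2 - r.2| = 1 := by omega
      have m1 : ld (p.1, r.2) p ≤ 1 := by
        rw [ld_comm, ld]; simp [d2]
      have m2 : ld (r.1, p.2) p ≤ 1 := by
        rw [ld_comm, ld]; simp [d1]
      by_cases hfar : ∀ w ∈ W, R ≤ ld (p.1, r.2) w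
      · have hm := hA _ m1 hfar
        exact (edge (by simp [Unit4, d2]) hp hfar hAp hm).trans
          (edge (by simp [Unit4, d1]) hfar hr hm hAr)
      · have hfar2 : ∀ w ∈ W, R ≤ ld (r.1, p.2) w := by
          push Not at hfar
          obtain ⟨w, hw, hlt⟩ := hfar
          intro w' hw'
          by_cases hww : w' = w
          · subst hww
            have a1 := hp w' hw
            have a2 := hr w' hw
            simp only [ld, max_lt_iff, le_max_iff] at a1 a2 hlt ⊢
            omega
          · have b1 := hW w' hw' w hw hww
            have b2 := ld_triangle w' (r.1, p.2) w
            have b3 := ld_triangle (r.1, p.2) p w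
            have b4 := ld_triangle p (p.1, r.2) w
            rw [ld_comm w' (r.1, p.2)] at b2
            rw [ld_comm] at m1
            omega
        have hm := hA _ m2 hfar2
        exact (edge (by simp [Unit4, d1]) hp hfar2 hAp hm).trans
          (edge (by simp [Unit4, d2]) hfar2 hr hm hAr)

theorem exists_latPath (hR : 1 ≤ R) (hW : ∀ w ∈ W, ∀ w' ∈ W, w ≠ w' → 4 * R < ld w w')
    {wu wv : ℤ × ℤ} (hu : wu ∈ W) (hv : wv ∈ W) (huv : wu ≠ wv) (q : ℕ → ℤ × ℤ) (N : ℕ)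
    (h0 : q 0 = wu) (hN : q N = wv) (hstep : ∀ i < N, ld (q i) (q (i + 1)) ≤ 1)
    (hfar : ∀ i ≤ N, ∀ w ∈ W, w ≠ wu → w ≠ wv → R ≤ ld (q i) w) :
    ∃ (f : ℕ → ℤ × ℤ) (n : ℕ), 1 ≤ n ∧ f 0 = wu ∧ f n = wv ∧ InjOn f (Iic n) ∧
      (∀ k < n, LEdge W R (f k) (f (k + 1))) ∧
      ∀ k ≤ n, f k = wu ∨ f k = wv ∨
        ((∀ w ∈ W, R ≤ ld (f k) w) ∧ ∃ i ≤ N, ld (f k) (q i) ≤ 1) := by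
  set A : Set (ℤ × ℤ) := {p | p = wu ∨ p = wv ∨
    ((∀ w ∈ W, R ≤ ld p w) ∧ ∃ i ≤ N, ld p (q i) ≤ 1)} with hA
  have huvd := hW _ hu _ hv huv
  set i1 := Nat.findGreatest (fun i => ld (q i) wu ≤ R) N with hi1
  have i1spec : ld (q i1) wu ≤ R :=
    Nat.findGreatest_spec (P := fun i => ld (q i) wu ≤ R) (m := 0) (Nat.zero_le _)
      (by rw [h0, ld_eq_zero.mpr rfl]; omega)
  have i1le : i1 ≤ N := Nat.findGreatest_le N
  have i1max : ∀ i, i1 < i → i ≤ N → R < ld (q i) wu := fun i h h' => by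
    have := Nat.findGreatest_is_greatest h h'
    omega
  have i1lt : i1 < N := by
    rcases i1le.lt_or_eq with h | h
    · exact h
    · rw [h, hN, ld_comm] at i1spec
      omega
  have hex : ∃ j, i1 ≤ j ∧ ld (q j) wv ≤ R := ⟨N, i1le, by rw [hN, ld_eq_zero.mpr rfl]; omega⟩
  set i2 := Nat.find hex with hi2
  obtain ⟨h12, i2spec⟩ := Nat.find_spec hex
  rw [← hi2] at h12 i2spec
  have i2le : i2 ≤ N := Nat.find_min' hex ⟨i1le, by rw [hN, ld_eq_zero.mpr rfl]; omega⟩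
  have i2min : ∀ j, i1 ≤ j → j < i2 → R < ld (q j) wv := by
    intro j h h'
    have := Nat.find_min hex h'
    push Not at this
    exact this h
  have h12' : i1 < i2 := by
    rcases h12.lt_or_eq with h | h
    · exact h
    · exfalso
      rw [← h] at i2spec
      have := ld_triangle wu (q i1) wv
      rw [ld_comm wu (q i1)] at this
      omega
  have e1 : ld (q i1) wu = R := by
    have a1 := i1max (i1 + 1) (by omega) (by omega)
    have a2 := hstep i1 i1lt
    have a3 := ld_triangle (q (i1 + 1)) (q i1) wu
    rw [ld_comm] at a2
    omega
  have e2 : ld (q i2) wv = R := by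
    obtain ⟨j, hj⟩ : ∃ j, i2 = j + 1 := ⟨i2 - 1, by omega⟩
    have a1 := i2min j (by omega) (by omega)
    have a2 := hstep j (by omega)
    have a3 := ld_triangle (q j) (q (j + 1)) wv
    rw [hj] at i2spec ⊢
    omega
  have far : ∀ i, i1 ≤ i → i ≤ i2 → ∀ w ∈ W, R ≤ ld (q i) w := by
    intro i hi hi' w hw
    by_cases hwu : w = wu
    · rcases hi.eq_or_lt with rfl | hi
      · rw [hwu, e1]
      · rw [hwu]; exact (i1max i hi (by omega)).le
    by_cases hwv : w = wv
    · rcases hi'.eq_or_lt with rfl | hi'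
      · rw [hwv, e2]
      · rw [hwv]; exact (i2min i hi hi').le
    exact hfar i (by omega) w hw hwu hwv
  have reach : ∀ d, i1 + d ≤ i2 → (latGraph W A R).Reachable (q i1) (q (i1 + d)) := by
    intro d
    induction d with
    | zero => intro _; exact SimpleGraph.Reachable.refl _
    | succ d ih =>
      intro hd
      refine (ih (by omega)).trans (latGraph_step hR hW (hstep _ (by omega))
        (far _ (by omega) (by omega)) (far _ (by omega) (by omega)) fun s hs hs' => ?_)
      exact Or.inr (Or.inr ⟨hs', i1 + d, by omega, hs⟩)
  have hq : ∀ i, i1 ≤ i → i ≤ i2 → q i ∈ A := fun i hi hi' =>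
    Or.inr (Or.inr ⟨far i hi hi', i, by omega, by rw [ld_eq_zero.mpr rfl]; norm_num⟩)
  have spoke : ∀ {w b : ℤ × ℤ}, w ∈ W → w ∈ A → b ∈ A → ld b w = R →
      (latGraph W A R).Reachable w b := by
    intro w b hw hwA hbA h
    refine SimpleGraph.Adj.reachable ?_
    rw [latGraph, SimpleGraph.fromRel_adj]
    refine ⟨?_, Or.inl ⟨Or.inr (Or.inl ⟨hw, h⟩), hwA, hbA⟩⟩
    rintro rfl
    rw [ld_eq_zero.mpr rfl] at h
    omega
  have total : (latGraph W A R).Reachable wu wv := by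
    have r2 := reach (i2 - i1) (by omega)
    rw [Nat.add_sub_cancel' h12] at r2
    exact (spoke hu (Or.inl rfl) (hq i1 le_rfl h12) e1).trans
      (r2.trans (spoke hv (Or.inr (Or.inl rfl)) (hq i2 h12 le_rfl) e2).symm)
  obtain ⟨P, hP⟩ := total.exists_isPath
  have hlen : 1 ≤ P.length := by
    rw [Nat.one_le_iff_ne_zero]
    intro h
    exact huv (SimpleGraph.Walk.eq_of_length_eq_zero h)
  have hadj : ∀ k < P.length, (latGraph W A R).Adj (P.getVert k) (P.getVert (k + 1)) :=
    fun k hk => P.adj_getVert_succ hk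
  refine ⟨P.getVert, P.length, hlen, P.getVert_zero, P.getVert_length, hP.getVert_injOn,
    fun k hk => (latGraph_adj (hadj k hk)).1, fun k hk => ?_⟩
  rcases hk.lt_or_eq with hk | rfl
  · exact (latGraph_adj (hadj k hk)).2.1
  · rw [P.getVert_length]
    exact Or.inr (Or.inl rfl)

end Path

section Drawing

/-- The lattice point below a point of the plane. -/
def fl (x : ℂ) : ℤ × ℤ := (⌊x.re⌋, ⌊x.im⌋)

theorem norm_sub_fl (x : ℂ) : ‖x - lat (fl x)‖ ≤ 2 := by
  have h1 : sd x (fl x) ≤ 1 := by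
    refine max_le ?_ ?_
    · rw [abs_le]
      constructor <;> simp only [fl] <;> linarith [Int.floor_le x.re, Int.lt_floor_add_one x.re]
    · rw [abs_le]
      constructor <;> simp only [fl] <;> linarith [Int.floor_le x.im, Int.lt_floor_add_one x.im]
  linarith [norm_le_sd x (fl x)]

theorem norm_lat_sub_le (p q : ℤ × ℤ) : ‖lat p - lat q‖ ≤ 2 * ld p q := by
  have := norm_le_sd (lat p) q
  rwa [sd_lat] at this

theorem ld_le_norm (p q : ℤ × ℤ) : ld p q ≤ ‖lat p - lat q‖ := by
  have := sd_le_norm (lat p) q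
  rwa [sd_lat] at this

theorem norm_sub_le_ld_fl (a b : ℂ) : ‖a - b‖ ≤ 4 + 2 * ld (fl a) (fl b) := by
  have e : a - b = (a - lat (fl a)) + (lat (fl a) - lat (fl b)) - (b - lat (fl b)) := by ring
  rw [e]
  refine (norm_sub_le _ _).trans ?_
  have := norm_add_le (a - lat (fl a)) (lat (fl a) - lat (fl b))
  linarith [norm_sub_fl a, norm_sub_fl b, norm_lat_sub_le (fl a) (fl b)]

theorem floor_sub_floor_le {s t : ℝ} (h : |s - t| < 1) : |⌊s⌋ - ⌊t⌋| ≤ 1 := by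
  rw [abs_lt] at h
  have h1 : (⌊s⌋ : ℝ) < ⌊t⌋ + 2 := by linarith [Int.floor_le s, Int.lt_floor_add_one t]
  have h2 : (⌊t⌋ : ℝ) < ⌊s⌋ + 2 := by linarith [Int.floor_le t, Int.lt_floor_add_one s]
  have h1' : ⌊s⌋ < ⌊t⌋ + 2 := by exact_mod_cast h1
  have h2' : ⌊t⌋ < ⌊s⌋ + 2 := by exact_mod_cast h2
  rw [abs_le]
  omega

theorem ld_fl_le {a b : ℂ} (h : ‖a - b‖ < 1) : ld (fl a) (fl b) ≤ 1 := by
  refine max_le (floor_sub_floor_le ?_) (floor_sub_floor_le ?_)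
  · exact (Complex.abs_re_le_norm (a - b)).trans_lt h
  · exact (Complex.abs_im_le_norm (a - b)).trans_lt h

theorem exists_discretization {γ : ℝ → ℂ} (h : ContinuousOn γ (Icc 0 1)) :
    ∃ N : ℕ, 0 < N ∧ ∀ i < N, ‖γ (i / N) - γ ((i + 1 : ℕ) / N)‖ < 1 := by
  have hu := isCompact_Icc.uniformContinuousOn_of_continuous h
  rw [Metric.uniformContinuousOn_iff] at hu
  obtain ⟨δ, hδ, hu⟩ := hu 1 one_pos
  obtain ⟨N, hN⟩ := exists_nat_one_div_lt hδ
  refine ⟨N + 1, Nat.succ_pos _, fun i hi => ?_⟩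
  have hN0 : (0 : ℝ) < (N + 1 : ℕ) := by positivity
  rw [← dist_eq_norm]
  refine hu _ ⟨by positivity, ?_⟩ _ ⟨by positivity, ?_⟩ ?_
  · rw [div_le_one hN0]; exact_mod_cast hi.le
  · rw [div_le_one hN0]; exact_mod_cast hi
  · rw [dist_comm, Real.dist_eq, ← sub_div]
    push_cast at hN ⊢
    rw [add_sub_cancel_left, abs_of_nonneg (by positivity)]
    exact hN

variable {E : Type*} [NormedAddCommGroup E] [NormedSpace ℝ E]

/-- A drawing of a graph with vertex set `Z` and edge set `ed` by broken lines close to the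
images of the edges under `h`. -/
structure IsDrawing (Z : Set E) (ed : Set (E × E)) (h : E → ℂ) (R : ℝ) (N : ℕ) (w : E → ℂ)
    (p : E × E → ℕ → ℂ) (n : E × E → ℕ) : Prop where
  near_vert : ∀ z ∈ Z, ‖w z - h z‖ ≤ 4
  pos : ∀ e ∈ ed, 1 ≤ n e
  le : ∀ e ∈ ed, n e ≤ N
  start : ∀ e ∈ ed, p e 0 = w e.1
  finish : ∀ e ∈ ed, p e (n e) = w e.2
  inj : ∀ e ∈ ed, InjOn (p e) (Iic (n e))
  near : ∀ e ∈ ed, ∀ k ≤ n e, ∃ t ∈ segment ℝ e.1 e.2, ‖p e k - h t‖ ≤ 4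
  step : ∀ e ∈ ed, ∀ k < n e, ‖p e (k + 1) - p e k‖ ≤ 2 * R
  vert : ∀ e ∈ ed, ∀ k ≤ n e, ∀ z ∈ Z, p e k = w z → (k = 0 ∧ z = e.1) ∨ (k = n e ∧ z = e.2)
  disj : ∀ e ∈ ed, ∀ e' ∈ ed, e ≠ e' → ∀ k ≤ n e, ∀ k' ≤ n e', p e k = p e' k' →
    ∃ z ∈ Z, p e k = w z
  meet : ∀ e ∈ ed, ∀ e' ∈ ed, ∀ k < n e, ∀ k' < n e', ∀ x ∈ segment ℝ (p e k) (p e (k + 1)),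
    x ∈ segment ℝ (p e' k') (p e' (k' + 1)) → (e = e' ∧ k = k') ∨
      ((x = p e k ∨ x = p e (k + 1)) ∧ (x = p e' k' ∨ x = p e' (k' + 1)))

variable {Z : Set E} {ed : Set (E × E)} {h : E → ℂ} {R B : ℕ}

theorem exists_edgePath (hR : 12 ≤ R) (hed : ∀ e ∈ ed, e.1 ∈ Z ∧ e.2 ∈ Z ∧ e.1 ≠ e.2)
    (hW : ∀ w ∈ (fun z => fl (h z)) '' Z, ∀ w' ∈ (fun z => fl (h z)) '' Z, w ≠ w' →
      4 * (R : ℤ) < ld w w') (hinj : InjOn (fun z => fl (h z)) Z)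
    (hcont : ∀ e ∈ ed, ContinuousOn h (segment ℝ e.1 e.2))
    (H2 : ∀ e ∈ ed, ∀ t ∈ segment ℝ e.1 e.2, ∀ z ∈ Z, z ≠ e.1 → z ≠ e.2 →
      10 * (R : ℝ) < ‖h t - h z‖) (e : E × E) (he : e ∈ ed) :
    ∃ (f : ℕ → ℤ × ℤ) (n : ℕ), 1 ≤ n ∧ f 0 = fl (h e.1) ∧ f n = fl (h e.2) ∧ InjOn f (Iic n) ∧
      (∀ k < n, LEdge ((fun z => fl (h z)) '' Z) R (f k) (f (k + 1))) ∧
      ∀ k ≤ n, f k = fl (h e.1) ∨ f k = fl (h e.2) ∨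
        ((∀ z ∈ Z, (R : ℤ) ≤ ld (f k) (fl (h z))) ∧
          ∃ t ∈ segment ℝ e.1 e.2, ‖lat (f k) - h t‖ ≤ 4) := by
  obtain ⟨h1, h2, h12⟩ := hed e he
  set γ : ℝ → ℂ := fun t => h (AffineMap.lineMap e.1 e.2 t) with hγ
  have hmem : ∀ t ∈ Icc (0 : ℝ) 1, AffineMap.lineMap e.1 e.2 t ∈ segment ℝ e.1 e.2 := by
    intro t ht
    rw [segment_eq_image_lineMap]
    exact mem_image_of_mem _ ht
  have hγc : ContinuousOn γ (Icc 0 1) :=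
    (hcont e he).comp AffineMap.lineMap_continuous.continuousOn hmem
  obtain ⟨N, hN, hstep⟩ := exists_discretization hγc
  have hN0 : (0 : ℝ) < N := by exact_mod_cast hN
  have hIcc : ∀ i ≤ N, (i / N : ℝ) ∈ Icc (0 : ℝ) 1 := fun i hi =>
    ⟨by positivity, by rw [div_le_one hN0]; exact_mod_cast hi⟩
  obtain ⟨f, n, a1, a2, a3, a4, a5, a6⟩ := exists_latPath (R := R) (by omega) hW
    (mem_image_of_mem _ h1) (mem_image_of_mem _ h2) (fun hh => h12 (hinj h1 h2 hh))
    (fun i => fl (γ (i / N))) N (by simp [hγ]) (by simp [hγ, hN0.ne'])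
    (fun i hi => ld_fl_le (hstep i hi)) (by
      rintro i hi _ ⟨z, hz, rfl⟩ hne1 hne2
      have k1 := H2 e he _ (hmem _ (hIcc i hi)) z hz (fun hh => hne1 (by rw [hh]))
        (fun hh => hne2 (by rw [hh]))
      have k2 := norm_sub_le_ld_fl (γ (i / N)) (h z)
      have hR' : (12 : ℝ) ≤ R := by exact_mod_cast hR
      have : (R : ℝ) ≤ ld (fl (γ (i / N))) (fl (h z)) := by
        have : 10 * (R : ℝ) < ‖γ (i / N) - h z‖ := k1
        linarith
      exact_mod_cast this)
  refine ⟨f, n, a1, a2, a3, a4, a5, fun k hk => ?_⟩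
  rcases a6 k hk with h' | h' | ⟨hf, i, hi, hd⟩
  · exact Or.inl h'
  · exact Or.inr (Or.inl h')
  · refine Or.inr (Or.inr ⟨fun z hz => hf _ (mem_image_of_mem _ hz), _, hmem _ (hIcc i hi), ?_⟩)
    have k1 := norm_lat_sub_le (f k) (fl (γ (i / N)))
    have k2 : (ld (f k) (fl (γ (i / N))) : ℝ) ≤ 1 := by exact_mod_cast hd
    have k3 := norm_sub_fl (γ (i / N))
    have k4 := norm_sub_le_norm_sub_add_norm_sub (lat (f k)) (lat (fl (γ (i / N)))) (γ (i / N))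
    rw [norm_sub_rev (lat (fl _))] at k4
    change ‖lat (f k) - γ (i / N)‖ ≤ 4
    linarith

theorem exists_isDrawing (hR : 12 ≤ R) (hed : ∀ e ∈ ed, e.1 ∈ Z ∧ e.2 ∈ Z ∧ e.1 ≠ e.2)
    (hcont : ∀ e ∈ ed, ContinuousOn h (segment ℝ e.1 e.2))
    (hB : ∀ e ∈ ed, ∀ t ∈ segment ℝ e.1 e.2, ‖h t‖ ≤ B)
    (H1 : ∀ z ∈ Z, ∀ z' ∈ Z, z ≠ z' → 10 * (R : ℝ) < ‖h z - h z'‖)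
    (H2 : ∀ e ∈ ed, ∀ t ∈ segment ℝ e.1 e.2, ∀ z ∈ Z, z ≠ e.1 → z ≠ e.2 →
      10 * (R : ℝ) < ‖h t - h z‖)
    (H3 : ∀ e ∈ ed, ∀ e' ∈ ed, e ≠ e' → ∀ t ∈ segment ℝ e.1 e.2, ∀ t' ∈ segment ℝ e'.1 e'.2,
      (∀ z ∈ Z, (R : ℝ) / 2 ≤ ‖h t - h z‖) → 10 < ‖h t - h t'‖) :
    ∃ w p n, IsDrawing Z ed h R ((2 * (B + 4) + 1) ^ 2) w p n := by
  have hR' : (12 : ℝ) ≤ R := by exact_mod_cast hR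
  have hsep : ∀ z ∈ Z, ∀ z' ∈ Z, z ≠ z' → 4 * (R : ℤ) < ld (fl (h z)) (fl (h z')) := by
    intro z hz z' hz' hne
    have k1 := H1 z hz z' hz' hne
    have k2 := norm_sub_le_ld_fl (h z) (h z')
    have : 4 * (R : ℝ) < ld (fl (h z)) (fl (h z')) := by linarith
    exact_mod_cast this
  have hinj : InjOn (fun z => fl (h z)) Z := by
    intro z hz z' hz' hzz
    by_contra hne
    have := hsep z hz z' hz' hne
    rw [ld_eq_zero.mpr hzz] at this
    omega
  have hW : ∀ w ∈ (fun z => fl (h z)) '' Z, ∀ w' ∈ (fun z => fl (h z)) '' Z, w ≠ w' →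
      4 * (R : ℤ) < ld w w' := by
    rintro _ ⟨z, hz, rfl⟩ _ ⟨z', hz', rfl⟩ hne
    exact hsep z hz z' hz' fun hh => hne (by rw [hh])
  have hex := exists_edgePath hR hed hW hinj hcont H2
  choose! f n hn f0 fn finj fedge fA using hex
  have hvert : ∀ e ∈ ed, ∀ k ≤ n e, ∀ z ∈ Z, f e k = fl (h z) →
      (k = 0 ∧ z = e.1) ∨ (k = n e ∧ z = e.2) := by
    intro e he k hk z hz hfz
    obtain ⟨h1, h2, -⟩ := hed e he
    rcases fA e he k hk with h' | h' | ⟨h', -⟩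
    · exact Or.inl ⟨finj e he hk (Nat.zero_le (n e)) (h'.trans (f0 e he).symm),
        hinj hz h1 (hfz.symm.trans h')⟩
    · exact Or.inr ⟨finj e he hk (le_refl (n e)) (h'.trans (fn e he).symm),
        hinj hz h2 (hfz.symm.trans h')⟩
    · have := h' z hz
      rw [ld_eq_zero.mpr hfz] at this
      omega
  have hnear : ∀ e ∈ ed, ∀ k ≤ n e, ∃ t ∈ segment ℝ e.1 e.2, ‖lat (f e k) - h t‖ ≤ 4 := by
    intro e he k hk
    rcases fA e he k hk with h' | h' | ⟨-, h'⟩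
    · refine ⟨e.1, left_mem_segment _ _ _, ?_⟩
      rw [h', norm_sub_rev]
      linarith [norm_sub_fl (h e.1)]
    · refine ⟨e.2, right_mem_segment _ _ _, ?_⟩
      rw [h', norm_sub_rev]
      linarith [norm_sub_fl (h e.2)]
    · exact h'
  have hdisj : ∀ e ∈ ed, ∀ e' ∈ ed, e ≠ e' → ∀ k ≤ n e, ∀ k' ≤ n e', f e k = f e' k' →
      ∃ z ∈ Z, f e k = fl (h z) := by
    intro e he e' he' hne k hk k' hk' hff
    obtain ⟨h1, h2, -⟩ := hed e he
    rcases fA e he k hk with h' | h' | ⟨hfar, t, ht, hnt⟩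
    · exact ⟨_, h1, h'⟩
    · exact ⟨_, h2, h'⟩
    exfalso
    obtain ⟨t', ht', hnt'⟩ := hnear e' he' k' hk'
    rw [← hff] at hnt'
    have := H3 e he e' he' hne t ht t' ht' fun z hz => by
      have k1 : (R : ℝ) ≤ ld (f e k) (fl (h z)) := by exact_mod_cast hfar z hz
      have k2 := ld_le_norm (f e k) (fl (h z))
      have k3 := norm_sub_fl (h z)
      have e1 : lat (f e k) - lat (fl (h z)) = (lat (f e k) - h t) + (h t - h z)
        + (h z - lat (fl (h z))) := by ring
      have k4 := norm_add₃_le (a := lat (f e k) - h t) (b := h t - h z)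
        (c := h z - lat (fl (h z)))
      rw [← e1] at k4
      linarith
    have k4 := norm_sub_le_norm_sub_add_norm_sub (h t) (lat (f e k)) (h t')
    rw [norm_sub_rev (h t) (lat _)] at k4
    linarith
  have hlat := lat_injective
  refine ⟨fun z => lat (fl (h z)), fun e k => lat (f e k), n, ?_, hn, ?_, ?_, ?_, ?_, hnear, ?_,
    ?_, ?_, ?_⟩
  · intro z _
    rw [norm_sub_rev]
    linarith [norm_sub_fl (h z)]
  · intro e he
    set S : Finset (ℤ × ℤ) := Finset.Icc (-(B + 4 : ℤ)) (B + 4) ×ˢ Finset.Icc (-(B + 4 : ℤ)) (B + 4)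
      with hS
    have hcard : (Finset.range (n e + 1)).card ≤ S.card := by
      refine Finset.card_le_card_of_injOn (f e) (fun k hk => ?_) fun k hk k' hk' => ?_
      · have hk' : k ≤ n e := by simpa [Nat.lt_succ_iff] using hk
        obtain ⟨t, ht, hnt⟩ := hnear e he k hk'
        have k1 := hB e he t ht
        have k2 : ‖lat (f e k)‖ ≤ B + 4 := by
          have := norm_le_norm_sub_add (lat (f e k)) (h t)
          linarith
        have k3 := (Complex.abs_re_le_norm (lat (f e k))).trans k2
        have k4 := (Complex.abs_im_le_norm (lat (f e k))).trans k2
        have k5 : |(f e k).1| ≤ B + 4 := by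
          have : |((f e k).1 : ℝ)| ≤ B + 4 := k3
          exact_mod_cast this
        have k6 : |(f e k).2| ≤ B + 4 := by
          have : |((f e k).2 : ℝ)| ≤ B + 4 := k4
          exact_mod_cast this
        rw [abs_le] at k5 k6
        exact Finset.mem_product.mpr ⟨Finset.mem_Icc.mpr k5, Finset.mem_Icc.mpr k6⟩
      · exact finj e he (by simpa [Nat.lt_succ_iff] using hk) (by simpa [Nat.lt_succ_iff] using hk')
    rw [Finset.card_range, hS, Finset.card_product, Int.card_Icc] at hcard
    have e1 : ((B : ℤ) + 4 + 1 - -((B : ℤ) + 4)).toNat = 2 * (B + 4) + 1 := by omega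
    rw [e1, ← pow_two] at hcard
    omega
  · intro e he
    simp only [f0 e he]
  · intro e he
    simp only [fn e he]
  · intro e he
    exact hlat.comp_injOn (finj e he)
  · intro e he k hk
    have key : ld (f e (k + 1)) (f e k) ≤ R := by
      rcases fedge e he k hk with ⟨hu, -⟩ | ⟨-, hh⟩ | ⟨-, hh⟩
      · have h1 := abs_nonneg ((f e k).1 - (f e (k + 1)).1)
        have h2 := abs_nonneg ((f e k).2 - (f e (k + 1)).2)
        rw [Unit4] at hu
        rw [ld_comm]
        exact max_le (by omega) (by omega)
      · exact hh.le
      · rw [ld_comm]; exact hh.le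
    have key' : (ld (f e (k + 1)) (f e k) : ℝ) ≤ R := by exact_mod_cast key
    have := norm_lat_sub_le (f e (k + 1)) (f e k)
    linarith
  · intro e he k hk z hz hh
    exact hvert e he k hk z hz (hlat hh)
  · intro e he e' he' hne k hk k' hk' hh
    obtain ⟨z, hz, hz'⟩ := hdisj e he e' he' hne k hk k' hk' (hlat hh)
    exact ⟨z, hz, congrArg lat hz'⟩
  · intro e he e' he' k hk k' hk' x hx hx'
    have hW2 : ∀ w ∈ (fun z => fl (h z)) '' Z, ∀ w' ∈ (fun z => fl (h z)) '' Z, w ≠ w' →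
        2 * (R : ℤ) < ld w w' := fun w hw w' hw' hne => by
      have := hW w hw w' hw' hne
      omega
    have noedge : e ≠ e' → (∃ j ≤ n e', f e k = f e' j) → (∃ j ≤ n e', f e (k + 1) = f e' j) →
        False := by
      rintro hne ⟨j, hj, e1⟩ ⟨j', hj', e2⟩
      obtain ⟨z, hz, hz'⟩ := hdisj e he e' he' hne k hk.le j hj e1
      obtain ⟨y, hy, hy'⟩ := hdisj e he e' he' hne (k + 1) hk j' hj' e2
      have hzy : z ≠ y := by
        rintro rfl
        have := finj e he (show k ∈ Iic (n e) from hk.le) (show k + 1 ∈ Iic (n e) from hk)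
          (hz'.trans hy'.symm)
        omega
      have hs1 := hsep z hz y hy hzy
      have hs2 := hsep y hy z hz hzy.symm
      have hl := fedge e he k hk
      rw [hz', hy'] at hl
      rcases hl with ⟨-, hh⟩ | ⟨-, hh⟩ | ⟨-, hh⟩
      · have := (hh _ (mem_image_of_mem _ hz)).1
        rw [ld_eq_zero.mpr rfl] at this
        omega
      · omega
      · omega
    rcases LEdge.goodMeet (by omega) hW2 (fedge e he k hk) (fedge e' he' k' hk') hx hx' with
      ⟨e1, e2⟩ | ⟨e1, e2⟩ | h'
    · left
      by_cases hne : e = e'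
      · subst hne
        exact ⟨rfl, finj e he (show k ∈ Iic (n e) from hk.le) (show k' ∈ Iic (n e) from hk'.le)
          (hlat e1)⟩
      · exact (noedge hne ⟨k', hk'.le, hlat e1⟩ ⟨k' + 1, hk', hlat e2⟩).elim
    · exfalso
      by_cases hne : e = e'
      · subst hne
        have a1 := finj e he (show k ∈ Iic (n e) from hk.le) (show k' + 1 ∈ Iic (n e) from hk')
          (hlat e1)
        have a2 := finj e he (show k + 1 ∈ Iic (n e) from hk) (show k' ∈ Iic (n e) from hk'.le)
          (hlat e2)
        omega
      · exact noedge hne ⟨k' + 1, hk', hlat e1⟩ ⟨k', hk'.le, hlat e2⟩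
    · exact Or.inr h'

end Drawing

section Concat

/-- The concatenation of the first `n` steps of `p` with `q`. -/
def cat (p q : ℕ → ℂ) (n k : ℕ) : ℂ := if k ≤ n then p k else q (k - n)

theorem cat_of_le {p q : ℕ → ℂ} {n k : ℕ} (h : k ≤ n) : cat p q n k = p k := if_pos h

theorem cat_add {p q : ℕ → ℂ} {n : ℕ} (h : p n = q 0) (k : ℕ) : cat p q n (n + k) = q k := by
  rw [cat]
  split_ifs with hk
  · have : k = 0 := by omega
    subst this
    exact h
  · rw [Nat.add_sub_cancel_left]

theorem PLN_cat_left {p q : ℕ → ℂ} {n : ℕ} (hn : 1 ≤ n) {s : ℝ} (h0 : 0 ≤ s) (h1 : s ≤ n) :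
    PLN (cat p q n) s = PLN p s := by
  obtain ⟨k, τ, hk, t0, t1, rfl⟩ := exists_nat_add hn h0 h1
  rw [PLN_add _ _ t0 t1, PLN_add _ _ t0 t1, cat_of_le hk.le, cat_of_le hk]

theorem PLN_cat_right {p q : ℕ → ℂ} {n m : ℕ} (h : p n = q 0) (hm : 1 ≤ m) {s : ℝ} (h0 : 0 ≤ s)
    (h1 : s ≤ m) : PLN (cat p q n) (n + s) = PLN q s := by
  obtain ⟨k, τ, hk, t0, t1, rfl⟩ := exists_nat_add hm h0 h1
  have := PLN_add (cat p q n) (n + k) t0 t1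
  rw [PLN_add _ _ t0 t1, ← cat_add h k, ← cat_add h (k + 1), ← add_assoc n k 1, ← this]
  push_cast
  rw [add_assoc]

theorem PLN_natCast (p : ℕ → ℂ) (k : ℕ) : PLN p k = p k := by
  have := PLN_add p k le_rfl zero_le_one
  simpa using this

end Concat

section Triangle

variable {E : Type*} [NormedAddCommGroup E] [NormedSpace ℝ E] {Z : Set E} {ed : Set (E × E)}
  {h : E → ℂ} {R : ℝ} {N : ℕ} {w : E → ℂ} {p : E × E → ℕ → ℂ} {n : E × E → ℕ}

/-- The closed polygon formed by the drawings of the three sides of a triangle. -/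
def triList (p : E × E → ℕ → ℂ) (n : E × E → ℕ) (a b c : E) : List ℂ :=
  lensList (cat (p (a, b)) (p (b, c)) (n (a, b))) (p (a, c)) (n (a, b) + n (b, c)) (n (a, c))

variable {a b c : E}

theorem IsDrawing.cat_start (H : IsDrawing Z ed h R N w p n) (hab : (a, b) ∈ ed)
    (hac : (a, c) ∈ ed) : cat (p (a, b)) (p (b, c)) (n (a, b)) 0 = p (a, c) 0 := by
  rw [cat_of_le (Nat.zero_le _), H.start _ hab, H.start _ hac]

theorem IsDrawing.cat_join (H : IsDrawing Z ed h R N w p n) (hab : (a, b) ∈ ed)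
    (hbc : (b, c) ∈ ed) : p (a, b) (n (a, b)) = p (b, c) 0 := by
  rw [H.finish _ hab, H.start _ hbc]

theorem IsDrawing.cat_finish (H : IsDrawing Z ed h R N w p n) (hab : (a, b) ∈ ed)
    (hbc : (b, c) ∈ ed) (hac : (a, c) ∈ ed) :
    cat (p (a, b)) (p (b, c)) (n (a, b)) (n (a, b) + n (b, c)) = p (a, c) (n (a, c)) := by
  rw [cat_add (H.cat_join hab hbc), H.finish _ hbc, H.finish _ hac]

theorem IsDrawing.mem_cyc_triList (H : IsDrawing Z ed h R N w p n) (hab : (a, b) ∈ ed)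
    (hbc : (b, c) ∈ ed) (hac : (a, c) ∈ ed) {e : ℂ × ℂ} :
    e ∈ cyc (triList p n a b c) ↔ (∃ k < n (a, b), e = (p (a, b) k, p (a, b) (k + 1))) ∨
      (∃ k < n (b, c), e = (p (b, c) k, p (b, c) (k + 1))) ∨
      ∃ k < n (a, c), e = (p (a, c) (k + 1), p (a, c) k) := by
  rw [triList, mem_cyc_lensList (H.cat_start hab hac) (H.cat_finish hab hbc hac) (H.pos _ hac)]
  have hj := H.cat_join hab hbc
  constructor
  · rintro (⟨k, hk, rfl⟩ | h')
    · rcases lt_or_ge k (n (a, b)) with hk' | hk'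
      · exact Or.inl ⟨k, hk', by rw [cat_of_le hk'.le, cat_of_le hk']⟩
      · obtain ⟨j, rfl⟩ := Nat.exists_eq_add_of_le hk'
        exact Or.inr (Or.inl ⟨j, by omega, by rw [cat_add hj, add_assoc, cat_add hj]⟩)
    · exact Or.inr (Or.inr h')
  · rintro (⟨k, hk, rfl⟩ | ⟨k, hk, rfl⟩ | h')
    · exact Or.inl ⟨k, by omega, by rw [cat_of_le hk.le, cat_of_le hk]⟩
    · exact Or.inl ⟨n (a, b) + k, by omega, by rw [cat_add hj, add_assoc, cat_add hj]⟩
    · exact Or.inr h'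

theorem IsDrawing.mem_triList (H : IsDrawing Z ed h R N w p n) (hab : (a, b) ∈ ed)
    (hbc : (b, c) ∈ ed) {v : ℂ} (hv : v ∈ triList p n a b c) :
    ∃ e ∈ ({(a, b), (b, c), (a, c)} : Set (E × E)), ∃ k ≤ n e, v = p e k := by
  rcases mem_lensList hv with ⟨k, hk, rfl⟩ | ⟨j, hj, rfl⟩
  · rcases le_total k (n (a, b)) with hk' | hk'
    · exact ⟨(a, b), by simp, k, hk', cat_of_le hk'⟩
    · obtain ⟨j, rfl⟩ := Nat.exists_eq_add_of_le hk'
      exact ⟨(b, c), by simp, j, by omega, cat_add (H.cat_join hab hbc) j⟩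
  · exact ⟨(a, c), by simp, j, hj, rfl⟩

theorem IsDrawing.exists_of_mem_cyc (H : IsDrawing Z ed h R N w p n) (hab : (a, b) ∈ ed)
    (hbc : (b, c) ∈ ed) (hac : (a, c) ∈ ed) (ab : a ≠ b) (bc : b ≠ c) {e : ℂ × ℂ}
    (he : e ∈ cyc (triList p n a b c)) :
    ∃ d ∈ ({(a, b), (b, c), (a, c)} : Set (E × E)), ∃ k < n d,
      (d ≠ (a, c) ∧ e = (p d k, p d (k + 1))) ∨ (d = (a, c) ∧ e = (p d (k + 1), p d k)) := by
  rcases (H.mem_cyc_triList hab hbc hac).mp he with ⟨k, hk, rfl⟩ | ⟨k, hk, rfl⟩ | ⟨k, hk, rfl⟩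
  · exact ⟨(a, b), by simp, k, hk, Or.inl ⟨by simp [bc], rfl⟩⟩
  · exact ⟨(b, c), by simp, k, hk, Or.inl ⟨by simp [ab.symm], rfl⟩⟩
  · exact ⟨(a, c), by simp, k, hk, Or.inr ⟨rfl, rfl⟩⟩

theorem IsDrawing.eq_of_eq (H : IsDrawing Z ed h R N w p n) {d d' : E × E} (hd : d ∈ ed)
    (hd' : d' ∈ ed) {k k' : ℕ} (hk : k ≤ n d) (hk' : k' ≤ n d') (hkk : p d k = p d' k') :
    (d = d' ∧ k = k') ∨ ((k = 0 ∧ k' = 0 ∧ d.1 = d'.1) ∨ (k = 0 ∧ k' = n d' ∧ d.1 = d'.2) ∨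
      (k = n d ∧ k' = 0 ∧ d.2 = d'.1) ∨ (k = n d ∧ k' = n d' ∧ d.2 = d'.2)) := by
  by_cases hdd : d = d'
  · subst hdd
    exact Or.inl ⟨rfl, H.inj _ hd hk hk' hkk⟩
  · obtain ⟨z, hz, hzk⟩ := H.disj _ hd _ hd' hdd _ hk _ hk' hkk
    right
    rcases H.vert _ hd _ hk z hz hzk with ⟨h1, rfl⟩ | ⟨h1, rfl⟩ <;>
      rcases H.vert _ hd' _ hk' _ hz (hkk ▸ hzk) with ⟨h2, h3⟩ | ⟨h2, h3⟩ <;> tauto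

theorem IsDrawing.simplePoly (H : IsDrawing Z ed h R N w p n)
    (hab : (a, b) ∈ ed) (hbc : (b, c) ∈ ed) (hac : (a, c) ∈ ed) (ab : a ≠ b) (bc : b ≠ c)
    (ac : a ≠ c) : SimplePoly (triList p n a b c) := by
  have h1 := H.pos _ hab
  have h2 := H.pos _ hbc
  have h3 := H.pos _ hac
  have hj := H.cat_join hab hbc
  have hmem : ∀ d ∈ ({(a, b), (b, c), (a, c)} : Set (E × E)), d ∈ ed := by
    rintro d (rfl | rfl | rfl) <;> assumption
  refine ⟨?_, ?_, ?_⟩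
  · rw [triList, lensList, List.length_map, List.length_range]
    omega
  · rw [triList, lensList, List.nodup_map_iff_inj_on List.nodup_range]
    have key : ∀ k < n (a, b) + n (b, c) + n (a, c), ∃ d j, j ≤ n d ∧
        lensFun (cat (p (a, b)) (p (b, c)) (n (a, b))) (p (a, c)) (n (a, b) + n (b, c))
          (n (a, c)) k = p d j ∧ ((d = (a, b) ∧ k = j) ∨ (d = (b, c) ∧ k = n (a, b) + j ∧ 1 ≤ j) ∨
          (d = (a, c) ∧ k + j = n (a, b) + n (b, c) + n (a, c) ∧ 1 ≤ j ∧ j < n (a, c))) := by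
      intro k hk
      rw [lensFun]
      split_ifs with hk1
      · rcases le_or_gt k (n (a, b)) with hk2 | hk2
        · exact ⟨(a, b), k, hk2, cat_of_le hk2, Or.inl ⟨rfl, rfl⟩⟩
        · obtain ⟨j, rfl⟩ := Nat.exists_eq_add_of_lt hk2
          exact ⟨(b, c), j + 1, by omega, by rw [add_assoc, cat_add hj],
            Or.inr (Or.inl ⟨rfl, by omega, by omega⟩)⟩
      · exact ⟨(a, c), _, by omega, rfl, Or.inr (Or.inr ⟨rfl, by omega, by omega, by omega⟩)⟩
    intro k hk k' hk' hkk
    rw [List.mem_range] at hk hk'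
    obtain ⟨d, j, hj, hdj, hh⟩ := key k hk
    obtain ⟨d', j', hj', hdj', hh'⟩ := key k' hk'
    rw [hdj, hdj'] at hkk
    have hd : d ∈ ed := hmem d (by rcases hh with hh | hh | hh <;> simp [hh.1])
    have hd' : d' ∈ ed := hmem d' (by rcases hh' with hh | hh | hh <;> simp [hh.1])
    have := H.eq_of_eq hd hd' hj hj' hkk
    rcases hh with ⟨rfl, hh⟩ | ⟨rfl, hh⟩ | ⟨rfl, hh⟩ <;>
      rcases hh' with ⟨rfl, hh'⟩ | ⟨rfl, hh'⟩ | ⟨rfl, hh'⟩ <;>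
      simp only [Prod.mk.injEq, ab, bc, ac, ab.symm, bc.symm, ac.symm, and_false, false_and,
        or_false, false_or, true_and, and_true] at this <;> omega
  · intro e he e' he' x hx hx'
    obtain ⟨d, hd, k, hk, hh⟩ := H.exists_of_mem_cyc hab hbc hac ab bc he
    obtain ⟨d', hd', k', hk', hh'⟩ := H.exists_of_mem_cyc hab hbc hac ab bc he'
    have hs : x ∈ segment ℝ (p d k) (p d (k + 1)) := by
      rcases hh with ⟨-, rfl⟩ | ⟨-, rfl⟩
      exacts [hx, segment_symm ℝ (p d k) _ ▸ hx]
    have hs' : x ∈ segment ℝ (p d' k') (p d' (k' + 1)) := by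
      rcases hh' with ⟨-, rfl⟩ | ⟨-, rfl⟩
      exacts [hx', segment_symm ℝ (p d' k') _ ▸ hx']
    rcases H.meet d (hmem d hd) d' (hmem d' hd') k hk k' hk' x hs hs' with ⟨rfl, rfl⟩ | hend
    · left
      rcases hh with ⟨h1, rfl⟩ | ⟨h1, rfl⟩ <;> rcases hh' with ⟨h2, rfl⟩ | ⟨h2, rfl⟩ <;>
        first | rfl | exact absurd h2 h1 | exact absurd h1 h2
    · right
      rcases hh with ⟨-, rfl⟩ | ⟨-, rfl⟩ <;> rcases hh' with ⟨-, rfl⟩ | ⟨-, rfl⟩ <;> tauto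

end Triangle

section TriMap

variable {E : Type*}

theorem PLOn.vec3 [AddCommGroup E] [Module ℝ E] {S : Set E} {f g k : E → ℝ} (hf : PLOn f S)
    (hg : PLOn g S) (hk : PLOn k S) : PLOn (fun x => (![f x, g x, k x] : Fin 3 → ℝ)) S := by
  have key : ∀ (i : Fin 3) {f : E → ℝ}, PLOn f S →
      PLOn (fun x => (Pi.single i (f x) : Fin 3 → ℝ)) S := fun i f hf =>
    (PLOn.affine (LinearMap.single ℝ (fun _ : Fin 3 => ℝ) i).toAffineMap).comp (T := univ) hf
      fun _ _ => trivial
  refine (((key 0 hf).add (key 1 hg)).add (key 2 hk)).congr fun x _ => ?_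
  ext i
  fin_cases i <;> simp

theorem exists_ranked {T : Finset E} (hT : T.card = 3) {r : E → ℕ} (hr : InjOn r T) :
    ∃ a b c, r a < r b ∧ r b < r c ∧ (T : Set E) = {a, b, c} := by
  classical
  obtain ⟨a, b, c, ab, ac, bc, rfl⟩ := Finset.card_eq_three.mp hT
  have h1 : r a ≠ r b := fun h => ab (hr (by simp) (by simp) h)
  have h2 : r a ≠ r c := fun h => ac (hr (by simp) (by simp) h)
  have h3 : r b ≠ r c := fun h => bc (hr (by simp) (by simp) h)
  rcases lt_or_gt_of_ne h1 with h1 | h1 <;> rcases lt_or_gt_of_ne h2 with h2 | h2 <;>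
    rcases lt_or_gt_of_ne h3 with h3 | h3
  · exact ⟨a, b, c, h1, h3, by simp⟩
  · exact ⟨a, c, b, h2, h3, by ext; simp; tauto⟩
  · omega
  · exact ⟨c, a, b, h2, h1, by ext; simp; tauto⟩
  · exact ⟨b, a, c, h1, h2, by ext; simp; tauto⟩
  · omega
  · exact ⟨b, c, a, h3, h2, by ext; simp; tauto⟩
  · exact ⟨c, b, a, h3, h1, by ext; simp; tauto⟩

/-- `F` maps the triangle `S` with barycentric coordinates `φ` and vertices `T` onto the closed
disc bounded by the drawings of the sides of the triangle, which has interior `V`. -/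
structure IsTriMap (S : Set E) (T : Finset E) (φ : E → E → ℝ) (ed : Set (E × E))
    (p : E × E → ℕ → ℂ) (n : E × E → ℕ) (L : ℝ) (F : E → ℂ) (l : List ℂ) (V : Set ℂ) : Prop where
  lip : ∀ x ∈ S, ∀ y ∈ S, ∀ δ, (∀ z ∈ T, |φ z x - φ z y| ≤ δ) → ‖F x - F y‖ ≤ L * δ
  inj : ∀ x ∈ S, ∀ y ∈ S, F x = F y → ∀ z ∈ T, φ z x = φ z y
  cell : Cell l V
  image : ∀ x ∈ S, F x ∈ poly l ∪ V
  side : ∀ e ∈ ed, e.1 ∈ T → e.2 ∈ T → ∀ x ∈ S, (∀ z ∈ T, z ≠ e.1 → z ≠ e.2 → φ z x = 0) →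
    F x = PLN (p e) (n e * φ e.2 x)
  mem_poly : ∀ x, x ∈ poly l ↔ ∃ e ∈ ed, e.1 ∈ T ∧ e.2 ∈ T ∧
    ∃ k < n e, x ∈ segment ℝ (p e k) (p e (k + 1))
  mem_cyc : ∀ d ∈ cyc l, ∃ e ∈ ed, e.1 ∈ T ∧ e.2 ∈ T ∧
    ∃ k < n e, d = (p e k, p e (k + 1)) ∨ d = (p e (k + 1), p e k)
  mem_list : ∀ v ∈ l, ∃ e ∈ ed, e.1 ∈ T ∧ e.2 ∈ T ∧ ∃ k ≤ n e, v = p e k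
  hull : ∀ B : Set ℂ, Convex ℝ B → (∀ v ∈ l, v ∈ B) → ∀ x ∈ S, F x ∈ B

variable [NormedAddCommGroup E] [NormedSpace ℝ E] {Z : Set E} {ed : Set (E × E)}
  {h : E → ℂ} {R : ℝ} {N : ℕ} {w : E → ℂ} {p : E × E → ℕ → ℂ} {n : E × E → ℕ}

theorem IsDrawing.exists_isTriMap (H : IsDrawing Z ed h R N w p n) {T : Finset E}
    (hT : T.card = 3) {r : E → ℕ} (hr : InjOn r T)
    (hed : ∀ u ∈ T, ∀ v ∈ T, (u, v) ∈ ed ↔ r u < r v) {S : Set E} {φ : E → E → ℝ}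
    (h0 : ∀ x ∈ S, ∀ z ∈ T, 0 ≤ φ z x) (h1 : ∀ x ∈ S, ∑ z ∈ T, φ z x = 1) {B : ℝ} (hB0 : 0 ≤ B)
    (hB : ∀ e ∈ ed, ∀ k ≤ n e, ‖p e k‖ ≤ B) :
    ∃ F l V, IsTriMap S T φ ed p n (180 * (2 * N ^ 2) ^ 5 * B) F l V ∧
      ((∀ z ∈ T, PLOn (φ z) S) → PLOn F S) := by
  classical
  obtain ⟨a, b, c, hab', hbc', hTs⟩ := exists_ranked hT hr
  have hmT : ∀ z, z ∈ T ↔ z = a ∨ z = b ∨ z = c := fun z => by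
    rw [← Finset.mem_coe, hTs]; simp
  have haT : a ∈ T := by simp [hmT]
  have hbT : b ∈ T := by simp [hmT]
  have hcT : c ∈ T := by simp [hmT]
  have hab : (a, b) ∈ ed := (hed a haT b hbT).mpr hab'
  have hbc : (b, c) ∈ ed := (hed b hbT c hcT).mpr hbc'
  have hac : (a, c) ∈ ed := (hed a haT c hcT).mpr (hab'.trans hbc')
  have ab : a ≠ b := by rintro rfl; omega
  have bc : b ≠ c := by rintro rfl; omega
  have ac : a ≠ c := by rintro rfl; omega
  have hT3 : T = {a, b, c} := by ext z; simp [hmT]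
  have hmed : ∀ e, e ∈ ({(a, b), (b, c), (a, c)} : Set (E × E)) ↔ e ∈ ed ∧ e.1 ∈ T ∧ e.2 ∈ T := by
    rintro ⟨u, v⟩
    constructor
    · rintro (h | h | h) <;> rw [h]
      exacts [⟨hab, haT, hbT⟩, ⟨hbc, hbT, hcT⟩, ⟨hac, haT, hcT⟩]
    · rintro ⟨h, hu, hv⟩
      have hlt := (hed u hu v hv).mp h
      rcases (hmT u).mp hu with rfl | rfl | rfl <;> rcases (hmT v).mp hv with rfl | rfl | rfl <;>
        first | omega | simp
  have p1 := H.pos _ hab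
  have p2 := H.pos _ hbc
  have p3 := H.pos _ hac
  obtain ⟨G, V, hG⟩ := exists_isCellMap (n := n (a, b)) (a := n (a, b) + n (b, c)) (c := n (a, c))
    (R := B) p1 (by omega) p3 (H.cat_start hab hac) (H.cat_finish hab hbc hac)
    (H.simplePoly hab hbc hac ab bc ac) (by
      intro k hk
      rcases le_total k (n (a, b)) with hk' | hk'
      · rw [cat_of_le hk']
        exact hB _ hab _ hk'
      · obtain ⟨j, rfl⟩ := Nat.exists_eq_add_of_le hk'
        rw [cat_add (H.cat_join hab hbc)]
        exact hB _ hbc _ (by omega)) (fun j hj => hB _ hac _ hj)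
  have hS : ∀ x ∈ S, (![φ a x, φ b x, φ c x] : Fin 3 → ℝ) ∈ stdSimplex ℝ (Fin 3) := by
    intro x hx
    refine ⟨?_, ?_⟩
    · intro i
      fin_cases i
      exacts [h0 x hx a haT, h0 x hx b hbT, h0 x hx c hcT]
    · have := h1 x hx
      rw [hT3, Finset.sum_insert (by simp [ab, ac]), Finset.sum_insert (by simp [bc]),
        Finset.sum_singleton] at this
      rw [Fin.sum_univ_three]
      simp [← this, add_assoc]
  have hle : ∀ x ∈ S, ∀ z ∈ T, φ z x ≤ 1 := by
    intro x hx z hz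
    rw [← h1 x hx]
    exact Finset.single_le_sum (f := fun z => φ z x) (h0 x hx) hz
  refine ⟨fun x => G ![φ a x, φ b x, φ c x], triList p n a b c, V, ⟨?_, ?_, hG.cell, ?_, ?_, ?_,
    ?_, ?_, ?_⟩, ?_⟩
  · intro x hx y hy δ hδ
    have hδ0 : 0 ≤ δ := (abs_nonneg _).trans (hδ a haT)
    refine (hG.lip _ (hS x hx) _ (hS y hy)).trans ?_
    have : ‖(![φ a x, φ b x, φ c x] : Fin 3 → ℝ) - ![φ a y, φ b y, φ c y]‖ ≤ δ := by
      rw [pi_norm_le_iff_of_nonneg hδ0]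
      intro i
      fin_cases i
      exacts [hδ a haT, hδ b hbT, hδ c hcT]
    have hn : ((n (a, b) + n (b, c) : ℕ) * n (a, c) : ℝ) ≤ 2 * N ^ 2 := by
      have e1 := H.le _ hab
      have e2 := H.le _ hbc
      have e3 := H.le _ hac
      have : (n (a, b) + n (b, c)) * n (a, c) ≤ (2 * N) * N :=
        Nat.mul_le_mul (by omega) e3
      calc ((n (a, b) + n (b, c) : ℕ) * n (a, c) : ℝ) ≤ (2 * N) * N := by exact_mod_cast this
        _ = _ := by ring
    refine mul_le_mul ?_ this (norm_nonneg _) (by positivity)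
    gcongr
  · intro x hx y hy hxy z hz
    have := hG.inj (hS x hx) (hS y hy) hxy
    rcases (hmT z).mp hz with rfl | rfl | rfl
    exacts [congrFun this 0, congrFun this 1, congrFun this 2]
  · exact fun x hx => hG.image _ (hS x hx)
  · intro e he h1' h2' x hx hz
    rcases (hmed e).mpr ⟨he, h1', h2'⟩ with rfl | rfl | rfl
    · have hb1 := hle x hx b hbT
      have hb0 := h0 x hx b hbT
      refine (hG.side_left _ (hS x hx) (hz c hcT ac.symm bc.symm)).trans ?_
      refine PLN_cat_left p1 (mul_nonneg (Nat.cast_nonneg _) hb0) ?_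
      exact mul_le_of_le_one_right (Nat.cast_nonneg _) hb1
    · have hb1 := hle x hx c hcT
      have hb0 := h0 x hx c hcT
      refine (hG.side_right _ (hS x hx) (hz a haT ab ac)).trans ?_
      rw [← PLN_cat_right (H.cat_join hab hbc) p2 (mul_nonneg (Nat.cast_nonneg _) hb0)
        (mul_le_of_le_one_right (Nat.cast_nonneg _) hb1)]
      push_cast
      rw [add_sub_cancel_left]
    · exact hG.side_long _ (hS x hx) (hz b hbT ab.symm bc)
  · intro x
    rw [poly, Set.mem_ofPred_eq]
    constructor
    · rintro ⟨d, hd, hx⟩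
      obtain ⟨e, he, k, hk, hh⟩ := H.exists_of_mem_cyc hab hbc hac ab bc hd
      obtain ⟨he, he1, he2⟩ := (hmed e).mp he
      refine ⟨e, he, he1, he2, k, hk, ?_⟩
      rcases hh with ⟨-, rfl⟩ | ⟨-, rfl⟩
      exacts [hx, segment_symm ℝ (p e k) _ ▸ hx]
    · rintro ⟨e, he, he1, he2, k, hk, hx⟩
      rcases (hmed e).mpr ⟨he, he1, he2⟩ with rfl | rfl | rfl
      · exact ⟨_, (H.mem_cyc_triList hab hbc hac).mpr (Or.inl ⟨k, hk, rfl⟩), hx⟩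
      · exact ⟨_, (H.mem_cyc_triList hab hbc hac).mpr (Or.inr (Or.inl ⟨k, hk, rfl⟩)), hx⟩
      · exact ⟨_, (H.mem_cyc_triList hab hbc hac).mpr (Or.inr (Or.inr ⟨k, hk, rfl⟩)),
          segment_symm ℝ (p (a, c) k) _ ▸ hx⟩
  · intro d hd
    obtain ⟨e, he, k, hk, hh⟩ := H.exists_of_mem_cyc hab hbc hac ab bc hd
    obtain ⟨he, he1, he2⟩ := (hmed e).mp he
    exact ⟨e, he, he1, he2, k, hk, hh.imp And.right And.right⟩
  · intro v hv
    obtain ⟨e, he, k, hk, hh⟩ := H.mem_triList hab hbc hv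
    obtain ⟨he, he1, he2⟩ := (hmed e).mp he
    exact ⟨e, he, he1, he2, k, hk, hh⟩
  · exact fun B hB hl x hx => hG.hull B hB hl _ (hS x hx)
  · intro hφ
    exact hG.pl.comp (PLOn.vec3 (hφ a haT) (hφ b hbT) (hφ c hcT)) hS

end TriMap

theorem dist_le_of_mem_segment {F : Type*} [NormedAddCommGroup F] [NormedSpace ℝ F] {a b x : F}
    (h : x ∈ segment ℝ a b) : ‖x - a‖ ≤ ‖b - a‖ := by
  obtain ⟨τ, t0, t1, rfl⟩ := segment_param h
  rw [add_sub_cancel_left, norm_smul, Real.norm_of_nonneg t0]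
  exact mul_le_of_le_one_left (norm_nonneg _) t1

/-- A closed polygon following the image of a convex set which is far away from `x` and small
compared with this distance does not wind around `x`. -/
theorem wind_eq_zero_of_shadow {E : Type*} [NormedAddCommGroup E] [NormedSpace ℝ E] {K : Set E}
    (hK : Convex ℝ K) (hne : K.Nonempty) {h : E → ℂ} (hc : ContinuousOn h K) {l : List ℂ} {x : ℂ}
    {R : ℝ} (hR : 0 ≤ R) (hl : ∀ v ∈ l, ∃ t ∈ K, ‖v - h t‖ ≤ 4)
    (hstep : ∀ d ∈ cyc l, ‖d.2 - d.1‖ ≤ 2 * R)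
    (hfar : ∀ t ∈ K, 2 * R + 12 < ‖h t - x‖)
    (hsmall : ∀ t ∈ K, ∀ t' ∈ K, ‖h t - h t'‖ ≤ 2 * R + 8 → ∀ s ∈ K, ∀ s' ∈ K,
      ‖s - s'‖ ≤ ‖t - t'‖ → ‖h s - h s'‖ < ‖h s - x‖) : wind l x = 0 := by
  obtain ⟨c, hcK⟩ := hne
  choose! τ hτK hτ using hl
  have hdist : ∀ d ∈ cyc l, ‖h (τ d.1) - h (τ d.2)‖ ≤ 2 * R + 8 := by
    intro d hd
    have h1 := hτ _ (mem_of_mem_cyc hd).1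
    have h2 := hτ _ (mem_of_mem_cyc hd).2
    have h3 := hstep d hd
    have : h (τ d.1) - h (τ d.2) = -(d.1 - h (τ d.1)) + (d.2 - h (τ d.2)) - (d.2 - d.1) := by ring
    rw [this]
    refine (norm_sub_le _ _).trans ?_
    have := norm_add_le (-(d.1 - h (τ d.1))) (d.2 - h (τ d.2))
    rw [norm_neg] at this
    linarith
  have h01 : IsPreconnected (Icc (0 : ℝ) 1) := isPreconnected_Icc
  have stage1 := wind_homotopy h01 (l.map fun v s => v + (s : ℂ) * (h (τ v) - v)) (fun _ => x)
    (by
      intro γ hγ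
      obtain ⟨v, -, rfl⟩ := List.mem_map.mp hγ
      fun_prop)
    continuousOn_const (by
      intro s hs e he hxe
      rw [cyc_map, List.mem_map] at he
      obtain ⟨d, hd, rfl⟩ := he
      have h1 := hτ _ (mem_of_mem_cyc hd).1
      have h2 := hdist d hd
      have h3 := hstep d hd
      have h4 := hfar _ (hτK _ (mem_of_mem_cyc hd).1)
      have h5 := dist_le_of_mem_segment hxe
      simp only [Prod.map_fst, Prod.map_snd] at h5
      have e1 : d.2 + (s : ℂ) * (h (τ d.2) - d.2) - (d.1 + (s : ℂ) * (h (τ d.1) - d.1)) =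
          ((1 - s : ℝ) : ℂ) * (d.2 - d.1) + (s : ℂ) * (h (τ d.2) - h (τ d.1)) := by
        push_cast; ring
      have e2 : h (τ d.1) - x = ((1 - s : ℝ) : ℂ) * (h (τ d.1) - d.1)
          - (x - (d.1 + (s : ℂ) * (h (τ d.1) - d.1))) := by push_cast; ring
      rw [e1] at h5
      have h6 := norm_add_le (((1 - s : ℝ) : ℂ) * (d.2 - d.1))
        ((s : ℂ) * (h (τ d.2) - h (τ d.1)))
      rw [norm_mul, norm_mul, Complex.norm_of_nonneg (by linarith [hs.2]),
        Complex.norm_of_nonneg hs.1, norm_sub_rev (h (τ d.2))] at h6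
      have h7 := norm_sub_le (((1 - s : ℝ) : ℂ) * (h (τ d.1) - d.1))
        (x - (d.1 + (s : ℂ) * (h (τ d.1) - d.1)))
      rw [← e2, norm_mul, Complex.norm_of_nonneg (by linarith [hs.2]), norm_sub_rev] at h7
      have hs0 := hs.1
      have hs1 := hs.2
      rw [norm_sub_rev] at h1
      have i1 : (1 - s) * ‖h (τ d.1) - d.1‖ ≤ 4 := by
        nlinarith [norm_nonneg (h (τ d.1) - d.1)]
      have i2 : (1 - s) * ‖d.2 - d.1‖ + s * ‖h (τ d.1) - h (τ d.2)‖ ≤ 2 * R + 8 := by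
        nlinarith [norm_nonneg (d.2 - d.1)]
      rw [norm_sub_rev x (h (τ d.1))] at h7
      linarith) (s := 0) (t := 1) ⟨le_rfl, zero_le_one⟩ ⟨zero_le_one, le_rfl⟩
  have stage2 := wind_homotopy h01 (l.map fun v s => h (τ v + s • (c - τ v))) (fun _ => x)
    (by
      intro γ hγ
      obtain ⟨v, hv, rfl⟩ := List.mem_map.mp hγ
      refine hc.comp (by fun_prop) fun s hs => ?_
      exact hK.add_smul_sub_mem (hτK v hv) hcK hs)
    continuousOn_const (by
      intro s hs e he hxe
      rw [cyc_map, List.mem_map] at he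
      obtain ⟨d, hd, rfl⟩ := he
      have k1 := hτK _ (mem_of_mem_cyc hd).1
      have k2 := hτK _ (mem_of_mem_cyc hd).2
      have h5 := dist_le_of_mem_segment hxe
      simp only [Prod.map_fst, Prod.map_snd] at h5
      have := hsmall _ k1 _ k2 (hdist d hd) _ (hK.add_smul_sub_mem k1 hcK hs) _
        (hK.add_smul_sub_mem k2 hcK hs) (by
          have : τ d.1 + s • (c - τ d.1) - (τ d.2 + s • (c - τ d.2)) =
              (1 - s) • (τ d.1 - τ d.2) := by module
          rw [this, norm_smul, Real.norm_of_nonneg (by linarith [hs.2])]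
          exact mul_le_of_le_one_left (norm_nonneg _) (by linarith [hs.1]))
      rw [norm_sub_rev, norm_sub_rev _ x] at this
      linarith) (s := 0) (t := 1) ⟨le_rfl, zero_le_one⟩ ⟨zero_le_one, le_rfl⟩
  have hend : wind (l.map fun _ => h c) x = 0 := by
    refine wind_eq_zero_of_halfPlane (c := (starRingEnd ℂ) (h c - x)) ?_
    intro q hq
    obtain ⟨v, -, rfl⟩ := List.mem_map.mp hq
    rw [Complex.mul_conj, Complex.ofReal_re, Complex.normSq_pos]
    intro h0
    have := hfar c hcK
    rw [h0, norm_zero] at this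
    linarith
  simp only [List.map_map, Function.comp_def] at stage1 stage2
  simp only [Complex.ofReal_zero, zero_mul, add_zero, Complex.ofReal_one, one_mul,
    add_sub_cancel, List.map_id'] at stage1
  simp only [zero_smul, add_zero, one_smul, add_sub_cancel] at stage2
  rw [stage1, stage2, hend]

/-- The winding number is constant along a broken line which meets the polygon at most in its
last point. -/
theorem wind_eq_of_brokenLine {l : List ℂ} {q : ℕ → ℂ} {n : ℕ} (h0 : ∀ k < n, q k ∉ poly l)
    (h1 : ∀ k < n, ∀ y ∈ segment ℝ (q k) (q (k + 1)), y ∈ poly l → y = q (k + 1)) {k : ℕ}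
    (hk : k < n) {x : ℂ} (hx : x ∈ segment ℝ (q k) (q (k + 1))) (hxl : x ∉ poly l) :
    wind l x = wind l (q 0) := by
  have key : ∀ k < n, wind l (q k) = wind l (q 0) := by
    intro k
    induction k with
    | zero => exact fun _ => rfl
    | succ k ih =>
      intro hk
      rw [← ih (by omega)]
      refine wind_const (convex_segment (q k) (q (k + 1))).isPreconnected ?_
        (right_mem_segment ℝ _ _) (left_mem_segment ℝ _ _)
      rw [Set.disjoint_left]
      intro y hy hyl
      exact h0 _ hk (h1 k (by omega) y hy hyl ▸ hyl)
  rw [← key k hk]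
  refine wind_const (convex_segment (q k) x).isPreconnected ?_
    (right_mem_segment ℝ _ _) (left_mem_segment ℝ _ _)
  rw [Set.disjoint_left]
  intro y hy hyl
  have hy' := h1 k hk y ((convex_segment _ _).segment_subset (left_mem_segment ℝ _ _) hx hy) hyl
  subst hy'
  exact hxl (eq_of_mem_segment_of_mem_segment hx hy ▸ hyl)

section Fine

variable {E : Type*} [NormedAddCommGroup E] [NormedSpace ℝ E]

/-- The set of vertices of a family of triangles. -/
def verts (𝒯 : Set (Finset E)) : Set E := {z | ∃ T ∈ 𝒯, z ∈ T}

/-- The set of edges of a family of triangles, oriented by the rank `r` of the vertices. -/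
def edges (r : E → ℕ) (𝒯 : Set (Finset E)) : Set (E × E) :=
  {e | r e.1 < r e.2 ∧ ∃ T ∈ 𝒯, e.1 ∈ T ∧ e.2 ∈ T}

/-- A triangulation of `Ω` at scale `1 / m`, given by its set of triangles and its barycentric
coordinates, with shape constant `C`. -/
structure IsFine (Ω : Set E) (C m : ℝ) (𝒯 : Set (Finset E)) (φ : E → E → ℝ) : Prop where
  finite : 𝒯.Finite
  card : ∀ T ∈ 𝒯, T.card = 3
  cover : ∀ x, x ∈ Ω ↔ ∃ T ∈ 𝒯, x ∈ convexHull ℝ (T : Set E)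
  coord : ∀ T ∈ 𝒯, ∀ b : E → ℝ, (∀ z ∈ T, 0 ≤ b z) → ∑ z ∈ T, b z = 1 →
    ∀ z ∈ T, φ z (∑ z ∈ T, b z • z) = b z
  coord_zero : ∀ T ∈ 𝒯, ∀ x ∈ convexHull ℝ (T : Set E), ∀ z ∈ verts 𝒯, z ∉ T → φ z x = 0
  lip : ∀ z ∈ verts 𝒯, ∀ x ∈ Ω, ∀ y ∈ Ω, |φ z x - φ z y| ≤ C * m * ‖x - y‖
  diam : ∀ T ∈ 𝒯, ∀ x ∈ convexHull ℝ (T : Set E), ∀ y ∈ convexHull ℝ (T : Set E), ‖x - y‖ ≤ C / m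
  pl : ∀ z ∈ verts 𝒯, PLOn (φ z) Ω

variable {Ω : Set E} {C m : ℝ} {𝒯 : Set (Finset E)} {φ : E → E → ℝ} {T T' : Finset E}

theorem IsFine.mem (h : IsFine Ω C m 𝒯 φ) (hT : T ∈ 𝒯) {x : E}
    (hx : x ∈ convexHull ℝ (T : Set E)) : x ∈ Ω := (h.cover x).mpr ⟨T, hT, hx⟩

theorem IsFine.bary (h : IsFine Ω C m 𝒯 φ) (hT : T ∈ 𝒯) {x : E}
    (hx : x ∈ convexHull ℝ (T : Set E)) :
    (∀ z ∈ T, 0 ≤ φ z x) ∧ ∑ z ∈ T, φ z x = 1 ∧ ∑ z ∈ T, φ z x • z = x := by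
  obtain ⟨b, h0, h1, rfl⟩ := Finset.mem_convexHull'.mp hx
  have := h.coord T hT b h0 h1
  refine ⟨fun z hz => (this z hz).symm ▸ h0 z hz, (Finset.sum_congr rfl this).trans h1,
    Finset.sum_congr rfl fun z hz => by rw [this z hz]⟩

theorem IsFine.ext (h : IsFine Ω C m 𝒯 φ) (hT : T ∈ 𝒯) {x y : E}
    (hx : x ∈ convexHull ℝ (T : Set E)) (hy : y ∈ convexHull ℝ (T : Set E))
    (hxy : ∀ z ∈ T, φ z x = φ z y) : x = y := by
  rw [← (h.bary hT hx).2.2, ← (h.bary hT hy).2.2]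
  exact Finset.sum_congr rfl fun z hz => by rw [hxy z hz]

theorem IsFine.coord_lineMap (h : IsFine Ω C m 𝒯 φ) (hT : T ∈ 𝒯) {x y : E}
    (hx : x ∈ convexHull ℝ (T : Set E)) (hy : y ∈ convexHull ℝ (T : Set E)) {τ : ℝ} (h0 : 0 ≤ τ)
    (h1 : τ ≤ 1) {z : E} (hz : z ∈ verts 𝒯) :
    φ z (x + τ • (y - x)) = φ z x + τ * (φ z y - φ z x) := by
  by_cases hzT : z ∈ T
  · obtain ⟨a1, a2, a3⟩ := h.bary hT hx
    obtain ⟨b1, b2, b3⟩ := h.bary hT hy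
    have : x + τ • (y - x) = ∑ z ∈ T, (φ z x + τ * (φ z y - φ z x)) • z := by
      simp only [add_smul, mul_smul, sub_smul, Finset.sum_add_distrib, ← Finset.smul_sum,
        Finset.sum_sub_distrib, a3, b3]
    rw [this]
    refine h.coord T hT (fun z => φ z x + τ * (φ z y - φ z x)) (fun z hz => ?_) ?_ z hzT
    · have := mul_nonneg h0 (b1 z hz)
      have := mul_nonneg (sub_nonneg.mpr h1) (a1 z hz)
      linarith
    · rw [Finset.sum_add_distrib, ← Finset.mul_sum, Finset.sum_sub_distrib, a2, b2]
      ring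
  · rw [h.coord_zero T hT _ hx z hz hzT, h.coord_zero T hT _ hy z hz hzT,
      h.coord_zero T hT _ ((convex_convexHull ℝ _).add_smul_sub_mem hx hy ⟨h0, h1⟩) z hz hzT]
    ring

theorem IsFine.coord_self (h : IsFine Ω C m 𝒯 φ) {z : E} (hz : z ∈ verts 𝒯) : φ z z = 1 := by
  classical
  obtain ⟨T, hT, hzT⟩ := hz
  have := h.coord T hT (fun v => if v = z then 1 else 0) (fun v _ => by split_ifs <;> simp)
    (by simp [hzT]) z hzT
  simpa [hzT] using this

theorem IsFine.coord_of_ne (h : IsFine Ω C m 𝒯 φ) {u z : E} (hu : u ∈ verts 𝒯) (hz : z ∈ verts 𝒯)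
    (huz : u ≠ z) : φ z u = 0 := by
  classical
  obtain ⟨T, hT, huT⟩ := hu
  by_cases hzT : z ∈ T
  · have := h.coord T hT (fun v => if v = u then 1 else 0) (fun v _ => by split_ifs <;> simp)
      (by simp [huT]) z hzT
    simpa [huT, huz.symm] using this
  · exact h.coord_zero T hT u (subset_convexHull ℝ _ huT) z hz hzT

theorem IsFine.coord_segment (h : IsFine Ω C m 𝒯 φ) (hT : T ∈ 𝒯) {u v : E} (hu : u ∈ T)
    (hv : v ∈ T) (huv : u ≠ v) {τ : ℝ} (h0 : 0 ≤ τ) (h1 : τ ≤ 1) :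
    φ v (u + τ • (v - u)) = τ ∧ φ u (u + τ • (v - u)) = 1 - τ ∧
      ∀ z ∈ verts 𝒯, z ≠ u → z ≠ v → φ z (u + τ • (v - u)) = 0 := by
  have hu' : u ∈ verts 𝒯 := ⟨T, hT, hu⟩
  have hv' : v ∈ verts 𝒯 := ⟨T, hT, hv⟩
  have key := fun {z} (hz : z ∈ verts 𝒯) => h.coord_lineMap hT (subset_convexHull ℝ _ hu)
    (subset_convexHull ℝ _ hv) h0 h1 hz
  refine ⟨?_, ?_, fun z hz zu zv => ?_⟩
  · rw [key hv', h.coord_self hv', h.coord_of_ne hu' hv' huv]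
    ring
  · rw [key hu', h.coord_self hu', h.coord_of_ne hv' hu' huv.symm]
    ring
  · rw [key hz, h.coord_of_ne hu' hz zu.symm, h.coord_of_ne hv' hz zv.symm]
    ring

/-- If two triangles of a triangulation have a common vertex, then a point of the first one can be
moved to the second one at the cost of its coordinates outside. -/
theorem IsFine.exists_common (h : IsFine Ω C m 𝒯 φ) (hT : T ∈ 𝒯) {z₀ : E}
    (hz : z₀ ∈ T) (hz' : z₀ ∈ T') {x : E} (hx : x ∈ convexHull ℝ (T : Set E)) {δ : ℝ}
    (hδ : ∀ z ∈ T, z ∉ T' → φ z x ≤ δ) (hδ0 : 0 ≤ δ) :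
    ∃ y ∈ convexHull ℝ (T : Set E), y ∈ convexHull ℝ (T' : Set E) ∧
      ∀ z ∈ verts 𝒯, |φ z x - φ z y| ≤ 3 * δ := by
  classical
  obtain ⟨a0, a1, -⟩ := h.bary hT hx
  set σ := ∑ z ∈ T \ T', φ z x with hσ
  have hσ0 : 0 ≤ σ := Finset.sum_nonneg fun z hz => a0 z (Finset.mem_sdiff.mp hz).1
  have hσδ : σ ≤ 3 * δ := by
    have hc : ((T \ T').card : ℝ) ≤ 3 := by
      have := Finset.card_le_card (Finset.sdiff_subset (s := T) (t := T'))
      rw [h.card T hT] at this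
      exact_mod_cast this
    calc σ ≤ (T \ T').card • δ := Finset.sum_le_card_nsmul _ _ _ fun z hz =>
          hδ z (Finset.mem_sdiff.mp hz).1 (Finset.mem_sdiff.mp hz).2
      _ = (T \ T').card * δ := nsmul_eq_mul _ _
      _ ≤ 3 * δ := by gcongr
  set b : E → ℝ := fun z => if z ∈ T ∩ T' then φ z x + (if z = z₀ then σ else 0) else 0 with hb
  have hbn : ∀ z, 0 ≤ b z := by
    intro z
    rw [hb]
    dsimp only
    split_ifs with h1 h2
    · have := a0 z (Finset.mem_inter.mp h1).1
      linarith
    · have := a0 z (Finset.mem_inter.mp h1).1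
      linarith
    · exact le_rfl
  have hb1 : ∑ z ∈ T ∩ T', b z = 1 := by
    rw [Finset.sum_congr rfl (g := fun z => φ z x + (if z = z₀ then σ else 0))
      fun z hz => if_pos hz,
      Finset.sum_add_distrib, Finset.sum_ite_eq', if_pos (Finset.mem_inter.mpr ⟨hz, hz'⟩), hσ, ← a1]
    exact Finset.sum_inter_add_sum_sdiff T T' fun z => φ z x
  have hbT : ∑ z ∈ T, b z = 1 := by
    rw [← hb1]
    exact (Finset.sum_subset Finset.inter_subset_left fun z _ hz => if_neg hz).symm
  have hbT' : ∑ z ∈ T', b z = 1 := by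
    rw [← hb1]
    exact (Finset.sum_subset Finset.inter_subset_right fun z _ hz => if_neg hz).symm
  have hsum : ∑ z ∈ T, b z • z = ∑ z ∈ T', b z • z := by
    rw [← Finset.sum_subset Finset.inter_subset_left (s₁ := T ∩ T') fun z _ hz => by
        rw [hb]; simp only [if_neg hz, zero_smul],
      ← Finset.sum_subset Finset.inter_subset_right (s₁ := T ∩ T') fun z _ hz => by
        rw [hb]; simp only [if_neg hz, zero_smul]]
  refine ⟨∑ z ∈ T, b z • z, Finset.mem_convexHull'.mpr ⟨b, fun z _ => hbn z, hbT, rfl⟩,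
    Finset.mem_convexHull'.mpr ⟨b, fun z _ => hbn z, hbT', hsum.symm⟩, fun z hzv => ?_⟩
  by_cases hzT : z ∈ T
  · rw [h.coord T hT b (fun z _ => hbn z) hbT z hzT, hb]
    dsimp only
    split_ifs with h1 h2
    · rw [sub_add_cancel_left, abs_neg, abs_of_nonneg hσ0]
      exact hσδ
    · rw [add_zero, sub_self, abs_zero]
      linarith
    · rw [sub_zero, abs_of_nonneg (a0 z hzT)]
      have := hδ z hzT fun h' => h1 (Finset.mem_inter.mpr ⟨hzT, h'⟩)
      linarith
  · rw [h.coord_zero T hT x hx z hzv hzT, h.coord_zero T hT _ (Finset.mem_convexHull'.mpr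
      ⟨b, fun z _ => hbn z, hbT, rfl⟩) z hzv hzT, sub_self, abs_zero]
    linarith

end Fine

section Assembly

variable {E : Type*} [NormedAddCommGroup E] [NormedSpace ℝ E] {Ω : Set E} {C m : ℝ}
  {𝒯 : Set (Finset E)} {φ : E → E → ℝ} {T T' : Finset E} {r : E → ℕ} {h : E → ℂ} {R : ℝ} {N : ℕ}
  {w : E → ℂ} {p : E × E → ℕ → ℂ} {n : E × E → ℕ} {L : ℝ} {F : Finset E → E → ℂ}
  {l : Finset E → List ℂ} {V : Finset E → Set ℂ}

omit [NormedAddCommGroup E] [NormedSpace ℝ E] in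
theorem edges_verts {e : E × E} (he : e ∈ edges r 𝒯) :
    e.1 ∈ verts 𝒯 ∧ e.2 ∈ verts 𝒯 ∧ e.1 ≠ e.2 := by
  obtain ⟨h1, T, hT, h2, h3⟩ := he
  exact ⟨⟨T, hT, h2⟩, ⟨T, hT, h3⟩, fun h => by rw [h] at h1; omega⟩

omit [NormedAddCommGroup E] [NormedSpace ℝ E] in
theorem exists_edge (hr : InjOn r (verts 𝒯)) (hT : T ∈ 𝒯) {u v : E} (hu : u ∈ T) (hv : v ∈ T)
    (huv : u ≠ v) : (u, v) ∈ edges r 𝒯 ∨ (v, u) ∈ edges r 𝒯 := by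
  rcases lt_trichotomy (r u) (r v) with h | h | h
  · exact Or.inl ⟨h, T, hT, hu, hv⟩
  · exact absurd (hr ⟨T, hT, hu⟩ ⟨T, hT, hv⟩ h) huv
  · exact Or.inr ⟨h, T, hT, hv, hu⟩

theorem IsFine.exists_edge_at (hF : IsFine Ω C m 𝒯 φ) (hr : InjOn r (verts 𝒯)) (hT : T ∈ 𝒯) {u : E}
    (hu : u ∈ T) : ∃ e ∈ edges r 𝒯, e.1 ∈ T ∧ e.2 ∈ T ∧ (u = e.1 ∨ u = e.2) := by
  obtain ⟨v, hv, hvu⟩ := Finset.exists_mem_ne (by rw [hF.card T hT]; norm_num) u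
  rcases exists_edge hr hT hu hv hvu.symm with h | h
  exacts [⟨_, h, hu, hv, Or.inl rfl⟩, ⟨_, h, hv, hu, Or.inr rfl⟩]

theorem IsDrawing.vert_segment (hD : IsDrawing (verts 𝒯) (edges r 𝒯) h R N w p n) {u : E}
    (hu : u ∈ verts 𝒯) {d : E × E} (hd : d ∈ edges r 𝒯) (hud : u = d.1 ∨ u = d.2) {e : E × E}
    (he : e ∈ edges r 𝒯) {k : ℕ} (hk : k < n e)
    (hx : w u ∈ segment ℝ (p e k) (p e (k + 1))) : u = e.1 ∨ u = e.2 := by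
  have hend : w u = p e k ∨ w u = p e (k + 1) := by
    have hpos := hD.pos d hd
    rcases hud with rfl | rfl
    · have hs := hD.start d hd
      rcases hD.meet d hd e he 0 hpos k hk (w d.1) (hs ▸ left_mem_segment ℝ _ _) hx with
        ⟨rfl, rfl⟩ | ⟨-, hh⟩
      exacts [Or.inl hs.symm, hh]
    · have hs := hD.finish d hd
      obtain ⟨j, hj⟩ : ∃ j, n d = j + 1 := ⟨n d - 1, by omega⟩
      rw [hj] at hs
      rcases hD.meet d hd e he j (by omega) k hk (w d.2) (hs ▸ right_mem_segment ℝ _ _) hx with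
        ⟨rfl, rfl⟩ | ⟨-, hh⟩
      exacts [Or.inr hs.symm, hh]
  rcases hend with hh | hh
  · rcases hD.vert e he k hk.le u hu hh.symm with h1 | h1
    exacts [Or.inl h1.2, Or.inr h1.2]
  · rcases hD.vert e he (k + 1) hk u hu hh.symm with h1 | h1
    exacts [Or.inl h1.2, Or.inr h1.2]

/-- Compatible triangle maps over a plane drawing of a triangulation, whose boundary curves do not
wind around the other vertices. -/
structure IsMapSystem (Ω : Set E) (C m : ℝ) (𝒯 : Set (Finset E)) (φ : E → E → ℝ) (r : E → ℕ)
    (h : E → ℂ) (R : ℝ) (N : ℕ) (w : E → ℂ) (p : E × E → ℕ → ℂ) (n : E × E → ℕ) (L : ℝ)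
    (F : Finset E → E → ℂ) (l : Finset E → List ℂ) (V : Finset E → Set ℂ) : Prop where
  fine : IsFine Ω C m 𝒯 φ
  rank : InjOn r (verts 𝒯)
  draw : IsDrawing (verts 𝒯) (edges r 𝒯) h R N w p n
  map : ∀ T ∈ 𝒯, IsTriMap (convexHull ℝ (T : Set E)) T φ (edges r 𝒯) p n L (F T) (l T) (V T)
  wind : ∀ T ∈ 𝒯, ∀ u ∈ verts 𝒯, u ∉ T → wind (l T) (w u) = 0

theorem IsMapSystem.eq_pt (S : IsMapSystem Ω C m 𝒯 φ r h R N w p n L F l V) (hT : T ∈ 𝒯)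
    {e : E × E} (he : e ∈ edges r 𝒯) (h1 : e.1 ∈ T) (h2 : e.2 ∈ T) {s : ℝ} (hs0 : 0 ≤ s)
    (hs1 : s ≤ n e) {x : E} (hx : x ∈ convexHull ℝ (T : Set E)) (hFx : F T x = PLN (p e) s) :
    x = e.1 + (s / n e) • (e.2 - e.1) := by
  have hn : (0 : ℝ) < n e := by exact_mod_cast S.draw.pos e he
  have t0 : 0 ≤ s / n e := by positivity
  have t1 : s / n e ≤ 1 := by rwa [div_le_one hn]
  have hmem : e.1 + (s / n e) • (e.2 - e.1) ∈ convexHull ℝ (T : Set E) :=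
    (convex_convexHull ℝ _).add_smul_sub_mem (subset_convexHull ℝ _ h1) (subset_convexHull ℝ _ h2)
      ⟨t0, t1⟩
  obtain ⟨c1, -, c3⟩ := S.fine.coord_segment hT h1 h2 (edges_verts he).2.2 t0 t1
  refine S.fine.ext hT hx hmem ((S.map T hT).inj x hx _ hmem ?_)
  rw [hFx, (S.map T hT).side e he h1 h2 _ hmem fun z hz => c3 z ⟨T, hT, hz⟩, c1]
  congr 1
  field_simp

theorem IsMapSystem.map_vert (S : IsMapSystem Ω C m 𝒯 φ r h R N w p n L F l V) (hT : T ∈ 𝒯)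
    {u : E} (hu : u ∈ T) : F T u = w u := by
  obtain ⟨e, he, h1, h2, hue⟩ := S.fine.exists_edge_at S.rank hT hu
  obtain ⟨v1, v2, hne⟩ := edges_verts he
  have hu' : u ∈ verts 𝒯 := ⟨T, hT, hu⟩
  rw [(S.map T hT).side e he h1 h2 u (subset_convexHull ℝ _ hu) fun z hz hz1 hz2 =>
    S.fine.coord_of_ne hu' ⟨T, hT, hz⟩ (by rcases hue with rfl | rfl; exacts [hz1.symm, hz2.symm])]
  rcases hue with rfl | rfl
  · rw [S.fine.coord_of_ne hu' v2 hne, mul_zero, ← S.draw.start e he]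
    exact_mod_cast PLN_natCast (p e) 0
  · rw [S.fine.coord_self hu', mul_one, PLN_natCast, S.draw.finish e he]

theorem IsMapSystem.eq_of_pt (S : IsMapSystem Ω C m 𝒯 φ r h R N w p n L F l V) (hT : T ∈ 𝒯)
    {u : E} (hu : u ∈ T) {x : E} (hx : x ∈ convexHull ℝ (T : Set E)) (hFx : F T x = w u) : x = u :=
  S.fine.ext hT hx (subset_convexHull ℝ _ hu) ((S.map T hT).inj x hx u (subset_convexHull ℝ _ hu)
    (hFx.trans (S.map_vert hT hu).symm))

/-- The two maps of triangles with a common point agree there. -/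
theorem IsMapSystem.compat (S : IsMapSystem Ω C m 𝒯 φ r h R N w p n L F l V) (hT : T ∈ 𝒯)
    (hT' : T' ∈ 𝒯) {x : E} (hx : x ∈ convexHull ℝ (T : Set E))
    (hx' : x ∈ convexHull ℝ (T' : Set E)) : F T x = F T' x := by
  classical
  by_cases hTT : T = T'
  · rw [hTT]
  have hs : ∀ z ∈ verts 𝒯, z ∉ T ∩ T' → φ z x = 0 := by
    intro z hz hzT
    rw [Finset.mem_inter, not_and_or] at hzT
    rcases hzT with hh | hh
    exacts [S.fine.coord_zero T hT x hx z hz hh, S.fine.coord_zero T' hT' x hx' z hz hh]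
  have hc : (T ∩ T').card < 3 := by
    by_contra! hc
    have h1 := Finset.eq_of_subset_of_card_le (Finset.inter_subset_left (s₁ := T) (s₂ := T'))
      (by rwa [S.fine.card T hT])
    have h2 := Finset.eq_of_subset_of_card_le (Finset.inter_subset_right (s₁ := T) (s₂ := T'))
      (by rwa [S.fine.card T' hT'])
    exact hTT (h1.symm.trans h2)
  obtain ⟨b0, b1, b2⟩ := S.fine.bary hT hx
  have hsum : ∑ z ∈ T ∩ T', φ z x = 1 := by
    rw [← b1]
    exact Finset.sum_subset Finset.inter_subset_left fun z hz hz' => hs z ⟨T, hT, hz⟩ hz'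
  have hsum' : ∑ z ∈ T ∩ T', φ z x • z = x := by
    conv_rhs => rw [← b2]
    exact Finset.sum_subset Finset.inter_subset_left fun z hz hz' => by
      rw [hs z ⟨T, hT, hz⟩ hz', zero_smul]
  have : (T ∩ T').card = 0 ∨ (T ∩ T').card = 1 ∨ (T ∩ T').card = 2 := by omega
  rcases this with hc | hc | hc
  · rw [Finset.card_eq_zero] at hc
    rw [hc] at hsum
    simp at hsum
  · obtain ⟨u, hu⟩ := Finset.card_eq_one.mp hc
    rw [hu, Finset.sum_singleton] at hsum hsum'
    rw [hsum, one_smul] at hsum'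
    have hu' : u ∈ T ∩ T' := by simp [hu]
    rw [Finset.mem_inter] at hu'
    rw [← hsum', S.map_vert hT hu'.1, S.map_vert hT' hu'.2]
  · obtain ⟨u, v, huv, hu⟩ := Finset.card_eq_two.mp hc
    have hu' : u ∈ T ∩ T' := by simp [hu]
    have hv' : v ∈ T ∩ T' := by simp [hu]
    rw [Finset.mem_inter] at hu' hv'
    have key : ∀ e ∈ edges r 𝒯, (e = (u, v) ∨ e = (v, u)) → F T x = F T' x := by
      intro e he hee
      have h3 : ∀ z ∈ verts 𝒯, z ≠ e.1 → z ≠ e.2 → φ z x = 0 := by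
        intro z hz h1 h2
        refine hs z hz ?_
        rw [hu]
        rcases hee with rfl | rfl <;> simp_all
      rw [(S.map T hT).side e he (by rcases hee with rfl | rfl; exacts [hu'.1, hv'.1])
          (by rcases hee with rfl | rfl; exacts [hv'.1, hu'.1]) x hx
          (fun z hz => h3 z ⟨T, hT, hz⟩),
        (S.map T' hT').side e he (by rcases hee with rfl | rfl; exacts [hu'.2, hv'.2])
          (by rcases hee with rfl | rfl; exacts [hv'.2, hu'.2]) x hx'
          (fun z hz => h3 z ⟨T', hT', hz⟩)]
    rcases exists_edge S.rank hT hu'.1 hv'.1 huv with he | he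
    exacts [key _ he (Or.inl rfl), key _ he (Or.inr rfl)]

theorem IsMapSystem.vert_mem_poly (S : IsMapSystem Ω C m 𝒯 φ r h R N w p n L F l V) (hT : T ∈ 𝒯)
    {u : E} (hu : u ∈ verts 𝒯) : w u ∈ poly (l T) ↔ u ∈ T := by
  obtain ⟨U, hU, huU⟩ := id hu
  rw [(S.map T hT).mem_poly]
  constructor
  · rintro ⟨e, he, h1, h2, k, hk, hx⟩
    obtain ⟨d, hd, -, -, hud⟩ := S.fine.exists_edge_at S.rank hU huU
    rcases S.draw.vert_segment hu hd hud he hk hx with rfl | rfl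
    exacts [h1, h2]
  · intro huT
    obtain ⟨d, hd, h1, h2, hud⟩ := S.fine.exists_edge_at S.rank hT huT
    have hpos := S.draw.pos d hd
    rcases hud with rfl | rfl
    · exact ⟨d, hd, h1, h2, 0, hpos, S.draw.start d hd ▸ left_mem_segment ℝ _ _⟩
    · refine ⟨d, hd, h1, h2, n d - 1, by omega, ?_⟩
      rw [Nat.sub_add_cancel hpos, ← S.draw.finish d hd]
      exact right_mem_segment ℝ _ _

/-- The drawing of an edge which is not an edge of `T` meets the boundary of the image of `T` at
most in the common vertices. -/
theorem IsMapSystem.edge_inter_poly (S : IsMapSystem Ω C m 𝒯 φ r h R N w p n L F l V) (hT : T ∈ 𝒯)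
    {e : E × E} (he : e ∈ edges r 𝒯) (heT : ¬ (e.1 ∈ T ∧ e.2 ∈ T)) {k : ℕ} (hk : k < n e) {y : ℂ}
    (hy : y ∈ segment ℝ (p e k) (p e (k + 1))) (hyT : y ∈ poly (l T)) :
    (k = 0 ∧ y = p e 0 ∧ e.1 ∈ T) ∨ (k + 1 = n e ∧ y = p e (k + 1) ∧ e.2 ∈ T) := by
  obtain ⟨d, hd, h1, h2, k', hk', hy'⟩ := ((S.map T hT).mem_poly y).mp hyT
  have hne : e ≠ d := by
    rintro rfl
    exact heT ⟨h1, h2⟩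
  rcases S.draw.meet e he d hd k hk k' hk' y hy hy' with ⟨hed, -⟩ | ⟨ha, hb⟩
  · exact absurd hed hne
  have key : ∀ j ≤ n e, ∀ j' ≤ n d, p e j = p d j' → (j = 0 ∧ e.1 ∈ T) ∨ (j = n e ∧ e.2 ∈ T) := by
    intro j hj j' hj' hh
    rcases S.draw.eq_of_eq he hd hj hj' hh with hh | ⟨a, -, b⟩ | ⟨a, -, b⟩ | ⟨a, -, b⟩ | ⟨a, -, b⟩
    · exact absurd hh.1 hne
    · exact Or.inl ⟨a, b ▸ h1⟩
    · exact Or.inl ⟨a, b ▸ h2⟩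
    · exact Or.inr ⟨a, b ▸ h1⟩
    · exact Or.inr ⟨a, b ▸ h2⟩
  obtain ⟨j', hj', hyj'⟩ : ∃ j' ≤ n d, y = p d j' := by
    rcases hb with hb | hb
    exacts [⟨k', hk'.le, hb⟩, ⟨k' + 1, hk', hb⟩]
  rcases ha with ha | ha
  · rcases key k hk.le j' hj' (ha ▸ hyj') with ⟨rfl, hh⟩ | ⟨hh, -⟩
    · exact Or.inl ⟨rfl, ha, hh⟩
    · omega
  · rcases key (k + 1) hk j' hj' (ha ▸ hyj') with ⟨hh, -⟩ | ⟨hh, hh'⟩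
    · omega
    · exact Or.inr ⟨hh, ha, hh'⟩

theorem IsMapSystem.wind_edge (S : IsMapSystem Ω C m 𝒯 φ r h R N w p n L F l V) (hT : T ∈ 𝒯)
    {e : E × E} (he : e ∈ edges r 𝒯) {k : ℕ} (hk : k < n e) {x : ℂ}
    (hx : x ∈ segment ℝ (p e k) (p e (k + 1))) (hxT : x ∉ poly (l T)) :
    _root_.wind (l T) x = 0 := by
  obtain ⟨v1, v2, -⟩ := edges_verts he
  have heT : ¬ (e.1 ∈ T ∧ e.2 ∈ T) := fun hh =>
    hxT (((S.map T hT).mem_poly x).mpr ⟨e, he, hh.1, hh.2, k, hk, hx⟩)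
  have hI := fun {k} hk {y} => S.edge_inter_poly hT he heT (k := k) hk (y := y)
  by_cases h1 : e.1 ∈ T
  · have h2 : e.2 ∉ T := fun h2 => heT ⟨h1, h2⟩
    have hfin : p e (n e) = w e.2 := S.draw.finish e he
    rw [wind_eq_of_brokenLine (q := fun j => p e (n e - j)) (n := n e) (k := n e - 1 - k) ?_ ?_
      (by omega) ?_ hxT]
    · rw [Nat.sub_zero, hfin]
      exact S.wind T hT _ v2 h2
    · intro j hj hjT
      obtain ⟨i, hi⟩ : ∃ i, n e - j = i + 1 := ⟨n e - j - 1, by omega⟩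
      simp only [hi] at hjT
      rcases hI (k := i) (by omega) (right_mem_segment ℝ _ _) hjT with ⟨-, hh, -⟩ | ⟨-, -, hh⟩
      · have := S.draw.inj e he (mem_Iic.mpr (by omega)) (mem_Iic.mpr (Nat.zero_le _)) hh
        omega
      · exact h2 hh
    · intro j hj y hy hyT
      obtain ⟨i, hi⟩ : ∃ i, n e - j = i + 1 := ⟨n e - j - 1, by omega⟩
      have hi' : n e - (j + 1) = i := by omega
      simp only [hi, hi'] at hy ⊢
      rw [segment_symm] at hy
      rcases hI (k := i) (by omega) hy hyT with ⟨rfl, hh, -⟩ | ⟨-, -, hh⟩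
      exacts [hh, absurd hh h2]
    · have e1 : n e - (n e - 1 - k) = k + 1 := by omega
      have e2 : n e - (n e - 1 - k + 1) = k := by omega
      simp only [e1, e2]
      rwa [segment_symm]
  · rw [wind_eq_of_brokenLine (q := p e) (n := n e) ?_ ?_ hk hx hxT, S.draw.start e he]
    · exact S.wind T hT _ v1 h1
    · intro j hj hjT
      rcases hI hj (left_mem_segment ℝ _ _) hjT with ⟨-, -, hh⟩ | ⟨-, hh, -⟩
      · exact h1 hh
      · have := S.draw.inj e he (mem_Iic.mpr hj.le) (mem_Iic.mpr hj) hh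
        omega
    · intro j hj y hy hyT
      rcases hI hj hy hyT with ⟨-, -, hh⟩ | ⟨-, hh, -⟩
      exacts [absurd hh h1, hh]

theorem IsMapSystem.wind_poly (S : IsMapSystem Ω C m 𝒯 φ r h R N w p n L F l V) (hT : T ∈ 𝒯)
    (hT' : T' ∈ 𝒯) : ∀ x ∈ poly (l T') \ poly (l T), _root_.wind (l T) x = 0 := by
  rintro x ⟨hx, hxT⟩
  obtain ⟨e, he, -, -, k, hk, hx⟩ := ((S.map T' hT').mem_poly x).mp hx
  exact S.wind_edge hT he hk hx hxT

theorem IsMapSystem.inter (S : IsMapSystem Ω C m 𝒯 φ r h R N w p n L F l V) (hT : T ∈ 𝒯)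
    (hT' : T' ∈ 𝒯) (hne : T ≠ T') {x : ℂ} (hx : x ∈ poly (l T) ∪ V T)
    (hx' : x ∈ poly (l T') ∪ V T') : x ∈ poly (l T) ∧ x ∈ poly (l T') := by
  have h1 := Set.disjoint_left.mp ((S.map T hT).cell.disjoint_poly (S.wind_poly hT hT'))
  have h2 := Set.disjoint_left.mp ((S.map T' hT').cell.disjoint_poly (S.wind_poly hT' hT))
  obtain ⟨u, hu, hu'⟩ : ∃ u ∈ T, u ∉ T' := by
    by_contra! hh
    exact hne (Finset.eq_of_subset_of_card_le hh
      (by rw [S.fine.card T hT, S.fine.card T' hT']))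
  have huv : u ∈ verts 𝒯 := ⟨T, hT, hu⟩
  have h3 := Set.disjoint_left.mp ((S.map T hT).cell.disjoint_cell (S.map T' hT').cell
    (S.wind_poly hT hT') ((S.vert_mem_poly hT huv).mpr hu)
    (fun hh => hu' ((S.vert_mem_poly hT' huv).mp hh)) (S.wind T' hT' u huv hu'))
  rcases hx with hx | hx <;> rcases hx' with hx' | hx'
  exacts [⟨hx, hx'⟩, absurd hx (h2 hx'), absurd hx' (h1 hx), absurd hx' (h3 hx)]

theorem IsMapSystem.inj (S : IsMapSystem Ω C m 𝒯 φ r h R N w p n L F l V) (hT : T ∈ 𝒯)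
    (hT' : T' ∈ 𝒯) {x y : E} (hx : x ∈ convexHull ℝ (T : Set E))
    (hy : y ∈ convexHull ℝ (T' : Set E)) (hxy : F T x = F T' y) : x = y := by
  by_cases hne : T = T'
  · subst hne
    exact S.fine.ext hT hx hy ((S.map T hT).inj x hx y hy hxy)
  obtain ⟨h1, h2⟩ := S.inter hT hT' hne ((S.map T hT).image x hx) (hxy ▸ (S.map T' hT').image y hy)
  obtain ⟨e, he, he1, he2, k, hk, hs⟩ := ((S.map T hT).mem_poly _).mp h1
  obtain ⟨d, hd, hd1, hd2, j, hj, hs'⟩ := ((S.map T' hT').mem_poly _).mp h2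
  have key : ∀ k ≤ n e, ∀ j ≤ n d, F T x = p e k → F T x = p d j → x = y := by
    intro k hk j hj hk' hj'
    have hv := edges_verts he
    rcases S.draw.eq_of_eq he hd hk hj (hk'.symm.trans hj') with ⟨rfl, rfl⟩ | hh
    · rw [S.eq_pt hT he he1 he2 (Nat.cast_nonneg k) (by exact_mod_cast hk) hx
          (by rw [PLN_natCast, hk']),
        S.eq_pt hT' he hd1 hd2 (Nat.cast_nonneg k) (by exact_mod_cast hk) hy
          (by rw [PLN_natCast, ← hk', hxy])]
    · obtain ⟨u, hu, hu', hw⟩ : ∃ u, u ∈ T ∧ u ∈ T' ∧ F T x = w u := by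
        rcases hh with ⟨rfl, -, hh⟩ | ⟨rfl, -, hh⟩ | ⟨rfl, -, hh⟩ | ⟨rfl, -, hh⟩
        · exact ⟨e.1, he1, hh ▸ hd1, hk'.trans (S.draw.start e he)⟩
        · exact ⟨e.1, he1, hh ▸ hd2, hk'.trans (S.draw.start e he)⟩
        · exact ⟨e.2, he2, hh ▸ hd1, hk'.trans (S.draw.finish e he)⟩
        · exact ⟨e.2, he2, hh ▸ hd2, hk'.trans (S.draw.finish e he)⟩
      rw [S.eq_of_pt hT hu hx hw, S.eq_of_pt hT' hu' hy (hxy ▸ hw)]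
  rcases S.draw.meet e he d hd k hk j hj _ hs hs' with ⟨rfl, rfl⟩ | ⟨ha, hb⟩
  · obtain ⟨τ, t0, t1, hτ⟩ := segment_param hs
    have hPL : F T x = PLN (p e) (k + τ) := by rw [PLN_add _ _ t0 t1, hτ]
    have hk1 : (k : ℝ) + τ ≤ n e := by
      have : ((k + 1 : ℕ) : ℝ) ≤ n e := by exact_mod_cast hk
      push_cast at this
      linarith
    rw [S.eq_pt hT he he1 he2 (by positivity) hk1 hx hPL,
      S.eq_pt hT' he hd1 hd2 (by positivity) hk1 hy (hxy ▸ hPL)]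
  · rcases ha with ha | ha <;> rcases hb with hb | hb
    exacts [key _ hk.le _ hj.le ha hb, key _ hk.le _ hj ha hb, key _ hk _ hj.le ha hb,
      key _ hk _ hj ha hb]

end Assembly

section Embedding

variable {E : Type*} [NormedAddCommGroup E] [NormedSpace ℝ E] {Ω : Set E} {C m : ℝ}
  {𝒯 : Set (Finset E)} {φ : E → E → ℝ}

theorem IsFine.edge_subset (hF : IsFine Ω C m 𝒯 φ) {r : E → ℕ} {e : E × E} (he : e ∈ edges r 𝒯) :
    segment ℝ e.1 e.2 ⊆ Ω := by
  obtain ⟨-, T, hT, h1, h2⟩ := he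
  exact (segment_subset_convexHull (s := (T : Set E)) h1 h2).trans fun x hx => hF.mem hT hx

theorem IsFine.verts_subset (hF : IsFine Ω C m 𝒯 φ) : verts 𝒯 ⊆ Ω := by
  rintro z ⟨T, hT, hz⟩
  exact hF.mem hT (subset_convexHull ℝ _ hz)

theorem IsFine.near_endpoint (hF : IsFine Ω C m 𝒯 φ) {r : E → ℕ} {e e' : E × E}
    (he : e ∈ edges r 𝒯) (he' : e' ∈ edges r 𝒯) (hne : e ≠ e') {t t' : E} (hm : 0 < m)
    (hC : 0 < C) (ht : t ∈ segment ℝ e.1 e.2) (ht' : t' ∈ segment ℝ e'.1 e'.2) :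
    ∃ z ∈ verts 𝒯, ‖t - z‖ ≤ C ^ 2 * ‖t - t'‖ := by
  obtain ⟨v1, v2, h12⟩ := edges_verts he
  obtain ⟨v1', v2', h12'⟩ := edges_verts he'
  have htΩ := hF.edge_subset he ht
  have htΩ' := hF.edge_subset he' ht'
  obtain ⟨hr, T, hT, h1, h2⟩ := he
  obtain ⟨hr', T', hT', h1', h2'⟩ := he'
  obtain ⟨τ, t0, t1, rfl⟩ := segment_param ht
  obtain ⟨τ', t0', t1', rfl⟩ := segment_param ht'
  obtain ⟨c1, c2, -⟩ := hF.coord_segment hT h1 h2 h12 t0 t1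
  obtain ⟨-, -, c3⟩ := hF.coord_segment hT' h1' h2' h12' t0' t1'
  have hd := hF.diam T hT _ (subset_convexHull ℝ _ h1) _ (subset_convexHull ℝ _ h2)
  have key : ∀ s : ℝ, 0 ≤ s → s ≤ C * m * ‖e.1 + τ • (e.2 - e.1) - (e'.1 + τ' • (e'.2 - e'.1))‖ →
      s * ‖e.1 - e.2‖ ≤ C ^ 2 * ‖e.1 + τ • (e.2 - e.1) - (e'.1 + τ' • (e'.2 - e'.1))‖ := by
    intro s hs hs'
    refine (mul_le_mul hs' hd (norm_nonneg _) (by positivity)).trans (le_of_eq ?_)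
    field_simp
  by_cases hv : e.2 ≠ e'.1 ∧ e.2 ≠ e'.2
  · refine ⟨e.1, v1, ?_⟩
    have := hF.lip e.2 v2 _ htΩ _ htΩ'
    rw [c1, c3 e.2 v2 hv.1 hv.2, sub_zero, abs_of_nonneg t0] at this
    rw [add_sub_cancel_left, norm_smul, Real.norm_of_nonneg t0, norm_sub_rev e.2]
    exact key τ t0 this
  · have hv1 : e.1 ≠ e'.1 ∧ e.1 ≠ e'.2 := by
      constructor
      · intro h
        rcases not_and_or.mp hv with h' | h' <;> rw [not_not] at h'
        · exact h12 (h.trans h'.symm)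
        · exact hne (Prod.ext h h')
      · intro h
        rcases not_and_or.mp hv with h' | h' <;> rw [not_not] at h'
        · rw [h, h'] at hr
          omega
        · exact h12 (h.trans h'.symm)
    refine ⟨e.2, v2, ?_⟩
    have := hF.lip e.1 v1 _ htΩ _ htΩ'
    rw [c2, c3 e.1 v1 hv1.1 hv1.2, sub_zero, abs_of_nonneg (by linarith)] at this
    have h3 : e.1 + τ • (e.2 - e.1) - e.2 = (1 - τ) • (e.1 - e.2) := by module
    rw [h3, norm_smul, Real.norm_of_nonneg (by linarith)]
    exact key _ (by linarith) this

/-- A map on a finely triangulated set, which separates the cells of the triangulation by a large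
distance, can be replaced by a piecewise affine embedding. -/
theorem IsFine.exists_embedding (hF : IsFine Ω C m 𝒯 φ) (hC : 1 ≤ C) (hm : 1 ≤ m) {h : E → ℂ}
    (hc : ContinuousOn h Ω) {R B : ℕ} (hR : 12 ≤ R) (hB : ∀ x ∈ Ω, ‖h x‖ ≤ B)
    (H2 : ∀ t ∈ Ω, ∀ z ∈ verts 𝒯, φ z t = 0 → 10 * (R : ℝ) < ‖h t - h z‖)
    (H3 : ∀ t ∈ Ω, ∀ t' ∈ Ω, ∀ z ∈ Ω, ‖t - z‖ ≤ C ^ 2 * ‖t - t'‖ → (R : ℝ) / 2 ≤ ‖h t - h z‖ →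
      10 < ‖h t - h t'‖)
    (H5 : ∀ t ∈ Ω, ∀ t' ∈ Ω, ∀ s ∈ Ω, ∀ s' ∈ Ω, ‖h t - h t'‖ ≤ 2 * R + 8 → ‖s - s'‖ ≤ ‖t - t'‖ →
      ∀ z ∈ verts 𝒯, φ z s = 0 → ‖h s - h s'‖ + 4 < ‖h s - h z‖)
    {D : ℝ} (hD : ∀ T ∈ 𝒯, ∀ s ∈ convexHull ℝ (T : Set E), ∀ t ∈ convexHull ℝ (T : Set E),
      ‖h s - h t‖ ≤ D) :
    ∃ f : E → ℂ, PLOn f Ω ∧ InjOn f Ω ∧ (∀ x ∈ Ω, ∀ y ∈ Ω, ‖f x - f y‖ ≤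
      7 * (180 * (2 * ((2 * ((B : ℝ) + 4) + 1) ^ 2) ^ 2) ^ 5 * (B + 4)) * (C * m * ‖x - y‖)) ∧
      ∀ x ∈ Ω, ‖f x - h x‖ ≤ D + 4 := by
  classical
  have hR' : (12 : ℝ) ≤ R := by exact_mod_cast hR
  have hfin : (verts 𝒯).Finite := by
    have : verts 𝒯 = ⋃ T ∈ 𝒯, (T : Set E) := by ext; simp [verts]
    rw [this]
    exact hF.finite.biUnion fun T _ => T.finite_toSet
  obtain ⟨r, hr⟩ := Set.countable_iff_exists_injOn.mp hfin.countable
  obtain ⟨w, p, n, hdraw⟩ := exists_isDrawing (Z := verts 𝒯) (ed := edges r 𝒯) (h := h) (R := R)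
    (B := B) hR (fun e he => edges_verts he) (fun e he => hc.mono (hF.edge_subset he))
    (fun e he t ht => hB t (hF.edge_subset he ht))
    (fun z hz z' hz' hne => H2 z (hF.verts_subset hz) z' hz' (hF.coord_of_ne hz hz' hne))
    (fun e he t ht z hz hz1 hz2 => by
      refine H2 t (hF.edge_subset he ht) z hz ?_
      obtain ⟨τ, t0, t1, rfl⟩ := segment_param ht
      obtain ⟨-, -, hne⟩ := edges_verts he
      obtain ⟨-, T, hT, h1, h2⟩ := he
      exact (hF.coord_segment hT h1 h2 hne t0 t1).2.2 z hz hz1 hz2)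
    (fun e he e' he' hne t ht t' ht' hz => by
      obtain ⟨z, hzv, hle⟩ := hF.near_endpoint he he' hne (by linarith) (by linarith) ht ht'
      exact H3 t (hF.edge_subset he ht) t' (hF.edge_subset he' ht') z (hF.verts_subset hzv) hle
        (hz z hzv))
  have hpB : ∀ e ∈ edges r 𝒯, ∀ k ≤ n e, ‖p e k‖ ≤ (B : ℝ) + 4 := by
    intro e he k hk
    obtain ⟨t, ht, hh⟩ := hdraw.near e he k hk
    have := norm_le_norm_add_norm_sub' (p e k) (h t)
    have := hB t (hF.edge_subset he ht)
    linarith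
  have hmap : ∀ T ∈ 𝒯, ∃ F l V, IsTriMap (convexHull ℝ (T : Set E)) T φ (edges r 𝒯) p n
      (180 * (2 * (((2 * (B + 4) + 1) ^ 2 : ℕ) : ℝ) ^ 2) ^ 5 * (B + 4)) F l V ∧
      ((∀ z ∈ T, PLOn (φ z) (convexHull ℝ (T : Set E))) → PLOn F (convexHull ℝ (T : Set E))) :=
    fun T hT => hdraw.exists_isTriMap (hF.card T hT)
      (hr.mono (fun z hz => (⟨T, hT, hz⟩ : z ∈ verts 𝒯)))
      (fun u hu v hv => ⟨fun h => h.1, fun h => ⟨h, T, hT, hu, hv⟩⟩)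
      (fun x hx => (hF.bary hT hx).1) (fun x hx => (hF.bary hT hx).2.1) (by positivity) hpB
  choose! F l V hmap hpl using hmap
  set L : ℝ := 180 * (2 * (((2 * (B + 4) + 1) ^ 2 : ℕ) : ℝ) ^ 2) ^ 5 * (B + 4) with hL
  have hwind : ∀ T ∈ 𝒯, ∀ u ∈ verts 𝒯, u ∉ T → wind (l T) (w u) = 0 := by
    intro T hT u hu huT
    have hzero : ∀ t ∈ convexHull ℝ (T : Set E), φ u t = 0 := fun t ht =>
      hF.coord_zero T hT t ht u hu huT
    have hwu := hdraw.near_vert u hu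
    have htri : ∀ t, ‖h t - h u‖ ≤ ‖h t - w u‖ + 4 := fun t => by
      have := norm_sub_le_norm_sub_add_norm_sub (h t) (w u) (h u)
      linarith
    refine wind_eq_zero_of_shadow (convex_convexHull ℝ (T : Set E)) ?_
      (hc.mono fun x hx => hF.mem hT hx) (R := R) (Nat.cast_nonneg _) ?_ ?_ ?_ ?_
    · obtain ⟨z, hz⟩ := Finset.card_pos.mp (by rw [hF.card T hT]; norm_num)
      exact ⟨z, subset_convexHull ℝ _ hz⟩
    · intro v hv
      obtain ⟨e, he, h1, h2, k, hk, rfl⟩ := (hmap T hT).mem_list v hv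
      obtain ⟨t, ht, hh⟩ := hdraw.near e he k hk
      exact ⟨t, segment_subset_convexHull (s := (T : Set E)) h1 h2 ht, hh⟩
    · intro d hd
      obtain ⟨e, he, h1, h2, k, hk, rfl | rfl⟩ := (hmap T hT).mem_cyc d hd
      · exact hdraw.step e he k hk
      · rw [norm_sub_rev]
        exact hdraw.step e he k hk
    · intro t ht
      have := H2 t (hF.mem hT ht) u hu (hzero t ht)
      have := htri t
      linarith
    · intro t ht t' ht' htt s hs s' hs' hss
      have := H5 t (hF.mem hT ht) t' (hF.mem hT ht') s (hF.mem hT hs) s' (hF.mem hT hs') htt hss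
        u hu (hzero s hs)
      have := htri s
      linarith
  have S : IsMapSystem Ω C m 𝒯 φ r h R _ w p n L F l V := ⟨hF, hr, hdraw, hmap, hwind⟩
  have hsel : ∀ x ∈ Ω, ∃ T ∈ 𝒯, x ∈ convexHull ℝ (T : Set E) := fun x hx => (hF.cover x).mp hx
  choose! τ hτ hτx using hsel
  have hf : ∀ T ∈ 𝒯, ∀ x ∈ convexHull ℝ (T : Set E), F (τ x) x = F T x := fun T hT x hx =>
    S.compat (hτ x (hF.mem hT hx)) hT (hτx x (hF.mem hT hx)) hx
  have hbound : ∀ T ∈ 𝒯, ∀ x ∈ convexHull ℝ (T : Set E), ‖F T x‖ ≤ B + 4 := by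
    intro T hT x hx
    have := (hmap T hT).hull (Metric.closedBall 0 (B + 4)) (convex_closedBall _ _) (by
      intro v hv
      obtain ⟨e, he, -, -, k, hk, rfl⟩ := (hmap T hT).mem_list v hv
      simpa using hpB e he k hk) x hx
    simpa using this
  have hLB : (B : ℝ) + 4 ≤ L := by
    rw [hL]
    refine le_mul_of_one_le_left (by positivity) ?_
    have h1 : (1 : ℝ) ≤ ((2 * (B + 4) + 1) ^ 2 : ℕ) := by
      exact_mod_cast Nat.one_le_pow _ _ (by omega)
    have h2 : (1 : ℝ) ≤ 2 * (((2 * (B + 4) + 1) ^ 2 : ℕ) : ℝ) ^ 2 := by nlinarith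
    have := one_le_pow₀ h2 (n := 5)
    linarith
  refine ⟨fun x => F (τ x) x, ?_, ?_, ?_, ?_⟩
  · have : ∀ T ∈ 𝒯, ∃ 𝒜 : Set (E →ᵃ[ℝ] ℂ), 𝒜.Finite ∧
        ∀ x ∈ convexHull ℝ (T : Set E), ∃ A ∈ 𝒜, F T x = A x := fun T hT =>
      hpl T hT fun z hz => (hF.pl z ⟨T, hT, hz⟩).mono fun x hx => hF.mem hT hx
    choose! 𝒜 hA hA' using this
    refine ⟨⋃ T ∈ 𝒯, 𝒜 T, hF.finite.biUnion hA, fun x hx => ?_⟩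
    obtain ⟨A, h1, h2⟩ := hA' (τ x) (hτ x hx) x (hτx x hx)
    exact ⟨A, mem_biUnion (hτ x hx) h1, h2⟩
  · exact fun x hx y hy hxy => S.inj (hτ x hx) (hτ y hy) (hτx x hx) (hτx y hy) hxy
  · intro x hx y hy
    have hlip : ∀ z ∈ verts 𝒯, |φ z x - φ z y| ≤ C * m * ‖x - y‖ := fun z hz =>
      hF.lip z hz x hx y hy
    set δ := C * m * ‖x - y‖ with hδ
    have hδ0 : 0 ≤ δ := by positivity
    have hT := hτ x hx
    have hT' := hτ y hy
    have hxT := hτx x hx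
    have hyT := hτx y hy
    have hcast : 7 * (180 * (2 * ((2 * ((B : ℝ) + 4) + 1) ^ 2) ^ 2) ^ 5 * (B + 4)) = 7 * L := by
      rw [hL]; push_cast; ring
    rw [hcast]
    have hsm : ∀ z ∈ τ x, z ∉ τ y → φ z x ≤ δ := by
      intro z hz hz'
      have := hlip z ⟨_, hT, hz⟩
      rw [hF.coord_zero _ hT' y hyT z ⟨_, hT, hz⟩ hz', sub_zero] at this
      exact (le_abs_self _).trans this
    by_cases hcom : ∃ z, z ∈ τ x ∧ z ∈ τ y
    · obtain ⟨z₀, hz, hz'⟩ := hcom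
      obtain ⟨x', hx1, hx2, hx3⟩ := hF.exists_common hT hz hz' hxT hsm hδ0
      have l1 := (hmap _ hT).lip x hxT x' hx1 (3 * δ) fun z hz => hx3 z ⟨_, hT, hz⟩
      have l2 := (hmap _ hT').lip x' hx2 y hyT (4 * δ) fun z hz => by
        have h1 := hx3 z ⟨_, hT', hz⟩
        have h2 := hlip z ⟨_, hT', hz⟩
        have h3 := abs_sub_le (φ z x') (φ z x) (φ z y)
        rw [abs_sub_comm (φ z x') (φ z x)] at h3
        linarith
      rw [S.compat hT hT' hx1 hx2] at l1
      have := norm_sub_le_norm_sub_add_norm_sub (F (τ x) x) (F (τ y) x') (F (τ y) y)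
      linarith
    · push Not at hcom
      have h1 : (1 : ℝ) ≤ 3 * δ := by
        rw [← (hF.bary hT hxT).2.1]
        calc ∑ z ∈ τ x, φ z x ≤ (τ x).card • δ :=
              Finset.sum_le_card_nsmul _ _ _ fun z hz => hsm z hz (hcom z hz)
          _ = 3 * δ := by rw [hF.card _ hT, nsmul_eq_mul]; norm_num
      have b1 := hbound _ hT x hxT
      have b2 := hbound _ hT' y hyT
      have b3 := norm_sub_le (F (τ x) x) (F (τ y) y)
      nlinarith
  · intro x hx
    have := (hmap _ (hτ x hx)).hull (Metric.closedBall (h x) (D + 4)) (convex_closedBall _ _) (by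
      intro v hv
      obtain ⟨e, he, h1, h2, k, hk, rfl⟩ := (hmap _ (hτ x hx)).mem_list v hv
      obtain ⟨t, ht, hh⟩ := hdraw.near e he k hk
      have := hD _ (hτ x hx) t (segment_subset_convexHull h1 h2 ht) x (hτx x hx)
      rw [mem_closedBall, dist_eq_norm]
      have := norm_sub_le_norm_sub_add_norm_sub (p e k) (h t) (h x)
      linarith) x (hτx x hx)
    rwa [mem_closedBall, dist_eq_norm] at this

end Embedding

section WeightComplex

variable {E : Type*} [AddCommGroup E] [Module ℝ E]

/-- `w` is a system of barycentric weights for `x`, supported in `s`. -/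
structure IsWeight (s : Finset E) (w : E →₀ ℝ) (x : E) : Prop where
  nonneg : ∀ z, 0 ≤ w z
  zero : ∀ z, z ∉ s → w z = 0
  sum : Finsupp.linearCombination ℝ (fun _ : E => (1 : ℝ)) w = 1
  comb : Finsupp.linearCombination ℝ (id : E → E) w = x

omit [AddCommGroup E] [Module ℝ E] in
theorem linearCombination_eq_sum {M : Type*} [AddCommGroup M] [Module ℝ M] (v : E → M)
    {s : Finset E} {w : E →₀ ℝ} (h : ∀ z, z ∉ s → w z = 0) :
    Finsupp.linearCombination ℝ v w = ∑ z ∈ s, w z • v z := by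
  rw [Finsupp.linearCombination_apply]
  refine Finsupp.sum_of_support_subset _ (fun z hz => ?_) _ (by simp)
  by_contra hzs
  exact (Finsupp.mem_support_iff.mp hz) (h z hzs)

theorem IsWeight.mem {s : Finset E} {w : E →₀ ℝ} {x : E} (h : IsWeight s w x) :
    x ∈ convexHull ℝ (s : Set E) := by
  refine Finset.mem_convexHull'.mpr ⟨w, fun z _ => h.nonneg z, ?_, ?_⟩
  · rw [← h.sum, linearCombination_eq_sum _ h.zero]
    simp
  · rw [← h.comb, linearCombination_eq_sum _ h.zero]
    simp

theorem isWeight_of_fun {s : Finset E} {b : E → ℝ} (h0 : ∀ z ∈ s, 0 ≤ b z)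
    (h1 : ∑ z ∈ s, b z = 1) : ∃ w : E →₀ ℝ, (∀ z ∈ s, w z = b z) ∧
      IsWeight s w (∑ z ∈ s, b z • z) := by
  classical
  let w : E →₀ ℝ := Finsupp.onFinset s (fun z => if z ∈ s then b z else 0) (by
    intro z hz
    by_contra h
    simp [h] at hz)
  have hw : ∀ z ∈ s, w z = b z := fun z hz => by simp [w, hz]
  have hz : ∀ z, z ∉ s → w z = 0 := fun z hz => by simp [w, hz]
  refine ⟨w, hw, fun z => ?_, hz, ?_, ?_⟩
  · by_cases h : z ∈ s
    · rw [hw z h]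
      exact h0 z h
    · rw [hz z h]
  · rw [linearCombination_eq_sum _ hz]
    refine Eq.trans ?_ h1
    exact Finset.sum_congr rfl fun z h => by rw [hw z h, smul_eq_mul, mul_one]
  · rw [linearCombination_eq_sum _ hz]
    exact Finset.sum_congr rfl fun z h => by rw [hw z h, id]

theorem exists_isWeight {s : Finset E} {x : E} (h : x ∈ convexHull ℝ (s : Set E)) :
    ∃ w, IsWeight s w x := by
  obtain ⟨b, h0, h1, rfl⟩ := Finset.mem_convexHull'.mp h
  obtain ⟨w, -, hw⟩ := isWeight_of_fun h0 h1
  exact ⟨w, hw⟩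

theorem IsWeight.mono {s t : Finset E} {w : E →₀ ℝ} {x : E} (h : IsWeight s w x) (hst : s ⊆ t) :
    IsWeight t w x :=
  ⟨h.nonneg, fun z hz => h.zero z fun hzs => hz (hst hzs), h.sum, h.comb⟩

theorem IsWeight.map {s : Finset E} {w : E →₀ ℝ} {x : E} (h : IsWeight s w x)
    (g : E →ᵃ[ℝ] ℝ) : g x = ∑ z ∈ s, w z * g z := by
  have key : ∀ w : E →₀ ℝ, Finsupp.linearCombination ℝ (g : E → ℝ) w =
      g.linear (Finsupp.linearCombination ℝ (id : E → E) w) +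
        Finsupp.linearCombination ℝ (fun _ : E => (1 : ℝ)) w * g 0 := by
    intro w
    induction w using Finsupp.induction_linear with
    | zero => simp
    | add f g hf hg => simp only [map_add, hf, hg]; ring
    | single a b =>
      have : g a = g.linear a + g 0 := congrFun g.decomp a
      simp [this, mul_add]
  have h1 := key w
  rw [h.comb, h.sum, one_mul, linearCombination_eq_sum _ h.zero] at h1
  have : g x = g.linear x + g 0 := congrFun g.decomp x
  rw [this, ← h1]
  simp

theorem affineIndependent_of_weights {s : Finset E}
    (hs : ∀ w w' x, IsWeight s w x → IsWeight s w' x → w = w') :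
    AffineIndependent ℝ ((↑) : s → E) := by
  classical
  rw [affineIndependent_iff_of_fintype]
  intro c hc hc' i
  rw [Finset.univ.weightedVSub_eq_linear_combination hc] at hc'
  have hn : (0 : ℝ) < s.card := by exact Nat.cast_pos.mpr (Finset.card_pos.mpr ⟨(i : E), i.2⟩)
  set M : ℝ := 1 + ∑ j, |c j| with hM
  have hM1 : 0 < M := by positivity
  have hle : ∀ j, |c j| ≤ M := fun j => by
    have := Finset.single_le_sum (f := fun j => |c j|) (fun j _ => abs_nonneg (c j))
      (Finset.mem_univ j)
    linarith
  let d : E → ℝ := fun z => if h : z ∈ s then c ⟨z, h⟩ else 0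
  have hd : ∀ j : s, d j = c j := fun j => by simp [d]
  have hb1 : ∑ z ∈ s, (1 / (s.card : ℝ)) = 1 := by
    rw [Finset.sum_const, nsmul_eq_mul]
    field_simp
  have hd1 : ∑ z ∈ s, d z = 0 := by
    rw [← Finset.sum_coe_sort, ← hc]
    exact Finset.sum_congr rfl fun j _ => hd j
  have hd2 : ∑ z ∈ s, d z • z = 0 := by
    rw [← Finset.sum_coe_sort s (fun z => d z • z), ← hc']
    exact Finset.sum_congr rfl fun j _ => by rw [hd j]
  obtain ⟨w, hw, hw'⟩ := isWeight_of_fun (s := s) (b := fun _ => 1 / (s.card : ℝ))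
    (fun z _ => by positivity) hb1
  obtain ⟨v, hv, hv'⟩ := isWeight_of_fun (s := s)
    (b := fun z => 1 / (s.card : ℝ) + 1 / (s.card * M) * d z)
    (fun z hz => by
      have h1 : -M ≤ d z := by
        have := hle ⟨z, hz⟩
        rw [← hd] at this
        exact (abs_le.mp this).1
      have : 1 / (s.card : ℝ) + 1 / (s.card * M) * d z = (M + d z) / (s.card * M) := by
        field_simp
      rw [this]
      exact div_nonneg (by linarith) (by positivity))
    (by rw [Finset.sum_add_distrib, hb1, ← Finset.mul_sum, hd1]; ring)
  have : ∑ z ∈ s, (1 / (s.card : ℝ) + 1 / (s.card * M) * d z) • z =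
      ∑ z ∈ s, (1 / (s.card : ℝ)) • z := by
    simp only [add_smul, mul_smul, Finset.sum_add_distrib, ← Finset.smul_sum, hd2]
    simp
  rw [this] at hv'
  have h1 := hw i i.2
  rw [hs _ _ _ hw' hv', hv i i.2, hd] at h1
  have h2 : 1 / ((s.card : ℝ) * M) * c i = 0 := by linarith
  have h3 : 1 / ((s.card : ℝ) * M) ≠ 0 := by positivity
  exact (mul_eq_zero.mp h2).resolve_left h3

theorem IsWeight.unique {s : Finset E} (hs : AffineIndependent ℝ ((↑) : s → E))
    {w w' : E →₀ ℝ} {x : E} (h : IsWeight s w x) (h' : IsWeight s w' x) : w = w' := by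
  ext z
  by_cases hz : z ∈ s
  · have h1 : ∑ j : s, (w j - w' j) = 0 := by
      have e := h.sum.trans h'.sum.symm
      rw [linearCombination_eq_sum _ h.zero, linearCombination_eq_sum _ h'.zero] at e
      rw [Finset.sum_coe_sort s (fun j => w j - w' j), Finset.sum_sub_distrib]
      simpa [sub_eq_zero] using e
    have h2 : ∑ j : s, (w j - w' j) • (j : E) = 0 := by
      have e := h.comb.trans h'.comb.symm
      rw [linearCombination_eq_sum _ h.zero, linearCombination_eq_sum _ h'.zero] at e
      rw [Finset.sum_coe_sort s (fun j => (w j - w' j) • j)]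
      simp only [sub_smul, Finset.sum_sub_distrib]
      simpa [sub_eq_zero] using e
    have := hs.eq_zero_of_sum_eq_zero h1 h2 ⟨z, hz⟩ (Finset.mem_univ _)
    exact sub_eq_zero.mp this
  · rw [h.zero z hz, h'.zero z hz]

/-- The faces of a pure two-dimensional complex, with uniqueness of barycentric weights. -/
structure IsWComplex (F : Set (Finset E)) : Prop where
  finite : F.Finite
  nonempty : ∀ s ∈ F, s.Nonempty
  down : ∀ s ∈ F, ∀ t, t ⊆ s → t.Nonempty → t ∈ F
  unique : ∀ s ∈ F, ∀ t ∈ F, ∀ w w' x, IsWeight s w x → IsWeight t w' x → w = w'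
  card : ∀ s ∈ F, s.card ≤ 3
  pure : ∀ s ∈ F, ∃ t ∈ F, s ⊆ t ∧ t.card = 3

/-- `F'` subdivides `F`. -/
structure IsRefinement (F' F : Set (Finset E)) : Prop where
  into : ∀ s ∈ F', ∃ t ∈ F, ∀ z ∈ s, z ∈ convexHull ℝ (t : Set E)
  onto : ∀ t ∈ F, ∀ x ∈ convexHull ℝ (t : Set E), ∃ s ∈ F', x ∈ convexHull ℝ (s : Set E)

theorem IsRefinement.trans {F F' F'' : Set (Finset E)} (h : IsRefinement F'' F')
    (h' : IsRefinement F' F) : IsRefinement F'' F where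
  into s hs := by
    obtain ⟨t, ht, hst⟩ := h.into s hs
    obtain ⟨r, hr, htr⟩ := h'.into t ht
    exact ⟨r, hr, fun z hz => convexHull_min htr (convex_convexHull ℝ _) (hst z hz)⟩
  onto t ht x hx := by
    obtain ⟨s, hs, hxs⟩ := h'.onto t ht x hx
    exact h.onto s hs x hxs

theorem IsRefinement.refl (F : Set (Finset E)) : IsRefinement F F :=
  ⟨fun s hs => ⟨s, hs, fun _ hz => subset_convexHull ℝ _ hz⟩, fun t ht _ hx => ⟨t, ht, hx⟩⟩

open Classical in
/-- The faces of the stellar subdivision of the edge `u v` at the point `p`. -/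
def stellar (F : Set (Finset E)) (u v p : E) : Set (Finset E) :=
  {s | s.Nonempty ∧ ¬ (u ∈ s ∧ v ∈ s) ∧
    (s ∈ F ∨ p ∈ s ∧ ∃ t ∈ F, u ∈ t ∧ v ∈ t ∧ s.erase p ⊆ t)}

theorem IsWComplex.midpoint_notMem {F : Set (Finset E)} (hF : IsWComplex F) {u v p : E} {θ : ℝ}
    (h0 : 0 < θ) (h1 : θ < 1) (huv : u ≠ v) {t : Finset E} (ht : t ∈ F) (hu : u ∈ t) (hv : v ∈ t)
    (hp : p = (1 - θ) • u + θ • v) {s : Finset E} (hs : s ∈ F) : p ∉ s := by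
  classical
  intro hps
  have w1 : IsWeight s (Finsupp.single p 1) p :=
    ⟨fun z => by rw [Finsupp.single_apply]; split_ifs <;> norm_num,
      fun z hz => Finsupp.single_eq_of_ne (fun h => hz (h ▸ hps)), by simp, by simp⟩
  have w2 : IsWeight t (Finsupp.single u (1 - θ) + Finsupp.single v θ) p := by
    refine ⟨fun z => ?_, fun z hz => ?_, by simp, by simp [hp, sub_smul]⟩
    · simp only [Finsupp.add_apply, Finsupp.single_apply]
      split_ifs <;> linarith
    · have hzu : u ≠ z := fun h => hz (h ▸ hu)
      have hzv : v ≠ z := fun h => hz (h ▸ hv)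
      simp [hzu, hzv]
  have := hF.unique s hs t ht _ _ _ w1 w2
  have eu := DFunLike.congr_fun this u
  have ev := DFunLike.congr_fun this v
  simp only [Finsupp.add_apply, Finsupp.single_apply, huv, huv.symm, if_true, if_false] at eu ev
  split_ifs at eu ev with h1 h2
  · exact huv (h1.symm.trans h2)
  all_goals linarith

open Classical in
theorem exists_push {F : Set (Finset E)} {u v p : E} {θ : ℝ} (h0 : 0 < θ) (h1 : θ < 1)
    (hp : p = (1 - θ) • u + θ • v) (hpF : ∀ s ∈ F, p ∉ s) {s : Finset E}
    (hs : s ∈ stellar F u v p) {w : E →₀ ℝ} {x : E} (hw : IsWeight s w x) :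
    ∃ t ∈ F, IsWeight t (w + w p • (Finsupp.single u (1 - θ) + Finsupp.single v θ
      - Finsupp.single p 1)) x := by
  obtain ⟨-, -, hs | ⟨hps, t, ht, hu, hv, hst⟩⟩ := hs
  · refine ⟨s, hs, ?_⟩
    rw [hw.zero p (hpF s hs), zero_smul, add_zero]
    exact hw
  · have hup : u ≠ p := fun h => hpF t ht (h ▸ hu)
    have hvp : v ≠ p := fun h => hpF t ht (h ▸ hv)
    refine ⟨t, ht, fun z => ?_, fun z hz => ?_, ?_, ?_⟩
    · have := hw.nonneg z
      have hwp := hw.nonneg p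
      simp only [Finsupp.add_apply, Finsupp.smul_apply, Finsupp.sub_apply, Finsupp.single_apply,
        smul_eq_mul]
      have hp1 : 0 ≤ w p * (1 - θ) := mul_nonneg hwp (by linarith)
      have hp2 : 0 ≤ w p * θ := mul_nonneg hwp h0.le
      by_cases hzp : p = z
      · subst hzp
        simp [hup, hvp]
      · rw [if_neg hzp]
        split_ifs <;> nlinarith
    · have hzu : u ≠ z := fun h => hz (h ▸ hu)
      have hzv : v ≠ z := fun h => hz (h ▸ hv)
      simp only [Finsupp.add_apply, Finsupp.smul_apply, Finsupp.sub_apply, Finsupp.single_apply,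
        smul_eq_mul, hzu, hzv, if_false]
      by_cases hzp : p = z
      · subst hzp
        simp
      · rw [if_neg hzp, hw.zero z fun hzs =>
          hz (hst (Finset.mem_erase.mpr ⟨fun h => hzp h.symm, hzs⟩))]
        simp
    · simp [hw.sum]
    · simp [hw.comb, hp, sub_smul]

theorem isWComplex_stellar {F : Set (Finset E)} (hF : IsWComplex F) {u v p : E} {θ : ℝ}
    (h0 : 0 < θ) (h1 : θ < 1) (huv : u ≠ v) {t₀ : Finset E} (ht₀ : t₀ ∈ F) (hu₀ : u ∈ t₀)
    (hv₀ : v ∈ t₀) (hp : p = (1 - θ) • u + θ • v) :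
    IsWComplex (stellar F u v p) ∧ IsRefinement (stellar F u v p) F := by
  classical
  have hpF : ∀ s ∈ F, p ∉ s := fun s hs => IsWComplex.midpoint_notMem hF h0 h1 huv ht₀ hu₀ hv₀ hp hs
  have new : ∀ t ∈ F, u ∈ t → v ∈ t → ∀ a, a = u ∨ a = v →
      insert p (t.erase a) ∈ stellar F u v p := by
    intro t ht hu hv a ha
    have hup : u ≠ p := fun h => hpF t ht (h ▸ hu)
    have hvp : v ≠ p := fun h => hpF t ht (h ▸ hv)
    refine ⟨⟨p, Finset.mem_insert_self _ _⟩, ?_,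
      Or.inr ⟨Finset.mem_insert_self _ _, t, ht, hu, hv, ?_⟩⟩
    · rcases ha with rfl | rfl <;> simp [hup, hvp]
    · exact (Finset.erase_insert_subset _ _).trans (Finset.erase_subset _ _)
  have newcard : ∀ t ∈ F, ∀ a ∈ t, (insert p (t.erase a)).card = t.card := by
    intro t ht a ha
    rw [Finset.card_insert_of_notMem fun h => hpF t ht (Finset.mem_of_mem_erase h),
      Finset.card_erase_add_one ha]
  have hsub : ∀ s ∈ stellar F u v p, s ∈ F ∨ ∃ t ∈ F, u ∈ t ∧ v ∈ t ∧ ∃ a, (a = u ∨ a = v) ∧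
      s ⊆ insert p (t.erase a) := by
    rintro s ⟨-, hns, hs | ⟨hps, t, ht, hu, hv, hst⟩⟩
    · exact Or.inl hs
    · refine Or.inr ⟨t, ht, hu, hv, ?_⟩
      have : ∃ a, (a = u ∨ a = v) ∧ a ∉ s := by
        by_contra! h
        exact hns ⟨h u (Or.inl rfl), h v (Or.inr rfl)⟩
      obtain ⟨a, ha, has⟩ := this
      refine ⟨a, ha, fun z hz => ?_⟩
      by_cases hzp : z = p
      · exact hzp ▸ Finset.mem_insert_self _ _
      · exact Finset.mem_insert_of_mem (Finset.mem_erase.mpr ⟨fun h => has (h ▸ hz),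
          hst (Finset.mem_erase.mpr ⟨hzp, hz⟩)⟩)
  have pure' : ∀ s ∈ F, s ∈ stellar F u v p → ∃ t ∈ stellar F u v p, s ⊆ t ∧ t.card = 3 := by
    intro s hs hs'
    obtain ⟨t, ht, hst, h3⟩ := hF.pure s hs
    by_cases huv' : u ∈ t ∧ v ∈ t
    · have : ∃ a, (a = u ∨ a = v) ∧ a ∉ s := by
        by_contra! h
        exact hs'.2.1 ⟨h u (Or.inl rfl), h v (Or.inr rfl)⟩
      obtain ⟨a, ha, has⟩ := this
      refine ⟨_, new t ht huv'.1 huv'.2 a ha, fun z hz => Finset.mem_insert_of_mem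
        (Finset.mem_erase.mpr ⟨fun h => has (h ▸ hz), hst hz⟩), ?_⟩
      rw [newcard t ht a (by rcases ha with rfl | rfl; exacts [huv'.1, huv'.2]), h3]
    · exact ⟨t, ⟨hF.nonempty t ht, huv', Or.inl ht⟩, hst, h3⟩
  refine ⟨⟨?_, fun s hs => hs.1, ?_, ?_, ?_, ?_⟩, ?_, ?_⟩
  · have : stellar F u v p ⊆ F ∪ ⋃ t ∈ F, ↑(insert p t).powerset := by
      intro s hs
      rcases hsub s hs with h | ⟨t, ht, -, -, a, -, hst⟩
      · exact Or.inl h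
      · refine Or.inr (mem_biUnion ht ?_)
        exact Finset.mem_coe.mpr (Finset.mem_powerset.mpr (hst.trans
          (Finset.insert_subset_insert _ (Finset.erase_subset _ _))))
    exact (hF.finite.union (hF.finite.biUnion fun t _ => Finset.finite_toSet _)).subset this
  · rintro s ⟨-, hns, hs⟩ t hts htn
    refine ⟨htn, fun h => hns ⟨hts h.1, hts h.2⟩, ?_⟩
    rcases hs with hs | ⟨hps, r, hr, hu, hv, hsr⟩
    · exact Or.inl (hF.down s hs t hts htn)
    · by_cases hpt : p ∈ t
      · exact Or.inr ⟨hpt, r, hr, hu, hv, (Finset.erase_subset_erase p hts).trans hsr⟩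
      · refine Or.inl (hF.down r hr t (fun z hz => hsr (Finset.mem_erase.mpr
          ⟨fun h => hpt (h ▸ hz), hts hz⟩)) htn)
  · intro s hs t ht w w' x hw hw'
    obtain ⟨s', hs', e⟩ := exists_push h0 h1 hp hpF hs hw
    obtain ⟨t', ht', e'⟩ := exists_push h0 h1 hp hpF ht hw'
    have key := hF.unique s' hs' t' ht' _ _ _ e e'
    have hup : u ≠ p := fun h => hpF t₀ ht₀ (h ▸ hu₀)
    have hvp : v ≠ p := fun h => hpF t₀ ht₀ (h ▸ hv₀)
    have eu := DFunLike.congr_fun key u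
    have ev := DFunLike.congr_fun key v
    simp only [Finsupp.add_apply, Finsupp.smul_apply, Finsupp.sub_apply, Finsupp.single_apply,
      smul_eq_mul, huv, huv.symm, hup.symm, hvp.symm, if_true, if_false, add_zero, sub_zero,
      zero_add] at eu ev
    have hs0 : w u = 0 ∨ w v = 0 := by
      rcases not_and_or.mp hs.2.1 with h | h
      exacts [Or.inl (hw.zero _ h), Or.inr (hw.zero _ h)]
    have ht0 : w' u = 0 ∨ w' v = 0 := by
      rcases not_and_or.mp ht.2.1 with h | h
      exacts [Or.inl (hw'.zero _ h), Or.inr (hw'.zero _ h)]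
    have n1 := hw.nonneg u
    have n2 := hw.nonneg v
    have n3 := hw'.nonneg u
    have n4 := hw'.nonneg v
    have hpp : w p = w' p := by
      rcases lt_trichotomy (w p) (w' p) with h | h | h
      · have g1 : 0 < (w' p - w p) * (1 - θ) := mul_pos (by linarith) (by linarith)
        have g2 : 0 < (w' p - w p) * θ := mul_pos (by linarith) h0
        rcases hs0 with h | h <;> nlinarith
      · exact h
      · have g1 : 0 < (w p - w' p) * (1 - θ) := mul_pos (by linarith) (by linarith)
        have g2 : 0 < (w p - w' p) * θ := mul_pos (by linarith) h0
        rcases ht0 with h | h <;> nlinarith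
    rw [hpp] at key
    exact add_right_cancel key
  · intro s hs
    rcases hsub s hs with h | ⟨t, ht, hu, hv, a, ha, hst⟩
    · exact hF.card s h
    · refine (Finset.card_le_card hst).trans ?_
      rw [newcard t ht a (by rcases ha with rfl | rfl; exacts [hu, hv])]
      exact hF.card t ht
  · intro s hs
    rcases hsub s hs with h | ⟨t, ht, hu, hv, a, ha, hst⟩
    · exact pure' s h hs
    · obtain ⟨r, hr, htr, h3⟩ := hF.pure t ht
      refine ⟨_, new r hr (htr hu) (htr hv) a ha, hst.trans
        (Finset.insert_subset_insert _ (Finset.erase_subset_erase _ htr)), ?_⟩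
      rw [newcard r hr a (by rcases ha with rfl | rfl; exacts [htr hu, htr hv]), h3]
  · intro s hs
    rcases hsub s hs with h | ⟨t, ht, hu, hv, a, -, hst⟩
    · exact ⟨s, h, fun z hz => subset_convexHull ℝ _ hz⟩
    · refine ⟨t, ht, fun z hz => ?_⟩
      rcases Finset.mem_insert.mp (hst hz) with rfl | h
      · rw [hp]
        exact (convex_convexHull ℝ _) (subset_convexHull ℝ _ hu) (subset_convexHull ℝ _ hv)
          (by linarith) h0.le (by ring)
      · exact subset_convexHull ℝ _ (Finset.mem_of_mem_erase h)
  · intro t ht x hx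
    by_cases huv' : u ∈ t ∧ v ∈ t
    · obtain ⟨w, hw⟩ := exists_isWeight hx
      obtain ⟨hu, hv⟩ := huv'
      have hup : u ≠ p := fun h => hpF t ht (h ▸ hu)
      have hvp : v ≠ p := fun h => hpF t ht (h ▸ hv)
      set l : ℝ := min (w u / (1 - θ)) (w v / θ) with hl
      have hθ : 0 < 1 - θ := by linarith
      have l0 : 0 ≤ l := le_min (div_nonneg (hw.nonneg u) hθ.le) (div_nonneg (hw.nonneg v) h0.le)
      have l1 : l * (1 - θ) ≤ w u := (le_div_iff₀ hθ).mp (min_le_left _ _)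
      have l2 : l * θ ≤ w v := (le_div_iff₀ h0).mp (min_le_right _ _)
      obtain ⟨a, ha, hla⟩ : ∃ a, (a = u ∨ a = v) ∧ (a = u ∧ l * (1 - θ) = w u ∨
          a = v ∧ l * θ = w v) := by
        rcases min_choice (w u / (1 - θ)) (w v / θ) with h | h
        · exact ⟨u, Or.inl rfl, Or.inl ⟨rfl, by rw [hl, h]; field_simp⟩⟩
        · exact ⟨v, Or.inr rfl, Or.inr ⟨rfl, by rw [hl, h]; field_simp⟩⟩
      refine ⟨_, new t ht hu hv a ha, IsWeight.mem (w := w - l • (Finsupp.single u (1 - θ) +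
        Finsupp.single v θ - Finsupp.single p 1)) ⟨fun z => ?_, fun z hz => ?_, ?_, ?_⟩⟩
      · have hz := hw.nonneg z
        have hwp := hw.zero p (hpF t ht)
        simp only [Finsupp.add_apply, Finsupp.smul_apply, Finsupp.sub_apply, Finsupp.single_apply,
          smul_eq_mul]
        by_cases hzp : p = z
        · subst hzp
          simp [hup, hvp, hwp, l0]
        · by_cases hzu : u = z
          · subst hzu
            simp only [huv.symm, hzp, if_true, if_false]
            linarith
          · by_cases hzv : v = z
            · subst hzv
              simp only [huv, hzp, if_true, if_false]
              linarith
            · simp [hzu, hzv, hzp, hz]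
      · have hzp : p ≠ z := fun h => hz (h ▸ Finset.mem_insert_self _ _)
        simp only [Finsupp.add_apply, Finsupp.smul_apply, Finsupp.sub_apply, Finsupp.single_apply,
          smul_eq_mul, hzp, if_false]
        by_cases hza : z = a
        · subst hza
          rcases hla with ⟨rfl, h⟩ | ⟨rfl, h⟩
          · simp only [huv.symm, if_true, if_false]
            linarith
          · simp only [huv, if_true, if_false]
            linarith
        · have hzt : z ∉ t := fun h => hz (Finset.mem_insert_of_mem (Finset.mem_erase.mpr ⟨hza, h⟩))
          have hzu : u ≠ z := fun h => hzt (h ▸ hu)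
          have hzv : v ≠ z := fun h => hzt (h ▸ hv)
          simp [hzu, hzv, hw.zero z hzt]
      · simp [hw.sum]
      · simp [hw.comb, hp, sub_smul]
    · exact ⟨t, ⟨hF.nonempty t ht, huv', Or.inl ht⟩, hx⟩

end WeightComplex

section Subdivide

variable {E : Type*} [AddCommGroup E] [Module ℝ E]

/-- The edges of `F` on whose endpoints `g` takes strictly opposite signs. -/
def crossing (F : Set (Finset E)) (g : E →ᵃ[ℝ] ℝ) : Set (E × E) :=
  {e | g e.1 < 0 ∧ 0 < g e.2 ∧ ∃ s ∈ F, e.1 ∈ s ∧ e.2 ∈ s}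

/-- `g` does not change sign on any face of `F`. -/
def OneSigned (F : Set (Finset E)) (g : E →ᵃ[ℝ] ℝ) : Prop :=
  ∀ s ∈ F, (∀ z ∈ s, 0 ≤ g z) ∨ ∀ z ∈ s, g z ≤ 0

theorem IsRefinement.oneSigned {F F' : Set (Finset E)} (h : IsRefinement F' F) {g : E →ᵃ[ℝ] ℝ}
    (hg : OneSigned F g) : OneSigned F' g := by
  intro s hs
  obtain ⟨t, ht, hst⟩ := h.into s hs
  refine (hg t ht).imp (fun H z hz => ?_) (fun H z hz => ?_) <;>
  obtain ⟨w, hw⟩ := exists_isWeight (hst z hz) <;>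
  rw [hw.map g]
  · exact Finset.sum_nonneg fun y hy => mul_nonneg (hw.nonneg y) (H y hy)
  · exact Finset.sum_nonpos fun y hy => mul_nonpos_of_nonneg_of_nonpos (hw.nonneg y) (H y hy)

theorem crossing_finite {F : Set (Finset E)} (hF : F.Finite) (g : E →ᵃ[ℝ] ℝ) :
    (crossing F g).Finite := by
  refine (hF.biUnion fun s _ => ((Finset.finite_toSet s).prod (Finset.finite_toSet s))).subset ?_
  rintro e ⟨-, -, s, hs, h1, h2⟩
  exact mem_biUnion hs ⟨h1, h2⟩

theorem IsWComplex.exists_oneSigned {F : Set (Finset E)} (hF : IsWComplex F) (g : E →ᵃ[ℝ] ℝ) :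
    ∃ F', IsWComplex F' ∧ IsRefinement F' F ∧ OneSigned F' g := by
  classical
  induction hn : (crossing F g).ncard using Nat.strong_induction_on generalizing F with
  | _ n ih =>
    rcases (crossing F g).eq_empty_or_nonempty with h | ⟨⟨u, v⟩, hu, hv, t, ht, hut, hvt⟩
    · refine ⟨F, hF, IsRefinement.refl F, fun s hs => ?_⟩
      by_contra! H
      obtain ⟨⟨a, ha, ha'⟩, b, hb, hb'⟩ := H
      exact (h ▸ (⟨ha', hb', s, hs, ha, hb⟩ : (a, b) ∈ crossing F g) : (a, b) ∈ (∅ : Set (E × E)))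
    · simp only at hu hv hut hvt
      have huv : u ≠ v := fun h => by rw [h] at hu; linarith
      set θ := g u / (g u - g v) with hθ
      have hd : g u - g v < 0 := by linarith
      have h0 : 0 < θ := div_pos_of_neg_of_neg hu hd
      have h1 : θ < 1 := by rw [hθ, div_lt_one_of_neg hd]; linarith
      set p := (1 - θ) • u + θ • v with hp
      obtain ⟨hF', hR⟩ := isWComplex_stellar hF h0 h1 huv ht hut hvt hp
      have hgp : g p = 0 := by
        have : p = AffineMap.lineMap u v θ := by rw [AffineMap.lineMap_apply_module]
        rw [this, AffineMap.apply_lineMap, AffineMap.lineMap_apply_module, hθ]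
        simp only [smul_eq_mul]
        field_simp [hd.ne]
        ring
      have hsub : crossing (stellar F u v p) g ⊂ crossing F g := by
        refine ⟨?_, fun h => ?_⟩
        · rintro ⟨a, b⟩ ⟨ha, hb, s, hs, has, hbs⟩
          refine ⟨ha, hb, ?_⟩
          obtain ⟨-, -, hs | ⟨-, r, hr, -, -, hsr⟩⟩ := hs
          · exact ⟨s, hs, has, hbs⟩
          · simp only at ha hb has hbs
            refine ⟨r, hr, hsr (Finset.mem_erase.mpr ⟨?_, has⟩),
              hsr (Finset.mem_erase.mpr ⟨?_, hbs⟩)⟩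
            · rintro rfl
              linarith
            · rintro rfl
              linarith
        · obtain ⟨-, -, s, hs, has, hbs⟩ :=
            h (show (u, v) ∈ crossing F g from ⟨hu, hv, t, ht, hut, hvt⟩)
          exact hs.2.1 ⟨has, hbs⟩
      have hlt := Set.ncard_lt_ncard hsub (crossing_finite hF.finite g)
      obtain ⟨F', h1, h2, h3⟩ := ih _ (hn ▸ hlt) hF' rfl
      exact ⟨F', h1, h2.trans hR, h3⟩

theorem IsWComplex.exists_oneSigned_all {F : Set (Finset E)} (hF : IsWComplex F)
    {𝒢 : Set (E →ᵃ[ℝ] ℝ)} (h𝒢 : 𝒢.Finite) :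
    ∃ F', IsWComplex F' ∧ IsRefinement F' F ∧ ∀ g ∈ 𝒢, OneSigned F' g := by
  induction 𝒢, h𝒢 using Set.Finite.induction_on with
  | empty => exact ⟨F, hF, IsRefinement.refl F, fun g hg => hg.elim⟩
  | insert _ _ ih =>
    rename_i g 𝒢 _ _
    obtain ⟨F1, h1, h2, h3⟩ := ih
    obtain ⟨F2, g1, g2, g3⟩ := h1.exists_oneSigned g
    refine ⟨F2, g1, g2.trans h2, fun g' hg' => ?_⟩
    rcases hg' with rfl | hg'
    · exact g3
    · exact g2.oneSigned (h3 g' hg')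

theorem isWComplex_of_isTriangulation {K : SimplicialComplex ℝ E2} {Ω : Set E2}
    (hK : IsTriangulation K Ω) : IsWComplex K.faces where
  finite := hK.1
  nonempty s hs := K.nonempty_of_mem_faces hs
  down s hs t hst ht := K.down_closed hs hst ht
  unique s hs t ht w w' x hw hw' := by
    classical
    have hx := K.inter_subset_convexHull hs ht ⟨hw.mem, hw'.mem⟩
    rw [← Finset.coe_inter] at hx
    obtain ⟨v, hv⟩ := exists_isWeight hx
    rw [hw.unique (K.indep hs) (hv.mono Finset.inter_subset_left),
      hw'.unique (K.indep ht) (hv.mono Finset.inter_subset_right)]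
  card := hK.2.1
  pure s hs := hK.2.2.2 s hs

/-- The simplicial complex of a complex with unique weights. -/
def IsWComplex.toComplex {F : Set (Finset E)} (hF : IsWComplex F) : SimplicialComplex ℝ E where
  faces := F
  isRelLowerSet_faces s hs := ⟨hF.nonempty s hs, fun t hst ht => hF.down s hs t hst ht⟩
  indep hs := affineIndependent_of_weights fun w w' x hw hw' => hF.unique _ hs _ hs w w' x hw hw'
  inter_subset_convexHull := by
    classical
    rintro s t hs ht x ⟨hxs, hxt⟩
    obtain ⟨w, hw⟩ := exists_isWeight hxs
    obtain ⟨w', hw'⟩ := exists_isWeight hxt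
    have e := hF.unique s hs t ht w w' x hw hw'
    subst e
    rw [← Finset.coe_inter]
    exact IsWeight.mem ⟨hw.nonneg, fun z hz => by
      rw [Finset.mem_inter, not_and_or] at hz
      exact hz.elim (hw.zero z) (hw'.zero z), hw.sum, hw.comb⟩

theorem IsWComplex.isTriangulation {F : Set (Finset E2)} (hF : IsWComplex F)
    {K : SimplicialComplex ℝ E2} {Ω : Set E2} (hK : IsTriangulation K Ω)
    (hR : IsRefinement F K.faces) : IsTriangulation hF.toComplex Ω := by
  refine ⟨hF.finite, hF.card, ?_, hF.pure⟩
  rw [← hK.2.2.1]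
  ext x
  rw [SimplicialComplex.mem_space_iff, SimplicialComplex.mem_space_iff]
  constructor
  · rintro ⟨s, hs, hx⟩
    obtain ⟨t, ht, hst⟩ := hR.into s hs
    exact ⟨t, ht, convexHull_min hst (convex_convexHull ℝ _) hx⟩
  · rintro ⟨t, ht, hx⟩
    exact hR.onto t ht x hx

theorem map_eq_of_positive {s : Finset E} {b : E → ℝ} (h0 : ∀ z ∈ s, 0 < b z)
    (h1 : ∑ z ∈ s, b z = 1) {A B : E →ᵃ[ℝ] ℝ}
    (hsgn : (∀ z ∈ s, A z ≤ B z) ∨ ∀ z ∈ s, B z ≤ A z)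
    (hAB : A (∑ z ∈ s, b z • z) = B (∑ z ∈ s, b z • z)) {x : E}
    (hx : x ∈ convexHull ℝ (s : Set E)) : A x = B x := by
  wlog h : ∀ z ∈ s, A z ≤ B z generalizing A B
  · exact (this hsgn.symm hAB.symm (hsgn.resolve_left h)).symm
  obtain ⟨w, hw, hw'⟩ := isWeight_of_fun (fun z hz => (h0 z hz).le) h1
  rw [hw'.map A, hw'.map B] at hAB
  have e := (Finset.sum_eq_sum_iff_of_le fun z hz =>
    mul_le_mul_of_nonneg_left (h z hz) (hw'.nonneg z)).mp hAB
  obtain ⟨v, hv⟩ := exists_isWeight hx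
  rw [hv.map A, hv.map B]
  refine Finset.sum_congr rfl fun z hz => ?_
  rw [mul_left_cancel₀ (hw z hz ▸ (h0 z hz).ne') (e z hz)]

theorem eq_affine_of_oneSigned {s : Finset E2} (hs : s.Nonempty) {𝒜 : Set (E2 →ᵃ[ℝ] E2)}
    (h𝒜 : 𝒜.Finite) {f : E2 → E2} (hc : ContinuousOn f (convexHull ℝ (s : Set E2)))
    (hf : ∀ x ∈ convexHull ℝ (s : Set E2), ∃ A ∈ 𝒜, f x = A x)
    (hsgn : ∀ A ∈ 𝒜, ∀ B ∈ 𝒜, ∀ i, (∀ z ∈ s, A z i ≤ B z i) ∨ ∀ z ∈ s, B z i ≤ A z i) :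
    ∃ A ∈ 𝒜, ∀ x ∈ convexHull ℝ (s : Set E2), f x = A x := by
  have hn : (0 : ℝ) < s.card := Nat.cast_pos.mpr (Finset.card_pos.mpr hs)
  have hb1 : ∑ z ∈ s, (1 / (s.card : ℝ)) = 1 := by
    rw [Finset.sum_const, nsmul_eq_mul]
    field_simp
  set c : E2 := ∑ z ∈ s, (1 / (s.card : ℝ)) • z with hcdef
  have hcs : c ∈ convexHull ℝ (s : Set E2) :=
    Finset.mem_convexHull'.mpr ⟨_, fun z _ => by positivity, hb1, rfl⟩
  obtain ⟨A, hA, hAc⟩ := hf c hcs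
  refine ⟨A, hA, fun x hx => ?_⟩
  obtain ⟨b, hb0, hbs, hbx⟩ := Finset.mem_convexHull'.mp hx
  set γ : ℝ → E2 := fun t => c + t • (x - c) with hγ
  have hγc : Continuous γ := by fun_prop
  have hγs : ∀ t ∈ Icc (0 : ℝ) 1, γ t ∈ convexHull ℝ (s : Set E2) := fun t ht =>
    (convex_convexHull ℝ _).add_smul_sub_mem hcs hx ht
  have hfγ : ContinuousOn (fun t => f (γ t)) (Icc 0 1) := hc.comp hγc.continuousOn hγs
  have hcl : ∀ B : E2 →ᵃ[ℝ] E2, IsClosed {t ∈ Icc (0 : ℝ) 1 | f (γ t) = B (γ t)} := fun B => by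
    have hBc : Continuous fun t => B (γ t) := B.continuous_of_finiteDimensional.comp hγc
    have := (hfγ.sub hBc.continuousOn).preimage_isClosed_of_isClosed isClosed_Icc
      (isClosed_singleton (x := (0 : E2)))
    convert this using 1
    ext t
    simp [sub_eq_zero]
  set Z : Set ℝ := ⋃ B ∈ {B ∈ 𝒜 | B c ≠ A c}, {t ∈ Icc (0 : ℝ) 1 | f (γ t) = B (γ t)} with hZ
  have hZc : IsClosed Z := (h𝒜.subset (sep_subset _ _)).isClosed_biUnion fun B _ => hcl B
  have key : ∀ t ∈ Ico (0 : ℝ) 1, ∀ B ∈ 𝒜, A (γ t) = B (γ t) → ∀ y ∈ convexHull ℝ (s : Set E2),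
      A y = B y := by
    intro t ht B hB hAB y hy
    ext i
    have e : γ t = ∑ z ∈ s, ((1 - t) * (1 / s.card) + t * b z) • z := by
      simp only [add_smul, Finset.sum_add_distrib, mul_smul, ← Finset.smul_sum]
      rw [hbx, hγ, Finset.smul_sum, ← Finset.smul_sum, ← hcdef]
      module
    have := map_eq_of_positive (s := s) (b := fun z => (1 - t) * (1 / s.card) + t * b z)
      (A := (EuclideanSpace.proj i : E2 →L[ℝ] ℝ).toLinearMap.toAffineMap.comp A)
      (B := (EuclideanSpace.proj i : E2 →L[ℝ] ℝ).toLinearMap.toAffineMap.comp B)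
      (fun z hz => add_pos_of_pos_of_nonneg
        (mul_pos (by linarith [ht.2]) (by positivity)) (mul_nonneg ht.1 (hb0 z hz)))
      (by rw [Finset.sum_add_distrib, ← Finset.mul_sum, hb1, ← Finset.mul_sum, hbs]; ring)
      (by simpa using hsgn A hA B hB i) (by rw [← e]; simp [hAB]) hy
    simpa using this
  have hall : ∀ t ∈ Ico (0 : ℝ) 1, f (γ t) = A (γ t) := by
    intro t ht
    by_contra hne
    have hcov : ∀ r ∈ Ico (0 : ℝ) 1, r ∈ {t ∈ Icc (0 : ℝ) 1 | f (γ t) = A (γ t)} ∪ Z := by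
      intro r hr
      have hr' := Ico_subset_Icc_self hr
      obtain ⟨B, hB, hBr⟩ := hf (γ r) (hγs r hr')
      by_cases hBc : B c = A c
      · refine Or.inl ⟨hr', ?_⟩
        have h0 : γ 0 = c := by simp [hγ]
        rw [hBr]
        exact (key 0 ⟨le_rfl, one_pos⟩ B hB (by rw [h0, hBc]) _ (hγs r hr')).symm
      · exact Or.inr (mem_biUnion (show B ∈ {B ∈ 𝒜 | B c ≠ A c} from ⟨hB, hBc⟩) ⟨hr', hBr⟩)
    have hpre := isPreconnected_closed_iff.mp (isPreconnected_Ico (a := (0 : ℝ)) (b := 1)) _ Z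
      (hcl A) hZc hcov
      ⟨0, ⟨le_rfl, one_pos⟩, ⟨le_rfl, zero_le_one⟩, by simpa [hγ] using hAc⟩
      ⟨t, ht, (hcov t ht).resolve_left fun h => hne h.2⟩
    obtain ⟨r, hr, hrA, hrZ⟩ := hpre
    obtain ⟨B, ⟨hB, hBc⟩, -, hBr⟩ := mem_iUnion₂.mp hrZ
    exact hBc (key r hr B hB (hrA.2.symm.trans hBr) c hcs).symm
  have hcl1 : (1 : ℝ) ∈ closure {t ∈ Icc (0 : ℝ) 1 | f (γ t) = A (γ t)} := by
    have : (1 : ℝ) ∈ closure (Ico (0 : ℝ) 1) := by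
      rw [closure_Ico zero_ne_one]
      exact ⟨zero_le_one, le_rfl⟩
    have hsub : Ico (0 : ℝ) 1 ⊆ {t ∈ Icc (0 : ℝ) 1 | f (γ t) = A (γ t)} := fun t ht =>
      ⟨Ico_subset_Icc_self ht, hall t ht⟩
    exact closure_mono hsub this
  rw [(hcl A).closure_eq] at hcl1
  have h1 : γ 1 = x := by simp [hγ]
  rw [← h1]
  exact hcl1.2

theorem exists_triangulation {Ω : Set E2} (hΩ : IsClosedPolygon Ω) {f : E2 → E2}
    (hc : ContinuousOn f Ω) (hf : PLOn f Ω) :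
    ∃ K, IsTriangulation K Ω ∧ PiecewiseAffineOn f K := by
  obtain ⟨-, K, hK⟩ := hΩ
  obtain ⟨𝒜, h𝒜, hf⟩ := hf
  have hfin : (image2 (fun (q : (E2 →ᵃ[ℝ] E2) × (E2 →ᵃ[ℝ] E2)) (i : Fin 2) =>
      (EuclideanSpace.proj i : E2 →L[ℝ] ℝ).toLinearMap.toAffineMap.comp (q.1 - q.2))
      (𝒜 ×ˢ 𝒜) univ).Finite := (h𝒜.prod h𝒜).image2 _ finite_univ
  obtain ⟨F, hF, hR, hS⟩ := (isWComplex_of_isTriangulation hK).exists_oneSigned_all hfin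
  have hT := hF.isTriangulation hK hR
  refine ⟨hF.toComplex, hT, fun s hs => ?_⟩
  have hsub : convexHull ℝ (s : Set E2) ⊆ Ω := by
    rw [← hT.2.2.1]
    exact SimplicialComplex.convexHull_subset_space hs
  obtain ⟨A, -, hA⟩ := eq_affine_of_oneSigned (hF.nonempty s hs) h𝒜 (hc.mono hsub)
    (fun x hx => hf x (hsub hx)) (fun A hA B hB i => by
      have := hS _ (mem_image2_of_mem (Set.mk_mem_prod hA hB) (mem_univ i)) s hs
      refine this.symm.imp (fun H z hz => ?_) (fun H z hz => ?_)
      · simpa using H z hz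
      · simpa using H z hz)
  exact ⟨A, fun x hx => hA x hx⟩

end Subdivide

section Barycentric

variable {E ι : Type*} [NormedAddCommGroup E] [NormedSpace ℝ E] [Fintype ι]

/-- `b` gives global barycentric coordinates on `Ω` for a complex with triangles `F` and vertices
`P`. -/
structure IsBary (F : Set (Finset ι)) (P : ι → E) (Ω : Set E) (b : E → ι → ℝ) : Prop where
  card : ∀ s ∈ F, s.card = 3
  nonneg : ∀ x ∈ Ω, ∀ i, 0 ≤ b x i
  face : ∀ x ∈ Ω, ∃ s ∈ F, ∀ i, i ∉ s → b x i = 0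
  sum : ∀ x ∈ Ω, ∑ i, b x i = 1
  comb : ∀ x ∈ Ω, ∑ i, b x i • P i = x
  eq : ∀ s ∈ F, ∀ c : ι → ℝ, (∀ i, 0 ≤ c i) → (∀ i, i ∉ s → c i = 0) → ∑ i, c i = 1 →
    ∑ i, c i • P i ∈ Ω ∧ b (∑ i, c i • P i) = c
  pl : ∀ i, PLOn (fun x => b x i) Ω

theorem norm_le_mul_of_closed_cone {X : Type*} [NormedAddCommGroup X] [NormedSpace ℝ X]
    [FiniteDimensional ℝ X] {D : Set X} (hD : IsClosed D)
    (hcone : ∀ d ∈ D, ∀ r : ℝ, 0 ≤ r → r • d ∈ D)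
    {f : X →ₗ[ℝ] E} (hf : ∀ d ∈ D, f d = 0 → d = 0) :
    ∃ L : ℝ, 0 ≤ L ∧ ∀ d ∈ D, ‖d‖ ≤ L * ‖f d‖ := by
  have hfc : Continuous f := f.continuous_of_finiteDimensional
  have hK : IsCompact (D ∩ sphere 0 1) := (isCompact_sphere 0 1).inter_left hD
  rcases (D ∩ sphere (0 : X) 1).eq_empty_or_nonempty with h | h
  · refine ⟨0, le_rfl, fun d hd => ?_⟩
    by_contra! hne
    rw [zero_mul] at hne
    have : ‖d‖⁻¹ • d ∈ D ∩ sphere (0 : X) 1 := by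
      refine ⟨hcone d hd _ (by positivity), ?_⟩
      rw [mem_sphere_zero_iff_norm, norm_smul, norm_inv, norm_norm, inv_mul_cancel₀ hne.ne']
    rw [h] at this
    exact this
  · obtain ⟨d₀, hd₀, hmin⟩ := hK.exists_isMinOn h hfc.norm.continuousOn
    have hpos : 0 < ‖f d₀‖ := by
      rw [norm_pos_iff]
      intro h0
      have := hf d₀ hd₀.1 h0
      have h1 := hd₀.2
      rw [this, mem_sphere_zero_iff_norm, norm_zero] at h1
      exact zero_ne_one h1
    refine ⟨‖f d₀‖⁻¹, by positivity, fun d hd => ?_⟩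
    by_cases hd0 : d = 0
    · simp [hd0]
    have hn : 0 < ‖d‖ := norm_pos_iff.mpr hd0
    have : ‖d‖⁻¹ • d ∈ D ∩ sphere (0 : X) 1 := by
      refine ⟨hcone d hd _ (by positivity), ?_⟩
      rw [mem_sphere_zero_iff_norm, norm_smul, norm_inv, norm_norm, inv_mul_cancel₀ hn.ne']
    have := hmin this
    simp only [Set.mem_ofPred_eq, map_smul, norm_smul, norm_inv, norm_norm] at this
    rw [inv_mul_eq_div, le_div_iff₀ hn] at this
    rw [inv_mul_eq_div, le_div_iff₀ hpos]
    linarith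

theorem IsBary.exists_lip {F : Set (Finset ι)} {P : ι → E} {Ω : Set E} {b : E → ι → ℝ}
    (hb : IsBary F P Ω b) :
    ∃ L : ℝ, 0 ≤ L ∧ ∀ x ∈ Ω, ∀ y ∈ Ω, ∀ i, |b x i - b y i| ≤ L * ‖x - y‖ := by
  set D : Set (ι → ℝ) := {d | ∑ i, d i = 0} ∩ ⋃ s ∈ F, ⋃ t ∈ F,
    {d | (∀ i, i ∉ s → d i ≤ 0) ∧ ∀ i, i ∉ t → 0 ≤ d i} with hD
  have hDc : IsClosed D := by
    refine (isClosed_eq (by fun_prop) continuous_const).inter ?_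
    refine F.toFinite.isClosed_biUnion fun s _ => F.toFinite.isClosed_biUnion fun t _ => ?_
    have e : {d : ι → ℝ | (∀ i, i ∉ s → d i ≤ 0) ∧ ∀ i, i ∉ t → 0 ≤ d i} =
        (⋂ i, ⋂ (_ : i ∉ s), {d | d i ≤ 0}) ∩ ⋂ i, ⋂ (_ : i ∉ t), {d | 0 ≤ d i} := by
      ext d
      simp
    rw [e]
    exact (isClosed_iInter fun i => isClosed_iInter fun _ =>
      isClosed_le (continuous_apply i) continuous_const).inter
      (isClosed_iInter fun i => isClosed_iInter fun _ =>
        isClosed_le continuous_const (continuous_apply i))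
  obtain ⟨L, hL, h⟩ := norm_le_mul_of_closed_cone (f := Fintype.linearCombination ℝ P) hDc
    (by
      rintro d ⟨h0, h1⟩ r hr
      simp only [mem_iUnion] at h1
      obtain ⟨s, hs, t, ht, h1, h2⟩ := h1
      refine ⟨?_, mem_biUnion hs (mem_biUnion ht ⟨fun i hi => ?_, fun i hi => ?_⟩)⟩
      · have h0 : ∑ i, d i = 0 := h0
        show ∑ i, r * d i = 0
        rw [← Finset.mul_sum, h0, mul_zero]
      · exact mul_nonpos_of_nonneg_of_nonpos hr (h1 i hi)
      · exact mul_nonneg hr (h2 i hi))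
    (by
      rintro d ⟨h0, h1⟩ hd
      have h0 : ∑ i, d i = 0 := h0
      simp only [mem_iUnion] at h1
      obtain ⟨s, hs, t, ht, h1, h2⟩ := h1
      rw [Fintype.linearCombination_apply] at hd
      have hpm : ∀ i, max (d i) 0 - max (-d i) 0 = d i := fun i => by
        rcases le_total (d i) 0 with h | h
        · rw [max_eq_right h, max_eq_left (by linarith)]; ring
        · rw [max_eq_left h, max_eq_right (by linarith)]; ring
      set c := ∑ i, max (d i) 0 with hc
      have hc' : ∑ i, max (-d i) 0 = c := by
        rw [hc, eq_comm, ← sub_eq_zero, ← Finset.sum_sub_distrib]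
        exact (Finset.sum_congr rfl fun i _ => hpm i).trans h0
      have hcomb : ∑ i, max (d i) 0 • P i = ∑ i, max (-d i) 0 • P i := by
        rw [← sub_eq_zero, ← Finset.sum_sub_distrib, ← hd]
        exact Finset.sum_congr rfl fun i _ => by rw [← sub_smul, hpm i]
      have hc0 : 0 ≤ c := Finset.sum_nonneg fun i _ => le_max_right _ _
      suffices hall : ∀ i, max (d i) 0 = max (-d i) 0 by
        funext i
        rw [← hpm i, hall i, sub_self]
        rfl
      intro i
      rcases hc0.eq_or_lt with h | h
      · have e1 := (Finset.sum_eq_zero_iff_of_nonneg fun i _ => le_max_right (d i) 0).mp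
          (hc.symm.trans h.symm) i (Finset.mem_univ i)
        have e2 := (Finset.sum_eq_zero_iff_of_nonneg fun i _ => le_max_right (-d i) 0).mp
          (hc'.trans h.symm) i (Finset.mem_univ i)
        rw [e1, e2]
      · have e1 := (hb.eq s hs (fun i => c⁻¹ * max (d i) 0) (fun i => by positivity)
          (fun i hi => by rw [max_eq_right (h1 i hi), mul_zero])
          (by rw [← Finset.mul_sum, ← hc, inv_mul_cancel₀ h.ne'])).2
        have e2 := (hb.eq t ht (fun i => c⁻¹ * max (-d i) 0) (fun i => by positivity)
          (fun i hi => by rw [max_eq_right (by linarith [h2 i hi]), mul_zero])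
          (by rw [← Finset.mul_sum, hc', inv_mul_cancel₀ h.ne'])).2
        simp only [mul_smul, ← Finset.smul_sum, hcomb] at e1 e2
        have := congrFun (e1.symm.trans e2) i
        exact mul_left_cancel₀ (inv_ne_zero h.ne') this)
  refine ⟨L, hL, fun x hx y hy i => ?_⟩
  obtain ⟨s, hs, hsx⟩ := hb.face x hx
  obtain ⟨t, ht, hty⟩ := hb.face y hy
  have hmem : b x - b y ∈ D := by
    refine ⟨?_, mem_biUnion hs (mem_biUnion ht ⟨fun i hi => ?_, fun i hi => ?_⟩)⟩
    · show ∑ i, (b x i - b y i) = 0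
      rw [Finset.sum_sub_distrib, hb.sum x hx, hb.sum y hy, sub_self]
    · have := hb.nonneg y hy i
      simp only [Pi.sub_apply, hsx i hi]
      linarith
    · have := hb.nonneg x hx i
      simp only [Pi.sub_apply, hty i hi]
      linarith
  have h1 := h _ hmem
  rw [map_sub, Fintype.linearCombination_apply, Fintype.linearCombination_apply, hb.comb x hx,
    hb.comb y hy] at h1
  exact (norm_le_pi_norm (b x - b y) i).trans h1

end Barycentric

theorem IsClosedPolygon.exists_isBary {Ω : Set E2} (hΩ : IsClosedPolygon Ω) :
    ∃ (V : Finset E2) (F : Set (Finset V)) (b : E2 → V → ℝ), IsBary F (fun i => (i : E2)) Ω b := by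
  classical
  obtain ⟨-, K, hK⟩ := hΩ
  have hW := isWComplex_of_isTriangulation hK
  set V : Finset E2 := hW.finite.toFinset.biUnion id with hV
  have hVs : ∀ s ∈ K.faces, s ⊆ V := fun s hs z hz =>
    Finset.mem_biUnion.mpr ⟨s, hW.finite.mem_toFinset.mpr hs, hz⟩
  set F : Set (Finset V) := {s | s.map (Function.Embedding.subtype _) ∈ K.faces ∧ s.card = 3}
  have hw : ∀ x : E2, ∃ w : E2 →₀ ℝ, x ∈ Ω → ∃ s ∈ K.faces, s.card = 3 ∧ IsWeight s w x := by
    intro x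
    by_cases hx : x ∈ Ω
    · rw [← hK.2.2.1] at hx
      obtain ⟨s, hs, hxs⟩ := SimplicialComplex.mem_space_iff.mp hx
      obtain ⟨t, ht, hst, h3⟩ := hW.pure s hs
      obtain ⟨w, hw⟩ := exists_isWeight hxs
      exact ⟨w, fun _ => ⟨t, ht, h3, hw.mono hst⟩⟩
    · exact ⟨0, fun h => (hx h).elim⟩
  choose w hw using hw
  refine ⟨V, F, fun x i => w x i, fun s hs => hs.2, fun x hx i => ?_, fun x hx => ?_,
    fun x hx => ?_, fun x hx => ?_, fun s hs c hc0 hcs hc1 => ?_, fun i => ?_⟩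
  · obtain ⟨s, -, -, h⟩ := hw x hx
    exact h.nonneg i
  · obtain ⟨s, hs, h3, h⟩ := hw x hx
    have e : (s.subtype (· ∈ V)).map (Function.Embedding.subtype _) = s := by
      rw [Finset.subtype_map, Finset.filter_true_of_mem fun z hz => hVs s hs hz]
    refine ⟨s.subtype (· ∈ V), ⟨by rwa [e], ?_⟩, fun i hi => h.zero i fun h => ?_⟩
    · rw [← h3, ← Finset.card_map (Function.Embedding.subtype _), e]
    · exact hi (Finset.mem_subtype.mpr h)
  · obtain ⟨s, hs, h3, h⟩ := hw x hx
    rw [← h.sum, linearCombination_eq_sum _ (h.mono (hVs s hs)).zero]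
    simp only [smul_eq_mul, mul_one]
    exact Finset.sum_coe_sort V fun z => w x z
  · obtain ⟨s, hs, h3, h⟩ := hw x hx
    conv_rhs => rw [← h.comb, linearCombination_eq_sum _ (h.mono (hVs s hs)).zero]
    exact Finset.sum_coe_sort V fun z => w x z • z
  · set c' : E2 → ℝ := fun z => if h : z ∈ V then c ⟨z, h⟩ else 0 with hc'
    have hcc : ∀ i : V, c' i = c i := fun i => by simp [hc']
    have e1 : ∑ z ∈ s.map (Function.Embedding.subtype _), c' z = 1 := by
      rw [Finset.sum_map, ← hc1, ← Finset.sum_subset (Finset.subset_univ s) fun i _ hi => hcs i hi]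
      exact Finset.sum_congr rfl fun i _ => hcc i
    have e2 : ∑ z ∈ s.map (Function.Embedding.subtype _), c' z • z = ∑ i, c i • (i : E2) := by
      rw [Finset.sum_map, ← Finset.sum_subset (Finset.subset_univ s) fun i _ hi => by
        rw [hcs i hi, zero_smul]]
      exact Finset.sum_congr rfl fun i _ => by rw [← hcc i]; rfl
    obtain ⟨v, hv, hv'⟩ := isWeight_of_fun (s := s.map (Function.Embedding.subtype _)) (b := c')
      (fun z hz => by
        obtain ⟨i, -, rfl⟩ := Finset.mem_map.mp hz
        exact (hcc i).symm ▸ hc0 i) e1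
    rw [e2] at hv'
    have hmem : ∑ i, c i • (i : E2) ∈ Ω := by
      rw [← hK.2.2.1]
      exact SimplicialComplex.mem_space_iff.mpr ⟨_, hs.1, hv'.mem⟩
    refine ⟨hmem, funext fun i => ?_⟩
    obtain ⟨t, ht, -, h⟩ := hw _ hmem
    rw [hW.unique t ht _ hs.1 _ _ _ h hv']
    by_cases hi : i ∈ s
    · rw [hv i (Finset.mem_map.mpr ⟨i, hi, rfl⟩), hcc]
    · rw [hcs i hi, hv'.zero]
      intro h
      obtain ⟨j, hj, hji⟩ := Finset.mem_map.mp h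
      exact hi (Subtype.ext hji ▸ hj)
  · have hA : ∀ s ∈ {s ∈ K.faces | s.card = 3}, ∃ A : E2 →ᵃ[ℝ] ℝ,
        ∀ x v, IsWeight s v x → v i = A x := by
      rintro s ⟨hs, h3⟩
      by_cases his : (i : E2) ∈ s
      · have hind := K.indep hs
        have htop : affineSpan ℝ (range ((↑) : s → E2)) = ⊤ :=
          hind.affineSpan_eq_top_iff_card_eq_finrank_add_one.mpr (by simp [h3])
        let B : AffineBasis s ℝ E2 := ⟨(↑), hind, htop⟩
        refine ⟨B.coord ⟨i, his⟩, fun x v hv => ?_⟩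
        rw [hv.map, Finset.sum_eq_single_of_mem (i : E2) his]
        · have : B.coord ⟨i, his⟩ (B ⟨i, his⟩) = 1 := B.coord_apply_eq _
          rw [show B ⟨i, his⟩ = (i : E2) from rfl] at this
          rw [this, mul_one]
        · intro z hz hne
          have : B.coord ⟨i, his⟩ (B ⟨z, hz⟩) = 0 := B.coord_apply_ne fun h =>
            hne (congrArg Subtype.val h).symm
          rw [show B ⟨z, hz⟩ = z from rfl] at this
          rw [this, mul_zero]
      · exact ⟨AffineMap.const ℝ E2 0, fun x v hv => by simp [hv.zero i his]⟩
    choose! A hA using hA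
    refine PLOn.select (s := {s ∈ K.faces | s.card = 3}) (hK.1.subset (sep_subset _ _))
      (f := fun s x => A s x) (fun s _ => PLOn.affine (A s)) fun x hx => ?_
    obtain ⟨s, hs, h3, h⟩ := hw x hx
    exact ⟨s, ⟨hs, h3⟩, hA s ⟨hs, h3⟩ x _ h⟩

section Tent

variable {ι : Type*} [Fintype ι]

/-- The tent function with peak at `c'` for the `ℓ¹` distance. -/
def tent (c c' : ι → ℝ) : ℝ := max 0 (1 - 1 / 2 * ∑ i, |c i - c' i|)

theorem two_mul_abs_le_sum {c : ι → ℝ} (hc : ∑ i, c i = 0) (k : ι) : 2 * |c k| ≤ ∑ i, |c i| := by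
  classical
  have h1 := Finset.add_sum_erase Finset.univ c (Finset.mem_univ k)
  have h2 := Finset.add_sum_erase Finset.univ (fun i => |c i|) (Finset.mem_univ k)
  have h3 := Finset.abs_sum_le_sum_abs c (Finset.univ.erase k)
  have h4 : ∑ i ∈ Finset.univ.erase k, c i = - c k := by linarith
  rw [h4, abs_neg] at h3
  linarith

theorem tent_add_smul (a β β' : ι → ℝ) {σ : ℝ} (hσ : |σ| = 1) :
    tent (fun i => a i + σ * β i) (fun i => a i + σ * β' i) = tent β β' := by
  unfold tent
  congr 3
  refine Finset.sum_congr rfl fun i _ => ?_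
  rw [add_sub_add_left_eq_sub, ← mul_sub, abs_mul, hσ, one_mul]

theorem tent_single [DecidableEq ι] {β : ι → ℝ} (h0 : ∀ i, 0 ≤ β i) (h1 : ∑ i, β i = 1) (k : ι) :
    tent β (Pi.single k 1) = β k := by
  have hs := Finset.add_sum_erase Finset.univ β (Finset.mem_univ k)
  have hk : β k ≤ 1 := by
    rw [← h1]
    exact Finset.single_le_sum (fun i _ => h0 i) (Finset.mem_univ k)
  have h2 := Finset.add_sum_erase Finset.univ (fun i => |β i - (Pi.single k 1 : ι → ℝ) i|)
    (Finset.mem_univ k)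
  have h3 : ∑ i ∈ Finset.univ.erase k, |β i - (Pi.single k 1 : ι → ℝ) i| =
      ∑ i ∈ Finset.univ.erase k, β i := by
    refine Finset.sum_congr rfl fun i hi => ?_
    rw [Pi.single_eq_of_ne (Finset.ne_of_mem_erase hi), sub_zero, abs_of_nonneg (h0 i)]
  rw [h3, Pi.single_eq_same, abs_of_nonpos (by linarith)] at h2
  rw [tent, ← h2, max_eq_right] <;> linarith [h0 k]

theorem tent_eq_zero [DecidableEq ι] {β : ι → ℝ} (h0 : ∀ i, 0 ≤ β i) (h1 : ∑ i, β i = 1)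
    {d : ι → ℤ} (hd : ∑ i, d i = 1) (hne : ∀ k, d = Pi.single k 1 → β k = 0) :
    tent β (fun i => (d i : ℝ)) = 0 := by
  have hs : ∑ i, (β i - (d i : ℝ)) = 0 := by
    rw [Finset.sum_sub_distrib, h1, ← Int.cast_sum, hd]
    norm_num
  suffices ∃ k, 1 ≤ |β k - d k| by
    obtain ⟨k, hk⟩ := this
    have := two_mul_abs_le_sum hs k
    exact max_eq_left (by linarith)
  by_cases hneg : ∃ k, d k ≤ -1
  · obtain ⟨k, hk⟩ := hneg
    have : (d k : ℝ) ≤ -1 := by exact_mod_cast hk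
    exact ⟨k, by rw [le_abs]; left; linarith [h0 k]⟩
  · push Not at hneg
    have hd0 : ∀ i, 0 ≤ d i := fun i => by have := hneg i; omega
    obtain ⟨k, -, hk⟩ : ∃ k ∈ Finset.univ, d k ≠ 0 :=
      Finset.exists_ne_zero_of_sum_ne_zero (by omega)
    have hk1 : 1 ≤ d k := by have := hd0 k; omega
    have h2 := Finset.add_sum_erase Finset.univ d (Finset.mem_univ k)
    have h3 : 0 ≤ ∑ i ∈ Finset.univ.erase k, d i := Finset.sum_nonneg fun i _ => hd0 i
    have h4 := (Finset.sum_eq_zero_iff_of_nonneg fun i _ => hd0 i).mp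
      (show ∑ i ∈ Finset.univ.erase k, d i = 0 by omega)
    have hdk : d = Pi.single k 1 := by
      funext i
      by_cases hi : i = k
      · subst hi
        rw [Pi.single_eq_same]
        omega
      · rw [Pi.single_eq_of_ne hi, h4 i (Finset.mem_erase.mpr ⟨hi, Finset.mem_univ _⟩)]
    refine ⟨k, ?_⟩
    rw [hne k hdk, hdk, Pi.single_eq_same]
    norm_num

theorem abs_tent_sub_le (c c' n : ι → ℝ) : |tent c n - tent c' n| ≤ 1 / 2 * ∑ i, |c i - c' i| := by
  have h : ∀ c c' : ι → ℝ, tent c n ≤ tent c' n + 1 / 2 * ∑ i, |c i - c' i| := by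
    intro c c'
    have h1 : ∑ i, |c' i - n i| ≤ ∑ i, |c i - n i| + ∑ i, |c i - c' i| := by
      rw [← Finset.sum_add_distrib]
      refine Finset.sum_le_sum fun i _ => ?_
      have := abs_sub_le (c' i) (c i) (n i)
      rw [abs_sub_comm (c' i) (c i)] at this
      linarith
    have h2 : 0 ≤ ∑ i, |c i - c' i| := Finset.sum_nonneg fun i _ => abs_nonneg _
    have h3 : 0 ≤ tent c' n := le_max_left _ _
    have h4 : 1 - 1 / 2 * ∑ i, |c' i - n i| ≤ tent c' n := le_max_right _ _
    refine max_le (by linarith) (by linarith)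
  rw [abs_le]
  have h1 := h c c'
  have h2 := h c' c
  simp only [abs_sub_comm (c' _) (c _)] at h2
  constructor <;> linarith

end Tent

section Fine

variable {E ι : Type*} [NormedAddCommGroup E] [NormedSpace ℝ E] [Fintype ι] [DecidableEq ι]

/-- The data of a small triangle of edge `1 / m` in a large triangle `s`, of orientation `σ`. -/
structure IsFineBase (F : Set (Finset ι)) (m : ℕ) (s : Finset ι) (σ : ℤ) (a : ι → ℤ) : Prop where
  mem : s ∈ F
  sign : σ = 1 ∨ σ = -1
  supp : ∀ i, i ∉ s → a i = 0
  sum : ∑ i, a i = m - σ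
  nonneg : ∀ i, 0 ≤ a i
  nonneg' : ∀ i ∈ s, 0 ≤ a i + σ

/-- The point with barycentric coordinates `(a + σ β) / m`. -/
def finePoint (P : ι → E) (m : ℕ) (σ : ℤ) (a : ι → ℤ) (β : ι → ℝ) : E :=
  ∑ i, (((a i : ℝ) + σ * β i) / m) • P i

/-- A small triangle. -/
def fineTri [DecidableEq E] (P : ι → E) (m : ℕ) (s : Finset ι) (σ : ℤ) (a : ι → ℤ) : Finset E :=
  s.image fun k => finePoint P m σ a (Pi.single k 1)

variable {F : Set (Finset ι)} {P : ι → E} {Ω : Set E} {b : E → ι → ℝ} {m : ℕ} {s : Finset ι}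
  {σ : ℤ} {a : ι → ℤ}

omit [DecidableEq ι] in
theorem IsBary.finePoint_mem (hb : IsBary F P Ω b) (hm : 0 < m) (h : IsFineBase F m s σ a)
    {β : ι → ℝ} (h0 : ∀ i, 0 ≤ β i) (hs : ∀ i, i ∉ s → β i = 0) (h1 : ∑ i, β i = 1) :
    finePoint P m σ a β ∈ Ω ∧ ∀ i, m * b (finePoint P m σ a β) i = a i + σ * β i := by
  have hm' : (0 : ℝ) < m := Nat.cast_pos.mpr hm
  obtain ⟨g1, g2⟩ := hb.eq s h.mem (fun i => ((a i : ℝ) + σ * β i) / m) (fun i => by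
    refine div_nonneg ?_ hm'.le
    have ha : (0 : ℝ) ≤ a i := by exact_mod_cast h.nonneg i
    rcases h.sign with hσ | hσ
    · rw [hσ, Int.cast_one, one_mul]
      exact add_nonneg ha (h0 i)
    · by_cases hi : i ∈ s
      · have h2 : (0 : ℝ) ≤ a i + σ := by exact_mod_cast h.nonneg' i hi
        have h3 : β i ≤ 1 := by
          rw [← h1]
          exact Finset.single_le_sum (fun i _ => h0 i) (Finset.mem_univ i)
        rw [hσ] at h2 ⊢
        push_cast at h2 ⊢
        linarith
      · rw [hs i hi, mul_zero, add_zero]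
        exact ha)
    (fun i hi => by rw [h.supp i hi, hs i hi]; simp)
    (by
      rw [← Finset.sum_div, Finset.sum_add_distrib, ← Finset.mul_sum, h1, ← Int.cast_sum, h.sum]
      push_cast
      field_simp
      ring)
  refine ⟨g1, fun i => ?_⟩
  have := congrFun g2 i
  rw [finePoint, this]
  field_simp

theorem IsBary.fineVertex (hb : IsBary F P Ω b) (hm : 0 < m) (h : IsFineBase F m s σ a) {k : ι}
    (hk : k ∈ s) : finePoint P m σ a (Pi.single k 1) ∈ Ω ∧
      ∀ i, m * b (finePoint P m σ a (Pi.single k 1)) i = a i + σ * (Pi.single k 1 : ι → ℝ) i := by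
  refine hb.finePoint_mem hm h (fun i => ?_) (fun i hi => ?_) (by simp)
  · rw [Pi.single_apply]
    split_ifs <;> norm_num
  · exact Pi.single_eq_of_ne (fun e : i = k => hi (e ▸ hk)) _

theorem IsBary.fineVertex_inj (hb : IsBary F P Ω b) (hm : 0 < m) (h : IsFineBase F m s σ a) :
    InjOn (fun k => finePoint P m σ a (Pi.single k 1)) s := by
  intro k hk l hl hkl
  have h1 := (hb.fineVertex hm h hk).2 k
  have h2 := (hb.fineVertex hm h hl).2 k
  simp only at hkl
  rw [hkl, h2, Pi.single_eq_same] at h1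
  by_contra hne
  rw [Pi.single_eq_of_ne hne] at h1
  rcases h.sign with hσ | hσ <;> rw [hσ] at h1 <;> norm_num at h1

/-- The small triangles. -/
def fineTris [DecidableEq E] (F : Set (Finset ι)) (P : ι → E) (m : ℕ) : Set (Finset E) :=
  {T | ∃ s σ a, IsFineBase F m s σ a ∧ T = fineTri P m s σ a}

/-- A convex combination of the vertices of a small triangle. -/
theorem IsBary.sum_fineTri [DecidableEq E] (hb : IsBary F P Ω b) (hm : 0 < m)
    (h : IsFineBase F m s σ a) (B : E → ℝ) :
    ∑ z ∈ fineTri P m s σ a, B z =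
      ∑ i, if i ∈ s then B (finePoint P m σ a (Pi.single i 1)) else 0 := by
  rw [fineTri, Finset.sum_image (hb.fineVertex_inj hm h), Finset.sum_ite_mem, Finset.univ_inter]

theorem IsBary.comb_fineTri [DecidableEq E] (hb : IsBary F P Ω b) (hm : 0 < m)
    (h : IsFineBase F m s σ a) {B : E → ℝ} (hB : ∑ z ∈ fineTri P m s σ a, B z = 1) :
    ∑ z ∈ fineTri P m s σ a, B z • z = finePoint P m σ a
      (fun i => if i ∈ s then B (finePoint P m σ a (Pi.single i 1)) else 0) := by
  have hB' := hb.sum_fineTri hm h B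
  rw [hB] at hB'
  set β : ι → ℝ := fun i => if i ∈ s then B (finePoint P m σ a (Pi.single i 1)) else 0 with hβ
  have h1 : ∑ z ∈ fineTri P m s σ a, B z • z =
      ∑ k, β k • finePoint P m σ a (Pi.single k 1) := by
    rw [fineTri, Finset.sum_image (hb.fineVertex_inj hm h)]
    rw [← Finset.sum_subset (Finset.subset_univ s) fun k _ hk => by simp [hβ, hk]]
    exact Finset.sum_congr rfl fun k hk => by simp [hβ, hk]
  rw [h1]
  simp only [finePoint, Finset.smul_sum, smul_smul]
  rw [Finset.sum_comm]
  refine Finset.sum_congr rfl fun i _ => ?_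
  rw [← Finset.sum_smul]
  congr 1
  have e : ∀ k, β k * ((↑(a i) + ↑σ * (Pi.single k 1 : ι → ℝ) i) / ↑m) =
      β k * (a i / m) + (Pi.single k (β k) : ι → ℝ) i * (σ / m) := fun k => by
    by_cases hk : i = k
    · subst hk
      simp only [Pi.single_eq_same]
      ring
    · simp only [Pi.single_eq_of_ne hk]
      ring
  rw [Finset.sum_congr rfl fun k _ => e k, Finset.sum_add_distrib, ← Finset.sum_mul,
    ← Finset.sum_mul, ← hB', Finset.sum_pi_single]
  simp only [Finset.mem_univ, if_true]
  ring

end Fine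

section FineComplex

variable {E ι : Type*} [NormedAddCommGroup E] [NormedSpace ℝ E] [Fintype ι] [DecidableEq ι]
variable {F : Set (Finset ι)} {P : ι → E} {Ω : Set E} {b : E → ι → ℝ} {m : ℕ} {s : Finset ι}
  {σ : ℤ} {a : ι → ℤ}

omit [Fintype ι] [DecidableEq ι] in
theorem PLOn.finset_sum {f : ι → E → ℝ} {S : Set E} (t : Finset ι) (hf : ∀ i, PLOn (f i) S) :
    PLOn (fun x => ∑ i ∈ t, f i x) S := by
  classical
  induction t using Finset.induction_on with
  | empty => exact (PLOn.const 0).congr fun x _ => by simp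
  | insert i t hi ih => exact ((hf i).add ih).congr fun x _ => by rw [Finset.sum_insert hi]

omit [DecidableEq ι] in
theorem IsBary.pl_tent (hb : IsBary F P Ω b) (r : ℝ) (n : ι → ℝ) :
    PLOn (fun x => tent (fun i => r * b x i) n) Ω := by
  have h1 : ∀ i, PLOn (fun x => |r * b x i - n i|) Ω := fun i => by
    have h := ((hb.pl i).smul r).sub (PLOn.const (n i))
    exact (h.max (h.smul (-1))).congr fun x _ => by
      simp only [smul_eq_mul, neg_one_mul]
      rfl
  have h2 := (PLOn.finset_sum Finset.univ h1).smul (-(1 / 2))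
  refine ((PLOn.const 0).max ((PLOn.const 1).add h2)).congr fun x _ => ?_
  simp only [tent, smul_eq_mul]
  congr 1
  ring

theorem IsBary.tent_fineVertex (hb : IsBary F P Ω b) (hm : 0 < m) (h : IsFineBase F m s σ a)
    {β : ι → ℝ} (h0 : ∀ i, 0 ≤ β i) (hs : ∀ i, i ∉ s → β i = 0) (h1 : ∑ i, β i = 1) {k : ι}
    (hk : k ∈ s) : tent (fun i => m * b (finePoint P m σ a β) i)
      (fun i => m * b (finePoint P m σ a (Pi.single k 1)) i) = β k := by
  simp only [(hb.finePoint_mem hm h h0 hs h1).2, (hb.fineVertex hm h hk).2]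
  rw [tent_add_smul, tent_single h0 h1]
  rcases h.sign with hσ | hσ <;> rw [hσ] <;> norm_num

theorem IsBary.exists_finePoint [DecidableEq E] (hb : IsBary F P Ω b) (hm : 0 < m)
    (h : IsFineBase F m s σ a) {x : E} (hx : x ∈ convexHull ℝ (fineTri P m s σ a : Set E)) :
    ∃ β : ι → ℝ, (∀ i, 0 ≤ β i) ∧ (∀ i, i ∉ s → β i = 0) ∧ ∑ i, β i = 1 ∧
      x = finePoint P m σ a β := by
  obtain ⟨B, h0, h1, rfl⟩ := Finset.mem_convexHull'.mp hx
  refine ⟨_, fun i => ?_, fun i hi => ?_, ?_, hb.comb_fineTri hm h h1⟩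
  · split_ifs with hi
    · exact h0 _ (Finset.mem_image_of_mem _ hi)
    · exact le_rfl
  · exact if_neg hi
  · rw [← hb.sum_fineTri hm h, h1]

theorem IsBary.exists_fineTri [DecidableEq E] (hb : IsBary F P Ω b) (hm : 0 < m) {x : E}
    (hx : x ∈ Ω) : ∃ T ∈ fineTris F P m, x ∈ convexHull ℝ (T : Set E) := by
  have hm' : (0 : ℝ) < m := Nat.cast_pos.mpr hm
  suffices ∃ s σ a, IsFineBase F m s σ a ∧ ∃ β : ι → ℝ, (∀ i, 0 ≤ β i) ∧
      (∀ i, i ∉ s → β i = 0) ∧ ∑ i, β i = 1 ∧ ∀ i, m * b x i = a i + σ * β i by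
    obtain ⟨s, σ, a, h, β, h0, hs, h1, hx'⟩ := this
    refine ⟨_, ⟨s, σ, a, h, rfl⟩, ?_⟩
    set q : ι → E := fun k => finePoint P m σ a (Pi.single k 1) with hq
    have hinj := hb.fineVertex_inj hm h
    let B : E → ℝ := fun z => ∑ k ∈ s, if q k = z then β k else 0
    have hB : ∀ k ∈ s, B (q k) = β k := fun k hk => by
      simp only [B]
      rw [Finset.sum_eq_single_of_mem k hk fun l hl hne =>
        if_neg fun e => hne (hinj hl hk e), if_pos rfl]
    have hβ : (fun i => if i ∈ s then B (q i) else 0) = β := by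
      funext i
      split_ifs with hi
      · exact hB i hi
      · exact (hs i hi).symm
    have hB1 : ∑ z ∈ fineTri P m s σ a, B z = 1 := by
      rw [hb.sum_fineTri hm h]
      exact (Finset.sum_congr rfl fun i _ => congrFun hβ i).trans h1
    refine Finset.mem_convexHull'.mpr ⟨B, fun z hz => ?_, hB1, ?_⟩
    · obtain ⟨k, hk, rfl⟩ := Finset.mem_image.mp hz
      exact (hB k hk).symm ▸ h0 k
    · rw [hb.comb_fineTri hm h hB1]
      refine Eq.trans ?_ (hb.comb x hx)
      change finePoint P m σ a (fun i => if i ∈ s then B (q i) else 0) = _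
      rw [hβ]
      refine Finset.sum_congr rfl fun i _ => ?_
      rw [← hx' i, mul_div_cancel_left₀ _ hm'.ne']
  obtain ⟨s, hs, hsx⟩ := hb.face x hx
  have hbx := hb.nonneg x hx
  set n : ι → ℤ := fun i => ⌊m * b x i⌋ with hn
  set r : ι → ℝ := fun i => Int.fract (m * b x i) with hr
  have hnr : ∀ i, m * b x i = n i + r i := fun i => (Int.floor_add_fract _).symm
  have hn0 : ∀ i, 0 ≤ n i := fun i => Int.floor_nonneg.mpr (mul_nonneg hm'.le (hbx i))
  have hr0 : ∀ i, 0 ≤ r i := fun i => Int.fract_nonneg _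
  have hr1 : ∀ i, r i < 1 := fun i => Int.fract_lt_one _
  have hns : ∀ i, i ∉ s → n i = 0 := fun i hi => by simp [hn, hsx i hi]
  have hrs : ∀ i, i ∉ s → r i = 0 := fun i hi => by simp [hr, hsx i hi]
  have hsum : (∑ i, n i : ℝ) + ∑ i, r i = m := by
    rw [← Finset.sum_add_distrib, ← mul_one (m : ℝ), ← hb.sum x hx, Finset.mul_sum]
    exact Finset.sum_congr rfl fun i _ => (hnr i).symm
  set N : ℤ := m - ∑ i, n i with hN
  have hrN : ∑ i, r i = N := by
    rw [hN]
    push_cast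
    linarith
  have hN0 : 0 ≤ N := by
    have : (0 : ℝ) ≤ N := hrN ▸ Finset.sum_nonneg fun i _ => hr0 i
    exact_mod_cast this
  have hN3 : N < 3 := by
    have : (N : ℝ) < 3 := by
      rw [← hrN, ← Finset.sum_subset (Finset.subset_univ s) fun i _ hi => hrs i hi]
      have hne : s.Nonempty := Finset.card_pos.mp (by rw [hb.card s hs]; norm_num)
      calc ∑ i ∈ s, r i < ∑ i ∈ s, (1 : ℝ) := Finset.sum_lt_sum_of_nonempty hne fun i _ => hr1 i
        _ = 3 := by rw [Finset.sum_const, hb.card s hs]; norm_num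
    exact_mod_cast this
  have hNs : ∑ i, n i = m - N := by omega
  interval_cases hN' : N
  · have hr00 : ∀ i, r i = 0 := fun i =>
      (Finset.sum_eq_zero_iff_of_nonneg fun i _ => hr0 i).mp (by simpa using hrN) i
        (Finset.mem_univ i)
    obtain ⟨k, -, hk⟩ : ∃ k ∈ Finset.univ, n k ≠ 0 :=
      Finset.exists_ne_zero_of_sum_ne_zero (by omega)
    have hks : k ∈ s := by
      by_contra h
      exact hk (hns k h)
    refine ⟨s, 1, n - Pi.single k 1,
      ⟨hs, Or.inl rfl, fun i hi => ?_, ?_, fun i => ?_, fun i _ => ?_⟩, Pi.single k 1, fun i => ?_,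
      fun i hi => ?_, by simp, fun i => ?_⟩
    · rw [Pi.sub_apply, hns i hi, Pi.single_eq_of_ne fun e : i = k => hi (e ▸ hks), sub_zero]
    · simp only [Pi.sub_apply, Finset.sum_sub_distrib, hNs]
      simp
    · have := hn0 i
      by_cases hi : i = k
      · subst hi
        simp only [Pi.sub_apply, Pi.single_eq_same]
        omega
      · simpa [Pi.single_eq_of_ne hi] using this
    · have := hn0 i
      by_cases hi : i = k
      · subst hi
        simp only [Pi.sub_apply, Pi.single_eq_same]
        omega
      · simp only [Pi.sub_apply, Pi.single_eq_of_ne hi]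
        omega
    · rw [Pi.single_apply]
      split_ifs <;> norm_num
    · exact Pi.single_eq_of_ne (fun e : i = k => hi (e ▸ hks)) _
    · rw [hnr, hr00]
      by_cases hi : i = k
      · subst hi
        simp
      · simp [Pi.single_eq_of_ne hi]
  · exact ⟨s, 1, n, ⟨hs, Or.inl rfl, hns, hNs, hn0, fun i _ => by linarith [hn0 i]⟩, r, hr0, hrs,
      by simpa using hrN, fun i => by rw [hnr]; simp⟩
  · have hcard : ∑ i, (if i ∈ s then (1 : ℤ) else 0) = 3 := by
      rw [Finset.sum_ite_mem, Finset.univ_inter, Finset.sum_const, hb.card s hs]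
      norm_num
    have hcard' : ∑ i, (if i ∈ s then (1 : ℝ) else 0) = 3 := by
      rw [Finset.sum_ite_mem, Finset.univ_inter, Finset.sum_const, hb.card s hs]
      norm_num
    refine ⟨s, -1, fun i => n i + if i ∈ s then 1 else 0, ⟨hs, Or.inr rfl, fun i hi => ?_, ?_,
      fun i => ?_, fun i hi => ?_⟩, fun i => (if i ∈ s then 1 else 0) - r i, fun i => ?_,
      fun i hi => ?_, ?_, fun i => ?_⟩
    · simp [hns i hi, hi]
    · rw [Finset.sum_add_distrib, hNs, hcard]
      ring
    · have := hn0 i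
      split_ifs <;> omega
    · have := hn0 i
      simp only [hi, if_true]
      omega
    · beta_reduce
      split_ifs with hi
      · linarith [hr1 i]
      · rw [hrs i hi, sub_zero]
    · simp [hrs i hi, hi]
    · rw [Finset.sum_sub_distrib, hcard', hrN]
      norm_num
    · rw [hnr]
      push_cast
      ring

theorem IsBary.exists_isFine (hb : IsBary F P Ω b) :
    ∃ C : ℝ, 1 ≤ C ∧ ∀ m : ℕ, 0 < m → ∃ 𝒯 φ, IsFine Ω C m 𝒯 φ := by
  classical
  obtain ⟨L, hL, hlip⟩ := hb.exists_lip
  refine ⟨1 + Fintype.card ι * L + ∑ i, ‖P i‖, ?_, fun m hm => ?_⟩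
  · have : 0 ≤ ∑ i, ‖P i‖ := Finset.sum_nonneg fun i _ => norm_nonneg _
    have : 0 ≤ Fintype.card ι * L := by positivity
    linarith
  have hm' : (0 : ℝ) < m := Nat.cast_pos.mpr hm
  refine ⟨fineTris F P m, fun p x => tent (fun i => m * b x i) (fun i => m * b p i), ?_, ?_, ?_, ?_,
    ?_, ?_, ?_, ?_⟩
  · have hfin : ((F ×ˢ ({1, -1} : Set ℤ)) ×ˢ Icc (0 : ι → ℤ) (fun _ => (m : ℤ) + 1)).Finite :=
      (F.toFinite.prod (by simp)).prod (finite_Icc _ _)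
    refine (hfin.image fun q => fineTri P m q.1.1 q.1.2 q.2).subset ?_
    rintro T ⟨s, σ, a, h, rfl⟩
    refine ⟨((s, σ), a), ⟨⟨h.mem, h.sign⟩, h.nonneg, fun i => ?_⟩, rfl⟩
    have h1 := Finset.single_le_sum (fun i _ => h.nonneg i) (Finset.mem_univ i)
    rw [h.sum] at h1
    rcases h.sign with hσ | hσ <;> simp only <;> omega
  · rintro T ⟨s, σ, a, h, rfl⟩
    rw [fineTri, Finset.card_image_of_injOn (hb.fineVertex_inj hm h), hb.card s h.mem]
  · refine fun x => ⟨fun hx => hb.exists_fineTri hm hx, ?_⟩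
    rintro ⟨T, ⟨s, σ, a, h, rfl⟩, hx⟩
    obtain ⟨β, h0, hs, h1, rfl⟩ := hb.exists_finePoint hm h hx
    exact (hb.finePoint_mem hm h h0 hs h1).1
  · rintro T ⟨s, σ, a, h, rfl⟩ B h0 h1 z hz
    rw [hb.comb_fineTri hm h h1]
    obtain ⟨k, hk, rfl⟩ := Finset.mem_image.mp hz
    rw [hb.tent_fineVertex hm h _ _ _ hk, if_pos hk]
    · intro i
      split_ifs with hi
      · exact h0 _ (Finset.mem_image_of_mem _ hi)
      · exact le_rfl
    · exact fun i hi => if_neg hi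
    · rw [← hb.sum_fineTri hm h, h1]
  · rintro T ⟨s, σ, a, h, rfl⟩ x hx z ⟨T', ⟨s', σ', a', h', rfl⟩, hz⟩ hzT
    obtain ⟨β, h0, hs, h1, rfl⟩ := hb.exists_finePoint hm h hx
    obtain ⟨k, hk, rfl⟩ := Finset.mem_image.mp hz
    obtain ⟨hzΩ, hz'⟩ := hb.fineVertex hm h' hk
    have hσ2 : σ * σ = 1 := by rcases h.sign with hσ | hσ <;> rw [hσ] <;> norm_num
    set d : ι → ℤ := fun i => σ * (a' i + σ' * (Pi.single k 1 : ι → ℤ) i - a i) with hd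
    have hd' : ∀ i, m * b (finePoint P m σ' a' (Pi.single k 1)) i =
        a i + σ * (d i : ℝ) := fun i => by
      have e : a i + σ * d i = a' i + σ' * (Pi.single k 1 : ι → ℤ) i := by
        simp only [hd]
        linear_combination (a' i + σ' * (Pi.single k 1 : ι → ℤ) i - a i) * hσ2
      have e' : (a i : ℝ) + σ * d i = a' i + σ' * ((Pi.single k 1 : ι → ℤ) i : ℝ) := by
        exact_mod_cast e
      rw [hz' i, e']
      congr 2
      by_cases hi : i = k
      · subst hi
        simp
      · simp [Pi.single_eq_of_ne hi]
    simp only [(hb.finePoint_mem hm h h0 hs h1).2, hd']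
    rw [tent_add_smul, tent_eq_zero h0 h1]
    · have e1 : ∑ i, (Pi.single k 1 : ι → ℤ) i = 1 := by simp
      simp only [hd]
      rw [← Finset.mul_sum, Finset.sum_sub_distrib, Finset.sum_add_distrib, ← Finset.mul_sum, e1,
        h.sum, h'.sum]
      linear_combination hσ2
    · intro l hl
      by_cases hls : l ∈ s
      · exfalso
        refine hzT (Finset.mem_image.mpr ⟨l, hls, ?_⟩)
        obtain ⟨gΩ, g⟩ := hb.fineVertex hm h hls
        rw [← hb.comb _ gΩ, ← hb.comb _ hzΩ]
        refine Finset.sum_congr rfl fun i _ => ?_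
        congr 1
        refine mul_left_cancel₀ hm'.ne' ?_
        rw [g i, hd' i, hl]
        congr 2
        by_cases hi : i = l
        · subst hi
          simp
        · simp [Pi.single_eq_of_ne hi]
      · exact hs l hls
    · rcases h.sign with hσ | hσ <;> rw [hσ] <;> norm_num
  · intro z _ x hx y hy
    refine (abs_tent_sub_le _ _ _).trans ?_
    have h1 : ∑ i, |m * b x i - m * b y i| ≤ ∑ _i : ι, m * (L * ‖x - y‖) := by
      refine Finset.sum_le_sum fun i _ => ?_
      rw [← mul_sub, abs_mul, abs_of_pos hm']
      exact mul_le_mul_of_nonneg_left (hlip x hx y hy i) hm'.le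
    rw [Finset.sum_const, nsmul_eq_mul, Finset.card_univ] at h1
    have h2 : 0 ≤ ∑ i, ‖P i‖ := Finset.sum_nonneg fun i _ => norm_nonneg _
    have h3 : 0 ≤ Fintype.card ι * (m * (L * ‖x - y‖)) := by positivity
    have h4 : 0 ≤ (1 + ∑ i, ‖P i‖) * m * ‖x - y‖ := by positivity
    linarith
  · rintro T ⟨s, σ, a, h, rfl⟩ x hx y hy
    obtain ⟨β, h0, hs, h1, rfl⟩ := hb.exists_finePoint hm h hx
    obtain ⟨β', h0', hs', h1', rfl⟩ := hb.exists_finePoint hm h hy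
    have hle : ∀ β : ι → ℝ, (∀ i, 0 ≤ β i) → ∑ i, β i = 1 → ∀ i, β i ≤ 1 := fun β h0 h1 i => by
      rw [← h1]
      exact Finset.single_le_sum (fun i _ => h0 i) (Finset.mem_univ i)
    have e : ‖finePoint P m σ a β - finePoint P m σ a β'‖ ≤ ∑ i, 1 / m * ‖P i‖ := by
      rw [finePoint, finePoint, ← Finset.sum_sub_distrib]
      refine (norm_sum_le _ _).trans (Finset.sum_le_sum fun i _ => ?_)
      rw [← sub_smul, norm_smul]
      refine mul_le_mul_of_nonneg_right ?_ (norm_nonneg _)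
      rw [← sub_div, norm_div, Real.norm_of_nonneg hm'.le]
      refine div_le_div_of_nonneg_right ?_ hm'.le
      have g1 := hle β h0 h1 i
      have g2 := hle β' h0' h1' i
      have g3 := h0 i
      have g4 := h0' i
      rw [Real.norm_eq_abs, abs_le]
      rcases h.sign with hσ | hσ <;> rw [hσ] <;> push_cast <;> constructor <;> linarith
    refine e.trans ?_
    rw [← Finset.mul_sum, one_div_mul_eq_div]
    refine div_le_div_of_nonneg_right ?_ hm'.le
    have : 0 ≤ Fintype.card ι * L := by positivity
    linarith
  · exact fun z _ => hb.pl_tent m _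

end FineComplex

theorem IsClosedPolygon.exists_isFine {Ω : Set E2} (hΩ : IsClosedPolygon Ω) :
    ∃ C : ℝ, 1 ≤ C ∧ ∀ m : ℕ, 0 < m → ∃ 𝒯 φ, IsFine Ω C m 𝒯 φ := by
  classical
  obtain ⟨V, F, b, hb⟩ := hΩ.exists_isBary
  exact hb.exists_isFine

theorem exists_scales {k : ℕ} (hk : 1 ≤ k) {C H : ℝ} (hC : 1 ≤ C) (hH : 1 ≤ H) :
    ∃ A : ℝ, 1 ≤ A ∧ ∀ m : ℝ, 1 ≤ m → ∃ (R : ℕ) (ρ : ℝ), 12 ≤ R ∧ 0 < ρ ∧ ρ ≤ 1 / m ∧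
      10 * ρ < (C * m)⁻¹ ^ k / H ∧
      3 * H ^ (k + 1) * ρ ≤ ((C * m)⁻¹ ^ k / H / 2) ^ k ^ 2 ∧
      10 * (ρ / R) < ((ρ / 2) ^ k / (H * C ^ 2)) ^ k / H ∧
      R / ρ ≤ A * m ^ (k ^ 3 * (k ^ 2 + 1)) := by
  have hk0 : k ≠ 0 := by omega
  have hC0 : 0 < C := by linarith
  have hH0 : 0 < H := by linarith
  have hHk : 1 ≤ H ^ (k + 1) := one_le_pow₀ hH
  set A₁ : ℝ := 20 * H ^ (k + 1) * (2 * (H * C ^ k)) ^ k ^ 2 with hA₁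
  set c : ℝ := H * (H * C ^ 2 * 2 ^ k) ^ k with hc
  have h2k : (1 : ℝ) ≤ 2 ^ k := one_le_pow₀ one_le_two
  have hc1 : 1 ≤ c := one_le_mul_of_one_le_of_one_le hH (one_le_pow₀
    (one_le_mul_of_one_le_of_one_le (one_le_mul_of_one_le_of_one_le hH (one_le_pow₀ hC)) h2k))
  have hA₁1 : 1 ≤ A₁ := by
    refine one_le_mul_of_one_le_of_one_le (by linarith) (one_le_pow₀ ?_)
    have := one_le_mul_of_one_le_of_one_le hH (one_le_pow₀ hC (n := k))
    linarith
  refine ⟨24 * c * A₁ ^ (k ^ 2 + 1), ?_, fun m hm => ?_⟩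
  · have := one_le_mul_of_one_le_of_one_le hc1 (one_le_pow₀ hA₁1 (n := k ^ 2 + 1))
    linarith
  have hm0 : 0 < m := by linarith
  set Δ : ℝ := (C * m)⁻¹ ^ k / H with hΔ
  have hΔ0 : 0 < Δ := by positivity
  have hCm : 1 ≤ C * m := one_le_mul_of_one_le_of_one_le hC hm
  have hΔm : Δ ≤ 1 / m := by
    calc Δ ≤ (C * m)⁻¹ ^ k := div_le_self (by positivity) hH
      _ ≤ (C * m)⁻¹ := pow_le_of_le_one (by positivity) (inv_le_one_of_one_le₀ hCm) hk0
      _ ≤ 1 / m := by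
        rw [one_div]
        exact inv_anti₀ hm0 (le_mul_of_one_le_left hm0.le hC)
  have hm1 : 1 / m ≤ 1 := by rw [div_le_one hm0]; exact hm
  have hpow : (Δ / 2) ^ k ^ 2 ≤ Δ / 2 :=
    pow_le_of_le_one (by positivity) (by linarith) (pow_ne_zero 2 hk0)
  set ρ : ℝ := (Δ / 2) ^ k ^ 2 / (20 * H ^ (k + 1)) with hρ
  have hρ0 : 0 < ρ := by positivity
  have hρe : 20 * H ^ (k + 1) * ρ = (Δ / 2) ^ k ^ 2 := by rw [hρ]; field_simp
  have hρ1 : 20 * ρ ≤ Δ / 2 := by nlinarith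
  set W : ℝ := ((ρ / 2) ^ k / (H * C ^ 2)) ^ k / H with hW
  have hW0 : 0 < W := by positivity
  have hv : 1 / ρ = A₁ * m ^ k ^ 3 := by
    have e : Δ / 2 = 1 / (2 * (H * C ^ k) * m ^ k) := by
      rw [hΔ, inv_pow, mul_pow]
      field_simp
    rw [hρ, e, hA₁, show k ^ 3 = k * k ^ 2 by ring, pow_mul m, div_pow, one_pow, mul_pow _ (m ^ k),
      one_div_div, div_div_eq_mul_div, div_one]
    simp only [mul_assoc]
  have hv1 : 1 ≤ 1 / ρ := by rw [le_div_iff₀ hρ0]; linarith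
  have hWe : 1 / W = c * (1 / ρ) ^ k ^ 2 := by
    rw [hW, hc, sq k, pow_mul (1 / ρ)]
    simp only [div_pow, mul_pow, one_pow]
    field_simp
  have hceil := Nat.le_ceil (11 / W)
  have hceil' := Nat.ceil_lt_add_one (show 0 ≤ 11 / W by positivity)
  refine ⟨⌈11 / W⌉₊ + 12, ρ, by omega, hρ0, by linarith, by linarith, ?_, ?_, ?_⟩
  · rw [← hρe]
    have : 0 < H ^ (k + 1) * ρ := by positivity
    nlinarith
  · push_cast
    rw [div_le_iff₀ hW0] at hceil
    rw [mul_div_assoc', div_lt_iff₀ (by positivity)]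
    nlinarith
  · have h1 : (1 : ℝ) ≤ c * (1 / ρ) ^ k ^ 2 :=
      one_le_mul_of_one_le_of_one_le hc1 (one_le_pow₀ hv1)
    have h2 : 11 / W = 11 * (c * (1 / ρ) ^ k ^ 2) := by rw [← hWe]; ring
    have h3 : ((⌈11 / W⌉₊ + 12 : ℕ) : ℝ) ≤ 24 * (c * (1 / ρ) ^ k ^ 2) := by push_cast; linarith
    calc ((⌈11 / W⌉₊ + 12 : ℕ) : ℝ) / ρ ≤ 24 * (c * (1 / ρ) ^ k ^ 2) / ρ := by gcongr
      _ = 24 * c * (1 / ρ) ^ (k ^ 2 + 1) := by rw [pow_succ]; ring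
      _ = _ := by rw [hv, mul_pow, ← pow_mul]; ring

section Approximation

variable {E : Type*} [NormedAddCommGroup E] [NormedSpace ℝ E] {Ω : Set E} {C : ℝ}

theorem exists_pl_approx {k : ℕ} (hk : 1 ≤ k) (hC : 1 ≤ C)
    (hΩ : ∀ m : ℕ, 0 < m → ∃ 𝒯 φ, IsFine Ω C m 𝒯 φ) {h : E → ℂ} (hc : ContinuousOn h Ω)
    {H B₀ : ℝ} (hH : 1 ≤ H) (hB₀ : ∀ x ∈ Ω, ‖h x‖ ≤ B₀)
    (h1 : ∀ x ∈ Ω, ∀ y ∈ Ω, ‖h x - h y‖ ^ k ≤ H * ‖x - y‖)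
    (h2 : ∀ x ∈ Ω, ∀ y ∈ Ω, ‖x - y‖ ^ k ≤ H * ‖h x - h y‖) :
    ∃ A : ℝ, 1 ≤ A ∧ ∀ m : ℕ, 0 < m → ∃ f : E → ℂ, PLOn f Ω ∧ InjOn f Ω ∧
      (∀ x ∈ Ω, ∀ y ∈ Ω, ‖f x - f y‖ ≤ A * m ^ (k ^ 3 * (k ^ 2 + 1) * 21 + 1) * ‖x - y‖) ∧
      ∀ x ∈ Ω, ‖f x - h x‖ ^ k ≤ A / m := by
  classical
  have hk0 : k ≠ 0 := by omega
  have hC0 : 0 < C := by linarith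
  have hH0 : 0 < H := by linarith
  obtain ⟨A, hA, hsc⟩ := exists_scales hk hC hH
  set N := k ^ 3 * (k ^ 2 + 1) with hN
  set b : ℝ := 2 * |B₀| + 11 with hb
  have hb0 : 11 ≤ b := by have := abs_nonneg B₀; linarith
  refine ⟨7 * (180 * (2 * (b ^ 2) ^ 2) ^ 5 * b) * A ^ 21 * C + 2 ^ k * (H * C), ?_, fun m hm => ?_⟩
  · have e1 : 1 ≤ 2 ^ k * (H * C) := one_le_mul_of_one_le_of_one_le (one_le_pow₀ one_le_two)
      (one_le_mul_of_one_le_of_one_le hH hC)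
    have e2 : 0 ≤ 7 * (180 * (2 * (b ^ 2) ^ 2) ^ 5 * b) * A ^ 21 * C := by positivity
    linarith
  have hm1 : (1 : ℝ) ≤ m := by exact_mod_cast hm
  have hm0 : (0 : ℝ) < m := by linarith
  obtain ⟨R, ρ, hR, hρ0, hρm, hρ1, hρ2, hρ3, hρ4⟩ := hsc m hm1
  obtain ⟨𝒯, φ, hF⟩ := hΩ m hm
  set Δ : ℝ := (C * m)⁻¹ ^ k / H with hΔ
  have hR' : (12 : ℝ) ≤ R := by exact_mod_cast hR
  have hR0 : (0 : ℝ) < R := by linarith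
  set s : ℝ := ρ / R with hs
  have hs0 : 0 < s := by positivity
  have hRs : R * s = ρ := by rw [hs]; field_simp
  have hρ1' : ρ ≤ 1 := hρm.trans (by rw [div_le_one hm0]; exact hm1)
  have hs12 : 12 * s ≤ ρ := by rw [← hRs]; gcongr
  have hsep : ∀ t ∈ Ω, ∀ z ∈ verts 𝒯, φ z t = 0 → Δ ≤ ‖h t - h z‖ := by
    intro t ht z hz h0
    have hzΩ := hF.verts_subset hz
    have e := hF.lip z hz t ht z hzΩ
    have hself : φ z z = 1 := by
      obtain ⟨T, hT, hzT⟩ := hz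
      have := hF.coord T hT (fun y => if y = z then 1 else 0)
        (fun y _ => by split_ifs <;> norm_num) (by simp [hzT]) z hzT
      simpa [hzT] using this
    rw [h0, hself, zero_sub, abs_neg, abs_one] at e
    have e2 : (C * m)⁻¹ ≤ ‖t - z‖ := (inv_le_iff_one_le_mul₀' (by positivity)).mpr e
    rw [hΔ, div_le_iff₀' hH0]
    exact (pow_le_pow_left₀ (by positivity) e2 k).trans (h2 t ht z hzΩ)
  set h' : E → ℂ := fun x => s⁻¹ • h x with hh'
  have hn : ∀ x y, ‖h' x - h' y‖ = ‖h x - h y‖ / s := fun x y => by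
    rw [hh', ← smul_sub, norm_smul, norm_inv, Real.norm_of_nonneg hs0.le, inv_mul_eq_div]
  set d : ℝ := (H * C / m) ^ (1 / (k : ℝ)) with hd
  have hd0 : 0 ≤ d := by positivity
  have hdk : d ^ k = H * C / m := by
    rw [hd, one_div, Real.rpow_inv_natCast_pow (by positivity) hk0]
  have hρd : ρ ≤ d := by
    refine le_of_pow_le_pow_left₀ hk0 hd0 ?_
    rw [hdk]
    calc ρ ^ k ≤ ρ := pow_le_of_le_one hρ0.le hρ1' hk0
      _ ≤ 1 / m := hρm
      _ ≤ H * C / m := by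
        gcongr
        exact one_le_mul_of_one_le_of_one_le hH hC
  have hBs : ∀ x ∈ Ω, ‖h' x‖ ≤ (⌈|B₀| / s⌉₊ : ℕ) := fun x hx => by
    refine le_trans ?_ (Nat.le_ceil _)
    rw [hh', norm_smul, norm_inv, Real.norm_of_nonneg hs0.le, inv_mul_eq_div]
    gcongr
    exact (hB₀ x hx).trans (le_abs_self _)
  have H2 : ∀ t ∈ Ω, ∀ z ∈ verts 𝒯, φ z t = 0 → 10 * (R : ℝ) < ‖h' t - h' z‖ := by
    intro t ht z hz h0
    rw [hn, lt_div_iff₀ hs0]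
    have := hsep t ht z hz h0
    linarith
  have H3 : ∀ t ∈ Ω, ∀ t' ∈ Ω, ∀ z ∈ Ω, ‖t - z‖ ≤ C ^ 2 * ‖t - t'‖ →
      (R : ℝ) / 2 ≤ ‖h' t - h' z‖ → 10 < ‖h' t - h' t'‖ := by
    intro t ht t' ht' z hz e1 e2
    rw [hn, le_div_iff₀ hs0] at e2
    rw [hn, lt_div_iff₀ hs0]
    refine hρ3.trans_le ?_
    rw [div_le_iff₀' hH0]
    refine le_trans (pow_le_pow_left₀ (by positivity) ?_ k) (h2 t ht t' ht')
    rw [div_le_iff₀ (by positivity)]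
    have e3 : ρ / 2 ≤ ‖h t - h z‖ := by linarith
    calc (ρ / 2) ^ k ≤ ‖h t - h z‖ ^ k := by gcongr
      _ ≤ H * ‖t - z‖ := h1 t ht z hz
      _ ≤ H * (C ^ 2 * ‖t - t'‖) := by gcongr
      _ = _ := by ring
  have H5 : ∀ t ∈ Ω, ∀ t' ∈ Ω, ∀ x ∈ Ω, ∀ x' ∈ Ω, ‖h' t - h' t'‖ ≤ 2 * R + 8 → ‖x - x'‖ ≤ ‖t - t'‖ →
      ∀ z ∈ verts 𝒯, φ z x = 0 → ‖h' x - h' x'‖ + 4 < ‖h' x - h' z‖ := by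
    intro t ht t' ht' x hx x' hx' e1 e2 z hz h0
    rw [hn, div_le_iff₀ hs0] at e1
    rw [hn, hn, ← sub_pos, ← mul_pos_iff_of_pos_right hs0, sub_mul, add_mul,
      div_mul_cancel₀ _ hs0.ne', div_mul_cancel₀ _ hs0.ne', sub_pos]
    have e3 := hsep x hx z hz h0
    have e4 : ‖h x - h x'‖ ≤ Δ / 2 := by
      refine le_of_pow_le_pow_left₀ (pow_ne_zero 2 hk0) (by positivity) (le_trans ?_ hρ2)
      calc ‖h x - h x'‖ ^ k ^ 2 = (‖h x - h x'‖ ^ k) ^ k := by rw [← pow_mul, sq]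
        _ ≤ (H * ‖t - t'‖) ^ k := by
          gcongr
          exact (h1 x hx x' hx').trans (by gcongr)
        _ = H ^ k * ‖t - t'‖ ^ k := mul_pow _ _ _
        _ ≤ H ^ k * (H * (3 * ρ)) := by
          gcongr
          refine (h2 t ht t' ht').trans ?_
          gcongr
          linarith
        _ = _ := by rw [pow_succ]; ring
    linarith
  have hD : ∀ T ∈ 𝒯, ∀ x ∈ convexHull ℝ (T : Set E), ∀ y ∈ convexHull ℝ (T : Set E),
      ‖h' x - h' y‖ ≤ d / s := by
    intro T hT x hx y hy
    rw [hn]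
    gcongr
    refine le_of_pow_le_pow_left₀ hk0 hd0 ?_
    rw [hdk]
    calc ‖h x - h y‖ ^ k ≤ H * ‖x - y‖ := h1 x (hF.mem hT hx) y (hF.mem hT hy)
      _ ≤ H * (C / m) := by
        gcongr
        exact hF.diam T hT x hx y hy
      _ = _ := by ring
  obtain ⟨f, hf1, hf2, hf3, hf4⟩ := hF.exists_embedding hC hm1 (hc.const_smul s⁻¹) hR hBs H2 H3
    H5 hD
  refine ⟨fun x => s • f x, hf1.smul s, fun x hx y hy e => ?_, fun x hx y hy => ?_,
    fun x hx => ?_⟩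
  · exact hf2 hx hy (smul_right_injective ℂ hs0.ne' e)
  · have hB1 : ((⌈|B₀| / s⌉₊ : ℕ) : ℝ) ≤ |B₀| / s + 1 :=
      (Nat.ceil_lt_add_one (by positivity)).le
    have hs1 : 1 ≤ 1 / s := by rw [le_div_iff₀ hs0]; linarith
    have hB2 : 2 * (((⌈|B₀| / s⌉₊ : ℕ) : ℝ) + 4) + 1 ≤ b * (1 / s) := by
      have : |B₀| / s = |B₀| * (1 / s) := by ring
      rw [hb]
      nlinarith
    have hB3 : ((⌈|B₀| / s⌉₊ : ℕ) : ℝ) + 4 ≤ b * (1 / s) := by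
      have : (0 : ℝ) ≤ (⌈|B₀| / s⌉₊ : ℕ) := Nat.cast_nonneg _
      linarith
    have hsA : 1 / s ≤ A * m ^ N := by
      refine le_trans (le_of_eq ?_ |>.trans (le_refl (1 * (R / ρ)))) (by rw [one_mul]; exact hρ4)
      rw [hs]; field_simp
    rw [← smul_sub, norm_smul, Real.norm_of_nonneg hs0.le]
    calc s * ‖f x - f y‖ ≤ 1 * (7 * (180 * (2 * ((b * (1 / s)) ^ 2) ^ 2) ^ 5 * (b * (1 / s))) *
          (C * m * ‖x - y‖)) := by
          refine mul_le_mul (by linarith) ((hf3 x hx y hy).trans ?_) (norm_nonneg _) zero_le_one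
          gcongr
      _ = 7 * (180 * (2 * (b ^ 2) ^ 2) ^ 5 * b) * (1 / s) ^ 21 * C * m * ‖x - y‖ := by ring
      _ ≤ 7 * (180 * (2 * (b ^ 2) ^ 2) ^ 5 * b) * (A * m ^ N) ^ 21 * C * m * ‖x - y‖ := by
          gcongr
      _ = 7 * (180 * (2 * (b ^ 2) ^ 2) ^ 5 * b) * A ^ 21 * C * m ^ (N * 21 + 1) * ‖x - y‖ := by
          rw [mul_pow, ← pow_mul, pow_succ]
          ring
      _ ≤ _ := by
          gcongr
          exact le_add_of_nonneg_right (by positivity)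
  · have e : s • f x - h x = s • (f x - h' x) := by
      rw [hh', smul_sub, smul_inv_smul₀ hs0.ne']
    have e2 : ‖s • f x - h x‖ ≤ 2 * d := by
      rw [e, norm_smul, Real.norm_of_nonneg hs0.le]
      calc s * ‖f x - h' x‖ ≤ s * (d / s + 4) := by gcongr; exact hf4 x hx
        _ = d + 4 * s := by field_simp
        _ ≤ 2 * d := by linarith
    calc ‖s • f x - h x‖ ^ k ≤ (2 * d) ^ k := by gcongr
      _ = 2 ^ k * (H * C) / m := by rw [mul_pow, hdk]; ring
      _ ≤ _ := by
        gcongr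
        exact le_add_of_nonneg_left (by positivity)

end Approximation

theorem exists_norm_sub_pow_le {S : Set E2} (hS : Bornology.IsBounded S) {u : E2 → E2} {α : ℝ}
    {k : ℕ} (hk : 1 ≤ k) (hkα : 1 / (k : ℝ) ≤ α) (hb : BddAbove (holderRatioSet α S u)) :
    ∃ H : ℝ, 1 ≤ H ∧ ∀ x ∈ S, ∀ y ∈ S, ‖u x - u y‖ ^ k ≤ H * ‖x - y‖ := by
  obtain ⟨c, hc⟩ := hb
  obtain ⟨d, hd⟩ := isBounded_iff.mp hS
  have hk0 : k ≠ 0 := by omega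
  have hk' : (1 : ℝ) ≤ k := by exact_mod_cast hk
  have hαk : 1 ≤ α * k := by rwa [div_le_iff₀ (by linarith)] at hkα
  refine ⟨max 1 (|c| ^ k * (max d 0) ^ (α * k - 1)), le_max_left _ _, fun x hx y hy => ?_⟩
  by_cases hxy : x = y
  · simp [hxy, hk0]
  have hr : 0 < ‖x - y‖ := norm_pos_iff.mpr (sub_ne_zero.mpr hxy)
  have h1 : ‖u x - u y‖ ≤ |c| * ‖x - y‖ ^ α := by
    rw [← div_le_iff₀ (by positivity)]
    exact (hc ⟨x, hx, y, hy, hxy, rfl⟩).trans (le_abs_self c)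
  have h2 : ‖x - y‖ ≤ max d 0 := by
    rw [← dist_eq_norm]
    exact (hd hx hy).trans (le_max_left _ _)
  calc ‖u x - u y‖ ^ k ≤ (|c| * ‖x - y‖ ^ α) ^ k := by gcongr
    _ = |c| ^ k * ‖x - y‖ ^ (α * k - 1) * ‖x - y‖ := by
      rw [mul_pow, ← Real.rpow_natCast (‖x - y‖ ^ α), ← Real.rpow_mul hr.le, mul_assoc,
        ← Real.rpow_add_one hr.ne', sub_add_cancel]
    _ ≤ |c| ^ k * (max d 0) ^ (α * k - 1) * ‖x - y‖ := by
      gcongr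
    _ ≤ _ := by
      gcongr
      exact le_max_right _ _

theorem supNorm_add_holderSeminorm_le {Ω : Set E2} {g : E2 → E2} {k M n : ℕ} (hk : 1 ≤ k)
    (hn : 1 ≤ n) {A H : ℝ} (hA : 0 ≤ A) (hH : 0 ≤ H) (h0 : ∀ x ∈ Ω, ‖g x‖ ≤ A / n)
    (h1 : ∀ x ∈ Ω, ∀ y ∈ Ω,
      ‖g x - g y‖ ≤ A * n ^ M * ‖x - y‖ + H * ‖x - y‖ ^ (1 / (k : ℝ))) :
    supNorm Ω g + holderSeminorm (1 / (2 * (k * (M + 1)))) Ω g ≤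
      (3 * A + H) * (n : ℝ) ^ (-(1 / 2) : ℝ) := by
  have hn1 : (1 : ℝ) ≤ n := by exact_mod_cast hn
  have hn0 : (0 : ℝ) < n := by linarith
  have hk1 : (1 : ℝ) ≤ k := by exact_mod_cast hk
  have hk0 : (0 : ℝ) < k := by linarith
  set β : ℝ := 1 / (2 * (k * (M + 1))) with hβ
  have hβ0 : 0 < β := by positivity
  have hβe : k * (M + 1) * β = 1 / 2 := by rw [hβ]; field_simp
  have hβk : β ≤ 1 / k := by
    rw [hβ]
    gcongr
    have : (0 : ℝ) ≤ M := Nat.cast_nonneg _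
    nlinarith
  have hk2 : 1 / (k : ℝ) ≤ 1 := by rw [div_le_one hk0]; exact hk1
  have hhalf : (n : ℝ) * (n : ℝ) ^ (-(1 / 2) : ℝ) = (n : ℝ) ^ (1 / 2 : ℝ) := by
    rw [mul_comm, ← Real.rpow_add_one hn0.ne']
    norm_num
  set η : ℝ := (n : ℝ) ^ (-(1 / 2) : ℝ) with hη
  have hη0 : 0 < η := by positivity
  have hnη : 1 / n ≤ η := by
    rw [hη, one_div, ← Real.rpow_neg_one]
    exact Real.rpow_le_rpow_of_exponent_le hn1 (by norm_num)
  have hsup : supNorm Ω g ≤ A * η := by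
    refine Real.sSup_le ?_ (by positivity)
    rintro _ ⟨x, hx, rfl⟩
    refine (h0 x hx).trans ?_
    rw [← mul_one_div]
    gcongr
  have hsemi : holderSeminorm β Ω g ≤ (2 * A + H) * η := by
    refine Real.sSup_le ?_ (by positivity)
    rintro _ ⟨x, hx, y, hy, hxy, rfl⟩
    have hr : 0 < ‖x - y‖ := norm_pos_iff.mpr (sub_ne_zero.mpr hxy)
    set r := ‖x - y‖ with hr'
    rw [div_le_iff₀ (by positivity)]
    rcases le_total ((n : ℝ) ^ (-(k * (M + 1)) : ℝ)) r with hle | hle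
    · have h2 : η ≤ r ^ β := by
        calc η = ((n : ℝ) ^ (-(k * (M + 1)) : ℝ)) ^ β := by
              rw [← Real.rpow_mul hn0.le, neg_mul, hβe]
          _ ≤ r ^ β := Real.rpow_le_rpow (by positivity) hle hβ0.le
      have h3 : 1 / (n : ℝ) = η * η := by
        rw [hη, ← Real.rpow_add hn0, one_div, ← Real.rpow_neg_one]
        norm_num
      calc ‖g x - g y‖ ≤ A / n + A / n := (norm_sub_le _ _).trans (add_le_add (h0 x hx) (h0 y hy))
        _ = 2 * A * (η * η) := by rw [← h3]; ring
        _ ≤ (2 * A + H) * (η * r ^ β) := by gcongr; linarith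
        _ = _ := by ring
    · have hr1 : r ≤ 1 := hle.trans (Real.rpow_le_one_of_one_le_of_nonpos hn1 (by
        have : (0 : ℝ) ≤ k * (M + 1) := by positivity
        linarith))
      have h2 : r ^ (1 / k - β : ℝ) ≤ (n : ℝ) ^ (-(M + 1 / 2) : ℝ) := by
        refine (Real.rpow_le_rpow hr.le hle (by linarith)).trans (le_of_eq ?_)
        rw [← Real.rpow_mul hn0.le]
        congr 1
        have : (k : ℝ) * (1 / k) = 1 := by field_simp
        linear_combination (-(M : ℝ) - 1) * this + hβe
      have h3 : (n : ℝ) ^ M * (n : ℝ) ^ (-(M + 1 / 2) : ℝ) = η := by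
        rw [hη, ← Real.rpow_natCast, ← Real.rpow_add hn0]
        congr 1
        ring
      have h4 : (n : ℝ) ^ (-(M + 1 / 2) : ℝ) ≤ η :=
        Real.rpow_le_rpow_of_exponent_le hn1 (by
          have : (0 : ℝ) ≤ M := Nat.cast_nonneg _
          linarith)
      have h5 : r ^ (1 / k : ℝ) = r ^ (1 / k - β : ℝ) * r ^ β := by
        rw [← Real.rpow_add hr, sub_add_cancel]
      have h6 : r ≤ r ^ (1 / k : ℝ) := by
        conv_lhs => rw [← Real.rpow_one r]
        exact Real.rpow_le_rpow_of_exponent_ge hr hr1 hk2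
      calc ‖g x - g y‖ ≤ A * n ^ M * r + H * r ^ (1 / k : ℝ) := h1 x hx y hy
        _ ≤ A * n ^ M * r ^ (1 / k : ℝ) + H * r ^ (1 / k : ℝ) := by gcongr
        _ ≤ A * n ^ M * ((n : ℝ) ^ (-(M + 1 / 2) : ℝ) * r ^ β) + H * (η * r ^ β) := by
          rw [h5]
          have := h2.trans h4
          gcongr
        _ = (A * (n ^ M * (n : ℝ) ^ (-(M + 1 / 2) : ℝ)) + H * η) * r ^ β := by ring
        _ ≤ _ := by
          rw [h3]
          gcongr
          nlinarith
  linarith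

theorem isHomeoOn_of_injOn {Ω : Set E2} (hΩ : IsCompact Ω) {f : E2 → E2} (hc : ContinuousOn f Ω)
    (hi : InjOn f Ω) : IsHomeoOn f Ω := by
  refine ⟨hc, hi, ?_⟩
  rcases Ω.eq_empty_or_nonempty with rfl | hne
  · simp
  have hinv : ∀ t : Set E2, f '' Ω ∩ Function.invFunOn f Ω ⁻¹' t = f '' (Ω ∩ t) := by
    intro t
    ext y
    constructor
    · rintro ⟨⟨x, hx, rfl⟩, hy⟩
      rw [mem_preimage, hi.leftInvOn_invFunOn hx] at hy
      exact ⟨x, ⟨hx, hy⟩, rfl⟩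
    · rintro ⟨x, ⟨hx, hxt⟩, rfl⟩
      refine ⟨mem_image_of_mem f hx, ?_⟩
      rwa [mem_preimage, hi.leftInvOn_invFunOn hx]
  rw [continuousOn_iff_isClosed]
  refine fun t ht => ⟨f '' (Ω ∩ t), ?_, ?_⟩
  · exact ((hΩ.inter_right ht).image_of_continuousOn (hc.mono inter_subset_left)).isClosed
  · rw [inter_comm, hinv t, inter_eq_self_of_subset_left (image_mono inter_subset_left)]

/-- approximation of bi-Hölder planar homeomorphisms by piecewise
affine homeomorphisms in the Hölder norm of some exponent `β < α` depending only on `α`. -/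
theorem statement0 (α : ℝ) (hα0 : 0 < α) (hα1 : α ≤ 1) :
    ∃ β : ℝ, 0 < β ∧ β < α ∧
      ∀ Ω : Set E2, IsClosedPolygon Ω →
      ∀ h : E2 → E2, IsHomeoOn h Ω →
      BddAbove (holderRatioSet α Ω h) →
      BddAbove (holderRatioSet α (h '' Ω) (Function.invFunOn h Ω)) →
      ∀ ε : ℝ, 0 < ε →
        ∃ (K : SimplicialComplex ℝ E2) (f : E2 → E2),
          IsTriangulation K Ω ∧ IsHomeoOn f Ω ∧ PiecewiseAffineOn f K ∧
          supNorm Ω (fun x => f x - h x) + holderSeminorm β Ω (fun x => f x - h x) < ε := by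
  set k : ℕ := ⌈1 / α⌉₊ with hk'
  have hk : 1 ≤ k := Nat.one_le_ceil_iff.mpr (by positivity)
  have hk0 : k ≠ 0 := by omega
  have hkpos : (0 : ℝ) < k := by exact_mod_cast hk
  have hkα : 1 / (k : ℝ) ≤ α := by
    rw [div_le_comm₀ hkpos hα0]
    exact Nat.le_ceil _
  set N : ℕ := k ^ 3 * (k ^ 2 + 1) * 21 + 1 with hN
  refine ⟨1 / (2 * (k * ((k * N : ℕ) + 1))), by positivity, ?_, ?_⟩
  · refine lt_of_lt_of_le ?_ hkα
    gcongr
    have : (0 : ℝ) ≤ (k * N : ℕ) := Nat.cast_nonneg _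
    nlinarith
  intro Ω hΩ h hh hb hb' ε hε
  have hcpt := hΩ.1
  have himg := hcpt.image_of_continuousOn hh.1
  obtain ⟨H₁, hH₁, h1⟩ := exists_norm_sub_pow_le hcpt.isBounded hk hkα hb
  obtain ⟨H₂, hH₂, h2⟩ := exists_norm_sub_pow_le himg.isBounded hk hkα hb'
  obtain ⟨B, hB⟩ := himg.isBounded.exists_norm_le
  set H := max H₁ H₂ with hHdef
  have hH : 1 ≤ H := hH₁.trans (le_max_left _ _)
  obtain ⟨C, hC, hfine⟩ := hΩ.exists_isFine
  let e : ℂ ≃ₗᵢ[ℝ] E2 := Complex.orthonormalBasisOneI.repr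
  have he : ∀ x y, ‖e.symm x - e.symm y‖ = ‖x - y‖ := fun x y => by
    rw [← map_sub, e.symm.norm_map]
  obtain ⟨A, hA, happ⟩ := exists_pl_approx hk hC hfine (h := fun x => e.symm (h x))
    (e.symm.continuous.comp_continuousOn hh.1) hH (B₀ := B)
    (fun x hx => by rw [e.symm.norm_map]; exact hB _ (mem_image_of_mem h hx))
    (fun x hx y hy => by
      rw [he]
      exact (h1 x hx y hy).trans (by gcongr; exact le_max_left _ _))
    (fun x hx y hy => by
      rw [he]
      have := h2 _ (mem_image_of_mem h hx) _ (mem_image_of_mem h hy)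
      rw [hh.2.1.leftInvOn_invFunOn hx, hh.2.1.leftInvOn_invFunOn hy] at this
      exact this.trans (by gcongr; exact le_max_right _ _))
  obtain ⟨n, hn1, hn⟩ : ∃ n : ℕ, 1 ≤ n ∧ (3 * A + H) * (n : ℝ) ^ (-(1 / 2) : ℝ) < ε := by
    have h3 := ((tendsto_rpow_neg_atTop (y := 1 / 2) (by norm_num)).comp
      tendsto_natCast_atTop_atTop).const_mul (3 * A + H)
    rw [mul_zero] at h3
    exact ((Filter.eventually_ge_atTop 1).and (h3.eventually_lt_const hε)).exists
  have hn0 : (0 : ℝ) < n := by exact_mod_cast hn1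
  obtain ⟨f, hf1, hf2, hf3, hf4⟩ := happ (n ^ k) (pow_pos hn1 k)
  set F : E2 → E2 := fun x => e (f x) with hF
  have hFlip : ∀ x ∈ Ω, ∀ y ∈ Ω, ‖F x - F y‖ ≤ A * n ^ (k * N) * ‖x - y‖ := fun x hx y hy => by
    rw [hF, ← map_sub, e.norm_map]
    refine (hf3 x hx y hy).trans (le_of_eq ?_)
    rw [Nat.cast_pow, ← pow_mul]
  have hFc : ContinuousOn F Ω := by
    refine (LipschitzOnWith.of_dist_le_mul (K := ⟨A * n ^ (k * N), by positivity⟩)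
      fun x hx y hy => ?_).continuousOn
    rw [dist_eq_norm, dist_eq_norm]
    exact hFlip x hx y hy
  have hFpl : PLOn F Ω :=
    (PLOn.affine (e.toLinearEquiv.toLinearMap.toAffineMap) (S := univ)).comp hf1
      fun x _ => mem_univ _
  have hFinj : InjOn F Ω := fun x hx y hy hxy => hf2 hx hy (e.injective hxy)
  obtain ⟨K, hK, hKF⟩ := exists_triangulation hΩ hFc hFpl
  refine ⟨K, F, hK, isHomeoOn_of_injOn hcpt hFc hFinj, hKF, lt_of_le_of_lt ?_ hn⟩
  refine supNorm_add_holderSeminorm_le hk hn1 (by linarith) (by linarith) (fun x hx => ?_)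
    fun x hx y hy => ?_
  · refine le_of_pow_le_pow_left₀ hk0 (by positivity) ?_
    have h3 : ‖F x - h x‖ = ‖f x - e.symm (h x)‖ := by
      rw [← e.norm_map, map_sub, e.apply_symm_apply]
    rw [h3, div_pow]
    refine (hf4 x hx).trans ?_
    rw [Nat.cast_pow]
    gcongr
    exact le_self_pow₀ hA hk0
  · have h3 : ‖h x - h y‖ ≤ H * ‖x - y‖ ^ (1 / (k : ℝ)) := by
      refine le_of_pow_le_pow_left₀ hk0 (by positivity) ?_
      rw [mul_pow, one_div, Real.rpow_inv_natCast_pow (norm_nonneg _) hk0]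
      refine (h1 x hx y hy).trans ?_
      gcongr
      exact (le_max_left _ _).trans (le_self_pow₀ hH hk0)
    rw [sub_sub_sub_comm]
    exact (norm_sub_le _ _).trans (add_le_add (hFlip x hx y hy) h3)

end
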